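/- Let r ≥ 3 and let (η, u) be a sufficiently smooth solution of (SSW) on [0,1]×[0,T] (it suffices that η, u ∈ C³([0,T]; C^r[0,1])). Let M be a positive integer, k = T/M, tⁿ = nk, Hⁿ = P(η(·,tⁿ)), Uⁿ = P₀(u(·,tⁿ)), and for 0 ≤ n ≤ M−1 define the intermediate stages H^{n,1} := Hⁿ − (k/2)P(∂_x Uⁿ) − (k/4)P(∂_x(HⁿUⁿ)) and U^{n,1} := Uⁿ − (k/2)P₀(∂_x Hⁿ) − (k/4)P₀(Hⁿ ∂_x Hⁿ) − (3k/4)P₀(Uⁿ ∂_x Uⁿ), and the consistency errors δ₁ⁿ := H^{n+1} − Hⁿ + kP(∂_x U^{n,1}) + (k/2)P(∂_x(H^{n,1} U^{n,1})) and δ₂ⁿ := U^{n+1} − Uⁿ + kP₀(∂_x H^{n,1}) + (k/2)P₀(H^{n,1} ∂_x H^{n,1}) + (3k/2)P₀(U^{n,1} ∂_x U^{n,1}). Then, for a fixed quasiuniformity constant γ, there exists a constant C = C(λ), depending polynomially on λ := k/h and otherwise independent of h, k, M, such that for every quasiuniform partition with constant γ, max_{0≤n≤M−1} (‖δ₁ⁿ‖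 + ‖δ₂ⁿ‖) ≤ C k (k² + h^{r−1}). -/

import Mathlib

noncomputable section
open Set

/-- The L²(0,1) inner product of two real functions. -/
def ip (f g : ℝ → ℝ) : ℝ := ∫ y in (0:ℝ)..1, f y * g y

/-- The L²(0,1) norm. -/
def nrm (f : ℝ → ℝ) : ℝ := Real.sqrt (∫ y in (0:ℝ)..1, (f y)^2)

/-- `g` is the L²(0,1)-orthogonal projection of `f` onto `S`. -/
def IsL2ProjOn (S : Set (ℝ → ℝ)) (f g : ℝ → ℝ) : Prop :=
  g ∈ S ∧ ∀ χ ∈ S, ip (fun y => f y - g y) χ = 0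

/-- The space `S_h` of `C^k` piecewise polynomials of degree ≤ r-1 on the partition `x`. -/
def Sh (N r k : ℕ) (x : ℕ → ℝ) : Set (ℝ → ℝ) :=
  {φ | ContDiffOn ℝ k φ (Icc (0:ℝ) 1) ∧
    ∀ j < N, ∃ p : Polynomial ℝ, p.natDegree ≤ r - 1 ∧
      ∀ y ∈ Icc (x j) (x (j+1)), φ y = Polynomial.eval y p}

/-- The subspace `S_{h,0}` of functions in `S_h` vanishing at 0 and 1. -/
def Sh0 (N r k : ℕ) (x : ℕ → ℝ) : Set (ℝ → ℝ) :=
  {φ | φ ∈ Sh N r k x ∧ φ 0 = 0 ∧ φ 1 = 0}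

/-- `x 0 = 0 < x 1 < ⋯ < x N = 1` is a partition of `[0,1]`. -/
def IsPartition (N : ℕ) (x : ℕ → ℝ) : Prop :=
  x 0 = 0 ∧ x N = 1 ∧ ∀ i < N, x i < x (i+1)

/-- `h` is the maximal meshlength of the partition `x`. -/
def IsMeshSize (N : ℕ) (x : ℕ → ℝ) (h : ℝ) : Prop :=
  (∀ i < N, x (i+1) - x i ≤ h) ∧ ∃ i < N, x (i+1) - x i = h

/-- The partition is quasiuniform with constant γ : `h ≤ γ · min meshlength`. -/
def QuasiUniform (N : ℕ) (x : ℕ → ℝ) (h γ : ℝ) : Prop :=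
  ∀ i < N, h ≤ γ * (x (i+1) - x i)

/-- `fs j` is the j-th time derivative of `fs 0` on `[0,1]×[0,T]` for `j ≤ m`,
each being r times continuously differentiable in space and jointly continuous:
an encoding of `fs 0 ∈ C^m([0,T]; C^r[0,1])`. -/
def SmoothChain (T : ℝ) (r m : ℕ) (fs : ℕ → ℝ → ℝ → ℝ) : Prop :=
  (∀ j < m, ∀ y ∈ Icc (0:ℝ) 1, ∀ t ∈ Icc (0:ℝ) T,
    HasDerivWithinAt (fun s => fs j y s) (fs (j+1) y t) (Icc (0:ℝ) T) t) ∧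
  (∀ j ≤ m, ∀ t ∈ Icc (0:ℝ) T, ContDiffOn ℝ r (fun y => fs j y t) (Icc (0:ℝ) 1)) ∧
  (∀ j ≤ m, ContinuousOn (fun p : ℝ × ℝ => fs j p.1 p.2) ((Icc (0:ℝ) 1) ×ˢ (Icc (0:ℝ) T)))

/-- `(η,u)` (with time derivatives `ηt`, `ut`) solves the symmetric shallow water
system on `[0,1]×[0,T]` with homogeneous boundary conditions for `u`. -/
def SSW (T : ℝ) (η u ηt ut : ℝ → ℝ → ℝ) : Prop :=
  (∀ y ∈ Icc (0:ℝ) 1, ∀ t ∈ Icc (0:ℝ) T,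
    ηt y t + derivWithin (fun z => u z t) (Icc (0:ℝ) 1) y
      + (1/2) * derivWithin (fun z => η z t * u z t) (Icc (0:ℝ) 1) y = 0 ∧
    ut y t + derivWithin (fun z => η z t) (Icc (0:ℝ) 1) y
      + (3/2) * (u y t * derivWithin (fun z => u z t) (Icc (0:ℝ) 1) y)
      + (1/2) * (η y t * derivWithin (fun z => η z t) (Icc (0:ℝ) 1) y) = 0) ∧
  (∀ t ∈ Icc (0:ℝ) T, u 0 t = 0 ∧ u 1 t = 0)

section Helpers
open MeasureTheory Filter Topology
set_option linter.all false
/-- essentially bounded functions on `(a,b]` -/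
def BM (a b : ℝ) (f : ℝ → ℝ) : Prop := MemLp f ⊤ (volume.restrict (Ioc a b))

noncomputable def n2 (a b : ℝ) (f : ℝ → ℝ) : ℝ := Real.sqrt (∫ x in a..b, (f x)^2)

theorem BM.add {a b : ℝ} {f g : ℝ → ℝ} (hf : BM a b f) (hg : BM a b g) :
    BM a b (fun x => f x + g x) := MemLp.add hf hg
theorem BM.sub {a b : ℝ} {f g : ℝ → ℝ} (hf : BM a b f) (hg : BM a b g) :
    BM a b (fun x => f x - g x) := MemLp.sub hf hg
theorem BM.neg {a b : ℝ} {f : ℝ → ℝ} (hf : BM a b f) :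
    BM a b (fun x => - f x) := MemLp.neg hf
theorem BM.mul {a b : ℝ} {f g : ℝ → ℝ} (hf : BM a b f) (hg : BM a b g) :
    BM a b (fun x => f x * g x) := MemLp.mul (r := ⊤) hg hf
theorem BM.cmul {a b : ℝ} {f : ℝ → ℝ} (c : ℝ) (hf : BM a b f) :
    BM a b (fun x => c * f x) := MemLp.const_mul hf c
theorem BM.const (a b c : ℝ) : BM a b (fun _ => c) := memLp_top_const c
theorem BM.sum {a b : ℝ} {ι : Type*} (s : Finset ι) {f : ι → ℝ → ℝ} (hf : ∀ i ∈ s, BM a b (f i)) :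
    BM a b (fun x => ∑ i ∈ s, f i x) := memLp_finsetSum s hf
theorem BM.sq {a b : ℝ} {f : ℝ → ℝ} (hf : BM a b f) :
    BM a b (fun x => f x ^ 2) := by simpa only [pow_two] using hf.mul hf

theorem BM.ii {a b : ℝ} {f : ℝ → ℝ} (hab : a ≤ b) (hf : BM a b f) :
    IntervalIntegrable f volume a b := by
  rw [intervalIntegrable_iff_integrableOn_Ioc_of_le hab]
  exact MemLp.integrable (q := ⊤) le_top hf

theorem BM.of_cont {a b : ℝ} {f : ℝ → ℝ} (hf : ContinuousOn f (Icc a b)) : BM a b f := by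
  obtain ⟨C, hC⟩ := isCompact_Icc.exists_bound_of_continuousOn hf
  refine memLp_top_of_bound ((hf.mono Ioc_subset_Icc_self).aestronglyMeasurable measurableSet_Ioc) C ?_
  exact (ae_restrict_iff' measurableSet_Ioc).2 (Filter.Eventually.of_forall fun x hx => hC x (Ioc_subset_Icc_self hx))

theorem BM.mono {a b c d : ℝ} {f : ℝ → ℝ} (hf : BM a b f) (h1 : a ≤ c) (h2 : d ≤ b) : BM c d f :=
  MemLp.mono_measure (Measure.restrict_mono (Ioc_subset_Ioc h1 h2) le_rfl) hf

theorem n2_nonneg (a b : ℝ) (f : ℝ → ℝ) : 0 ≤ n2 a b f := Real.sqrt_nonneg _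

theorem n2_sq {a b : ℝ} (hab : a ≤ b) (f : ℝ → ℝ) : n2 a b f ^ 2 = ∫ x in a..b, (f x)^2 :=
  Real.sq_sqrt (intervalIntegral.integral_nonneg hab fun x _ => sq_nonneg _)

theorem cs {a b : ℝ} (hab : a ≤ b) {f g : ℝ → ℝ} (hf : BM a b f) (hg : BM a b g) :
    |∫ x in a..b, f x * g x| ≤ n2 a b f * n2 a b g := by
  have key : ∀ t : ℝ, 0 ≤ (∫ x in a..b, (g x)^2) * (t * t) + (2 * ∫ x in a..b, f x * g x) * t
      + ∫ x in a..b, (f x)^2 := by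
    intro t
    have h0 : 0 ≤ ∫ x in a..b, (f x + t * g x)^2 :=
      intervalIntegral.integral_nonneg hab fun x _ => sq_nonneg _
    have h1 : ∫ x in a..b, (f x + t * g x)^2
        = ∫ x in a..b, ((f x)^2 + (2*t) * (f x * g x) + (t*t) * (g x)^2) := by
      congr 1; ext x; ring
    rw [h1, intervalIntegral.integral_add, intervalIntegral.integral_add,
      intervalIntegral.integral_const_mul, intervalIntegral.integral_const_mul] at h0
    · linarith
    · exact hf.sq.ii hab
    · exact ((hf.mul hg).cmul _).ii hab
    · exact (hf.sq.add ((hf.mul hg).cmul _)).ii hab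
    · exact (hg.sq.cmul _).ii hab
  have h2 := discrim_le_zero key
  rw [discrim] at h2
  have h3 : (∫ x in a..b, f x * g x)^2 ≤ (n2 a b f * n2 a b g)^2 := by
    rw [mul_pow, n2_sq hab, n2_sq hab]; nlinarith
  exact abs_le_of_sq_le_sq h3 (mul_nonneg (n2_nonneg _ _ _) (n2_nonneg _ _ _))

theorem n2_add {a b : ℝ} (hab : a ≤ b) {f g : ℝ → ℝ} (hf : BM a b f) (hg : BM a b g) :
    n2 a b (fun x => f x + g x) ≤ n2 a b f + n2 a b g := by
  apply abs_le_of_sq_le_sq' _ (add_nonneg (n2_nonneg _ _ _) (n2_nonneg _ _ _)) |>.2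
  have h1 : ∫ x in a..b, (f x + g x)^2
        = ∫ x in a..b, ((f x)^2 + 2 * (f x * g x) + (g x)^2) := by
      congr 1; ext x; ring
  rw [n2_sq hab, h1, intervalIntegral.integral_add, intervalIntegral.integral_add,
      intervalIntegral.integral_const_mul, add_sq, n2_sq hab, n2_sq hab]
  · have := (abs_le.1 (cs hab hf hg)).2
    linarith
  · exact hf.sq.ii hab
  · exact ((hf.mul hg).cmul _).ii hab
  · exact (hf.sq.add ((hf.mul hg).cmul _)).ii hab
  · exact (hg.sq).ii hab

theorem n2_cmul {a b : ℝ} (c : ℝ) (f : ℝ → ℝ) :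
    n2 a b (fun x => c * f x) = |c| * n2 a b f := by
  unfold n2
  rw [show (∫ x in a..b, (c * f x)^2) = c^2 * ∫ x in a..b, (f x)^2 by
    rw [← intervalIntegral.integral_const_mul]; congr 1; ext x; ring]
  rw [Real.sqrt_mul (sq_nonneg c), Real.sqrt_sq_eq_abs]

theorem n2_neg {a b : ℝ} (f : ℝ → ℝ) : n2 a b (fun x => - f x) = n2 a b f := by
  unfold n2; simp

theorem n2_sub {a b : ℝ} (hab : a ≤ b) {f g : ℝ → ℝ} (hf : BM a b f) (hg : BM a b g) :
    n2 a b (fun x => f x - g x) ≤ n2 a b f + n2 a b g := by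
  have := n2_add hab hf hg.neg
  rw [n2_neg] at this
  simpa only [sub_eq_add_neg] using this

theorem n2_congr {a b : ℝ} (hab : a ≤ b) {f g : ℝ → ℝ} (h : ∀ x ∈ Icc a b, f x = g x) :
    n2 a b f = n2 a b g := by
  unfold n2; congr 1
  apply intervalIntegral.integral_congr
  intro x hx; rw [uIcc_of_le hab] at hx
  simp only [h x hx]

theorem n2_mono_int {a b c d : ℝ} (hac : a ≤ c) (hcd : c ≤ d) (hdb : d ≤ b) {f : ℝ → ℝ} (hf : BM a b f) :
    n2 c d f ≤ n2 a b f := by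
  apply Real.sqrt_le_sqrt
  have hab := hac.trans (hcd.trans hdb)
  rw [intervalIntegral.integral_of_le hcd, intervalIntegral.integral_of_le hab]
  apply setIntegral_mono_set
  · exact (intervalIntegrable_iff_integrableOn_Ioc_of_le hab).1 (hf.sq.ii hab)
  · exact Filter.Eventually.of_forall fun x => sq_nonneg _
  · exact (Ioc_subset_Ioc hac hdb).eventuallyLE

theorem n2_le_of_ae {a b : ℝ} (hab : a ≤ b) {f g : ℝ → ℝ} (hf : BM a b f) (hg : BM a b g)
    (h : ∀ᵐ x, x ∈ Ioc a b → |f x| ≤ |g x|) : n2 a b f ≤ n2 a b g := by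
  apply Real.sqrt_le_sqrt
  rw [intervalIntegral.integral_of_le hab, intervalIntegral.integral_of_le hab]
  apply setIntegral_mono_on_ae ((intervalIntegrable_iff_integrableOn_Ioc_of_le hab).1 (hf.sq.ii hab))
    ((intervalIntegrable_iff_integrableOn_Ioc_of_le hab).1 (hg.sq.ii hab)) measurableSet_Ioc
  filter_upwards [h] with x hx hx'
  exact sq_le_sq.2 (hx hx')

theorem n2_const {a b : ℝ} (hab : a ≤ b) (c : ℝ) : n2 a b (fun _ => c) = |c| * Real.sqrt (b - a) := by
  unfold n2
  rw [intervalIntegral.integral_const, smul_eq_mul, mul_comm, Real.sqrt_mul (sq_nonneg _), Real.sqrt_sq_eq_abs]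

theorem n2_le_sup {a b : ℝ} (hab : a ≤ b) {f : ℝ → ℝ} (hf : BM a b f) {c : ℝ}
    (h : ∀ x ∈ Icc a b, |f x| ≤ c) : n2 a b f ≤ c * Real.sqrt (b - a) := by
  have hc : 0 ≤ c := (abs_nonneg _).trans (h a ⟨le_rfl, hab⟩)
  have := n2_le_of_ae hab hf (BM.const a b c) (Filter.Eventually.of_forall fun x hx => by
    rw [abs_of_nonneg hc]; exact h x (Ioc_subset_Icc_self hx))
  rwa [n2_const hab, abs_of_nonneg hc] at this

theorem n2_mul_sup {a b : ℝ} (hab : a ≤ b) {f g : ℝ → ℝ} (hf : BM a b f) (hg : BM a b g) {c : ℝ}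
    (h : ∀ x ∈ Icc a b, |f x| ≤ c) : n2 a b (fun x => f x * g x) ≤ c * n2 a b g := by
  have hc : 0 ≤ c := (abs_nonneg _).trans (h a ⟨le_rfl, hab⟩)
  have := n2_le_of_ae hab (hf.mul hg) (hg.cmul c) (Filter.Eventually.of_forall fun x hx => by
    rw [abs_mul, abs_mul, abs_of_nonneg hc]
    exact mul_le_mul_of_nonneg_right (h x (Ioc_subset_Icc_self hx)) (abs_nonneg _))
  rwa [n2_cmul, abs_of_nonneg hc] at this

theorem int_abs_le {a b : ℝ} (hab : a ≤ b) {f : ℝ → ℝ} (hf : BM a b f) :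
    |∫ x in a..b, f x| ≤ Real.sqrt (b - a) * n2 a b f := by
  have := cs hab (BM.const a b 1) hf
  simpa [n2_const hab] using this

theorem n2_sum {a b : ℝ} (hab : a ≤ b) {ι : Type*} (s : Finset ι) {f : ι → ℝ → ℝ} (hf : ∀ i ∈ s, BM a b (f i)) :
    n2 a b (fun x => ∑ i ∈ s, f i x) ≤ ∑ i ∈ s, n2 a b (f i) := by
  classical
  induction s using Finset.induction_on with
  | empty => simp [n2]
  | insert i s hi ih =>
    simp only [Finset.sum_insert hi]
    have h1 : ∀ j ∈ s, BM a b (f j) := fun j hj => hf j (Finset.mem_insert_of_mem hj)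
    exact (n2_add hab (hf i (Finset.mem_insert_self _ _)) (BM.sum s h1)).trans
      (add_le_add le_rfl (ih h1))

/-- chains of derivatives -/
def Ch (a b : ℝ) (r : ℕ) (F : ℕ → ℝ → ℝ) : Prop :=
  (∀ i < r, ∀ x ∈ Icc a b, HasDerivWithinAt (F i) (F (i+1) x) (Icc a b) x) ∧
    ContinuousOn (F r) (Icc a b)

theorem Ch.cont {a b : ℝ} {r : ℕ} {F : ℕ → ℝ → ℝ} (h : Ch a b r F) {i : ℕ} (hi : i ≤ r) :
    ContinuousOn (F i) (Icc a b) := by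
  rcases hi.lt_or_eq with h1 | h1
  · exact fun x hx => (h.1 i h1 x hx).continuousWithinAt
  · rw [h1]; exact h.2

theorem Ch.bm {a b : ℝ} {r : ℕ} {F : ℕ → ℝ → ℝ} (h : Ch a b r F) {i : ℕ} (hi : i ≤ r) :
    BM a b (F i) := BM.of_cont (h.cont hi)

theorem Ch.mono {a b c d : ℝ} {r : ℕ} {F : ℕ → ℝ → ℝ} (h : Ch a b r F) (h1 : a ≤ c) (h2 : d ≤ b) :
    Ch c d r F :=
  ⟨fun i hi x hx => (h.1 i hi x (Icc_subset_Icc h1 h2 hx)).mono (Icc_subset_Icc h1 h2),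
   h.2.mono (Icc_subset_Icc h1 h2)⟩

theorem Ch.le {a b : ℝ} {r s : ℕ} {F : ℕ → ℝ → ℝ} (h : Ch a b r F) (hs : s ≤ r) : Ch a b s F :=
  ⟨fun i hi => h.1 i (hi.trans_le hs), h.cont hs⟩

theorem Ch.shift {a b : ℝ} {r : ℕ} {F : ℕ → ℝ → ℝ} (h : Ch a b (r+1) F) :
    Ch a b r (fun i => F (i+1)) :=
  ⟨fun i hi => h.1 (i+1) (by omega), h.2⟩

theorem Ch.add {a b : ℝ} {r : ℕ} {F G : ℕ → ℝ → ℝ} (h : Ch a b r F) (h' : Ch a b r G) :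
    Ch a b r (fun i x => F i x + G i x) :=
  ⟨fun i hi x hx => (h.1 i hi x hx).add (h'.1 i hi x hx), h.2.add h'.2⟩

theorem Ch.sub {a b : ℝ} {r : ℕ} {F G : ℕ → ℝ → ℝ} (h : Ch a b r F) (h' : Ch a b r G) :
    Ch a b r (fun i x => F i x - G i x) :=
  ⟨fun i hi x hx => (h.1 i hi x hx).sub (h'.1 i hi x hx), h.2.sub h'.2⟩

theorem Ch.cmul {a b : ℝ} {r : ℕ} {F : ℕ → ℝ → ℝ} (c : ℝ) (h : Ch a b r F) :
    Ch a b r (fun i x => c * F i x) :=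
  ⟨fun i hi x hx => (h.1 i hi x hx).const_mul c, h.2.const_smul c⟩

theorem ftc {a b : ℝ} (hab : a ≤ b) {f f' : ℝ → ℝ}
    (h : ∀ x ∈ Icc a b, HasDerivWithinAt f (f' x) (Icc a b) x) (hc : ContinuousOn f' (Icc a b)) :
    ∫ x in a..b, f' x = f b - f a := by
  apply intervalIntegral.integral_eq_sub_of_hasDeriv_right_of_le hab
  · exact fun x hx => (h x hx).continuousWithinAt
  · intro x hx
    exact ((h x (Ioo_subset_Icc_self hx)).hasDerivAt (Icc_mem_nhds hx.1 hx.2)).hasDerivWithinAt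
  · exact (BM.of_cont hc).ii hab

theorem ftc' {a b : ℝ} {f f' : ℝ → ℝ}
    (h : ∀ x ∈ Icc a b, HasDerivWithinAt f (f' x) (Icc a b) x) (hc : ContinuousOn f' (Icc a b))
    {c d : ℝ} (h1 : a ≤ c) (h2 : c ≤ d) (h3 : d ≤ b) :
    ∫ x in c..d, f' x = f d - f c :=
  ftc h2 (fun x hx => (h x (Icc_subset_Icc h1 h3 hx)).mono (Icc_subset_Icc h1 h3))
    (hc.mono (Icc_subset_Icc h1 h3))

open Polynomial in
theorem poly_bm (a b : ℝ) (q : ℝ[X]) : BM a b (fun x => q.eval x) := BM.of_cont q.continuous.continuousOn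

open Polynomial in
theorem pinv01 (d : ℕ) : ∃ C : ℝ, 0 ≤ C ∧ ∀ q : ℝ[X], q.natDegree ≤ d → ∀ x ∈ Icc (0:ℝ) 1,
    |q.eval x| ≤ C * n2 0 1 (fun x => q.eval x) ∧
    |q.derivative.eval x| ≤ C * n2 0 1 (fun x => q.eval x) := by
  let ev : EuclideanSpace ℝ (Fin (d+1)) → ℝ → ℝ := fun c x => ∑ i, c i * x ^ (i:ℕ)
  have hevc : Continuous (Function.uncurry ev) := by
    show Continuous fun p : EuclideanSpace ℝ (Fin (d+1)) × ℝ => ∑ i, p.1 i * p.2 ^ (i:ℕ)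
    fun_prop
  let Φ : EuclideanSpace ℝ (Fin (d+1)) → ℝ := fun c => ∫ x in (0:ℝ)..1, (ev c x)^2
  have hΦ : Continuous Φ := by
    apply intervalIntegral.continuous_parametric_intervalIntegral_of_continuous'
    exact hevc.pow 2
  have hpos : ∀ c : EuclideanSpace ℝ (Fin (d+1)), c ≠ 0 → 0 < Φ c := by
    intro c hc
    have h0 : 0 ≤ Φ c := intervalIntegral.integral_nonneg zero_le_one fun x _ => sq_nonneg _
    rcases h0.lt_or_eq with h | h
    · exact h
    exfalso; apply hc
    have hcc : Continuous fun x => (ev c x)^2 := (hevc.comp (Continuous.prodMk_right c)).pow 2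
    have hz : ∀ x ∈ Icc (0:ℝ) 1, ev c x = 0 := by
      intro x hx
      by_contra hne
      have : 0 < ∫ x in (0:ℝ)..1, (ev c x)^2 :=
        intervalIntegral.integral_pos zero_lt_one hcc.continuousOn (fun x _ => sq_nonneg _)
          ⟨x, hx, by positivity⟩
      exact absurd h this.ne
    let q : ℝ[X] := ∑ i : Fin (d+1), Polynomial.C (c i) * X ^ (i:ℕ)
    have hq : ∀ x, q.eval x = ev c x := by intro x; simp [q, ev, eval_finset_sum]
    have hq0 : q = 0 := by
      apply Polynomial.eq_zero_of_infinite_isRoot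
      apply Set.Infinite.mono _ (Icc_infinite (zero_lt_one (α := ℝ)))
      intro x hx
      show q.IsRoot x
      rw [IsRoot, hq, hz x hx]
    ext i
    have := congrArg (fun p : ℝ[X] => p.coeff i) hq0
    simp only [q, finset_sum_coeff, coeff_C_mul, coeff_X_pow, coeff_zero] at this
    rw [Finset.sum_eq_single i] at this
    · simpa using this
    · intro j _ hj
      rw [if_neg (fun h => hj (Fin.ext h.symm))]; simp
    · simp
  obtain ⟨m, hm, hmΦ⟩ : ∃ m > 0, ∀ c : EuclideanSpace ℝ (Fin (d+1)), m * ‖c‖^2 ≤ Φ c := by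
    obtain ⟨c0, hc0, hmin⟩ := (isCompact_sphere (0:EuclideanSpace ℝ (Fin (d+1))) 1).exists_isMinOn
      (NormedSpace.sphere_nonempty.2 zero_le_one) hΦ.continuousOn
    have hc0n : c0 ≠ 0 := by
      rintro rfl; simp at hc0
    refine ⟨Φ c0, hpos _ hc0n, fun c => ?_⟩
    rcases eq_or_ne c 0 with rfl | hc
    · simp [Φ, ev]
    have hn : ‖c‖ ≠ 0 := norm_ne_zero_iff.2 hc
    have h1 : Φ c0 ≤ Φ ((‖c‖⁻¹) • c) := hmin (by simp [norm_smul, hn])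
    have h2 : Φ ((‖c‖⁻¹) • c) = (‖c‖⁻¹)^2 * Φ c := by
      simp only [Φ]
      rw [← intervalIntegral.integral_const_mul]
      congr 1; ext x
      have : ev ((‖c‖⁻¹) • c) x = ‖c‖⁻¹ * ev c x := by
        simp only [ev, Finset.mul_sum, PiLp.smul_apply, smul_eq_mul, mul_assoc]
      rw [this]; ring
    rw [h2] at h1
    calc Φ c0 * ‖c‖^2 ≤ ((‖c‖⁻¹)^2 * Φ c) * ‖c‖^2 := by gcongr
      _ = Φ c := by field_simp
  refine ⟨(∑ i ∈ Finset.range (d+1), ((1:ℝ) + i)) / Real.sqrt m, by positivity, fun q hq x hx => ?_⟩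
  let c : EuclideanSpace ℝ (Fin (d+1)) := WithLp.toLp 2 (fun i : Fin (d+1) => q.coeff i)
  have hq' : ∀ x, q.eval x = ev c x := by
    intro x
    rw [eval_eq_sum_range' (Nat.lt_succ_of_le hq), Finset.sum_range]
  have hcoef : ∀ i ∈ Finset.range (d+1), |q.coeff i| ≤ n2 0 1 (fun x => q.eval x) / Real.sqrt m := by
    intro i hi
    rw [Finset.mem_range] at hi
    have h1 : |q.coeff i| ≤ ‖c‖ := by
      have := PiLp.norm_apply_le c ⟨i, hi⟩
      simpa [c] using this
    refine h1.trans ?_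
    rw [le_div_iff₀ (Real.sqrt_pos.2 hm)]
    unfold n2
    apply Real.le_sqrt_of_sq_le
    have := hmΦ c
    rw [mul_pow, Real.sq_sqrt hm.le]
    simp only [hq']
    linarith
  set n := n2 0 1 (fun x => q.eval x)
  have hn : 0 ≤ n / Real.sqrt m := div_nonneg (n2_nonneg _ _ _) (Real.sqrt_nonneg _)
  have hxp : ∀ i : ℕ, |x ^ i| ≤ 1 := fun i => by
    rw [abs_of_nonneg (pow_nonneg hx.1 _)]; exact pow_le_one₀ hx.1 hx.2
  constructor
  · rw [eval_eq_sum_range' (Nat.lt_succ_of_le hq), div_mul_eq_mul_div, mul_div_assoc, Finset.sum_mul]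
    refine (Finset.abs_sum_le_sum_abs _ _).trans (Finset.sum_le_sum fun i hi => ?_)
    rw [abs_mul]
    calc |q.coeff i| * |x ^ i| ≤ (n / Real.sqrt m) * 1 := by
          gcongr; exacts [hcoef i hi, hxp i]
      _ ≤ (1 + i) * (n / Real.sqrt m) := by
          have : (0:ℝ) ≤ i * (n / Real.sqrt m) := by positivity
          linarith
  · rw [derivative_eval, Polynomial.sum_over_range' _ _ (d+1) (Nat.lt_succ_of_le hq),
      div_mul_eq_mul_div, mul_div_assoc, Finset.sum_mul]
    · refine (Finset.abs_sum_le_sum_abs _ _).trans (Finset.sum_le_sum fun i hi => ?_)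
      rw [abs_mul, abs_mul]
      calc |q.coeff i| * |(i:ℝ)| * |x ^ (i-1)| ≤ (n / Real.sqrt m) * i * 1 := by
            have := hcoef i hi
            have h3 := hxp (i-1)
            rw [abs_of_nonneg (Nat.cast_nonneg (α := ℝ) i)]
            gcongr
        _ ≤ (1 + i) * (n / Real.sqrt m) := by linarith
    · simp

open Polynomial in
/-- inverse inequality -/
theorem pinv (d : ℕ) : ∃ C : ℝ, 1 ≤ C ∧ ∀ a b : ℝ, a < b → ∀ q : ℝ[X], q.natDegree ≤ d →
    ∀ x ∈ Icc a b,
    Real.sqrt (b - a) * |q.eval x| ≤ C * n2 a b (fun x => q.eval x) ∧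
    Real.sqrt (b - a) * ((b - a) * |q.derivative.eval x|) ≤ C * n2 a b (fun x => q.eval x) := by
  obtain ⟨C, hC, h⟩ := pinv01 d
  refine ⟨C + 1, by linarith, fun a b hab q hq x hx => ?_⟩
  have hl : 0 < b - a := sub_pos.2 hab
  let p : ℝ[X] := q.comp (Polynomial.C a + Polynomial.C (b - a) * X)
  have hp : p.natDegree ≤ d := by
    refine natDegree_comp_le.trans ?_
    have : (Polynomial.C a + Polynomial.C (b - a) * X : ℝ[X]).natDegree ≤ 1 := by
      compute_degree
    calc _ ≤ d * 1 := Nat.mul_le_mul hq this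
      _ = d := mul_one d
  have hpe : ∀ y, p.eval y = q.eval (a + (b - a) * y) := by
    intro y; simp [p, eval_comp]
  have hpd : ∀ y, p.derivative.eval y = (b - a) * q.derivative.eval (a + (b - a) * y) := by
    intro y; simp [p, derivative_comp, eval_comp]
  have hn : Real.sqrt (b - a) * n2 0 1 (fun y => p.eval y) = n2 a b (fun x => q.eval x) := by
    unfold n2
    rw [← Real.sqrt_mul hl.le]
    congr 1
    simp only [hpe]
    have := intervalIntegral.mul_integral_comp_add_mul (a := 0) (b := 1)
      (f := fun x => (q.eval x)^2) (b - a) a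
    rw [this]; congr 1 <;> ring
  obtain ⟨y, hy, rfl⟩ : ∃ y ∈ Icc (0:ℝ) 1, a + (b - a) * y = x := by
    refine ⟨(x - a) / (b - a), ⟨div_nonneg (by linarith [hx.1]) hl.le, ?_⟩, by field_simp; ring⟩
    rw [div_le_one hl]; linarith [hx.2]
  obtain ⟨h1, h2⟩ := h p hp y hy
  rw [hpe] at h1
  rw [hpd, abs_mul, abs_of_pos hl] at h2
  have hs := Real.sqrt_nonneg (b - a)
  rw [← hn]
  have hn0 := n2_nonneg 0 1 (fun y => p.eval y)
  constructor <;> nlinarith [mul_le_mul_of_nonneg_left h1 hs, mul_le_mul_of_nonneg_left h2 hs, mul_nonneg hs hn0]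

open Polynomial in
theorem pinvj (d : ℕ) (j : ℕ) : ∃ C : ℝ, 1 ≤ C ∧ ∀ a b : ℝ, a < b → ∀ q : ℝ[X], q.natDegree ≤ d →
    ∀ x ∈ Icc a b,
    Real.sqrt (b - a) * (b - a) ^ j * |(derivative^[j] q).eval x| ≤ C * n2 a b (fun x => q.eval x) := by
  obtain ⟨C, hC, h⟩ := pinv d
  induction j with
  | zero => exact ⟨C, hC, fun a b hab q hq x hx => by simpa using (h a b hab q hq x hx).1⟩
  | succ j ih =>
    obtain ⟨D, hD, ih⟩ := ih
    refine ⟨D * C, by nlinarith, fun a b hab q hq x hx => ?_⟩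
    have hl : 0 < b - a := sub_pos.2 hab
    have h1 := ih a b hab q.derivative ((natDegree_derivative_le q).trans (by omega)) x hx
    have h2 : (b - a) * n2 a b (fun x => q.derivative.eval x) ≤ C * n2 a b (fun x => q.eval x) := by
      have h3 : n2 a b (fun x => q.derivative.eval x)
          ≤ (C * n2 a b (fun x => q.eval x) / (Real.sqrt (b-a) * (b - a))) * Real.sqrt (b - a) := by
        apply n2_le_sup hab.le (poly_bm _ _ _)
        intro y hy
        rw [le_div_iff₀ (mul_pos (Real.sqrt_pos.2 hl) hl)]
        linarith [(h a b hab q hq y hy).2]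
      have h4 := Real.sqrt_pos.2 hl
      calc _ ≤ (b - a) * ((C * n2 a b (fun x => q.eval x) / (Real.sqrt (b-a) * (b - a))) * Real.sqrt (b - a)) := by gcongr
        _ = _ := by field_simp
    rw [Function.iterate_succ_apply]
    calc _ = (b - a) * (Real.sqrt (b - a) * (b - a) ^ j * |(derivative^[j] q.derivative).eval x|) := by ring
      _ ≤ (b - a) * (D * n2 a b (fun x => q.derivative.eval x)) := by gcongr
      _ = D * ((b - a) * n2 a b (fun x => q.derivative.eval x)) := by ring
      _ ≤ D * (C * n2 a b (fun x => q.eval x)) := by gcongr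
      _ = _ := by ring

theorem taylor_rem {a b : ℝ} (hab : a ≤ b) {r : ℕ} {G : ℕ → ℝ → ℝ} (hG : Ch a b r G)
    (h0 : ∀ j < r, G j a = 0) (m : ℕ) (hm : m < r) :
    ∀ x ∈ Icc a b, |G (r - 1 - m) x| ≤ (b - a)^m * Real.sqrt (b - a) * n2 a b (G r) := by
  have hl : 0 ≤ b - a := sub_nonneg.2 hab
  induction m with
  | zero =>
    intro x hx
    have e : r - 1 - 0 + 1 = r := by omega
    have h1 := ftc' (hG.1 (r-1-0) (by omega)) (by rw [e]; exact hG.2) le_rfl hx.1 hx.2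
    rw [h0 _ (by omega), sub_zero, e] at h1
    rw [← h1, pow_zero, one_mul]
    refine (int_abs_le hx.1 ((hG.bm le_rfl).mono le_rfl hx.2)).trans ?_
    gcongr
    · exact n2_nonneg _ _ _
    · exact hx.2
    · exact n2_mono_int le_rfl hx.1 hx.2 (hG.bm le_rfl)
  | succ m ih =>
    intro x hx
    have e : r - 1 - (m+1) + 1 = r - 1 - m := by omega
    have h1 := ftc' (hG.1 (r-1-(m+1)) (by omega)) (hG.cont (by omega)) le_rfl hx.1 hx.2
    rw [h0 _ (by omega), sub_zero, e] at h1
    rw [← h1]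
    have := intervalIntegral.norm_integral_le_of_norm_le_const (a := a) (b := x)
      (f := G (r-1-m)) (C := (b - a)^m * Real.sqrt (b - a) * n2 a b (G r)) (fun y hy => by
        rw [uIoc_of_le hx.1] at hy
        exact ih (by omega) y ⟨hy.1.le, hy.2.trans hx.2⟩)
    rw [Real.norm_eq_abs, abs_of_nonneg (sub_nonneg.2 hx.1)] at this
    refine this.trans ?_
    have h2 : 0 ≤ (b - a)^m * Real.sqrt (b - a) * n2 a b (G r) := by
      have := n2_nonneg a b (G r); positivity
    calc _ ≤ (b - a)^m * Real.sqrt (b - a) * n2 a b (G r) * (b - a) := by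
          gcongr; exact hx.2
      _ = _ := by ring

open Polynomial in
theorem poly_ch (a b : ℝ) (r : ℕ) (q : ℝ[X]) : Ch a b r (fun i x => (derivative^[i] q).eval x) := by
  refine ⟨fun i _ x _ => ?_, (Polynomial.continuous _).continuousOn⟩
  simp only [Function.iterate_succ_apply']
  exact ((derivative^[i] q).hasDerivAt x).hasDerivWithinAt

open Polynomial in
theorem ehr (r d : ℕ) : ∃ C : ℝ, 1 ≤ C ∧ ∀ a b : ℝ, a < b → ∀ (F : ℕ → ℝ → ℝ) (q : ℝ[X]),
    Ch a b r F → q.natDegree ≤ d → ∀ j < r, ∀ x ∈ Icc a b,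
    Real.sqrt (b - a) * (b - a)^j * |F j x - (derivative^[j] q).eval x|
      ≤ C * (n2 a b (fun x => F 0 x - q.eval x) + (b - a)^r * n2 a b (F r)) := by
  have hch : ∀ j : ℕ, ∃ C : ℝ, 1 ≤ C ∧ ∀ a b : ℝ, a < b → ∀ q : ℝ[X], q.natDegree ≤ max r d →
    ∀ x ∈ Icc a b,
    Real.sqrt (b - a) * (b - a) ^ j * |(derivative^[j] q).eval x| ≤ C * n2 a b (fun x => q.eval x) :=
    fun j => pinvj (max r d) j
  choose D hD hDj using hch
  refine ⟨1 + ∑ j ∈ Finset.range r, D j, ?_, ?_⟩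
  · have : 0 ≤ ∑ j ∈ Finset.range r, D j := Finset.sum_nonneg fun i _ => zero_le_one.trans (hD i)
    linarith
  intro a b hab F q hF hq j hj x hx
  have hl : 0 < b - a := sub_pos.2 hab
  -- Taylor polynomial
  obtain ⟨p, hpd, hp⟩ : ∃ p : ℝ[X], p.natDegree ≤ r ∧ (∀ i < r, (derivative^[i] p).eval a = F i a) ∧
      derivative^[r] p = 0 := by
    let p0 : ℝ[X] := ∑ i ∈ Finset.range r, Polynomial.C (F i a / (i.factorial : ℝ)) * X ^ i
    have hp0 : p0.degree < r := by
      rw [degree_lt_iff_coeff_zero]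
      intro m hm
      simp only [p0, finset_sum_coeff, coeff_C_mul, coeff_X_pow]
      apply Finset.sum_eq_zero
      intro i hi
      rw [if_neg (by have := Finset.mem_range.1 hi; omega), mul_zero]
    let p : ℝ[X] := p0.comp (X - Polynomial.C a)
    have hit : ∀ i, derivative^[i] p = (derivative^[i] p0).comp (X - Polynomial.C a) := by
      intro i
      induction i with
      | zero => rfl
      | succ i ih => rw [Function.iterate_succ_apply', ih, derivative_comp, Function.iterate_succ_apply']; simp
    refine ⟨p, ?_, ?_, ?_⟩
    · rw [natDegree_comp, natDegree_X_sub_C, mul_one]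
      exact natDegree_le_of_degree_le hp0.le
    · intro i hi
      rw [hit, eval_comp]; simp only [eval_sub, eval_X, eval_C, sub_self]
      rw [← coeff_zero_eq_eval_zero, coeff_iterate_derivative]
      simp only [p0, finset_sum_coeff, coeff_C_mul, coeff_X_pow, zero_add]
      rw [Finset.sum_eq_single i]
      · simp only [if_true, mul_one, Nat.descFactorial_self, nsmul_eq_mul]
        have : (i.factorial : ℝ) ≠ 0 := by exact_mod_cast i.factorial_ne_zero
        field_simp
      · intro k _ hk; rw [if_neg (Ne.symm hk)]; simp
      · intro h; exact absurd (Finset.mem_range.2 hi) h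
    · rw [hit]
      have : derivative^[r] p0 = 0 := by
        rcases eq_or_ne p0 0 with h | h
        · simp [h]
        · exact iterate_derivative_eq_zero ((natDegree_lt_iff_degree_lt h).2 hp0)
      simp [this]
  have hG : Ch a b r (fun i x => F i x - (derivative^[i] p).eval x) := hF.sub (poly_ch a b r p)
  have hGr : n2 a b (fun x => F r x - (derivative^[r] p).eval x) = n2 a b (F r) := by
    rw [hp.2]; simp
  have hrem : ∀ i < r, ∀ x ∈ Icc a b, |F i x - (derivative^[i] p).eval x|
      ≤ (b - a)^(r-1-i) * Real.sqrt (b - a) * n2 a b (F r) := by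
    intro i hi x hx
    have := taylor_rem hab.le hG (fun j hj => by simp [hp.1 j hj]) (r-1-i) (by omega) x hx
    rw [hGr] at this
    rwa [show r - 1 - (r - 1 - i) = i by omega] at this
  have hsq : Real.sqrt (b-a) * Real.sqrt (b-a) = b - a := Real.mul_self_sqrt hl.le
  set K := n2 a b (F r)
  have hK : 0 ≤ K := n2_nonneg _ _ _
  have hG0 : n2 a b (fun x => F 0 x - p.eval x) ≤ (b-a)^r * K := by
    have := n2_le_sup hab.le ((hF.bm (Nat.zero_le r)).sub (poly_bm a b p)) (hrem 0 (by omega))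
    refine this.trans (le_of_eq ?_)
    calc _ = (b-a)^(r-1-0) * (Real.sqrt (b-a) * Real.sqrt (b-a)) * K := by ring
      _ = (b-a)^(r-1-0+1) * K := by rw [hsq]; ring
      _ = _ := by congr 2; omega
  have hpq := hDj j a b hab (p - q) ((natDegree_sub_le p q).trans (max_le_max hpd hq)) x hx
  have hn : n2 a b (fun x => (p-q).eval x) ≤ n2 a b (fun x => F 0 x - q.eval x) + (b-a)^r * K := by
    have h1 := n2_sub hab.le ((hF.bm (Nat.zero_le r)).sub (poly_bm a b q)) ((hF.bm (Nat.zero_le r)).sub (poly_bm a b p))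
    have h2 : (fun x => (p-q).eval x) = fun x => (F 0 x - q.eval x) - (F 0 x - p.eval x) := by
      ext x; simp
    rw [h2]; linarith
  have hrj : Real.sqrt (b-a) * (b-a)^j * |F j x - (derivative^[j] p).eval x| ≤ (b-a)^r * K := by
    calc _ ≤ Real.sqrt (b-a) * (b-a)^j * ((b - a)^(r-1-j) * Real.sqrt (b - a) * K) := by
          gcongr; exact hrem j hj x hx
      _ = (Real.sqrt (b-a) * Real.sqrt (b-a)) * ((b-a)^j * (b-a)^(r-1-j)) * K := by ring
      _ = (b-a)^(j + (r-1-j) + 1) * K := by rw [hsq]; ring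
      _ = _ := by congr 2; omega
  set S := n2 a b (fun x => F 0 x - q.eval x) + (b-a)^r * K with hS
  have hS0 : 0 ≤ n2 a b (fun x => F 0 x - q.eval x) := n2_nonneg _ _ _
  have hSn : 0 ≤ S := by positivity
  have htri : |F j x - (derivative^[j] q).eval x| ≤ |F j x - (derivative^[j] p).eval x|
      + |(derivative^[j] (p-q)).eval x| := by
    rw [iterate_derivative_sub, eval_sub]
    refine le_trans (le_of_eq ?_) (abs_add_le _ _)
    congr 1; ring
  have hDle : D j ≤ ∑ j ∈ Finset.range r, D j :=
    Finset.single_le_sum (f := D) (fun i _ => zero_le_one.trans (hD i)) (Finset.mem_range.2 hj)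
  calc _ ≤ Real.sqrt (b-a) * (b-a)^j * (|F j x - (derivative^[j] p).eval x|
      + |(derivative^[j] (p-q)).eval x|) := by gcongr
    _ = Real.sqrt (b-a) * (b-a)^j * |F j x - (derivative^[j] p).eval x|
      + Real.sqrt (b-a) * (b-a)^j * |(derivative^[j] (p-q)).eval x| := by ring
    _ ≤ S + D j * S := by
        have h1 : D j * n2 a b (fun x => (p-q).eval x) ≤ D j * S :=
          mul_le_mul_of_nonneg_left hn (zero_le_one.trans (hD j))
        have : (b-a)^r * K ≤ S := by linarith
        linarith
    _ ≤ _ := by nlinarith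

theorem ibp {a b : ℝ} (hab : a ≤ b) {f f' g g' : ℝ → ℝ}
    (hf : ∀ x ∈ Icc a b, HasDerivWithinAt f (f' x) (Icc a b) x) (hf' : ContinuousOn f' (Icc a b))
    (hg : ∀ x ∈ Icc a b, HasDerivWithinAt g (g' x) (Icc a b) x) (hg' : ContinuousOn g' (Icc a b)) :
    ∫ x in a..b, f' x * g x = f b * g b - f a * g a - ∫ x in a..b, f x * g' x := by
  have hfc : ContinuousOn f (Icc a b) := fun x hx => (hf x hx).continuousWithinAt
  have hgc : ContinuousOn g (Icc a b) := fun x hx => (hg x hx).continuousWithinAt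
  have := ftc hab (f := fun x => f x * g x) (f' := fun x => f' x * g x + f x * g' x)
    (fun x hx => (hf x hx).mul (hg x hx)) ((hf'.mul hgc).add (hfc.mul hg'))
  rw [intervalIntegral.integral_add (((BM.of_cont hf').mul (BM.of_cont hgc)).ii hab)
    (((BM.of_cont hfc).mul (BM.of_cont hg')).ii hab)] at this
  linarith

theorem interp (r : ℕ) : ∃ C : ℝ, 1 ≤ C ∧ ∀ a b l : ℝ, 0 < l → l ≤ b - a → ∀ D : ℕ → ℝ → ℝ, Ch a b r D →
    ∀ j < r, ∀ x ∈ Icc a b,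
    Real.sqrt l * l ^ j * |D j x| ≤ C * (n2 a b (D 0) + l ^ r * n2 a b (D r)) := by
  obtain ⟨C, hC, h⟩ := ehr r 0
  refine ⟨C, hC, fun a b l hl hl1 D hD j hj x hx => ?_⟩
  obtain ⟨c, ha0, ha1, hxa⟩ : ∃ c : ℝ, a ≤ c ∧ c + l ≤ b ∧ x ∈ Icc c (c + l) := by
    rcases le_total (x + l) b with h1 | h1
    · exact ⟨x, hx.1, h1, le_rfl, by linarith⟩
    · exact ⟨b - l, by linarith, by linarith, by linarith, by linarith [hx.2]⟩
  have h1 := h c (c + l) (by linarith) D 0 (hD.mono ha0 ha1) (by simp) j hj x hxa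
  rw [add_sub_cancel_left] at h1
  simp only [Polynomial.iterate_derivative_zero, Polynomial.eval_zero, sub_zero] at h1
  refine h1.trans ?_
  have := n2_mono_int ha0 (by linarith) ha1 (hD.bm (Nat.zero_le r))
  have := n2_mono_int ha0 (by linarith) ha1 (hD.bm le_rfl)
  gcongr

theorem sob (r : ℕ) : ∃ C : ℝ, 1 ≤ C ∧ ∀ D : ℕ → ℝ → ℝ, Ch 0 1 r D →
    ∀ j < r, ∀ x ∈ Icc (0:ℝ) 1, |D j x| ≤ C * (n2 0 1 (D 0) + n2 0 1 (D r)) := by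
  obtain ⟨C, hC, h⟩ := interp r
  exact ⟨C, hC, fun D hD j hj x hx => by simpa using h 0 1 1 one_pos (by simp) D hD j hj x hx⟩

theorem conv_sup {ι : Type*} {L : Filter ι} {r : ℕ} {f : ι → ℕ → ℝ → ℝ} {F : ℕ → ℝ → ℝ} {K a b : ℝ} (hab : a < b)
    (hf : ∀ k, Ch a b r (f k)) (hF : Ch a b r F)
    (h0 : Tendsto (fun k => n2 a b (fun x => f k 0 x - F 0 x)) L (𝓝 0))
    (hK : ∀ᶠ k in L, n2 a b (f k r) ≤ K) {j : ℕ} (hj : j < r) {ε : ℝ} (hε : 0 < ε) :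
    ∀ᶠ k in L, ∀ x ∈ Icc a b, |f k j x - F j x| < ε := by
  obtain ⟨C, hC, h⟩ := interp r
  set K1 := |K| + n2 a b (F r) + 1 with hK1
  have hK1p : 0 < K1 := by have := n2_nonneg a b (F r); positivity
  have hba : 0 < b - a := sub_pos.2 hab
  set s := min (min 1 (b - a)) (ε / (4 * C * K1)) with hs
  have hsp : 0 < s := lt_min (lt_min one_pos hba) (by positivity)
  set l := s ^ 2 with hl
  have hlp : 0 < l := by positivity
  have hs1 : s ≤ 1 := (min_le_left _ _).trans (min_le_left _ _)
  have hs2 : s ≤ b - a := (min_le_left _ _).trans (min_le_right _ _)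
  have hl1 : l ≤ 1 := pow_le_one₀ hsp.le hs1
  have hlb : l ≤ b - a := by rw [hl]; nlinarith
  have hsl : Real.sqrt l = s := Real.sqrt_sq hsp.le
  have hsm : C * (l ^ r * K1) ≤ s * l^j * (ε / 4) := by
    have h1 : l ^ r ≤ l ^ (j+1) := pow_le_pow_of_le_one hlp.le hl1 (by omega)
    have h2 : s * (4 * C * K1) ≤ ε := by
      rw [← le_div_iff₀ (by positivity)]; exact min_le_right _ _
    calc C * (l^r * K1) ≤ C * (l^(j+1) * K1) := by gcongr
      _ = (s * l^j) * (s * (4 * C * K1)) / 4 := by rw [pow_succ]; nth_rewrite 2 [hl]; ring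
      _ ≤ (s * l^j) * ε / 4 := by gcongr
      _ = _ := by ring
  have hev : ∀ᶠ k in L, n2 a b (fun x => f k 0 x - F 0 x) < s * l^j * (ε/4) / C :=
    h0.eventually_lt_const (by positivity)
  filter_upwards [hev, hK] with k hk hkK x hx
  have h3 := h a b l hlp hlb _ ((hf k).sub hF) j hj x hx
  have h4 : n2 a b (fun x => f k r x - F r x) ≤ K1 := by
    have := n2_sub hab.le ((hf k).bm le_rfl) (hF.bm le_rfl)
    have := le_abs_self K
    linarith
  rw [lt_div_iff₀ (by positivity)] at hk
  rw [hsl] at h3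
  have h5 : C * (l^r * n2 a b (fun x => f k r x - F r x)) ≤ C * (l ^ r * K1) := by gcongr
  have h6 : s * l^j * |f k j x - F j x| < s * l^j * ε := by
    have : 0 < s * l^j * ε := by positivity
    nlinarith
  exact lt_of_mul_lt_mul_left h6 (by positivity)

theorem lsc {ι : Type*} {L : Filter ι} [L.NeBot] {r : ℕ} (hr : 1 ≤ r) {f : ι → ℕ → ℝ → ℝ} {F : ℕ → ℝ → ℝ} {K : ℝ}
    (hf : ∀ k, Ch 0 1 r (f k)) (hF : Ch 0 1 r F)
    (h0 : Tendsto (fun k => n2 0 1 (fun x => f k 0 x - F 0 x)) L (𝓝 0))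
    (hK : ∀ᶠ k in L, n2 0 1 (f k r) ≤ K) : n2 0 1 (F r) ≤ K := by
  have hKn : 0 ≤ K := by
    obtain ⟨k, hk⟩ := hK.exists
    exact (n2_nonneg _ _ _).trans hk
  obtain ⟨m, rfl⟩ : ∃ m, r = m + 1 := ⟨r - 1, by omega⟩
  have key : ∀ φ : Polynomial ℝ, |∫ x in (0:ℝ)..1, F (m+1) x * φ.eval x| ≤ K * n2 0 1 (fun x => φ.eval x) := by
    intro φ
    have hφ : ∀ x ∈ Icc (0:ℝ) 1, HasDerivWithinAt (fun x => φ.eval x) (φ.derivative.eval x) (Icc 0 1) x :=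
      fun x _ => (φ.hasDerivAt x).hasDerivWithinAt
    have hφc : ContinuousOn (fun x => φ.eval x) (Icc (0:ℝ) 1) := φ.continuous.continuousOn
    have hφ' : ContinuousOn (fun x => φ.derivative.eval x) (Icc (0:ℝ) 1) := φ.derivative.continuous.continuousOn
    apply le_of_forall_pos_le_add
    intro ε hε
    set B := |φ.eval 1| + |φ.eval 0| + n2 0 1 (fun x => φ.derivative.eval x) + 1 with hB
    have hBp : 0 < B := by
      have := n2_nonneg 0 1 (fun x => φ.derivative.eval x)
      positivity
    obtain ⟨k, hk, hkK⟩ := ((conv_sup zero_lt_one hf hF h0 hK (Nat.lt_succ_self m) (div_pos hε hBp)).and hK).exists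
    have hD := (hf k).sub hF
    have e1 := ibp zero_le_one (hD.1 m (Nat.lt_succ_self m)) hD.2 hφ hφ'
    have hb1 : BM 0 1 (fun x => f k (m+1) x * φ.eval x) := ((hf k).bm le_rfl).mul (BM.of_cont hφc)
    have hb2 : BM 0 1 (fun x => F (m+1) x * φ.eval x) := (hF.bm le_rfl).mul (BM.of_cont hφc)
    have e2 : ∫ x in (0:ℝ)..1, (f k (m+1) x - F (m+1) x) * φ.eval x
        = (∫ x in (0:ℝ)..1, f k (m+1) x * φ.eval x) - ∫ x in (0:ℝ)..1, F (m+1) x * φ.eval x := by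
      rw [← intervalIntegral.integral_sub (hb1.ii zero_le_one) (hb2.ii zero_le_one)]
      congr 1; ext x; ring
    have e3 := cs zero_le_one ((hf k).bm le_rfl) (BM.of_cont hφc)
    have e4 := cs zero_le_one (hD.bm (Nat.le_succ m)) (BM.of_cont hφ')
    have e5 : n2 0 1 (fun x => f k m x - F m x) ≤ ε / B := by
      have := n2_le_sup zero_le_one (hD.bm (Nat.le_succ m)) (fun x hx => (hk x hx).le)
      simpa using this
    have e6 := (hk 1 (by simp)).le
    have e7 := (hk 0 (by simp)).le
    have hq0 := n2_nonneg 0 1 (fun x => φ.derivative.eval x)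
    have hqφ := n2_nonneg 0 1 (fun x => φ.eval x)
    have e8 : |∫ x in (0:ℝ)..1, (f k (m+1) x - F (m+1) x) * φ.eval x| ≤ ε := by
      rw [e1]
      have t1 : |(f k m 1 - F m 1) * φ.eval 1| ≤ ε / B * |φ.eval 1| := by
        rw [abs_mul]; gcongr
      have t2 : |(f k m 0 - F m 0) * φ.eval 0| ≤ ε / B * |φ.eval 0| := by
        rw [abs_mul]; gcongr
      have t3 : n2 0 1 (fun x => f k m x - F m x) * n2 0 1 (fun x => φ.derivative.eval x)
        ≤ ε / B * n2 0 1 (fun x => φ.derivative.eval x) := by gcongr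
      have t4 : ε / B * B = ε := by field_simp
      have t5 : 0 ≤ ε / B := by positivity
      refine (abs_sub _ _).trans ?_
      have := abs_sub ((f k m 1 - F m 1) * φ.eval 1) ((f k m 0 - F m 0) * φ.eval 0)
      rw [hB] at t4
      nlinarith
    rw [e2] at e8
    have e9 : n2 0 1 (f k (m+1)) * n2 0 1 (fun x => φ.eval x) ≤ K * n2 0 1 (fun x => φ.eval x) := by gcongr
    rw [abs_le] at *
    constructor <;> linarith [e8.1, e8.2, e3.1, e3.2]
  set n := n2 0 1 (F (m+1)) with hn
  have hn0 : 0 ≤ n := n2_nonneg _ _ _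
  have main : n * n ≤ K * n := by
    apply le_of_forall_pos_le_add
    intro ε hε
    obtain ⟨φ, hφ⟩ := exists_polynomial_near_of_continuousOn 0 1 (F (m+1)) hF.2 (ε / (n + K + 1)) (by positivity)
    set e := ε / (n + K + 1) with he
    have hep : 0 < e := by positivity
    have hee : e * (n + K + 1) = ε := by rw [he]; field_simp
    have b1 : BM 0 1 (fun x => φ.eval x) := poly_bm _ _ _
    have b2 := hF.bm (le_refl (m+1))
    have h1 : n2 0 1 (fun x => φ.eval x - F (m+1) x) ≤ e := by
      have := n2_le_sup zero_le_one (b1.sub b2) (fun x hx => (hφ x hx).le)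
      simpa using this
    have h2 : n2 0 1 (fun x => φ.eval x) ≤ n + e := by
      have := n2_add zero_le_one (b1.sub b2) b2
      simp only [sub_add_cancel] at this
      linarith
    have h3 := cs zero_le_one b2 (b1.sub b2)
    have h4 : ∫ x in (0:ℝ)..1, F (m+1) x * (φ.eval x - F (m+1) x)
      = (∫ x in (0:ℝ)..1, F (m+1) x * φ.eval x) - n^2 := by
      rw [hn, n2_sq zero_le_one, ← intervalIntegral.integral_sub ((b2.mul b1).ii zero_le_one) (b2.sq.ii zero_le_one)]
      congr 1; ext x; ring
    have h5 := key φ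
    rw [h4] at h3
    rw [abs_le] at h3 h5
    have h6 : n * n2 0 1 (fun x => φ.eval x - F (m+1) x) ≤ n * e := by gcongr
    have h7 : K * n2 0 1 (fun x => φ.eval x) ≤ K * (n + e) := by gcongr
    nlinarith [h3.1, h5.2]
  by_contra hcon
  push Not at hcon
  nlinarith

theorem gron {c d K ε : ℝ} (hK : 0 ≤ K) (hε : 0 ≤ ε) {y y' : ℝ → ℝ}
    (hy : ∀ s ∈ Icc c d, HasDerivWithinAt y (y' s) (Icc c d) s)
    (hb : ∀ s ∈ Icc c d, |y' s| ≤ K * y s + ε) {a t : ℝ} (ha : a ∈ Icc c d) (ht : t ∈ Icc c d) :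
    y t ≤ (y a + ε * |t - a|) * Real.exp (K * |t - a|) := by
  rcases le_total a t with h | h
  · rw [abs_of_nonneg (sub_nonneg.2 h)]
    have hsub : Icc a t ⊆ Icc c d := Icc_subset_Icc ha.1 ht.2
    have hd : ∀ s ∈ Icc a t, HasDerivWithinAt (fun s => Real.exp (-(K * (s - a))) * y s - ε * (s - a))
        ((Real.exp (-(K * (s - a))) * (-(K * 1))) * y s + Real.exp (-(K * (s - a))) * y' s - ε * 1) (Icc a t) s := by
      intro s hs
      have h1 : HasDerivWithinAt (fun s => s - a) 1 (Icc a t) s := ((hasDerivAt_id s).sub_const a).hasDerivWithinAt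
      exact (((h1.const_mul K).neg.exp).mul ((hy s (hsub hs)).mono hsub)).sub (h1.const_mul ε)
    have hanti : AntitoneOn (fun s => Real.exp (-(K * (s - a))) * y s - ε * (s - a)) (Icc a t) := by
      apply antitoneOn_of_hasDerivWithinAt_nonpos (convex_Icc a t)
        (fun s hs => (hd s hs).continuousWithinAt) (fun s hs => (hd s (interior_subset hs)).mono interior_subset)
      intro s hs
      have hs' := interior_subset hs
      have hbs := (abs_le.1 (hb s (hsub hs'))).2
      have hexp : Real.exp (-(K * (s - a))) ≤ 1 := by
        rw [Real.exp_le_one_iff]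
        have := mul_nonneg hK (sub_nonneg.2 hs'.1); linarith
      have hep := Real.exp_pos (-(K * (s - a)))
      nlinarith [mul_le_mul_of_nonneg_left hbs hep.le, mul_le_mul_of_nonneg_right hexp hε]
    have := hanti ⟨le_rfl, h⟩ ⟨h, le_rfl⟩ h
    simp only [sub_self, mul_zero, neg_zero, Real.exp_zero, one_mul, sub_zero] at this
    have he : Real.exp (K * (t-a)) * Real.exp (-(K * (t-a))) = 1 := by rw [← Real.exp_add]; simp
    have hep := Real.exp_pos (K * (t - a))
    calc y t = (Real.exp (K * (t-a)) * Real.exp (-(K * (t-a)))) * y t := by rw [he, one_mul]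
      _ = Real.exp (K * (t-a)) * (Real.exp (-(K * (t-a))) * y t) := by ring
      _ ≤ Real.exp (K * (t-a)) * (y a + ε * (t - a)) := by gcongr; linarith
      _ = _ := by ring
  · rw [abs_of_nonpos (sub_nonpos.2 h), neg_sub]
    have hsub : Icc t a ⊆ Icc c d := Icc_subset_Icc ht.1 ha.2
    have hd : ∀ s ∈ Icc t a, HasDerivWithinAt (fun s => Real.exp (K * (s - a)) * y s + ε * (s - a))
        ((Real.exp (K * (s - a)) * (K * 1)) * y s + Real.exp (K * (s - a)) * y' s + ε * 1) (Icc t a) s := by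
      intro s hs
      have h1 : HasDerivWithinAt (fun s => s - a) 1 (Icc t a) s := ((hasDerivAt_id s).sub_const a).hasDerivWithinAt
      exact (((h1.const_mul K).exp).mul ((hy s (hsub hs)).mono hsub)).add (h1.const_mul ε)
    have hanti : MonotoneOn (fun s => Real.exp (K * (s - a)) * y s + ε * (s - a)) (Icc t a) := by
      apply monotoneOn_of_hasDerivWithinAt_nonneg (convex_Icc t a)
        (fun s hs => (hd s hs).continuousWithinAt) (fun s hs => (hd s (interior_subset hs)).mono interior_subset)
      intro s hs
      have hs' := interior_subset hs
      have hbs := (abs_le.1 (hb s (hsub hs'))).1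
      have hexp : Real.exp (K * (s - a)) ≤ 1 := by
        rw [Real.exp_le_one_iff]
        exact mul_nonpos_of_nonneg_of_nonpos hK (sub_nonpos.2 hs'.2)
      have hep := Real.exp_pos (K * (s - a))
      nlinarith [mul_le_mul_of_nonneg_left hbs hep.le, mul_le_mul_of_nonneg_right hexp hε]
    have := hanti ⟨le_rfl, h⟩ ⟨h, le_rfl⟩ h
    simp only [sub_self, mul_zero, Real.exp_zero, one_mul, add_zero] at this
    have he : Real.exp (K * (a-t)) * Real.exp (K * (t-a)) = 1 := by rw [← Real.exp_add, ← mul_add]; simp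
    have hep := Real.exp_pos (K * (a - t))
    calc y t = (Real.exp (K * (a-t)) * Real.exp (K * (t-a))) * y t := by rw [he, one_mul]
      _ = Real.exp (K * (a-t)) * (Real.exp (K * (t-a)) * y t) := by ring
      _ ≤ Real.exp (K * (a-t)) * (y a + ε * (a - t)) := by gcongr; linarith
      _ = _ := by ring

/-- weak chains: derivatives off the points 0, 1 -/
def WC (a b : ℝ) (r : ℕ) (F : ℕ → ℝ → ℝ) : Prop :=
  (∀ i < r, ContinuousOn (F i) (Icc a b) ∧
    ∀ x ∈ Ioo a b \ {0, 1}, HasDerivAt (F i) (F (i+1) x) x) ∧ ∀ i ≤ r, BM a b (F i)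

/-- smooth chains on the line -/
def SC (F : ℕ → ℝ → ℝ) : Prop := ∀ i x, HasDerivAt (F i) (F (i+1) x) x

theorem SC.cont {F : ℕ → ℝ → ℝ} (h : SC F) (i : ℕ) : Continuous (F i) :=
  continuous_iff_continuousAt.2 fun x => (h i x).continuousAt

theorem SC.bm {F : ℕ → ℝ → ℝ} (h : SC F) (i : ℕ) (a b : ℝ) : BM a b (F i) := BM.of_cont (h.cont i).continuousOn

theorem SC.ch {F : ℕ → ℝ → ℝ} (h : SC F) (a b : ℝ) (r : ℕ) : Ch a b r F :=
  ⟨fun i _ x _ => (h i x).hasDerivWithinAt, (h.cont r).continuousOn⟩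

theorem SC.wc {F : ℕ → ℝ → ℝ} (h : SC F) (a b : ℝ) (r : ℕ) : WC a b r F :=
  ⟨fun i _ => ⟨(h.cont i).continuousOn, fun x _ => h i x⟩, fun i _ => h.bm i a b⟩

theorem SC.add {F G : ℕ → ℝ → ℝ} (h : SC F) (h' : SC G) : SC (fun i x => F i x + G i x) :=
  fun i x => (h i x).add (h' i x)

theorem SC.cmul {F : ℕ → ℝ → ℝ} (c : ℝ) (h : SC F) : SC (fun i x => c * F i x) :=
  fun i x => (h i x).const_mul c

theorem SC.shift {F : ℕ → ℝ → ℝ} (h : SC F) : SC (fun i => F (i+1)) := fun i x => h (i+1) x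

theorem SC.sum {F : ℕ → ℕ → ℝ → ℝ} (s : Finset ℕ) (h : ∀ n ∈ s, SC (F n)) :
    SC (fun i x => ∑ n ∈ s, F n i x) := fun i x => by
  have := HasDerivAt.fun_sum (u := s) (A := fun n => F n i) (A' := fun n => F n (i+1) x) (x := x)
    (fun n hn => h n hn i x)
  exact this

/-- Leibniz product of chains -/
def LB (F G : ℕ → ℝ → ℝ) : ℕ → ℝ → ℝ := fun i x =>
  ∑ p ∈ Finset.HasAntidiagonal.antidiagonal i, (i.choose p.1 : ℝ) * (F p.1 x * G p.2 x)

theorem LB_succ (F G : ℕ → ℝ → ℝ) (i : ℕ) (x : ℝ) : LB F G (i+1) x =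
    ∑ p ∈ Finset.HasAntidiagonal.antidiagonal i, (i.choose p.1 : ℝ) * (F (p.1+1) x * G p.2 x + F p.1 x * G (p.2+1) x) := by
  unfold LB
  rw [Finset.sum_antidiagonal_choose_succ_mul (fun k l => F k x * G l x)]
  have : ∀ p ∈ Finset.HasAntidiagonal.antidiagonal i, (i.choose p.2 : ℝ) = i.choose p.1 := by
    intro p hp
    rw [Finset.HasAntidiagonal.mem_antidiagonal] at hp
    rw [← Nat.choose_symm_of_eq_add (by omega : i = p.1 + p.2)]
  rw [← Finset.sum_add_distrib]
  apply Finset.sum_congr rfl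
  intro p hp
  rw [this p hp]; ring

theorem SC.mul {F G : ℕ → ℝ → ℝ} (h : SC F) (h' : SC G) : SC (LB F G) := fun i x => by
  rw [LB_succ]
  have := HasDerivAt.fun_sum (u := Finset.HasAntidiagonal.antidiagonal i) (A := fun p => fun x => (i.choose p.1 : ℝ) * (F p.1 x * G p.2 x))
    (A' := fun p => (i.choose p.1 : ℝ) * (F (p.1+1) x * G p.2 x + F p.1 x * G (p.2+1) x)) (x := x)
    (fun p _ => ((h p.1 x).mul (h' p.2 x)).const_mul _)
  exact this

theorem Ch.mul {a b : ℝ} {r : ℕ} {F G : ℕ → ℝ → ℝ} (h : Ch a b r F) (h' : Ch a b r G) : Ch a b r (LB F G) := by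
  refine ⟨fun i hi x hx => ?_, ?_⟩
  · rw [LB_succ]
    have := HasDerivWithinAt.fun_sum (u := Finset.HasAntidiagonal.antidiagonal i) (A := fun p => fun x => (i.choose p.1 : ℝ) * (F p.1 x * G p.2 x))
      (A' := fun p => (i.choose p.1 : ℝ) * (F (p.1+1) x * G p.2 x + F p.1 x * G (p.2+1) x)) (x := x) (s := Icc a b)
      (fun p hp => by
        rw [Finset.HasAntidiagonal.mem_antidiagonal] at hp
        exact ((h.1 p.1 (by omega) x hx).mul (h'.1 p.2 (by omega) x hx)).const_mul _)
    exact this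
  · unfold LB
    apply continuousOn_finset_sum
    intro p hp
    rw [Finset.HasAntidiagonal.mem_antidiagonal] at hp
    exact continuousOn_const.mul ((h.cont (by omega)).mul (h'.cont (by omega)))

/-- parity classes at the points a, b (derivatives of order < r) -/
def PE (a b : ℝ) (r : ℕ) (F : ℕ → ℝ → ℝ) : Prop := ∀ i < r, Odd i → F i a = 0 ∧ F i b = 0
def PO (a b : ℝ) (r : ℕ) (F : ℕ → ℝ → ℝ) : Prop := ∀ i < r, Even i → F i a = 0 ∧ F i b = 0

theorem PE.mulE {a b : ℝ} {r : ℕ} {F G : ℕ → ℝ → ℝ} (h : PE a b r F) (h' : PE a b r G) : PE a b r (LB F G) := by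
  intro i hi hodd
  constructor <;>
  · unfold LB
    apply Finset.sum_eq_zero
    intro p hp
    rw [Finset.HasAntidiagonal.mem_antidiagonal] at hp
    rw [← hp, Nat.odd_add] at hodd
    by_cases h1 : Odd p.1
    · simp [h p.1 (by omega) h1]
    · have h2 : Odd p.2 := by
        rw [← Nat.not_even_iff_odd]; exact fun h => h1 (hodd.2 h)
      simp [h' p.2 (by omega) h2]

theorem PO.mulO {a b : ℝ} {r : ℕ} {F G : ℕ → ℝ → ℝ} (h : PO a b r F) (h' : PO a b r G) : PE a b r (LB F G) := by
  intro i hi hodd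
  constructor <;>
  · unfold LB
    apply Finset.sum_eq_zero
    intro p hp
    rw [Finset.HasAntidiagonal.mem_antidiagonal] at hp
    rw [← hp, Nat.odd_add] at hodd
    by_cases h1 : Even p.1
    · simp [h p.1 (by omega) h1]
    · have h2 : Even p.2 := hodd.1 (Nat.not_even_iff_odd.1 h1)
      simp [h' p.2 (by omega) h2]

theorem PE.mulO {a b : ℝ} {r : ℕ} {F G : ℕ → ℝ → ℝ} (h : PE a b r F) (h' : PO a b r G) : PO a b r (LB F G) := by
  intro i hi hodd
  constructor <;>
  · unfold LB
    apply Finset.sum_eq_zero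
    intro p hp
    rw [Finset.HasAntidiagonal.mem_antidiagonal] at hp
    rw [← hp, Nat.even_add] at hodd
    by_cases h1 : Odd p.1
    · simp [h p.1 (by omega) h1]
    · have h2 : Even p.2 := hodd.1 (Nat.not_odd_iff_even.1 h1)
      simp [h' p.2 (by omega) h2]

theorem PE.shift {a b : ℝ} {r : ℕ} {F : ℕ → ℝ → ℝ} (h : PE a b (r+1) F) : PO a b r (fun i => F (i+1)) :=
  fun i hi he => h (i+1) (by omega) he.add_one
theorem PO.shift {a b : ℝ} {r : ℕ} {F : ℕ → ℝ → ℝ} (h : PO a b (r+1) F) : PE a b r (fun i => F (i+1)) :=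
  fun i hi he => h (i+1) (by omega) he.add_one

theorem wibp {a b : ℝ} (hab : a ≤ b) {r : ℕ} {F G : ℕ → ℝ → ℝ} (hF : WC a b r F) (hG : SC G) (l m : ℕ) (hl : l < r) :
    ∫ x in a..b, F (l+1) x * G m x = F l b * G m b - F l a * G m a - ∫ x in a..b, F l x * G (m+1) x := by
  have hc := (hF.1 l hl).1
  have h1 : BM a b (fun x => F (l+1) x * G m x) := (hF.2 (l+1) (by omega)).mul (hG.bm m a b)
  have h2 : BM a b (fun x => F l x * G (m+1) x) := (hF.2 l hl.le).mul (hG.bm (m+1) a b)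
  have := MeasureTheory.integral_eq_of_hasDerivAt_off_countable_of_le (fun x => F l x * G m x)
    (fun x => F (l+1) x * G m x + F l x * G (m+1) x) hab (s := {0,1}) (Set.to_countable _)
    (hc.mul (hG.cont m).continuousOn) (fun x hx => ((hF.1 l hl).2 x hx).mul (hG m x))
    ((h1.add h2).ii hab)
  rw [intervalIntegral.integral_add (h1.ii hab) (h2.ii hab)] at this
  linarith

/-- pair inner product -/
noncomputable def ipp (a b : ℝ) (f1 f2 g1 g2 : ℝ → ℝ) : ℝ := ∫ x in a..b, (f1 x * g1 x + f2 x * g2 x)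

theorem ipp_eq {a b : ℝ} (hab : a ≤ b) {f1 f2 g1 g2 : ℝ → ℝ} (h1 : BM a b f1) (h2 : BM a b f2)
    (h3 : BM a b g1) (h4 : BM a b g2) :
    ipp a b f1 f2 g1 g2 = (∫ x in a..b, f1 x * g1 x) + ∫ x in a..b, f2 x * g2 x :=
  intervalIntegral.integral_add ((h1.mul h3).ii hab) ((h2.mul h4).ii hab)

theorem ipp_step {a b : ℝ} (hab : a ≤ b) {r : ℕ} {f1 f2 g1 g2 : ℕ → ℝ → ℝ}
    (hf1 : WC a b r f1) (hf2 : WC a b r f2) (hg1 : SC g1) (hg2 : SC g2)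
    (pf1 : PE a b r f1) (pf2 : PO a b r f2) (pg1 : ∀ k, PE a b k g1) (pg2 : ∀ k, PO a b k g2)
    (l m : ℕ) (hl : l < r) (hlm : Odd (l + m)) :
    ipp a b (f1 (l+1)) (f2 (l+1)) (g1 m) (g2 m) = - ipp a b (f1 l) (f2 l) (g1 (m+1)) (g2 (m+1)) := by
  rw [ipp_eq hab (hf1.2 _ (by omega)) (hf2.2 _ (by omega)) (hg1.bm _ _ _) (hg2.bm _ _ _),
    ipp_eq hab (hf1.2 _ (by omega)) (hf2.2 _ (by omega)) (hg1.bm _ _ _) (hg2.bm _ _ _),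
    wibp hab hf1 hg1 l m hl, wibp hab hf2 hg2 l m hl]
  have z1 : f1 l b * g1 m b = 0 ∧ f1 l a * g1 m a = 0 ∧ f2 l b * g2 m b = 0 ∧ f2 l a * g2 m a = 0 := by
    rw [Nat.odd_add] at hlm
    by_cases h : Odd l
    · have h2 := hlm.1 h
      simp [pf1 l hl h, pg2 (m+1) m (by omega) h2]
    · have h2 : Odd m := by rw [← Nat.not_even_iff_odd]; exact fun h' => h (hlm.2 h')
      simp [pf2 l hl (Nat.not_odd_iff_even.1 h), pg1 (m+1) m (by omega) h2]
  rw [z1.1, z1.2.1, z1.2.2.1, z1.2.2.2]; ring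

theorem ipp_steps {a b : ℝ} (hab : a ≤ b) {r : ℕ} {f1 f2 g1 g2 : ℕ → ℝ → ℝ}
    (hf1 : WC a b r f1) (hf2 : WC a b r f2) (hg1 : SC g1) (hg2 : SC g2)
    (pf1 : PE a b r f1) (pf2 : PO a b r f2) (pg1 : ∀ k, PE a b k g1) (pg2 : ∀ k, PO a b k g2)
    (s j : ℕ) (hs : s ≤ r) (hj : j ≤ s) :
    ipp a b (f1 s) (f2 s) (g1 s) (g2 s) = (-1)^j * ipp a b (f1 (s-j)) (f2 (s-j)) (g1 (s+j)) (g2 (s+j)) := by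
  induction j with
  | zero => simp
  | succ j ih =>
    rw [ih (by omega)]
    have := ipp_step hab hf1 hf2 hg1 hg2 pf1 pf2 pg1 pg2 (s-(j+1)) (s+j) (by omega)
      ⟨s-1, by omega⟩
    rw [show s - (j+1) + 1 = s - j by omega, show s + j + 1 = s + (j+1) by omega] at this
    rw [this]; ring

/-! ### trigonometric basis -/
noncomputable def mu (a b : ℝ) (n : ℕ) : ℝ := Real.pi / (b - a) * (((n+1)/2 : ℕ) : ℝ)
noncomputable def bs (a b : ℝ) (n : ℕ) (θ : ℝ) (i : ℕ) (x : ℝ) : ℝ :=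
  mu a b n ^ i * Real.cos (mu a b n * (x - a) + θ + i * (Real.pi/2))
noncomputable def cn (a b : ℝ) (n : ℕ) : ℝ := if n = 0 then Real.sqrt (1/(b-a)) else Real.sqrt (2/(b-a))
noncomputable def e1 (a b : ℝ) (n i : ℕ) (x : ℝ) : ℝ := if Even n then cn a b n * bs a b n 0 i x else 0
noncomputable def e2 (a b : ℝ) (n i : ℕ) (x : ℝ) : ℝ := if Even n then 0 else cn a b n * bs a b n (-(Real.pi/2)) i x

theorem bs_sc (a b : ℝ) (n : ℕ) (θ : ℝ) : SC (bs a b n θ) := by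
  intro i x
  have h1 : HasDerivAt (fun x : ℝ => mu a b n * (x - a) + θ + i * (Real.pi/2)) (mu a b n * 1) x :=
    ((((hasDerivAt_id x).sub_const a).const_mul (mu a b n)).add_const θ).add_const _
  have h2 := (h1.cos).const_mul (mu a b n ^ i)
  refine HasDerivAt.congr_deriv h2 ?_
  unfold bs
  rw [show mu a b n * (x - a) + θ + ((i+1 : ℕ):ℝ) * (Real.pi/2) = (mu a b n * (x - a) + θ + i * (Real.pi/2)) + Real.pi/2 by push_cast; ring,
    Real.cos_add_pi_div_two]
  ring

theorem bs_two (a b : ℝ) (n : ℕ) (θ : ℝ) (i : ℕ) (x : ℝ) : bs a b n θ (i+2) x = - (mu a b n)^2 * bs a b n θ i x := by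
  unfold bs
  rw [show mu a b n * (x - a) + θ + ((i+2 : ℕ):ℝ) * (Real.pi/2) = (mu a b n * (x - a) + θ + i * (Real.pi/2)) + Real.pi by push_cast; ring,
    Real.cos_add_pi]
  ring

theorem e1_sc (a b : ℝ) (n : ℕ) : SC (e1 a b n) := by
  intro i x; unfold e1
  split_ifs
  · exact (bs_sc a b n 0 i x).const_mul _
  · exact hasDerivAt_const x 0
theorem e2_sc (a b : ℝ) (n : ℕ) : SC (e2 a b n) := by
  intro i x; unfold e2
  split_ifs
  · exact hasDerivAt_const x 0
  · exact (bs_sc a b n _ i x).const_mul _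

theorem e1_two (a b : ℝ) (n i j : ℕ) (x : ℝ) : e1 a b n (i+2*j) x = (-1)^j * (mu a b n)^(2*j) * e1 a b n i x := by
  induction j with
  | zero => simp
  | succ j ih =>
    rw [show i + 2*(j+1) = i+2*j+2 by ring]
    have : e1 a b n (i+2*j+2) x = - (mu a b n)^2 * e1 a b n (i+2*j) x := by
      unfold e1; split_ifs
      · rw [bs_two]; ring
      · simp
    rw [this, ih]; ring
theorem e2_two (a b : ℝ) (n i j : ℕ) (x : ℝ) : e2 a b n (i+2*j) x = (-1)^j * (mu a b n)^(2*j) * e2 a b n i x := by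
  induction j with
  | zero => simp
  | succ j ih =>
    rw [show i + 2*(j+1) = i+2*j+2 by ring]
    have : e2 a b n (i+2*j+2) x = - (mu a b n)^2 * e2 a b n (i+2*j) x := by
      unfold e2; split_ifs
      · simp
      · rw [bs_two]; ring
    rw [this, ih]; ring

theorem cos_zero_aux (m : ℕ) (k : ℤ) (hk : Odd k) : Real.cos (m * Real.pi + k * (Real.pi/2)) = 0 := by
  rw [Real.cos_eq_zero_iff]
  obtain ⟨j, rfl⟩ := hk
  exact ⟨m + j, by push_cast; ring⟩

theorem mu_mul {a b : ℝ} (hab : a < b) (n : ℕ) : mu a b n * (b - a) = (((n+1)/2 : ℕ) : ℝ) * Real.pi := by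
  unfold mu; have : b - a ≠ 0 := (sub_pos.2 hab).ne'
  field_simp

theorem e1_pe {a b : ℝ} (hab : a < b) (n k : ℕ) : PE a b k (e1 a b n) := by
  intro i _ hi
  unfold e1 bs
  have hi' : Odd (i:ℤ) := by exact_mod_cast hi
  constructor <;> split_ifs
  · have := cos_zero_aux 0 i hi'
    simp only [sub_self, mul_zero, add_zero, Nat.cast_zero, zero_mul, zero_add, Int.cast_natCast] at this ⊢
    rw [this]; simp
  · rfl
  · have := cos_zero_aux ((n+1)/2) i hi'
    rw [Int.cast_natCast] at this
    rw [mu_mul hab, add_zero, this]; simp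
  · rfl

theorem e2_po {a b : ℝ} (hab : a < b) (n k : ℕ) : PO a b k (e2 a b n) := by
  intro i _ hi
  unfold e2 bs
  have hi' : Odd ((i:ℤ) - 1) := by
    rw [← Int.not_even_iff_odd, Int.even_sub_one, not_not]; exact_mod_cast hi
  constructor <;> split_ifs
  · rfl
  · have := cos_zero_aux 0 _ hi'
    rw [show mu a b n * (a - a) + -(Real.pi/2) + i * (Real.pi/2) = ((0:ℕ):ℝ) * Real.pi + (((i:ℤ)-1 : ℤ):ℝ) * (Real.pi/2) by push_cast; ring, this]
    simp
  · rfl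
  · have := cos_zero_aux ((n+1)/2) _ hi'
    rw [mu_mul hab, show (((n+1)/2 : ℕ) : ℝ) * Real.pi + -(Real.pi/2) + i * (Real.pi/2) = (((n+1)/2 : ℕ):ℝ) * Real.pi + (((i:ℤ)-1 : ℤ):ℝ) * (Real.pi/2) by push_cast; ring, this]
    simp

theorem ipp_cmul_right {a b : ℝ} {f1 f2 g1 g2 : ℝ → ℝ} (c : ℝ) :
    ipp a b f1 f2 (fun x => c * g1 x) (fun x => c * g2 x) = c * ipp a b f1 f2 g1 g2 := by
  unfold ipp
  rw [← intervalIntegral.integral_const_mul]; congr 1; ext x; ring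

/-- identity I1 -/
theorem I1 {a b : ℝ} (hab : a < b) {r : ℕ} {f1 f2 : ℕ → ℝ → ℝ}
    (hf1 : WC a b r f1) (hf2 : WC a b r f2) (pf1 : PE a b r f1) (pf2 : PO a b r f2)
    (s n : ℕ) (hs : s ≤ r) :
    ipp a b (f1 s) (f2 s) (e1 a b n s) (e2 a b n s)
      = (mu a b n)^(2*s) * ipp a b (f1 0) (f2 0) (e1 a b n 0) (e2 a b n 0) := by
  rw [ipp_steps hab.le hf1 hf2 (e1_sc a b n) (e2_sc a b n) pf1 pf2 (e1_pe hab n) (e2_po hab n) s s hs le_rfl,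
    Nat.sub_self, ← ipp_cmul_right, ← ipp_cmul_right]
  unfold ipp; congr 1; ext x
  have h1 := e1_two a b n 0 s x
  have h2 := e2_two a b n 0 s x
  rw [zero_add, two_mul] at h1 h2
  beta_reduce
  rw [h1, h2, ← two_mul]
  have : (-1:ℝ)^s * (-1)^s = 1 := by rw [← mul_pow]; simp
  linear_combination (mu a b n ^ (2*s) * (f1 0 x * e1 a b n 0 x + f2 0 x * e2 a b n 0 x)) * this

theorem ipp_comm (a b : ℝ) (f1 f2 g1 g2 : ℝ → ℝ) : ipp a b f1 f2 g1 g2 = ipp a b g1 g2 f1 f2 := by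
  unfold ipp; congr 1; ext x; ring

theorem mu_nonneg {a b : ℝ} (hab : a < b) (n : ℕ) : 0 ≤ mu a b n := by
  unfold mu; have := sub_pos.2 hab; have := Real.pi_pos; positivity

theorem mu_ge {a b : ℝ} (hab : a < b) {n : ℕ} (hn : n ≠ 0) : Real.pi / (b - a) ≤ mu a b n := by
  unfold mu; have := sub_pos.2 hab; have := Real.pi_pos
  have h : (1:ℝ) ≤ (((n+1)/2 : ℕ) : ℝ) := by exact_mod_cast (by omega : 1 ≤ (n+1)/2)
  exact le_mul_of_one_le_right (by positivity) h

theorem mu_zero (a b : ℝ) : mu a b 0 = 0 := by unfold mu; simp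

theorem e_pyth {a b : ℝ} (hab : a < b) {n : ℕ} (hn : n ≠ 0) (x : ℝ) :
    (mu a b n)^2 * (e1 a b n 0 x * e1 a b n 0 x + e2 a b n 0 x * e2 a b n 0 x)
      + (e1 a b n 1 x * e1 a b n 1 x + e2 a b n 1 x * e2 a b n 1 x) = 2/(b-a) * (mu a b n)^2 := by
  have hL := sub_pos.2 hab
  have hc : Real.sqrt (2/(b-a)) ^ 2 = 2/(b-a) := Real.sq_sqrt (by positivity)
  unfold e1 e2 cn bs
  rw [if_neg hn]
  split_ifs
  · have := Real.sin_sq_add_cos_sq (mu a b n * (x - a))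
    simp only [Nat.cast_zero, Nat.cast_one, one_mul, zero_mul, add_zero, Real.cos_add_pi_div_two, pow_zero, pow_one]
    linear_combination (mu a b n)^2 * Real.sqrt (2/(b-a)) ^ 2 * this + (mu a b n)^2 * hc
  · have := Real.sin_sq_add_cos_sq (mu a b n * (x - a))
    have h1 : mu a b n * (x - a) + -(Real.pi/2) + 1 * (Real.pi/2) = mu a b n * (x-a) := by ring
    have h2 : mu a b n * (x - a) + -(Real.pi/2) + 0 * (Real.pi/2) = mu a b n * (x-a) - Real.pi/2 := by ring
    simp only [Nat.cast_zero, Nat.cast_one, h1, h2, Real.cos_sub_pi_div_two, pow_zero, pow_one]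
    linear_combination (mu a b n)^2 * Real.sqrt (2/(b-a)) ^ 2 * this + (mu a b n)^2 * hc

theorem orth {a b : ℝ} (hab : a < b) (m n : ℕ) :
    ipp a b (e1 a b m 0) (e2 a b m 0) (e1 a b n 0) (e2 a b n 0) = if m = n then 1 else 0 := by
  have hL := sub_pos.2 hab
  have key : ∀ m n, ipp a b (e1 a b m 1) (e2 a b m 1) (e1 a b n 1) (e2 a b n 1) = (mu a b n)^2 * ipp a b (e1 a b m 0) (e2 a b m 0) (e1 a b n 0) (e2 a b n 0) :=
    fun m n => I1 hab ((e1_sc a b m).wc a b 1) ((e2_sc a b m).wc a b 1) (e1_pe hab m 1) (e2_po hab m 1) 1 n le_rfl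
  split_ifs with h
  · subst h
    by_cases hm : m = 0
    · subst hm
      have hc : Real.sqrt (1/(b-a)) ^ 2 = 1/(b-a) := Real.sq_sqrt (by positivity)
      unfold ipp e1 e2 cn bs
      simp only [mu_zero, if_true, Even.zero, Nat.cast_zero, zero_mul, add_zero, Real.cos_zero, pow_zero, mul_one]
      rw [intervalIntegral.integral_const, smul_eq_mul, ← pow_two, hc]
      field_simp
    · have k := key m m
      have hmu : 0 < mu a b m := lt_of_lt_of_le (by have := Real.pi_pos; positivity) (mu_ge hab hm)
      have : ∫ x in a..b, ((mu a b m)^2 * (e1 a b m 0 x * e1 a b m 0 x + e2 a b m 0 x * e2 a b m 0 x)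
      + (e1 a b m 1 x * e1 a b m 1 x + e2 a b m 1 x * e2 a b m 1 x)) = 2 * (mu a b m)^2 := by
        simp_rw [e_pyth hab hm]
        rw [intervalIntegral.integral_const, smul_eq_mul]; field_simp
      rw [intervalIntegral.integral_add, intervalIntegral.integral_const_mul] at this
      · change _ * ipp a b _ _ _ _ + ipp a b _ _ _ _ = _ at this
        rw [k] at this
        have h3 : (mu a b m)^2 * (2 * (ipp a b (e1 a b m 0) (e2 a b m 0) (e1 a b m 0) (e2 a b m 0) - 1)) = 0 := by linarith
        rcases mul_eq_zero.1 h3 with h4 | h4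
        · exact absurd h4 (by positivity)
        · linarith
      · refine BM.ii hab.le ?_
        exact (((e1_sc a b m).bm 0 a b).mul ((e1_sc a b m).bm 0 a b) |>.add (((e2_sc a b m).bm 0 a b).mul ((e2_sc a b m).bm 0 a b))).cmul _
      · refine BM.ii hab.le ?_
        exact (((e1_sc a b m).bm 1 a b).mul ((e1_sc a b m).bm 1 a b) |>.add (((e2_sc a b m).bm 1 a b).mul ((e2_sc a b m).bm 1 a b)))
  · by_cases hmu : mu a b m = mu a b n
    · have hpi := Real.pi_pos
      unfold mu at hmu
      have h1 : (((m+1)/2 : ℕ) : ℝ) = (((n+1)/2 : ℕ) : ℝ) :=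
        mul_left_cancel₀ (by positivity) hmu
      have h2 : (m+1)/2 = (n+1)/2 := by exact_mod_cast h1
      have h3 : ¬ (Even m ↔ Even n) := by
        simp only [Nat.even_iff]; omega
      unfold ipp
      rw [intervalIntegral.integral_congr (g := fun _ => 0)]
      · simp
      · intro x _
        unfold e1 e2
        by_cases hm : Even m
        · have hn : ¬ Even n := fun hn => h3 ⟨fun _ => hn, fun _ => hm⟩
          simp [hm, hn]
        · have hn : Even n := by
            by_contra hn; exact h3 ⟨fun h => absurd h hm, fun h => absurd h hn⟩
          simp [hm, hn]
    · have k1 := key m n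
      have k2 := key n m
      rw [ipp_comm a b (e1 a b n 1), k1, ipp_comm a b (e1 a b n 0)] at k2
      have h3 : ((mu a b n - mu a b m) * (mu a b n + mu a b m)) * ipp a b (e1 a b m 0) (e2 a b m 0) (e1 a b n 0) (e2 a b n 0) = 0 := by
        linear_combination k2
      rcases mul_eq_zero.1 h3 with h4 | h4
      · rcases mul_eq_zero.1 h4 with h5 | h5
        · exact absurd (by linarith) hmu
        · have := mu_nonneg hab m; have := mu_nonneg hab n
          exact absurd (by linarith) hmu
      · exact h4

theorem orths {a b : ℝ} (hab : a < b) (m n s : ℕ) :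
    ipp a b (e1 a b m s) (e2 a b m s) (e1 a b n s) (e2 a b n s) = if m = n then (mu a b n)^(2*s) else 0 := by
  rw [I1 hab ((e1_sc a b m).wc a b s) ((e2_sc a b m).wc a b s) (e1_pe hab m s) (e2_po hab m s) s n le_rfl, orth hab]
  simp

/-- Galerkin sums -/
noncomputable def WP (a b : ℝ) (N : ℕ) (z : ℕ → ℝ) (i : ℕ) (x : ℝ) : ℝ := ∑ n ∈ Finset.range N, z n * e1 a b n i x
noncomputable def WU (a b : ℝ) (N : ℕ) (z : ℕ → ℝ) (i : ℕ) (x : ℝ) : ℝ := ∑ n ∈ Finset.range N, z n * e2 a b n i x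
noncomputable def En (a b : ℝ) (N : ℕ) (z : ℕ → ℝ) (s : ℕ) : ℝ := ∑ n ∈ Finset.range N, (mu a b n)^(2*s) * (z n)^2

theorem WP_sc (a b : ℝ) (N : ℕ) (z : ℕ → ℝ) : SC (WP a b N z) :=
  SC.sum _ (fun n _ => (e1_sc a b n).cmul (z n))
theorem WU_sc (a b : ℝ) (N : ℕ) (z : ℕ → ℝ) : SC (WU a b N z) :=
  SC.sum _ (fun n _ => (e2_sc a b n).cmul (z n))
theorem WP_pe {a b : ℝ} (hab : a < b) (N : ℕ) (z : ℕ → ℝ) (k : ℕ) : PE a b k (WP a b N z) := by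
  intro i hi ho
  unfold WP
  constructor <;>
  · apply Finset.sum_eq_zero
    intro n _
    simp [e1_pe hab n k i hi ho]
theorem WU_po {a b : ℝ} (hab : a < b) (N : ℕ) (z : ℕ → ℝ) (k : ℕ) : PO a b k (WU a b N z) := by
  intro i hi ho
  unfold WU
  constructor <;>
  · apply Finset.sum_eq_zero
    intro n _
    simp [e2_po hab n k i hi ho]

theorem ipp_W {a b : ℝ} (hab : a < b) {f1 f2 : ℝ → ℝ} (h1 : BM a b f1) (h2 : BM a b f2) (N : ℕ) (z : ℕ → ℝ) (i : ℕ) :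
    ipp a b f1 f2 (WP a b N z i) (WU a b N z i) = ∑ n ∈ Finset.range N, z n * ipp a b f1 f2 (e1 a b n i) (e2 a b n i) := by
  unfold ipp
  have : ∀ n, z n * (∫ x in a..b, (f1 x * e1 a b n i x + f2 x * e2 a b n i x)) = ∫ x in a..b, z n * (f1 x * e1 a b n i x + f2 x * e2 a b n i x) :=
    fun n => (intervalIntegral.integral_const_mul _ _).symm
  simp_rw [this]
  rw [← intervalIntegral.integral_finset_sum]
  · congr 1; ext x; unfold WP WU
    rw [Finset.mul_sum, Finset.mul_sum, ← Finset.sum_add_distrib]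
    exact Finset.sum_congr rfl fun n _ => by ring
  · intro n _
    exact BM.ii hab.le (((h1.mul ((e1_sc a b n).bm i a b)).add (h2.mul ((e2_sc a b n).bm i a b))).cmul _)

theorem W_coef {a b : ℝ} (hab : a < b) (N : ℕ) (z : ℕ → ℝ) (i n : ℕ) (hn : n < N) :
    ipp a b (WP a b N z i) (WU a b N z i) (e1 a b n i) (e2 a b n i) = (mu a b n)^(2*i) * z n := by
  rw [ipp_comm, ipp_W hab ((e1_sc a b n).bm i a b) ((e2_sc a b n).bm i a b)]
  simp_rw [orths hab]
  rw [Finset.sum_eq_single n]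
  · simp [mul_comm]
  · intro m _ hm; rw [if_neg (Ne.symm hm), mul_zero]
  · intro h; exact absurd (Finset.mem_range.2 hn) h

theorem I2 {a b : ℝ} (hab : a < b) (N : ℕ) (z : ℕ → ℝ) (s : ℕ) :
    ipp a b (WP a b N z s) (WU a b N z s) (WP a b N z s) (WU a b N z s) = En a b N z s := by
  rw [ipp_W hab ((WP_sc a b N z).bm s a b) ((WU_sc a b N z).bm s a b)]
  unfold En
  refine Finset.sum_congr rfl fun n hn => ?_
  rw [W_coef hab N z s n (Finset.mem_range.1 hn)]; ring

theorem ipp_self {a b : ℝ} (hab : a ≤ b) {f1 f2 : ℝ → ℝ} (h1 : BM a b f1) (h2 : BM a b f2) :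
    ipp a b f1 f2 f1 f2 = n2 a b f1 ^ 2 + n2 a b f2 ^ 2 := by
  rw [ipp_eq hab h1 h2 h1 h2, n2_sq hab, n2_sq hab]; simp only [pow_two]

theorem ipp_cs {a b : ℝ} (hab : a ≤ b) {f1 f2 g1 g2 : ℝ → ℝ} (h1 : BM a b f1) (h2 : BM a b f2) (h3 : BM a b g1) (h4 : BM a b g2) :
    |ipp a b f1 f2 g1 g2| ≤ Real.sqrt (n2 a b f1 ^ 2 + n2 a b f2 ^ 2) * Real.sqrt (n2 a b g1 ^ 2 + n2 a b g2 ^ 2) := by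
  rw [ipp_eq hab h1 h2 h3 h4]
  have c1 := cs hab h1 h3
  have c2 := cs hab h2 h4
  rw [← Real.sqrt_mul (by positivity)]
  apply Real.le_sqrt_of_sq_le
  have h5 : |(∫ x in a..b, f1 x * g1 x) + ∫ x in a..b, f2 x * g2 x| ≤ n2 a b f1 * n2 a b g1 + n2 a b f2 * n2 a b g2 :=
    (abs_add_le _ _).trans (add_le_add c1 c2)
  refine (pow_le_pow_left₀ (abs_nonneg _) h5 2).trans ?_
  nlinarith [sq_nonneg (n2 a b f1 * n2 a b g2 - n2 a b f2 * n2 a b g1)]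

theorem En_nonneg (a b : ℝ) (N : ℕ) (z : ℕ → ℝ) (s : ℕ) : 0 ≤ En a b N z s :=
  Finset.sum_nonneg fun n _ => by rw [pow_mul]; positivity

theorem WP_n2 {a b : ℝ} (hab : a < b) (N : ℕ) (z : ℕ → ℝ) (s : ℕ) : n2 a b (WP a b N z s) ≤ Real.sqrt (En a b N z s) := by
  apply Real.le_sqrt_of_sq_le
  rw [← I2 hab, ipp_self hab.le ((WP_sc a b N z).bm s a b) ((WU_sc a b N z).bm s a b)]
  nlinarith [sq_nonneg (n2 a b (WU a b N z s))]
theorem WU_n2 {a b : ℝ} (hab : a < b) (N : ℕ) (z : ℕ → ℝ) (s : ℕ) : n2 a b (WU a b N z s) ≤ Real.sqrt (En a b N z s) := by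
  apply Real.le_sqrt_of_sq_le
  rw [← I2 hab, ipp_self hab.le ((WP_sc a b N z).bm s a b) ((WU_sc a b N z).bm s a b)]
  nlinarith [sq_nonneg (n2 a b (WP a b N z s))]

/-- Poincare -/
theorem En_poinc {a b : ℝ} (hab : a < b) (N : ℕ) (z : ℕ → ℝ) (l m : ℕ) (hl : 1 ≤ l) (hlm : l ≤ m) :
    En a b N z l ≤ (((b-a)/Real.pi)^(m-l))^2 * En a b N z m := by
  unfold En; rw [Finset.mul_sum]
  refine Finset.sum_le_sum fun n _ => ?_
  by_cases hn : n = 0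
  · subst hn; rw [mu_zero, zero_pow (by omega), zero_mul, zero_pow (by omega)]; simp
  · have hL := sub_pos.2 hab
    have hpi := Real.pi_pos
    have h1 := mu_ge hab hn
    have h2 : 1 ≤ (b-a)/Real.pi * mu a b n := by
      calc (1:ℝ) = (b-a)/Real.pi * (Real.pi/(b-a)) := by field_simp
        _ ≤ _ := by gcongr
    have h3 : 1 ≤ ((b-a)/Real.pi * mu a b n)^(2*(m-l)) := one_le_pow₀ h2
    have h0 := mu_nonneg hab n
    calc mu a b n ^ (2*l) * z n ^ 2 ≤ ((b-a)/Real.pi * mu a b n)^(2*(m-l)) * (mu a b n ^ (2*l) * z n ^ 2) :=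
          le_mul_of_one_le_left (by positivity) h3
      _ = _ := by
        rw [mul_pow, show mu a b n ^ (2*m) = mu a b n ^ (2*(m-l)) * mu a b n ^ (2*l) by rw [← pow_add]; congr 1; omega]
        rw [← pow_mul, mul_comm (m-l) 2]; ring

/-- coefficients of a function; the projected sum has smaller seminorms -/
noncomputable def cf (a b : ℝ) (g1 g2 : ℝ → ℝ) (n : ℕ) : ℝ := ipp a b g1 g2 (e1 a b n 0) (e2 a b n 0)

theorem En_cf {a b : ℝ} (hab : a < b) {r : ℕ} {f1 f2 : ℕ → ℝ → ℝ}
    (hf1 : WC a b r f1) (hf2 : WC a b r f2) (pf1 : PE a b r f1) (pf2 : PO a b r f2) (N s : ℕ) (hs : s ≤ r) :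
    En a b N (cf a b (f1 0) (f2 0)) s ≤ n2 a b (f1 s) ^ 2 + n2 a b (f2 s) ^ 2 := by
  set z := cf a b (f1 0) (f2 0) with hz
  have h1 : ipp a b (f1 s) (f2 s) (WP a b N z s) (WU a b N z s) = En a b N z s := by
    rw [ipp_W hab (hf1.2 s hs) (hf2.2 s hs)]
    unfold En
    refine Finset.sum_congr rfl fun n _ => ?_
    rw [I1 hab hf1 hf2 pf1 pf2 s n hs]
    change z n * (_ * z n) = _; ring
  have h2 := ipp_cs hab.le (hf1.2 s hs) (hf2.2 s hs) ((WP_sc a b N z).bm s a b) ((WU_sc a b N z).bm s a b)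
  rw [h1, ← ipp_self hab.le ((WP_sc a b N z).bm s a b) ((WU_sc a b N z).bm s a b), I2 hab, abs_of_nonneg (En_nonneg _ _ _ _ _)] at h2
  set E := En a b N z s
  have hE : 0 ≤ E := En_nonneg _ _ _ _ _
  set G := n2 a b (f1 s) ^ 2 + n2 a b (f2 s) ^ 2
  have hG : 0 ≤ G := by positivity
  have h3 : E ^ 2 ≤ G * E := by
    calc E^2 ≤ (Real.sqrt G * Real.sqrt E)^2 := pow_le_pow_left₀ hE h2 2
      _ = G * E := by rw [mul_pow, Real.sq_sqrt hG, Real.sq_sqrt hE]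
  rcases hE.eq_or_lt with h | h
  · rw [← h]; exact hG
  · nlinarith

theorem LB_mid (F G : ℕ → ℝ → ℝ) (m : ℕ) (x : ℝ) : LB F G (m+2) x = F 0 x * G (m+2) x + F (m+2) x * G 0 x
    + ∑ p ∈ Finset.HasAntidiagonal.antidiagonal m, ((m+2).choose (p.1+1) : ℝ) * (F (p.1+1) x * G (p.2+1) x) := by
  unfold LB
  rw [Finset.Nat.sum_antidiagonal_succ, Finset.Nat.sum_antidiagonal_succ']
  simp; ring

theorem tri {a b : ℝ} (hab : a ≤ b) {f g h : ℝ → ℝ} (hf : BM a b f) (hg : BM a b g) (hh : BM a b h) {c : ℝ}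
    (hc : ∀ x ∈ Icc a b, |f x| ≤ c) : |∫ x in a..b, f x * g x * h x| ≤ c * n2 a b g * n2 a b h :=
  (cs hab (hf.mul hg) hh).trans (mul_le_mul_of_nonneg_right (n2_mul_sup hab hf hg hc) (n2_nonneg _ _ _))

/-- chains controlled by the energies -/
def HB (a b : ℝ) (N : ℕ) (z : ℕ → ℝ) (X : ℕ → ℝ → ℝ) : Prop :=
  SC X ∧ ∀ k, n2 a b (X k) ≤ Real.sqrt (En a b N z k)

theorem En_poinc' {a b : ℝ} (hab : a < b) {A : ℝ} (hA : 1 ≤ A) (hA' : (b-a)/Real.pi ≤ A) (N : ℕ) (z : ℕ → ℝ) (l m k : ℕ) (hl : 1 ≤ l) (hlm : l ≤ m)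
    (hk : m - l ≤ k) :
    Real.sqrt (En a b N z l) ≤ A ^ k * Real.sqrt (En a b N z m) := by
  have hL := sub_pos.2 hab
  have hpi := Real.pi_pos
  have h1 := Real.sqrt_le_sqrt (En_poinc hab N z l m hl hlm)
  rw [Real.sqrt_mul (by positivity), Real.sqrt_sq (by positivity)] at h1
  refine h1.trans (mul_le_mul_of_nonneg_right ?_ (Real.sqrt_nonneg _))
  exact (pow_le_pow_left₀ (by positivity) hA' _).trans (pow_le_pow_right₀ hA hk)

theorem HB_sup0 {a b : ℝ} (hab : a < b) : ∃ C : ℝ, 1 ≤ C ∧ ∀ (N : ℕ) (z : ℕ → ℝ) (X : ℕ → ℝ → ℝ), HB a b N z X →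
    ∀ k, ∀ x ∈ Icc a b, |X k x| ≤ C * (Real.sqrt (En a b N z k) + Real.sqrt (En a b N z (k+1))) := by
  obtain ⟨C, hC, h⟩ := interp 1
  have hL := sub_pos.2 hab
  have hs := Real.sqrt_pos.2 hL
  refine ⟨1 + C / Real.sqrt (b-a) * (1 + (b-a)), by have : 0 ≤ C / Real.sqrt (b-a) * (1 + (b-a)) := by positivity
                                                    linarith, fun N z X hX k x hx => ?_⟩
  have h1 := h a b (b-a) hL le_rfl (fun i => X (k+i)) ((show SC (fun i => X (k+i)) from fun i => hX.1 (k+i)).ch a b 1) 0 (by norm_num) x hx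
  simp only [pow_zero, mul_one, add_zero, pow_one] at h1
  have h2 := hX.2 k
  have h3 := hX.2 (k+1)
  have e1 := Real.sqrt_nonneg (En a b N z k)
  have e2 := Real.sqrt_nonneg (En a b N z (k+1))
  set s1 := Real.sqrt (En a b N z k)
  set s2 := Real.sqrt (En a b N z (k+1))
  have h4 : |X k x| ≤ C / Real.sqrt (b-a) * (s1 + (b-a) * s2) := by
    rw [div_mul_eq_mul_div, le_div_iff₀ hs, mul_comm]
    refine h1.trans ?_
    gcongr
  refine h4.trans ?_
  have h5 : 0 ≤ C / Real.sqrt (b-a) := by positivity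
  have : s1 + (b-a) * s2 ≤ (1 + (b-a)) * (s1+s2) := by nlinarith [mul_nonneg hL.le e1]
  calc _ ≤ C / Real.sqrt (b-a) * ((1 + (b-a)) * (s1+s2)) := by gcongr
    _ ≤ _ := by nlinarith

theorem HB_sup {a b : ℝ} (hab : a < b) : ∃ C : ℝ, 1 ≤ C ∧ ∀ (N : ℕ) (z : ℕ → ℝ) (X : ℕ → ℝ → ℝ), HB a b N z X →
    ∀ k, 1 ≤ k → ∀ x ∈ Icc a b, |X k x| ≤ C * Real.sqrt (En a b N z (k+1)) := by
  obtain ⟨C, hC, h⟩ := HB_sup0 hab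
  set A := max 1 ((b-a)/Real.pi)
  have hA : 1 ≤ A := le_max_left _ _
  refine ⟨C * (A + 1), by nlinarith, fun N z X hX k hk x hx => (h N z X hX k x hx).trans ?_⟩
  have := En_poinc' hab hA (le_max_right _ _) N z k (k+1) 1 hk (by omega) (by omega)
  rw [pow_one] at this
  rw [mul_assoc]; gcongr; linarith

theorem tri_bound {a b : ℝ} (hab : a < b) (s : ℕ) (hs : 2 ≤ s) : ∃ C : ℝ, 1 ≤ C ∧ ∀ (N : ℕ) (z : ℕ → ℝ) (X Y Z : ℕ → ℝ → ℝ),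
    HB a b N z X → HB a b N z Y → HB a b N z Z → ∀ i j, 1 ≤ i → 1 ≤ j → i + j = s + 1 →
    |∫ x in a..b, X i x * Y j x * Z s x| ≤ C * Real.sqrt (En a b N z (max 2 (s-1))) * En a b N z s := by
  obtain ⟨C, hC, h⟩ := HB_sup hab
  set A := max 1 ((b-a)/Real.pi)
  have hA : 1 ≤ A := le_max_left _ _
  have hA1 : 1 ≤ A ^ s := one_le_pow₀ hA
  refine ⟨C * A ^ s * A ^ s, by nlinarith [mul_nonneg (by linarith : 0 ≤ C) (by positivity : 0 ≤ A^s)], ?_⟩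
  intro N z X Y Z hX hY hZ
  set E := fun k => Real.sqrt (En a b N z k)
  have hE0 : ∀ k, 0 ≤ E k := fun k => Real.sqrt_nonneg _
  have hEs : En a b N z s = E s * E s := (Real.mul_self_sqrt (En_nonneg _ _ _ _ _)).symm
  have hp : ∀ l m, 1 ≤ l → l ≤ m → m ≤ s → E l ≤ A ^ s * E m := fun l m h1 h2 h3 =>
    En_poinc' hab hA (le_max_right _ _) N z l m s h1 h2 (by omega)
  have h2m : E 2 ≤ A ^ s * E (max 2 (s-1)) := hp _ _ (by omega) (by omega) (by omega)
  have first : ∀ X Y : ℕ → ℝ → ℝ, HB a b N z X → HB a b N z Y →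
      |∫ x in a..b, X 1 x * Y s x * Z s x| ≤ C * A ^ s * A ^ s * E (max 2 (s-1)) * (E s * E s) := by
    intro X Y hX hY
    refine (tri hab.le (hX.1.bm _ a b) (hY.1.bm _ a b) (hZ.1.bm _ a b) (h N z X hX 1 le_rfl)).trans ?_
    calc C * E 2 * n2 a b (Y s) * n2 a b (Z s) ≤ C * (A ^ s * E (max 2 (s-1))) * E s * E s := by
          have := hE0 s; have := hE0 (max 2 (s-1))
          gcongr
          · exact n2_nonneg _ _ _
          · exact n2_nonneg _ _ _
          · exact hY.2 s
          · exact hZ.2 s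
      _ ≤ A ^ s * (C * (A ^ s * E (max 2 (s-1))) * E s * E s) := by
          refine le_mul_of_one_le_left ?_ hA1
          have := hE0 s; have := hE0 (max 2 (s-1)); positivity
      _ = _ := by ring
  intro i j hi hj hij
  rw [hEs]
  change _ ≤ C * A ^ s * A ^ s * E (max 2 (s-1)) * (E s * E s)
  rcases hi.eq_or_lt with h1 | h1
  · subst h1; obtain rfl : j = s := by omega
    exact first X Y hX hY
  rcases hj.eq_or_lt with h2 | h2
  · subst h2; obtain rfl : i = s := by omega
    simp_rw [mul_comm (X i _)]
    exact first Y X hY hX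
  · refine (tri hab.le (hX.1.bm _ a b) (hY.1.bm _ a b) (hZ.1.bm _ a b) (h N z X hX i hi)).trans ?_
    calc C * E (i+1) * n2 a b (Y j) * n2 a b (Z s) ≤ C * (A ^ s * E s) * (A ^ s * E (max 2 (s-1))) * E s := by
          have := hE0 s; have := hE0 (max 2 (s-1))
          gcongr
          · exact n2_nonneg _ _ _
          · exact n2_nonneg _ _ _
          · exact hp _ _ (by omega) (by omega) (by omega)
          · exact (hY.2 j).trans (hp _ _ (by omega) (by omega) (by omega))
          · exact hZ.2 s
      _ = _ := by ring

/-- fluxes -/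
noncomputable def F1 (P U : ℕ → ℝ → ℝ) : ℕ → ℝ → ℝ := fun i x => 1/2 * LB P U i x
noncomputable def F2 (P U : ℕ → ℝ → ℝ) : ℕ → ℝ → ℝ := fun i x => 1/4 * LB P P i x + 3/4 * LB U U i x

theorem F1_sc {P U : ℕ → ℝ → ℝ} (hP : SC P) (hU : SC U) : SC (F1 P U) := (hP.mul hU).cmul _
theorem F2_sc {P U : ℕ → ℝ → ℝ} (hP : SC P) (hU : SC U) : SC (F2 P U) := ((hP.mul hP).cmul _).add ((hU.mul hU).cmul _)
theorem F1_po {a b : ℝ} {k : ℕ} {P U : ℕ → ℝ → ℝ} (hP : PE a b k P) (hU : PO a b k U) : PO a b k (F1 P U) := by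
  intro i hi h
  have := PE.mulO hP hU i hi h
  simp [F1, this]
theorem F2_pe {a b : ℝ} {k : ℕ} {P U : ℕ → ℝ → ℝ} (hP : PE a b k P) (hU : PO a b k U) : PE a b k (F2 P U) := by
  intro i hi h
  have h1 := PE.mulE hP hP i hi h
  have h2 := PO.mulO hU hU i hi h
  simp [F2, h1, h2]

noncomputable def Mid (F G : ℕ → ℝ → ℝ) (m : ℕ) (x : ℝ) : ℝ :=
  ∑ p ∈ Finset.HasAntidiagonal.antidiagonal m, ((m+2).choose (p.1+1) : ℝ) * (F (p.1+1) x * G (p.2+1) x)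

theorem Mid_bm {a b : ℝ} {F G : ℕ → ℝ → ℝ} (hF : SC F) (hG : SC G) (m : ℕ) : BM a b (Mid F G m) :=
  BM.sum _ fun p _ => ((hF.bm _ a b).mul (hG.bm _ a b)).cmul _

theorem energy_bound {a b : ℝ} (hab : a < b) (s : ℕ) (hs : 2 ≤ s) : ∃ C : ℝ, 1 ≤ C ∧ ∀ (N : ℕ) (z : ℕ → ℝ),
    |ipp a b (F1 (WP a b N z) (WU a b N z) (s+1)) (F2 (WP a b N z) (WU a b N z) (s+1)) (WP a b N z s) (WU a b N z s)|
      ≤ C * Real.sqrt (En a b N z (max 2 (s-1))) * En a b N z s := by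
  obtain ⟨C, hC, h⟩ := tri_bound hab s hs
  obtain ⟨m, rfl⟩ : ∃ m, s = m + 1 := ⟨s - 1, by omega⟩
  set S := ∑ p ∈ Finset.HasAntidiagonal.antidiagonal m, ((m+2).choose (p.1+1) : ℝ) with hS
  have hS0 : 0 ≤ S := Finset.sum_nonneg fun _ _ => by positivity
  refine ⟨3/2 * (1 + S) * C, by nlinarith, fun N z => ?_⟩
  set P := WP a b N z with hPdef
  set U := WU a b N z with hUdef
  have hP : SC P := WP_sc a b N z
  have hU : SC U := WU_sc a b N z
  have HP : HB a b N z P := ⟨hP, WP_n2 hab N z⟩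
  have HU : HB a b N z U := ⟨hU, WU_n2 hab N z⟩
  have pP := fun k => WP_pe hab N z k
  have pU := fun k => WU_po hab N z k
  set D := C * Real.sqrt (En a b N z (max 2 (m + 1 - 1))) * En a b N z (m+1) with hD
  have hmid : ∀ X Y Z : ℕ → ℝ → ℝ, HB a b N z X → HB a b N z Y → HB a b N z Z →
      |∫ x in a..b, Mid X Y m x * Z (m+1) x| ≤ S * D := by
    intro X Y Z hX hY hZ
    have : ∫ x in a..b, Mid X Y m x * Z (m+1) x = ∑ p ∈ Finset.HasAntidiagonal.antidiagonal m, ((m+2).choose (p.1+1) : ℝ) *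
        ∫ x in a..b, X (p.1+1) x * Y (p.2+1) x * Z (m+1) x := by
      simp_rw [← intervalIntegral.integral_const_mul]
      rw [← intervalIntegral.integral_finset_sum]
      · congr 1; ext x; unfold Mid; rw [Finset.sum_mul]
        exact Finset.sum_congr rfl fun p _ => by ring
      · intro p _
        exact BM.ii hab.le ((((hX.1.bm _ a b).mul (hY.1.bm _ a b)).mul (hZ.1.bm _ a b)).cmul _)
    rw [this, hS, Finset.sum_mul]
    refine (Finset.abs_sum_le_sum_abs _ _).trans (Finset.sum_le_sum fun p hp => ?_)
    rw [Finset.HasAntidiagonal.mem_antidiagonal] at hp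
    rw [abs_mul, abs_of_nonneg (by positivity)]
    exact mul_le_mul_of_nonneg_left (h N z X Y Z hX hY hZ _ _ (by omega) (by omega) (by omega)) (by positivity)
  have hone : ∀ X Y Z : ℕ → ℝ → ℝ, HB a b N z X → HB a b N z Y → HB a b N z Z →
      |∫ x in a..b, X 1 x * Y (m+1) x * Z (m+1) x| ≤ D := fun X Y Z hX hY hZ =>
    h N z X Y Z hX hY hZ 1 (m+1) le_rfl (by omega) (by omega)
  -- boundary part
  have hB : ∫ x in a..b, (1/2 * P 1 x * P (m+1) x * U (m+1) x + 1/2 * P 0 x * (P (m+2) x * U (m+1) x + P (m+1) x * U (m+2) x)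
      + 1/4 * U 1 x * P (m+1) x ^ 2 + 1/2 * U 0 x * P (m+1) x * P (m+2) x
      + 3/4 * U 1 x * U (m+1) x ^ 2 + 3/2 * U 0 x * U (m+1) x * U (m+2) x) = 0 := by
    have hd : ∀ x, HasDerivAt (fun x => 1/2 * P 0 x * P (m+1) x * U (m+1) x + 1/4 * U 0 x * P (m+1) x ^ 2 + 3/4 * U 0 x * U (m+1) x ^ 2)
      (1/2 * P 1 x * P (m+1) x * U (m+1) x + 1/2 * P 0 x * (P (m+2) x * U (m+1) x + P (m+1) x * U (m+2) x)
      + 1/4 * U 1 x * P (m+1) x ^ 2 + 1/2 * U 0 x * P (m+1) x * P (m+2) x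
      + 3/4 * U 1 x * U (m+1) x ^ 2 + 3/2 * U 0 x * U (m+1) x * U (m+2) x) x := by
      intro x
      have p0 := hP 0 x; have u0 := hU 0 x; have ps := hP (m+1) x; have us := hU (m+1) x
      have := ((((p0.const_mul (1/2)).mul ps).mul us).add ((u0.const_mul (1/4)).mul (ps.pow 2))).add ((u0.const_mul (3/4)).mul (us.pow 2))
      refine HasDerivAt.congr_deriv this ?_
      simp; ring
    rw [intervalIntegral.integral_eq_sub_of_hasDerivAt (fun x _ => hd x)]
    · have hu := pU 1 0 (by norm_num) (by norm_num)
      have : P (m+1) a * U (m+1) a = 0 ∧ P (m+1) b * U (m+1) b = 0 := by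
        rcases Nat.even_or_odd (m+1) with he | ho
        · have := pU (m+2) (m+1) (by omega) he
          constructor <;> simp [hUdef, this]
        · have := pP (m+2) (m+1) (by omega) ho
          constructor <;> simp [hPdef, this]
      have hua : U 0 a = 0 := hu.1
      have hub : U 0 b = 0 := hu.2
      rw [hua, hub]
      linear_combination (1/2 * P 0 b) * this.2 - (1/2 * P 0 a) * this.1
    · apply Continuous.intervalIntegrable
      have c := fun i => hP.cont i
      have d := fun i => hU.cont i
      have := c 0; have := c 1; have := c (m+1); have := c (m+2)
      have := d 0; have := d 1; have := d (m+1); have := d (m+2)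
      fun_prop
  have bP := fun i => hP.bm i a b
  have bU := fun i => hU.bm i a b
  have hrest : ipp a b (F1 P U (m+1+1)) (F2 P U (m+1+1)) (P (m+1)) (U (m+1)) =
      -(1/2 * ∫ x in a..b, P 1 x * P (m+1) x * U (m+1) x) - (1/4 * ∫ x in a..b, U 1 x * P (m+1) x * P (m+1) x)
      - (3/4 * ∫ x in a..b, U 1 x * U (m+1) x * U (m+1) x) + (1/2 * ∫ x in a..b, Mid P U m x * P (m+1) x)
      + (1/4 * ∫ x in a..b, Mid P P m x * U (m+1) x) + (3/4 * ∫ x in a..b, Mid U U m x * U (m+1) x) := by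
    have e : ∀ x, F1 P U (m+1+1) x * P (m+1) x + F2 P U (m+1+1) x * U (m+1) x =
      (1/2 * P 1 x * P (m+1) x * U (m+1) x + 1/2 * P 0 x * (P (m+2) x * U (m+1) x + P (m+1) x * U (m+2) x)
      + 1/4 * U 1 x * P (m+1) x ^ 2 + 1/2 * U 0 x * P (m+1) x * P (m+2) x
      + 3/4 * U 1 x * U (m+1) x ^ 2 + 3/2 * U 0 x * U (m+1) x * U (m+2) x)
      + (-(1/2)) * (P 1 x * P (m+1) x * U (m+1) x) + (-(1/4)) * (U 1 x * P (m+1) x * P (m+1) x)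
      + (-(3/4)) * (U 1 x * U (m+1) x * U (m+1) x) + (1/2) * (Mid P U m x * P (m+1) x)
      + (1/4) * (Mid P P m x * U (m+1) x) + (3/4) * (Mid U U m x * U (m+1) x) := by
      intro x
      unfold F1 F2 Mid
      rw [LB_mid, LB_mid, LB_mid]
      ring
    unfold ipp
    simp_rw [e]
    have i0 : BM a b (fun x => 1/2 * P 1 x * P (m+1) x * U (m+1) x + 1/2 * P 0 x * (P (m+2) x * U (m+1) x + P (m+1) x * U (m+2) x)
      + 1/4 * U 1 x * P (m+1) x ^ 2 + 1/2 * U 0 x * P (m+1) x * P (m+2) x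
      + 3/4 * U 1 x * U (m+1) x ^ 2 + 3/2 * U 0 x * U (m+1) x * U (m+2) x) := by
      apply BM.of_cont
      apply Continuous.continuousOn
      have c := fun i => hP.cont i
      have d := fun i => hU.cont i
      have := c 0; have := c 1; have := c (m+1); have := c (m+2)
      have := d 0; have := d 1; have := d (m+1); have := d (m+2)
      fun_prop
    have i1 := (((bP 1).mul (bP (m+1))).mul (bU (m+1))).cmul (-(1/2))
    have i2 := (((bU 1).mul (bP (m+1))).mul (bP (m+1))).cmul (-(1/4))
    have i3 := (((bU 1).mul (bU (m+1))).mul (bU (m+1))).cmul (-(3/4))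
    have i4 := ((Mid_bm (a := a) (b := b) hP hU m).mul (bP (m+1))).cmul (1/2)
    have i5 := ((Mid_bm (a := a) (b := b) hP hP m).mul (bU (m+1))).cmul (1/4)
    have i6 := ((Mid_bm (a := a) (b := b) hU hU m).mul (bU (m+1))).cmul (3/4)
    rw [intervalIntegral.integral_add ((((((i0.add i1).add i2).add i3).add i4).add i5).ii hab.le) (i6.ii hab.le),
      intervalIntegral.integral_add (((((i0.add i1).add i2).add i3).add i4).ii hab.le) (i5.ii hab.le),
      intervalIntegral.integral_add ((((i0.add i1).add i2).add i3).ii hab.le) (i4.ii hab.le),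
      intervalIntegral.integral_add (((i0.add i1).add i2).ii hab.le) (i3.ii hab.le),
      intervalIntegral.integral_add ((i0.add i1).ii hab.le) (i2.ii hab.le),
      intervalIntegral.integral_add (i0.ii hab.le) (i1.ii hab.le), hB]
    simp only [intervalIntegral.integral_const_mul]
    ring
  rw [hrest]
  have a1 := abs_le.1 (hone P P U HP HP HU)
  have a2 := abs_le.1 (hone U P P HU HP HP)
  have a3 := abs_le.1 (hone U U U HU HU HU)
  have a4 := abs_le.1 (hmid P U P HP HU HP)
  have a5 := abs_le.1 (hmid P P U HP HP HU)
  have a6 := abs_le.1 (hmid U U U HU HU HU)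
  have : 3/2 * (1 + S) * C * Real.sqrt (En a b N z (max 2 (m + 1 - 1))) * En a b N z (m+1) = 3/2 * (D + S * D) := by
    rw [hD]; ring
  rw [this, abs_le]
  constructor <;> linarith [a1.1, a1.2, a2.1, a2.2, a3.1, a3.2, a4.1, a4.2, a5.1, a5.2, a6.1, a6.2]

theorem ode_global {N : ℕ} (v : (Fin N → ℝ) → (Fin N → ℝ)) (hv : ContDiff ℝ 1 v)
    (ho : ∀ ζ, ∑ i, ζ i * v ζ i = 0) (ζ0 : Fin N → ℝ) {τ : ℝ} (hτ : 0 < τ) :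
    ∃ α : ℝ → Fin N → ℝ, α 0 = ζ0 ∧ ∀ t ∈ Icc (-τ) τ, HasDerivWithinAt α (v (α t)) (Icc (-τ) τ) t := by
  set R := Real.sqrt (∑ i, ζ0 i ^ 2) with hR
  have hR0 : 0 ≤ R := Real.sqrt_nonneg _
  let f : ContDiffBump (0 : Fin N → ℝ) := ⟨R + 1, R + 2, by positivity, by linarith⟩
  set w : (Fin N → ℝ) → (Fin N → ℝ) := fun ζ => f ζ • v ζ with hw
  have hwc : ContDiff ℝ 1 w := f.contDiff.smul hv
  have hws : HasCompactSupport w := f.hasCompactSupport.smul_right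
  obtain ⟨K, hK⟩ := hwc.lipschitzWith_of_hasCompactSupport hws (by norm_num)
  obtain ⟨L, hL⟩ := hws.exists_bound_of_continuous hwc.continuous
  set L' : NNReal := Real.toNNReal |L|
  set A : NNReal := L' * Real.toNNReal τ
  have h0 : (0:ℝ) ∈ Icc (-τ) τ := ⟨by linarith, hτ.le⟩
  have pl : IsPicardLindelof (fun _ => w) (⟨0, h0⟩ : Icc (-τ) τ) ζ0 A 0 L' K := by
    apply IsPicardLindelof.of_time_independent
    · intro x _; simp only [L', Real.coe_toNNReal _ (abs_nonneg L)]; exact (hL x).trans (le_abs_self L)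
    · exact hK.lipschitzOnWith
    · simp [A, L', hτ.le]
  obtain ⟨α, h1, h2⟩ := pl.exists_eq_forall_mem_Icc_hasDerivWithinAt₀
  refine ⟨α, h1, ?_⟩
  have hcons : ∀ t ∈ Icc (-τ) τ, ∑ i, α t i ^ 2 = ∑ i, ζ0 i ^ 2 := by
    have hd : ∀ t ∈ Icc (-τ) τ, HasDerivWithinAt (fun t => ∑ i, α t i ^ 2) 0 (Icc (-τ) τ) t := by
      intro t ht
      have h3 := fun i => (hasDerivWithinAt_pi.1 (h2 t ht) i).pow 2
      have h4 := HasDerivWithinAt.fun_sum (u := Finset.univ) (fun i _ => h3 i)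
      refine h4.congr_deriv ?_
      have : ∀ i, ((2:ℕ):ℝ) * α t i ^ (2-1) * w (α t) i = 2 * f (α t) * (α t i * v (α t) i) := by
        intro i; simp [hw]; ring
      rw [Finset.sum_congr rfl (fun i _ => this i), ← Finset.mul_sum, ho, mul_zero]
    intro t ht
    have := Convex.norm_image_sub_le_of_norm_hasDerivWithin_le (C := 0) hd (by simp) (convex_Icc _ _) h0 ht
    simp only [zero_mul, norm_le_zero_iff, sub_eq_zero] at this
    rw [this, show α 0 = ζ0 from h1]
  intro t ht
  have hb : f (α t) = 1 := by
    apply f.one_of_mem_closedBall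
    rw [mem_closedBall_zero_iff]
    change _ ≤ R + 1
    rw [pi_norm_le_iff_of_nonneg (by positivity)]
    intro i
    have : |α t i| ≤ R := by
      rw [hR, ← hcons t ht]
      apply Real.abs_le_sqrt
      exact Finset.single_le_sum (f := fun i => α t i ^ 2) (fun i _ => sq_nonneg _) (Finset.mem_univ i)
    exact this.trans (by linarith)
  have := h2 t ht
  simpa only [hw, hb, one_smul] using this

theorem LB_one (F G : ℕ → ℝ → ℝ) (x : ℝ) : LB F G 1 x = F 0 x * G 1 x + F 1 x * G 0 x := by
  rw [show (1:ℕ) = 0 + 1 from rfl, LB_succ]; simp; ring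

noncomputable def coA (a b : ℝ) (n j k : ℕ) : ℝ := ∫ x in a..b,
  ((1/2 * (e1 a b j 0 x * e2 a b k 1 x + e1 a b j 1 x * e2 a b k 0 x)) * e1 a b n 0 x
    + (1/2 * (e1 a b j 0 x * e1 a b k 1 x) + 3/2 * (e2 a b j 0 x * e2 a b k 1 x)) * e2 a b n 0 x)

theorem cf_expand {a b : ℝ} (hab : a < b) (N : ℕ) (z : ℕ → ℝ) (n : ℕ) :
    cf a b (F1 (WP a b N z) (WU a b N z) 1) (F2 (WP a b N z) (WU a b N z) 1) n
      = ∑ j ∈ Finset.range N, ∑ k ∈ Finset.range N, z j * z k * coA a b n j k := by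
  unfold cf ipp coA
  simp_rw [← intervalIntegral.integral_const_mul]
  have hbm : ∀ j k, BM a b (fun x => z j * z k * ((1/2 * (e1 a b j 0 x * e2 a b k 1 x + e1 a b j 1 x * e2 a b k 0 x)) * e1 a b n 0 x
    + (1/2 * (e1 a b j 0 x * e1 a b k 1 x) + 3/2 * (e2 a b j 0 x * e2 a b k 1 x)) * e2 a b n 0 x)) := by
    intro j k
    have c1 := fun n i => (e1_sc a b n).bm i a b
    have c2 := fun n i => (e2_sc a b n).bm i a b
    exact ((((((c1 j 0).mul (c2 k 1)).add ((c1 j 1).mul (c2 k 0))).cmul _).mul (c1 n 0)).add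
      (((((c1 j 0).mul (c1 k 1)).cmul _).add (((c2 j 0).mul (c2 k 1)).cmul _)).mul (c2 n 0))).cmul _
  have h1 : ∀ j, (∑ k ∈ Finset.range N, ∫ x in a..b, z j * z k * ((1/2 * (e1 a b j 0 x * e2 a b k 1 x + e1 a b j 1 x * e2 a b k 0 x)) * e1 a b n 0 x
    + (1/2 * (e1 a b j 0 x * e1 a b k 1 x) + 3/2 * (e2 a b j 0 x * e2 a b k 1 x)) * e2 a b n 0 x))
    = ∫ x in a..b, ∑ k ∈ Finset.range N, z j * z k * ((1/2 * (e1 a b j 0 x * e2 a b k 1 x + e1 a b j 1 x * e2 a b k 0 x)) * e1 a b n 0 x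
    + (1/2 * (e1 a b j 0 x * e1 a b k 1 x) + 3/2 * (e2 a b j 0 x * e2 a b k 1 x)) * e2 a b n 0 x) := by
    intro j
    rw [intervalIntegral.integral_finset_sum]
    exact fun k _ => (hbm j k).ii hab.le
  simp_rw [h1]
  rw [← intervalIntegral.integral_finset_sum]
  · congr 1; ext x
    unfold F1 F2
    rw [LB_one, LB_one, LB_one]
    have e : 1/4 * (WP a b N z 0 x * WP a b N z 1 x + WP a b N z 1 x * WP a b N z 0 x) +
      3/4 * (WU a b N z 0 x * WU a b N z 1 x + WU a b N z 1 x * WU a b N z 0 x)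
      = 1/2 * (WP a b N z 0 x * WP a b N z 1 x) + 3/2 * (WU a b N z 0 x * WU a b N z 1 x) := by ring
    rw [e]
    unfold WP WU
    rw [Finset.sum_mul_sum, Finset.sum_mul_sum, Finset.sum_mul_sum, Finset.sum_mul_sum]
    rw [← Finset.sum_add_distrib, Finset.mul_sum, Finset.sum_mul, Finset.mul_sum, Finset.mul_sum, ← Finset.sum_add_distrib,
      Finset.sum_mul, ← Finset.sum_add_distrib]
    refine Finset.sum_congr rfl fun j _ => ?_
    rw [← Finset.sum_add_distrib, Finset.mul_sum, Finset.sum_mul, Finset.mul_sum, Finset.mul_sum, ← Finset.sum_add_distrib,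
      Finset.sum_mul, ← Finset.sum_add_distrib]
    refine Finset.sum_congr rfl fun k _ => ?_
    ring
  · exact fun j _ => (BM.sum _ fun k _ => hbm j k).ii hab.le

theorem cons0 {a b : ℝ} (hab : a < b) (N : ℕ) (z : ℕ → ℝ) :
    ∑ n ∈ Finset.range N, z n * cf a b (F1 (WP a b N z) (WU a b N z) 1) (F2 (WP a b N z) (WU a b N z) 1) n = 0 := by
  set P := WP a b N z with hPdef
  set U := WU a b N z with hUdef
  have hP : SC P := WP_sc a b N z
  have hU : SC U := WU_sc a b N z
  have := ipp_W hab ((F1_sc hP hU).bm 1 a b) ((F2_sc hP hU).bm 1 a b) N z 0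
  unfold cf
  rw [← this]
  have hd : ∀ x, HasDerivAt (fun x => 1/2 * (P 0 x ^ 2 * U 0 x) + 1/2 * U 0 x ^ 3)
      (F1 P U 1 x * P 0 x + F2 P U 1 x * U 0 x) x := by
    intro x
    have := ((((hP 0 x).pow 2).mul (hU 0 x)).const_mul (1/2)).add (((hU 0 x).pow 3).const_mul (1/2))
    refine HasDerivAt.congr_deriv this ?_
    unfold F1 F2
    rw [LB_one, LB_one, LB_one]
    simp; ring
  unfold ipp
  rw [intervalIntegral.integral_eq_sub_of_hasDerivAt (fun x _ => hd x)]
  · have hu := WU_po hab N z 1 0 (by norm_num) (by norm_num)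
    rw [show U 0 a = 0 from hu.1, show U 0 b = 0 from hu.2]; simp
  · apply Continuous.intervalIntegrable
    have := hP.cont 0; have := hU.cont 0; have := (F1_sc hP hU).cont 1; have := (F2_sc hP hU).cont 1
    fun_prop

theorem galerkin_ode {a b : ℝ} (hab : a < b) (N : ℕ) (z0 : ℕ → ℝ) {τ : ℝ} (hτ : 0 < τ) :
    ∃ z : ℝ → ℕ → ℝ, (∀ n < N, z 0 n = z0 n) ∧ ∀ t ∈ Icc (-τ) τ, ∀ n < N,
      HasDerivWithinAt (fun t => z t n) (-(cf a b (F1 (WP a b N (z t)) (WU a b N (z t)) 1) (F2 (WP a b N (z t)) (WU a b N (z t)) 1) n))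
        (Icc (-τ) τ) t := by
  let ex : (Fin N → ℝ) → ℕ → ℝ := fun ζ n => if h : n < N then ζ ⟨n, h⟩ else 0
  have hex : ∀ n, ContDiff ℝ 1 (fun ζ => ex ζ n) := by
    intro n; simp only [ex]
    split_ifs
    · exact contDiff_apply ℝ ℝ _
    · exact contDiff_const
  let v : (Fin N → ℝ) → (Fin N → ℝ) := fun ζ i =>
    -(cf a b (F1 (WP a b N (ex ζ)) (WU a b N (ex ζ)) 1) (F2 (WP a b N (ex ζ)) (WU a b N (ex ζ)) 1) i)
  have hv : ContDiff ℝ 1 v := by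
    rw [contDiff_pi]
    intro i
    simp only [v, cf_expand hab]
    refine ContDiff.neg (ContDiff.sum fun j _ => ContDiff.sum fun k _ => ?_)
    exact ((hex j).mul (hex k)).mul contDiff_const
  obtain ⟨α, h1, h2⟩ := ode_global v hv (fun ζ => by
    have := cons0 hab N (ex ζ)
    rw [Finset.sum_range] at this
    have e : ∀ i : Fin N, ex ζ i = ζ i := fun i => by simp [ex]
    simp only [v, mul_neg, Finset.sum_neg_distrib, neg_eq_zero]
    rw [← this]
    exact Finset.sum_congr rfl fun i _ => by rw [e]) (fun i => z0 i) hτ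
  refine ⟨fun t => ex (α t), fun n hn => by simp [ex, hn, h1], fun t ht n hn => ?_⟩
  have := hasDerivWithinAt_pi.1 (h2 t ht) ⟨n, hn⟩
  have e : (fun t => ex (α t) n) = fun t => α t ⟨n, hn⟩ := by ext t; simp [ex, hn]
  rw [e]; exact this

/-- energy identity -/
theorem I3 {a b : ℝ} (hab : a < b) (N : ℕ) {z : ℝ → ℕ → ℝ} {S : Set ℝ} {t : ℝ} (hz : ∀ n < N,
      HasDerivWithinAt (fun t => z t n) (-(cf a b (F1 (WP a b N (z t)) (WU a b N (z t)) 1) (F2 (WP a b N (z t)) (WU a b N (z t)) 1) n))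
        S t) (s : ℕ) :
    HasDerivWithinAt (fun t => En a b N (z t) s) (-2 * ipp a b (F1 (WP a b N (z t)) (WU a b N (z t)) (s+1)) (F2 (WP a b N (z t)) (WU a b N (z t)) (s+1))
      (WP a b N (z t) s) (WU a b N (z t) s)) S t := by
  have hP := WP_sc a b N (z t)
  have hU := WU_sc a b N (z t)
  set P := WP a b N (z t)
  set U := WU a b N (z t)
  have pP := WP_pe hab N (z t)
  have pU := WU_po hab N (z t)
  have h1 := HasDerivWithinAt.fun_sum (u := Finset.range N) (fun n hn => ((hz n (Finset.mem_range.1 hn)).pow 2).const_mul ((mu a b n)^(2*s)))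
  refine HasDerivWithinAt.congr_deriv h1 ?_
  rw [ipp_W hab ((F1_sc hP hU).bm _ a b) ((F2_sc hP hU).bm _ a b), Finset.mul_sum]
  refine Finset.sum_congr rfl fun n _ => ?_
  have := I1 hab (r := s) ((F1_sc hP hU).shift.wc a b s) ((F2_sc hP hU).shift.wc a b s)
    (F1_po (pP (s+1)) (pU (s+1))).shift (F2_pe (pP (s+1)) (pU (s+1))).shift s n le_rfl
  rw [this]
  change _ = -2 * (z t n * (_ * cf a b _ _ n))
  simp; ring

theorem compl_pow {a b κ φ : ℝ} (hab : a < b) {H : ℝ → ℝ} (hH : ContinuousOn H (Icc a b))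
    (h : ∀ m : ℤ, ∫ x in a..b, H x * Real.cos (m * (κ * (x - a)) + φ) = 0) (k : ℕ) :
    ∀ m : ℤ, ∫ x in a..b, H x * Real.cos (m * (κ * (x - a)) + φ) * Real.cos (κ * (x - a)) ^ k = 0 := by
  have hI : ∀ (m : ℤ) (k : ℕ), IntervalIntegrable (fun x => H x * Real.cos (m * (κ * (x - a)) + φ) * Real.cos (κ * (x - a)) ^ k) volume a b := by
    intro m k
    apply ContinuousOn.intervalIntegrable
    rw [uIcc_of_le hab.le]
    fun_prop
  induction k with
  | zero => simpa using h
  | succ k ih =>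
    intro m
    have e : ∀ x, H x * Real.cos (m * (κ * (x - a)) + φ) * Real.cos (κ * (x - a)) ^ (k+1)
        = (1/2) * (H x * Real.cos ((m+1 : ℤ) * (κ * (x - a)) + φ) * Real.cos (κ * (x - a)) ^ k
          + H x * Real.cos ((m-1 : ℤ) * (κ * (x - a)) + φ) * Real.cos (κ * (x - a)) ^ k) := by
      intro x
      push_cast
      rw [show ((m:ℝ)+1) * (κ * (x - a)) + φ = (m * (κ * (x - a)) + φ) + κ * (x - a) by ring,
        show ((m:ℝ)-1) * (κ * (x - a)) + φ = (m * (κ * (x - a)) + φ) - κ * (x - a) by ring]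
      generalize (m:ℝ) * (κ * (x - a)) + φ = A
      generalize κ * (x - a) = B
      rw [Real.cos_add, Real.cos_sub]
      ring
    simp_rw [e]
    rw [intervalIntegral.integral_const_mul, intervalIntegral.integral_add (hI _ _) (hI _ _), ih, ih]; simp

theorem compl_w {a b : ℝ} (hab : a < b) {H : ℝ → ℝ} (hH : ContinuousOn H (Icc a b))
    (h : ∀ k : ℕ, ∫ x in a..b, H x * Real.cos (Real.pi / (b-a) * (x - a)) ^ k = 0) : ∀ x ∈ Icc a b, H x = 0 := by
  have hL := sub_pos.2 hab
  have hpi := Real.pi_pos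
  set κ := Real.pi / (b-a) with hκ
  have hκ0 : 0 < κ := by positivity
  have hp : ∀ p : Polynomial ℝ, ∫ x in a..b, H x * p.eval (Real.cos (κ * (x - a))) = 0 := by
    intro p
    simp_rw [Polynomial.eval_eq_sum_range, Finset.mul_sum]
    rw [intervalIntegral.integral_finset_sum]
    · apply Finset.sum_eq_zero
      intro i _
      have : ∀ x, H x * (p.coeff i * Real.cos (κ * (x - a)) ^ i) = p.coeff i * (H x * Real.cos (κ * (x - a)) ^ i) := fun x => by ring
      simp_rw [this]; rw [intervalIntegral.integral_const_mul, h, mul_zero]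
    · intro i _
      apply ContinuousOn.intervalIntegrable
      rw [uIcc_of_le hab.le]; fun_prop
  have hth : ∀ x ∈ Icc a b, κ * (x - a) ∈ Icc 0 Real.pi := by
    intro x hx
    refine ⟨mul_nonneg hκ0.le (by linarith [hx.1]), ?_⟩
    calc κ * (x - a) ≤ κ * (b - a) := by gcongr; exact hx.2
      _ = Real.pi := by rw [hκ]; field_simp
  have hG : ContinuousOn (fun y => H (a + Real.arccos y / κ)) (Icc (-1) 1) := by
    apply ContinuousOn.comp hH
    · exact (continuous_const.add (Real.continuous_arccos.div_const _)).continuousOn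
    · intro y hy
      refine ⟨by have := Real.arccos_nonneg y; have : 0 ≤ Real.arccos y / κ := by positivity
                 linarith, ?_⟩
      have : Real.arccos y / κ ≤ b - a := by
        rw [div_le_iff₀ hκ0, hκ]
        have := Real.arccos_le_pi y
        field_simp; linarith
      linarith
  have hHbm := BM.of_cont hH
  have key : ∀ ε > 0, n2 a b H ^ 2 ≤ n2 a b H * (ε * Real.sqrt (b-a)) := by
    intro ε hε
    obtain ⟨p, hp2⟩ := exists_polynomial_near_of_continuousOn (-1) 1 _ hG ε hε
    have hc : ContinuousOn (fun x => H x - p.eval (Real.cos (κ * (x - a)))) (Icc a b) := by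
      have := p.continuous; fun_prop
    have e1 : n2 a b H ^ 2 = ∫ x in a..b, H x * (H x - p.eval (Real.cos (κ * (x - a)))) := by
      rw [n2_sq hab.le]
      have := hp p
      have e : ∀ x, H x * (H x - p.eval (Real.cos (κ * (x - a)))) = H x ^ 2 - H x * p.eval (Real.cos (κ * (x - a))) := fun x => by ring
      simp_rw [e]
      rw [intervalIntegral.integral_sub (hHbm.sq.ii hab.le), this, sub_zero]
      apply ContinuousOn.intervalIntegrable
      rw [uIcc_of_le hab.le]; have := p.continuous; fun_prop
    rw [e1]
    refine (le_abs_self _).trans ((cs hab.le hHbm (BM.of_cont hc)).trans ?_)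
    gcongr
    · exact n2_nonneg _ _ _
    · apply n2_le_sup hab.le (BM.of_cont hc)
      intro x hx
      have h1 := hth x hx
      have := hp2 (Real.cos (κ * (x-a))) ⟨Real.neg_one_le_cos _, Real.cos_le_one _⟩
      rw [Real.arccos_cos h1.1 h1.2, mul_div_cancel_left₀ _ hκ0.ne', add_sub_cancel] at this
      rw [abs_sub_comm]; exact this.le
  have h0 : n2 a b H = 0 := by
    by_contra hne
    have hpos : 0 < n2 a b H := lt_of_le_of_ne (n2_nonneg _ _ _) (Ne.symm hne)
    have hs := Real.sqrt_pos.2 hL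
    have := key (n2 a b H / (2 * Real.sqrt (b-a))) (by positivity)
    have e : n2 a b H / (2 * Real.sqrt (b-a)) * Real.sqrt (b-a) = n2 a b H / 2 := by field_simp
    rw [e] at this; nlinarith
  have h1 : ∫ x in a..b, H x ^ 2 = 0 := by rw [← n2_sq hab.le, h0]; simp
  intro x hx
  by_contra hne
  have := intervalIntegral.integral_pos hab (hH.pow 2) (fun y _ => sq_nonneg _) ⟨x, hx, by have := sq_pos_of_ne_zero (a := H x) hne; simpa using this⟩
  simp only [Pi.pow_apply] at this
  linarith

theorem e_even (a b : ℝ) (m : ℕ) (x : ℝ) : e1 a b (2*m) 0 x = cn a b (2*m) * Real.cos (m * (Real.pi / (b-a) * (x - a)) + 0)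
    ∧ e2 a b (2*m) 0 x = 0 := by
  unfold e1 e2 bs mu
  rw [if_pos (by simp), if_pos (by simp), show (2*m+1)/2 = m by omega]
  refine ⟨?_, rfl⟩
  rw [pow_zero, one_mul]; congr 2; push_cast; ring

theorem e_odd (a b : ℝ) (m : ℕ) (x : ℝ) : e1 a b (2*m+1) 0 x = 0 ∧
    e2 a b (2*m+1) 0 x = cn a b (2*m+1) * Real.cos ((m+1:ℕ) * (Real.pi / (b-a) * (x - a)) + -(Real.pi/2)) := by
  unfold e1 e2 bs mu
  rw [if_neg (by simp), if_neg (by simp), show (2*m+1+1)/2 = m+1 by omega]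
  refine ⟨rfl, ?_⟩
  rw [pow_zero, one_mul]; congr 2; push_cast; ring

theorem compl {a b : ℝ} (hab : a < b) {f1 f2 : ℝ → ℝ} (h1 : ContinuousOn f1 (Icc a b)) (h2 : ContinuousOn f2 (Icc a b))
    (h : ∀ n, cf a b f1 f2 n = 0) : ∀ x ∈ Icc a b, f1 x = 0 ∧ f2 x = 0 := by
  have hL := sub_pos.2 hab
  set κ := Real.pi / (b-a) with hκ
  have hcn : ∀ n, cn a b n ≠ 0 := by
    intro n; unfold cn; split_ifs <;> exact (Real.sqrt_pos.2 (by positivity)).ne'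
  have c1 : ∀ m : ℕ, ∫ x in a..b, f1 x * Real.cos (m * (κ * (x - a)) + 0) = 0 := by
    intro m
    have := h (2*m)
    unfold cf ipp at this
    simp only [e_even, mul_zero, add_zero, mul_left_comm (f1 _)] at this ⊢
    rw [intervalIntegral.integral_const_mul] at this
    exact (mul_eq_zero.1 this).resolve_left (hcn _)
  have c2 : ∀ m : ℕ, ∫ x in a..b, f2 x * Real.cos (m * (κ * (x - a)) + -(Real.pi/2)) = 0 := by
    intro m
    rcases m with _ | m
    · simp
    have := h (2*m+1)
    unfold cf ipp at this
    simp only [e_odd, mul_zero, zero_add, mul_left_comm (f2 _)] at this ⊢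
    rw [intervalIntegral.integral_const_mul] at this
    exact (mul_eq_zero.1 this).resolve_left (hcn _)
  have d1 : ∀ m : ℤ, ∫ x in a..b, f1 x * Real.cos (m * (κ * (x - a)) + 0) = 0 := by
    intro m
    rcases Int.eq_nat_or_neg m with ⟨k, rfl | rfl⟩
    · exact_mod_cast c1 k
    · have := c1 k
      simpa [neg_mul, Real.cos_neg] using this
  have d2 : ∀ m : ℤ, ∫ x in a..b, f2 x * Real.cos (m * (κ * (x - a)) + -(Real.pi/2)) = 0 := by
    intro m
    rcases Int.eq_nat_or_neg m with ⟨k, rfl | rfl⟩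
    · exact_mod_cast c2 k
    · have := c2 k
      simp only [← sub_eq_add_neg, Real.cos_sub_pi_div_two] at this ⊢
      push_cast
      simp only [neg_mul, Real.sin_neg, mul_neg, intervalIntegral.integral_neg, this, neg_zero]
  have r1 : ∀ x ∈ Icc a b, f1 x = 0 := by
    apply compl_w hab h1
    intro k
    simpa using compl_pow hab h1 d1 k 0
  have r2 : ∀ x ∈ Icc a b, f2 x * Real.sin (κ * (x - a)) = 0 := by
    apply compl_w hab (by fun_prop)
    intro k
    have := compl_pow hab h2 d2 k 1
    simpa [← sub_eq_add_neg, Real.cos_sub_pi_div_two] using this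
  have r3 : ∀ x ∈ Ioo a b, f2 x = 0 := by
    intro x hx
    have hs : 0 < Real.sin (κ * (x - a)) := by
      have hpi := Real.pi_pos
      apply Real.sin_pos_of_pos_of_lt_pi
      · exact mul_pos (by positivity) (by linarith [hx.1])
      · calc κ * (x - a) < κ * (b - a) := by
              apply mul_lt_mul_of_pos_left _ (by positivity); linarith [hx.2]
          _ = Real.pi := by rw [hκ]; field_simp
    exact (mul_eq_zero.1 (r2 x (Ioo_subset_Icc_self hx))).resolve_right hs.ne'
  have r4 : ∀ x ∈ Icc a b, f2 x = 0 := by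
    have : EqOn f2 (fun _ => 0) (Icc a b) := by
      apply Set.EqOn.of_subset_closure (s := Ioo a b) (fun x hx => r3 x hx) h2 continuousOn_const Ioo_subset_Icc_self
      rw [closure_Ioo hab.ne]
    exact this
  exact fun x hx => ⟨r1 x hx, r4 x hx⟩

theorem e_bd {a b : ℝ} (hab : a < b) (n : ℕ) (x : ℝ) : |e1 a b n 0 x| ≤ Real.sqrt (2/(b-a)) ∧ |e2 a b n 0 x| ≤ Real.sqrt (2/(b-a)) := by
  have hL := sub_pos.2 hab
  have hc : 0 ≤ cn a b n ∧ cn a b n ≤ Real.sqrt (2/(b-a)) := by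
    unfold cn; split_ifs
    · exact ⟨Real.sqrt_nonneg _, Real.sqrt_le_sqrt (by gcongr; norm_num)⟩
    · exact ⟨Real.sqrt_nonneg _, le_rfl⟩
  have h : ∀ θ, |cn a b n * bs a b n θ 0 x| ≤ Real.sqrt (2/(b-a)) := by
    intro θ
    unfold bs
    rw [pow_zero, one_mul, abs_mul, abs_of_nonneg hc.1]
    calc _ ≤ cn a b n * 1 := by gcongr; exact hc.1; exact Real.abs_cos_le_one _
      _ ≤ _ := by rw [mul_one]; exact hc.2
  unfold e1 e2
  constructor <;> split_ifs
  · exact h _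
  · rw [abs_zero]; positivity
  · rw [abs_zero]; positivity
  · exact h _

noncomputable def tl (a b : ℝ) (N : ℕ) : ℝ := ∑' n, ((mu a b (n+N))⁻¹)^2

theorem mu_summable {a b : ℝ} (hab : a < b) : Summable (fun n => ((mu a b n)⁻¹)^2) := by
  have hL := sub_pos.2 hab
  have hpi := Real.pi_pos
  have h2 : Summable (fun n : ℕ => (2 * (b-a) / Real.pi)^2 * (1 / (n:ℝ)^2)) := ((Real.summable_one_div_nat_pow (p := 2)).2 (by norm_num)).mul_left _
  refine Summable.of_nonneg_of_le (fun n => by positivity) (fun n => ?_) h2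
  by_cases hn : n = 0
  · subst hn; simp [mu_zero]
  have hn' : (0:ℝ) < n := by exact_mod_cast Nat.pos_of_ne_zero hn
  have h3 : (n:ℝ)/2 ≤ (((n+1)/2 : ℕ):ℝ) := by
    rw [div_le_iff₀ (by norm_num)]
    exact_mod_cast (by omega : n ≤ (n+1)/2 * 2)
  have h4 : (mu a b n)⁻¹ ≤ (2 * (b-a) / Real.pi) * (1/n) := by
    have : Real.pi / (b-a) * (n/2) ≤ mu a b n := by unfold mu; gcongr
    have h5 := inv_anti₀ (by positivity) this
    refine h5.trans (le_of_eq ?_)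
    field_simp
  have h0 : 0 ≤ (mu a b n)⁻¹ := inv_nonneg.2 (mu_nonneg hab n)
  calc _ ≤ ((2 * (b-a) / Real.pi) * (1/n))^2 := by gcongr
    _ = _ := by ring

theorem tl_tendsto {a b : ℝ} : Tendsto (tl a b) atTop (𝓝 0) :=
  tendsto_sum_nat_add (fun n => ((mu a b n)⁻¹)^2)

theorem tl_nonneg {a b : ℝ} (N : ℕ) : 0 ≤ tl a b N := tsum_nonneg fun n => by positivity

theorem part_bd {a b : ℝ} (hab : a < b) (z : ℕ → ℝ) {N M : ℕ} (hN : 1 ≤ N) (hNM : N ≤ M) (x : ℝ) :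
    |WP a b M z 0 x - WP a b N z 0 x| ≤ Real.sqrt (2/(b-a)) * Real.sqrt (tl a b N) * Real.sqrt (En a b M z 1) ∧
    |WU a b M z 0 x - WU a b N z 0 x| ≤ Real.sqrt (2/(b-a)) * Real.sqrt (tl a b N) * Real.sqrt (En a b M z 1) := by
  have hL := sub_pos.2 hab
  have hmain : ∑ n ∈ Finset.Ico N M, |z n| ≤ Real.sqrt (tl a b N) * Real.sqrt (En a b M z 1) := by
    have h1 : ∀ n ∈ Finset.Ico N M, |z n| = (mu a b n)⁻¹ * (mu a b n * |z n|) := by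
      intro n hn
      have hn0 : n ≠ 0 := by have := (Finset.mem_Ico.1 hn).1; omega
      have : 0 < mu a b n := lt_of_lt_of_le (by have := Real.pi_pos; positivity) (mu_ge hab hn0)
      field_simp
    rw [Finset.sum_congr rfl h1]
    refine (Real.sum_mul_le_sqrt_mul_sqrt _ _ _).trans ?_
    gcongr
    · rw [Finset.sum_Ico_eq_sum_range]
      unfold tl
      have := (((summable_nat_add_iff N).2 (mu_summable hab))).sum_le_tsum (Finset.range (M-N)) (fun i _ => by positivity)
      simpa [add_comm] using this
    · unfold En
      rw [Finset.range_eq_Ico]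
      have h2 : ∀ n, (mu a b n * |z n|)^2 = mu a b n ^ (2*1) * z n ^ 2 := by intro n; rw [mul_pow, sq_abs]
      simp_rw [h2]
      apply Finset.sum_le_sum_of_subset_of_nonneg
      · exact Finset.Ico_subset_Ico (Nat.zero_le _) le_rfl
      · intro i _ _; rw [pow_mul]; positivity
  have gen : ∀ e : ℕ → ℝ, (∀ n, |e n| ≤ Real.sqrt (2/(b-a))) → |∑ n ∈ Finset.range M, z n * e n - ∑ n ∈ Finset.range N, z n * e n|
      ≤ Real.sqrt (2/(b-a)) * Real.sqrt (tl a b N) * Real.sqrt (En a b M z 1) := by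
    intro e he
    rw [← Finset.sum_Ico_eq_sub _ hNM]
    refine (Finset.abs_sum_le_sum_abs _ _).trans ?_
    calc _ ≤ ∑ n ∈ Finset.Ico N M, Real.sqrt (2/(b-a)) * |z n| := by
          apply Finset.sum_le_sum; intro n _; rw [abs_mul, mul_comm]; gcongr; exact he n
      _ ≤ _ := by rw [← Finset.mul_sum, mul_assoc]; gcongr
  exact ⟨gen _ fun n => (e_bd hab n x).1, gen _ fun n => (e_bd hab n x).2⟩

theorem cf_sub_bd {a b : ℝ} (hab : a < b) {f1 f2 : ℝ → ℝ} (h1 : BM a b f1) (h2 : BM a b f2) {c : ℝ} (hc : 0 ≤ c)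
    (b1 : ∀ x ∈ Icc a b, |f1 x| ≤ c) (b2 : ∀ x ∈ Icc a b, |f2 x| ≤ c) (n : ℕ) : |cf a b f1 f2 n| ≤ 2 * c * Real.sqrt (b-a) := by
  unfold cf
  refine (ipp_cs hab.le h1 h2 ((e1_sc a b n).bm 0 a b) ((e2_sc a b n).bm 0 a b)).trans ?_
  rw [← ipp_self hab.le ((e1_sc a b n).bm 0 a b) ((e2_sc a b n).bm 0 a b), orth hab, if_pos rfl, Real.sqrt_one, mul_one]
  have k1 := n2_le_sup hab.le h1 b1
  have k2 := n2_le_sup hab.le h2 b2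
  have := Real.sqrt_nonneg (b-a)
  apply Real.sqrt_le_iff.2
  refine ⟨by positivity, ?_⟩
  have := n2_nonneg a b f1
  have := n2_nonneg a b f2
  nlinarith [mul_nonneg hc (Real.sqrt_nonneg (b-a))]

theorem cf_sub {a b : ℝ} (hab : a < b) {f1 f2 g1 g2 : ℝ → ℝ} (h1 : BM a b f1) (h2 : BM a b f2) (h3 : BM a b g1) (h4 : BM a b g2) (n : ℕ) :
    cf a b (fun x => f1 x - g1 x) (fun x => f2 x - g2 x) n = cf a b f1 f2 n - cf a b g1 g2 n := by
  have a1 := (e1_sc a b n).bm 0 a b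
  have a2 := (e2_sc a b n).bm 0 a b
  unfold cf ipp
  rw [← intervalIntegral.integral_sub (((h1.mul a1).add (h2.mul a2)).ii hab.le) (((h3.mul a1).add (h4.mul a2)).ii hab.le)]
  congr 1; ext x; ring

theorem tail {a b : ℝ} (hab : a < b) {f1 f2 : ℕ → ℝ → ℝ} (h1 : WC a b 1 f1) (h2 : WC a b 1 f2) (p2 : PO a b 1 f2)
    (N : ℕ) (hN : 1 ≤ N) : ∀ x ∈ Icc a b,
    |f1 0 x - WP a b N (cf a b (f1 0) (f2 0)) 0 x| ≤ Real.sqrt (2/(b-a)) * Real.sqrt (tl a b N) * (n2 a b (f1 1) + n2 a b (f2 1)) ∧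
    |f2 0 x - WU a b N (cf a b (f1 0) (f2 0)) 0 x| ≤ Real.sqrt (2/(b-a)) * Real.sqrt (tl a b N) * (n2 a b (f1 1) + n2 a b (f2 1)) := by
  have hL := sub_pos.2 hab
  have p1 : PE a b 1 f1 := by intro i hi ho; interval_cases i; simp at ho
  set z := cf a b (f1 0) (f2 0) with hz
  set D := n2 a b (f1 1) + n2 a b (f2 1) with hD
  have hEn : ∀ M, Real.sqrt (En a b M z 1) ≤ D := by
    intro M
    apply Real.sqrt_le_iff.2
    have := n2_nonneg a b (f1 1); have := n2_nonneg a b (f2 1)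
    refine ⟨by positivity, (En_cf hab h1 h2 p1 p2 M 1 le_rfl).trans ?_⟩
    nlinarith
  have hD0 : 0 ≤ D := (Real.sqrt_nonneg _).trans (hEn 0)
  set B : ℕ → ℝ := fun N => Real.sqrt (2/(b-a)) * Real.sqrt (tl a b N) * D with hB
  have hB0 : ∀ N, 0 ≤ B N := fun N => by positivity
  have hBt : Tendsto B atTop (𝓝 0) := by
    have := ((Real.continuous_sqrt.tendsto 0).comp (tl_tendsto (a := a) (b := b))).const_mul (Real.sqrt (2/(b-a)))
    have := this.mul_const D
    rw [Real.sqrt_zero, mul_zero, zero_mul] at this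
    exact this
  have pb : ∀ N M, 1 ≤ N → N ≤ M → ∀ x, |WP a b M z 0 x - WP a b N z 0 x| ≤ B N ∧ |WU a b M z 0 x - WU a b N z 0 x| ≤ B N := by
    intro N M h3 h4 x
    have := part_bd hab z h3 h4 x
    have h5 := hEn M
    exact ⟨this.1.trans (by simp only [hB]; gcongr), this.2.trans (by simp only [hB]; gcongr)⟩
  have lim : ∀ S : ℕ → ℝ → ℝ, (∀ M, Continuous (S M)) → (∀ N M, 1 ≤ N → N ≤ M → ∀ x, |S M x - S N x| ≤ B N) →
      ∃ g : ℝ → ℝ, Continuous g ∧ ∀ N, 1 ≤ N → ∀ x, |g x - S N x| ≤ B N := by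
    intro S hS hb
    have hc : ∀ x, CauchySeq (fun M => S M x) := by
      intro x
      refine cauchySeq_of_le_tendsto_0 (fun N => 2 * B N + if N = 0 then 2 * |S 0 x| + 2 * |S 1 x| + 2 * B 1 else 0) ?_ ?_
      · intro n m N hn hm
        by_cases h0 : N = 0
        · have key : ∀ n, |S n x| ≤ |S 0 x| + |S 1 x| + B 1 := by
            intro n
            rcases Nat.eq_zero_or_pos n with h | h
            · subst h; linarith [hB0 1, abs_nonneg (S 1 x)]
            · have := hb 1 n le_rfl h x
              have := abs_sub_abs_le_abs_sub (S n x) (S 1 x)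
              linarith [abs_nonneg (S 0 x)]
          rw [if_pos h0, Real.dist_eq]
          have := abs_sub (S n x) (S m x)
          linarith [key n, key m, hB0 N]
        · rw [if_neg h0, Real.dist_eq]
          have e1 := hb N n (by omega) hn x
          have e2 := hb N m (by omega) hm x
          rw [abs_le] at *
          constructor <;> linarith [e1.1, e1.2, e2.1, e2.2]
      · have h3 : Tendsto (fun N : ℕ => if N = 0 then 2 * |S 0 x| + 2 * |S 1 x| + 2 * B 1 else 0) atTop (𝓝 0) := by
          apply tendsto_const_nhds.congr'
          filter_upwards [eventually_ge_atTop 1] with N hN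
          rw [if_neg (by omega)]
        simpa using (hBt.const_mul 2).add h3
    choose g hg using fun x => cauchySeq_tendsto_of_complete (hc x)
    have hgb : ∀ N, 1 ≤ N → ∀ x, |g x - S N x| ≤ B N := by
      intro N hN x
      refine le_of_tendsto (((hg x).sub_const (S N x)).abs) ?_
      filter_upwards [eventually_ge_atTop N] with M hM using hb N M hN hM x
    refine ⟨g, ?_, hgb⟩
    have : TendstoUniformly S g atTop := by
      rw [Metric.tendstoUniformly_iff]
      intro ε hε
      filter_upwards [hBt.eventually (gt_mem_nhds hε), eventually_ge_atTop 1] with N h3 h4 x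
      rw [Real.dist_eq]; exact (hgb N h4 x).trans_lt h3
    exact this.continuous (Frequently.of_forall hS)
  obtain ⟨g1, gc1, gb1⟩ := lim (fun M => WP a b M z 0) (fun M => (WP_sc a b M z).cont 0) (fun N M h3 h4 x => (pb N M h3 h4 x).1)
  obtain ⟨g2, gc2, gb2⟩ := lim (fun M => WU a b M z 0) (fun M => (WU_sc a b M z).cont 0) (fun N M h3 h4 x => (pb N M h3 h4 x).2)
  have fc1 := (h1.1 0 (by norm_num)).1
  have fc2 := (h2.1 0 (by norm_num)).1
  have g1b := BM.of_cont (gc1.continuousOn (s := Icc a b))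
  have g2b := BM.of_cont (gc2.continuousOn (s := Icc a b))
  have hz0 : ∀ n, cf a b (fun x => f1 0 x - g1 x) (fun x => f2 0 x - g2 x) n = 0 := by
    intro n
    rw [cf_sub hab (h1.2 0 (by norm_num)) (h2.2 0 (by norm_num)) g1b g2b]
    have : ∀ M, n < M → 1 ≤ M → |cf a b (f1 0) (f2 0) n - cf a b g1 g2 n| ≤ 2 * B M * Real.sqrt (b-a) := by
      intro M h3 h4
      have e := W_coef hab M z 0 n h3
      simp only [mul_zero, pow_zero, one_mul] at e
      have e' : cf a b (WP a b M z 0) (WU a b M z 0) n = cf a b (f1 0) (f2 0) n := e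
      rw [← e', ← cf_sub hab ((WP_sc a b M z).bm 0 a b) ((WU_sc a b M z).bm 0 a b) g1b g2b]
      apply cf_sub_bd hab (((WP_sc a b M z).bm 0 a b).sub g1b) (((WU_sc a b M z).bm 0 a b).sub g2b) (hB0 M)
      · intro x _; rw [abs_sub_comm]; exact gb1 M h4 x
      · intro x _; rw [abs_sub_comm]; exact gb2 M h4 x
    have h3 : Tendsto (fun M => 2 * B M * Real.sqrt (b-a)) atTop (𝓝 0) := by
      simpa using (hBt.const_mul 2).mul_const (Real.sqrt (b-a))
    have h4 : |cf a b (f1 0) (f2 0) n - cf a b g1 g2 n| ≤ 0 := by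
      refine ge_of_tendsto h3 ?_
      filter_upwards [eventually_gt_atTop n, eventually_ge_atTop 1] with M h5 h6 using this M h5 h6
    exact abs_eq_zero.1 (le_antisymm h4 (abs_nonneg _))
  have := compl hab (fc1.sub gc1.continuousOn) (fc2.sub gc2.continuousOn) hz0
  intro x hx
  have e1 := gb1 N hN x
  have e2 := gb2 N hN x
  have := this x hx
  rw [← sub_eq_zero.1 this.1] at e1
  rw [← sub_eq_zero.1 this.2] at e2
  exact ⟨e1, e2⟩

/-- differentiation under the integral -/
theorem ddint {a b c d B : ℝ} (hab : a ≤ b) {f f' : ℝ → ℝ → ℝ}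
    (hd : ∀ t ∈ Icc c d, ∀ x ∈ Icc a b, HasDerivWithinAt (fun s => f s x) (f' t x) (Icc c d) t)
    (hc : ∀ t ∈ Icc c d, ContinuousOn (f t) (Icc a b))
    (hB : ∀ t ∈ Icc c d, ∀ x ∈ Icc a b, |f' t x| ≤ B) {t : ℝ} (ht : t ∈ Icc c d) :
    HasDerivWithinAt (fun s => ∫ x in a..b, f s x) (∫ x in a..b, f' t x) (Icc c d) t := by
  rw [hasDerivWithinAt_iff_tendsto_slope]
  have hi : ∀ s ∈ Icc c d, IntervalIntegrable (f s) volume a b := fun s hs => (BM.of_cont (hc s hs)).ii hab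
  have e : ∀ s ∈ Icc c d \ {t}, slope (fun s => ∫ x in a..b, f s x) t s = ∫ x in Ioc a b, slope (fun s => f s x) t s := by
    intro s hs
    rw [← intervalIntegral.integral_of_le hab]
    simp only [slope, vsub_eq_sub, smul_eq_mul]
    rw [intervalIntegral.integral_const_mul, intervalIntegral.integral_sub (hi s hs.1) (hi t ht)]
  rw [tendsto_congr' (eventually_nhdsWithin_of_forall (fun s hs => e s hs)), intervalIntegral.integral_of_le hab]
  apply tendsto_integral_filter_of_dominated_convergence (fun _ => B)
  · refine eventually_nhdsWithin_of_forall (fun s hs => ?_)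
    simp only [slope, vsub_eq_sub, smul_eq_mul]
    exact ((((hc s hs.1).sub (hc t ht)).const_smul (s - t)⁻¹).mono Ioc_subset_Icc_self).aestronglyMeasurable measurableSet_Ioc
  · refine eventually_nhdsWithin_of_forall (fun s hs => ?_)
    refine (ae_restrict_iff' measurableSet_Ioc).2 (Eventually.of_forall fun x hx => ?_)
    have hx' := Ioc_subset_Icc_self hx
    have := Convex.norm_image_sub_le_of_norm_hasDerivWithin_le (fun s hs => hd s hs x hx') (fun s hs => hB s hs x hx') (convex_Icc _ _) ht hs.1
    have hne : 0 < ‖s - t‖ := by rw [norm_pos_iff, sub_ne_zero]; exact hs.2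
    simp only [slope, vsub_eq_sub, smul_eq_mul]
    rw [norm_mul, norm_inv, inv_mul_le_iff₀ hne, mul_comm]; exact this
  · exact integrable_const B
  · refine (ae_restrict_iff' measurableSet_Ioc).2 (Eventually.of_forall fun x hx => ?_)
    exact hasDerivWithinAt_iff_tendsto_slope.1 (hd t ht x (Ioc_subset_Icc_self hx))

def GO (a b : ℝ) (N : ℕ) (z : ℝ → ℕ → ℝ) (c : ℝ) : Prop := ∀ t ∈ Icc (-c) c, ∀ n < N,
  HasDerivWithinAt (fun t => z t n) (-(cf a b (F1 (WP a b N (z t)) (WU a b N (z t)) 1) (F2 (WP a b N (z t)) (WU a b N (z t)) 1) n)) (Icc (-c) c) t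

theorem gal_E0 {a b c : ℝ} (hab : a < b) (hc : 0 ≤ c) {N : ℕ} {z : ℝ → ℕ → ℝ} (h : GO a b N z c) :
    ∀ t ∈ Icc (-c) c, En a b N (z t) 0 = En a b N (z 0) 0 := by
  have hd : ∀ t ∈ Icc (-c) c, HasDerivWithinAt (fun t => En a b N (z t) 0) 0 (Icc (-c) c) t := by
    intro t ht
    refine (I3 hab N (h t ht) 0).congr_deriv ?_
    have hP := WP_sc a b N (z t)
    have hU := WU_sc a b N (z t)
    rw [ipp_W hab ((F1_sc hP hU).bm _ a b) ((F2_sc hP hU).bm _ a b)]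
    have := cons0 hab N (z t)
    unfold cf at this
    rw [zero_add, this, mul_zero]
  intro t ht
  have := Convex.norm_image_sub_le_of_norm_hasDerivWithin_le (C := 0) hd (by simp) (convex_Icc _ _) (⟨by linarith, hc⟩ : (0:ℝ) ∈ Icc (-c) c) ht
  simp only [zero_mul, norm_le_zero_iff, sub_eq_zero] at this
  exact this

theorem gal_E2 {a b : ℝ} (hab : a < b) {K : ℝ} (hK : 0 ≤ K) : ∃ c : ℝ, 0 < c ∧ ∀ (N : ℕ) (z : ℝ → ℕ → ℝ), GO a b N z c →
    En a b N (z 0) 2 ≤ K → ∀ t ∈ Icc (-c) c, En a b N (z t) 2 ≤ 4 * (1 + K) := by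
  obtain ⟨C, hC, hb⟩ := energy_bound hab 2 le_rfl
  have hs : 0 < Real.sqrt (1 + K) := Real.sqrt_pos.2 (by linarith)
  refine ⟨1 / (2 * C * Real.sqrt (1 + K)), by positivity, fun N z h h0 t ht => ?_⟩
  set c := 1 / (2 * C * Real.sqrt (1 + K)) with hc
  have hc0 : 0 < c := by positivity
  set E : ℝ → ℝ := fun t => En a b N (z t) 2 with hE
  have hE0 : ∀ t, 0 ≤ E t := fun t => En_nonneg _ _ _ _ _
  have key : ∀ t ∈ Icc (-c) c, HasDerivWithinAt (fun t => (Real.sqrt (1 + E t))⁻¹)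
      (-(-2 * ipp a b (F1 (WP a b N (z t)) (WU a b N (z t)) (2+1)) (F2 (WP a b N (z t)) (WU a b N (z t)) (2+1))
      (WP a b N (z t) 2) (WU a b N (z t) 2) / (2 * Real.sqrt (1 + E t))) / Real.sqrt (1 + E t) ^ 2) (Icc (-c) c) t := by
    intro t ht
    have h1 := ((I3 hab N (h t ht) 2).const_add 1).sqrt (by have := hE0 t; simp only [hE] at this; positivity)
    have h2 : Real.sqrt (1 + E t) ≠ 0 := (Real.sqrt_pos.2 (by linarith [hE0 t])).ne'
    exact h1.fun_inv h2
  have kb : ∀ t ∈ Icc (-c) c, ‖(-(-2 * ipp a b (F1 (WP a b N (z t)) (WU a b N (z t)) (2+1)) (F2 (WP a b N (z t)) (WU a b N (z t)) (2+1))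
      (WP a b N (z t) 2) (WU a b N (z t) 2) / (2 * Real.sqrt (1 + E t))) / Real.sqrt (1 + E t) ^ 2)‖ ≤ C := by
    intro t ht
    have h1 := hb N (z t)
    set I := ipp a b (F1 (WP a b N (z t)) (WU a b N (z t)) (2+1)) (F2 (WP a b N (z t)) (WU a b N (z t)) (2+1))
      (WP a b N (z t) 2) (WU a b N (z t) 2)
    have hEt := hE0 t
    have hs1 : 0 < Real.sqrt (1 + E t) := Real.sqrt_pos.2 (by linarith)
    have hs2 : Real.sqrt (1 + E t) ^ 2 = 1 + E t := Real.sq_sqrt (by linarith)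
    have hs3 : Real.sqrt (E t) ≤ Real.sqrt (1 + E t) := Real.sqrt_le_sqrt (by linarith)
    have e : -(-2 * I / (2 * Real.sqrt (1 + E t))) / Real.sqrt (1 + E t) ^ 2 = I / (Real.sqrt (1 + E t) * (1 + E t)) := by
      rw [hs2]; field_simp
    rw [e, Real.norm_eq_abs, abs_div, abs_of_pos (by positivity : 0 < Real.sqrt (1 + E t) * (1 + E t)), div_le_iff₀ (by positivity)]
    refine h1.trans ?_
    simp only [show max 2 (2-1) = 2 from rfl]
    change C * Real.sqrt (E t) * E t ≤ _
    rw [mul_assoc]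
    gcongr; linarith
  have h00 : (0:ℝ) ∈ Icc (-c) c := ⟨by linarith, hc0.le⟩
  have := Convex.norm_image_sub_le_of_norm_hasDerivWithin_le key kb (convex_Icc _ _) h00 ht
  rw [Real.norm_eq_abs, Real.norm_eq_abs, sub_zero] at this
  have ht' : |t| ≤ c := abs_le.2 ht
  have h3 : (Real.sqrt (1 + K))⁻¹ ≤ (Real.sqrt (1 + E 0))⁻¹ := by
    have : 0 < Real.sqrt (1 + E 0) := Real.sqrt_pos.2 (by linarith [hE0 0])
    apply inv_anti₀ this
    exact Real.sqrt_le_sqrt (by simp only [hE]; linarith)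
  have h4 : C * |t| ≤ (Real.sqrt (1 + K))⁻¹ / 2 := by
    calc C * |t| ≤ C * c := by gcongr
      _ = _ := by rw [hc]; field_simp
  have h5 : (Real.sqrt (1 + K))⁻¹ / 2 ≤ (Real.sqrt (1 + E t))⁻¹ := by
    have := (abs_le.1 this).1; linarith
  have hs1 : 0 < Real.sqrt (1 + E t) := Real.sqrt_pos.2 (by linarith [hE0 t])
  have h6 : Real.sqrt (1 + E t) ≤ 2 * Real.sqrt (1 + K) := by
    have h7 := inv_anti₀ (by positivity) h5
    rw [inv_inv] at h7
    refine h7.trans (le_of_eq ?_); field_simp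
  have h8 : Real.sqrt (1 + E t) ^ 2 = 1 + E t := Real.sq_sqrt (by linarith [hE0 t])
  have h9 : Real.sqrt (1 + K) ^ 2 = 1 + K := Real.sq_sqrt (by linarith)
  change E t ≤ _
  nlinarith

theorem gal_Es {a b : ℝ} (hab : a < b) {K c : ℝ} (hc : 0 ≤ c) (hK : 0 ≤ K) (s : ℕ) (hs : 2 ≤ s) : ∀ D : ℕ → ℝ, ∃ K' : ℝ, 0 ≤ K' ∧ ∀ (N : ℕ) (z : ℝ → ℕ → ℝ), GO a b N z c →
    (∀ t ∈ Icc (-c) c, En a b N (z t) 2 ≤ K) → (∀ i ≤ s, En a b N (z 0) i ≤ D i) → ∀ t ∈ Icc (-c) c, En a b N (z t) s ≤ K' := by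
  intro D
  induction s, hs using Nat.le_induction with
  | base => exact ⟨K, hK, fun N z h h2 _ => h2⟩
  | succ s hs ih =>
    obtain ⟨K1, hK1, h1⟩ := ih
    obtain ⟨C, hC, hb⟩ := energy_bound hab (s+1) (by omega)
    refine ⟨|D (s+1)| * Real.exp (2 * C * Real.sqrt K1 * c), by positivity, fun N z h h2 hD t ht => ?_⟩
    have h3 := h1 N z h h2 (fun i hi => hD i (by omega))
    have h00 : (0:ℝ) ∈ Icc (-c) c := ⟨by linarith, hc⟩
    have := gron (K := 2 * C * Real.sqrt K1) (ε := 0) (by positivity) le_rfl (fun t ht => I3 hab N (h t ht) (s+1)) (fun t ht => by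
      rw [abs_mul, show |(-2:ℝ)| = 2 by norm_num, add_zero]
      have h4 := hb N (z t)
      rw [show max 2 (s+1-1) = s by omega] at h4
      have h5 : Real.sqrt (En a b N (z t) s) ≤ Real.sqrt K1 := Real.sqrt_le_sqrt (h3 t ht)
      have h6 := En_nonneg a b N (z t) (s+1)
      calc _ ≤ 2 * (C * Real.sqrt (En a b N (z t) s) * En a b N (z t) (s+1)) := by gcongr
        _ ≤ 2 * (C * Real.sqrt K1 * En a b N (z t) (s+1)) := by gcongr
        _ = _ := by ring) h00 ht
    refine this.trans ?_
    rw [zero_mul, add_zero, sub_zero]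
    have ht' : |t| ≤ c := abs_le.2 ht
    gcongr
    exact (hD (s+1) le_rfl).trans (le_abs_self _)

theorem LB_two (F G : ℕ → ℝ → ℝ) (x : ℝ) : LB F G 2 x = F 0 x * G 2 x + 2 * (F 1 x * G 1 x) + F 2 x * G 0 x := by
  rw [show (2:ℕ) = 0 + 2 from rfl, LB_mid]; simp; ring

theorem LB2_bd {a b A k : ℝ} (hab : a < b) {X Y : ℕ → ℝ → ℝ} (hX : SC X) (hY : SC Y) (hA : 0 ≤ A)
    (x0 : ∀ x ∈ Icc a b, |X 0 x| ≤ A) (x1 : ∀ x ∈ Icc a b, |X 1 x| ≤ A) (y0 : ∀ x ∈ Icc a b, |Y 0 x| ≤ A) (y1 : ∀ x ∈ Icc a b, |Y 1 x| ≤ A)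
    (x2 : n2 a b (X 2) ≤ k) (y2 : n2 a b (Y 2) ≤ k) : n2 a b (LB X Y 2) ≤ 2 * A * k + 2 * A * (A * Real.sqrt (b-a)) := by
  have e : LB X Y 2 = fun x => (X 0 x * Y 2 x + 2 * (X 1 x * Y 1 x)) + Y 0 x * X 2 x := by ext x; rw [LB_two]; ring
  have hx := fun i => hX.bm i a b
  have hy := fun i => hY.bm i a b
  rw [e]
  have h1 := n2_add hab.le (((hx 0).mul (hy 2)).add (((hx 1).mul (hy 1)).cmul 2)) ((hy 0).mul (hx 2))
  have h2 := n2_add hab.le ((hx 0).mul (hy 2)) (((hx 1).mul (hy 1)).cmul 2)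
  have h3 := n2_mul_sup hab.le (hx 0) (hy 2) x0
  have h4 := n2_mul_sup hab.le (hy 0) (hx 2) y0
  have h5 := n2_mul_sup hab.le (hx 1) (hy 1) x1
  have h6 := n2_le_sup hab.le (hy 1) y1
  have h7 : n2 a b (fun x => 2 * (X 1 x * Y 1 x)) = 2 * n2 a b (fun x => X 1 x * Y 1 x) := by
    rw [n2_cmul]; norm_num
  have h8 := mul_le_mul_of_nonneg_left x2 hA
  have h9 := mul_le_mul_of_nonneg_left y2 hA
  have h10 := mul_le_mul_of_nonneg_left h6 hA
  linarith

structure GalSol (a b c A K : ℝ) (r : ℕ) (g1 g2 : ℝ → ℝ) (ρ : ℕ → ℝ) (P U : ℕ → ℝ → ℕ → ℝ → ℝ) (R1 R2 : ℕ → ℝ → ℝ → ℝ) : Prop where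
  scP : ∀ N t, SC (P N t)
  scU : ∀ N t, SC (U N t)
  pe : ∀ N t k, PE a b k (P N t)
  po : ∀ N t k, PO a b k (U N t)
  dP : ∀ N, ∀ t ∈ Icc (-c) c, ∀ x, HasDerivWithinAt (fun t => P N t 0 x) (-F1 (P N t) (U N t) 1 x + R1 N t x) (Icc (-c) c) t
  dU : ∀ N, ∀ t ∈ Icc (-c) c, ∀ x, HasDerivWithinAt (fun t => U N t 0 x) (-F2 (P N t) (U N t) 1 x + R2 N t x) (Icc (-c) c) t
  cR1 : ∀ N t, Continuous (R1 N t)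
  cR2 : ∀ N t, Continuous (R2 N t)
  bR1 : ∀ N, ∀ t ∈ Icc (-c) c, ∀ x ∈ Icc a b, |R1 N t x| ≤ ρ N
  bR2 : ∀ N, ∀ t ∈ Icc (-c) c, ∀ x ∈ Icc a b, |R2 N t x| ≤ ρ N
  bP : ∀ N, ∀ t ∈ Icc (-c) c, ∀ x ∈ Icc a b, |P N t 0 x| ≤ A ∧ |P N t 1 x| ≤ A
  bU : ∀ N, ∀ t ∈ Icc (-c) c, ∀ x ∈ Icc a b, |U N t 0 x| ≤ A ∧ |U N t 1 x| ≤ A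
  kP : ∀ N, ∀ t ∈ Icc (-c) c, n2 a b (P N t r) ≤ K
  kU : ∀ N, ∀ t ∈ Icc (-c) c, n2 a b (U N t r) ≤ K
  iP : ∀ N, ∀ x ∈ Icc a b, |P N 0 0 x - g1 x| ≤ ρ N
  iU : ∀ N, ∀ x ∈ Icc a b, |U N 0 0 x - g2 x| ≤ ρ N
  tρ : Tendsto ρ atTop (𝓝 0)

theorem WC.le {a b : ℝ} {r s : ℕ} {F : ℕ → ℝ → ℝ} (h : WC a b r F) (hs : s ≤ r) : WC a b s F :=
  ⟨fun i hi => h.1 i (by omega), fun i hi => h.2 i (by omega)⟩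

theorem WP_congr {a b : ℝ} {N : ℕ} {z z' : ℕ → ℝ} (h : ∀ n < N, z n = z' n) : WP a b N z = WP a b N z' ∧ WU a b N z = WU a b N z' ∧ En a b N z = En a b N z' := by
  refine ⟨?_, ?_, ?_⟩
  · ext i x; unfold WP; exact Finset.sum_congr rfl fun n hn => by rw [h n (Finset.mem_range.1 hn)]
  · ext i x; unfold WU; exact Finset.sum_congr rfl fun n hn => by rw [h n (Finset.mem_range.1 hn)]
  · ext i; unfold En; exact Finset.sum_congr rfl fun n hn => by rw [h n (Finset.mem_range.1 hn)]

theorem gal {a b : ℝ} (hab : a < b) (K2 : ℝ) : ∃ c A : ℝ, 0 < c ∧ 0 ≤ A ∧ ∀ r, 2 ≤ r → ∀ g1 g2 : ℕ → ℝ → ℝ,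
    WC a b r g1 → WC a b r g2 → PE a b r g1 → PO a b r g2 → (∀ s ≤ 2, n2 a b (g1 s) ≤ K2 ∧ n2 a b (g2 s) ≤ K2) →
    ∃ K ρ P U R1 R2, GalSol a b c A K r (g1 0) (g2 0) ρ P U R1 R2 := by
  have hL := sub_pos.2 hab
  set D := 2 * K2^2 with hD
  have hD0 : 0 ≤ D := by positivity
  obtain ⟨c, hc, h2⟩ := gal_E2 hab hD0
  obtain ⟨C0, hC0, hsup⟩ := HB_sup0 hab
  set Q := max 1 ((b-a)/Real.pi) with hQ
  have hQ1 : 1 ≤ Q := le_max_left _ _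
  set k2 := Real.sqrt (4 * (1 + D)) with hk2
  have hk20 : 0 ≤ k2 := Real.sqrt_nonneg _
  set A := C0 * (Real.sqrt D + Q * k2) + C0 * (Q * k2 + k2) with hA
  have hA0 : 0 ≤ A := by positivity
  refine ⟨c, A, hc, hA0, fun r hr g1 g2 w1 w2 p1 p2 hg => ?_⟩
  obtain ⟨K, hK, hKs⟩ := gal_Es hab hc.le (by positivity : 0 ≤ 4 * (1 + D)) r hr (fun s => n2 a b (g1 s)^2 + n2 a b (g2 s)^2)
  choose z hz0 hz using fun N => galerkin_ode hab (N+1) (cf a b (g1 0) (g2 0)) hc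
  have hGO : ∀ N, GO a b (N+1) (z N) c := fun N => hz N
  have hEn0 : ∀ N, ∀ s ≤ r, En a b (N+1) (z N 0) s ≤ n2 a b (g1 s)^2 + n2 a b (g2 s)^2 := by
    intro N s hs
    rw [(WP_congr (a := a) (b := b) (hz0 N)).2.2]
    exact En_cf hab w1 w2 p1 p2 (N+1) s hs
  have hEnD : ∀ N, ∀ s ≤ 2, En a b (N+1) (z N 0) s ≤ D := by
    intro N s hs
    refine (hEn0 N s (by omega)).trans ?_
    have h3 := hg s hs
    have := n2_nonneg a b (g1 s); have := n2_nonneg a b (g2 s)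
    have a1 := pow_le_pow_left₀ this h3.2 2
    have a2 := pow_le_pow_left₀ (n2_nonneg a b (g1 s)) h3.1 2
    linarith
  have hE2 : ∀ N, ∀ t ∈ Icc (-c) c, En a b (N+1) (z N t) 2 ≤ 4 * (1 + D) := fun N => h2 (N+1) (z N) (hGO N) (hEnD N 2 le_rfl)
  have hs2 : ∀ N, ∀ t ∈ Icc (-c) c, Real.sqrt (En a b (N+1) (z N t) 2) ≤ k2 := fun N t ht => Real.sqrt_le_sqrt (hE2 N t ht)
  have hs1 : ∀ N, ∀ t ∈ Icc (-c) c, Real.sqrt (En a b (N+1) (z N t) 1) ≤ Q * k2 := fun N t ht => by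
    have := En_poinc' hab hQ1 (le_max_right _ _) (N+1) (z N t) 1 2 1 le_rfl (by norm_num) (by norm_num)
    rw [pow_one] at this
    exact this.trans (by gcongr; exact hs2 N t ht)
  have hs0 : ∀ N, ∀ t ∈ Icc (-c) c, Real.sqrt (En a b (N+1) (z N t) 0) ≤ Real.sqrt D := fun N t ht => by
    apply Real.sqrt_le_sqrt
    rw [gal_E0 hab hc.le (hGO N) t ht]; exact hEnD N 0 (by norm_num)
  have hEr : ∀ N, ∀ t ∈ Icc (-c) c, En a b (N+1) (z N t) r ≤ K := fun N => hKs (N+1) (z N) (hGO N) (hE2 N) (hEn0 N)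
  have hHB1 : ∀ N t, HB a b (N+1) (z N t) (WP a b (N+1) (z N t)) := fun N t => ⟨WP_sc _ _ _ _, fun k => WP_n2 hab _ _ k⟩
  have hHB2 : ∀ N t, HB a b (N+1) (z N t) (WU a b (N+1) (z N t)) := fun N t => ⟨WU_sc _ _ _ _, fun k => WU_n2 hab _ _ k⟩
  have supg : ∀ N, ∀ t ∈ Icc (-c) c, ∀ X, HB a b (N+1) (z N t) X → ∀ x ∈ Icc a b, |X 0 x| ≤ A ∧ |X 1 x| ≤ A := by
    intro N t ht X hX x hx
    have e0 := hsup (N+1) (z N t) X hX 0 x hx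
    have e1 := hsup (N+1) (z N t) X hX 1 x hx
    have b0 := hs0 N t ht; have b1 := hs1 N t ht; have b2 := hs2 N t ht
    have d0 : C0 * (Real.sqrt (En a b (N+1) (z N t) 0) + Real.sqrt (En a b (N+1) (z N t) (0+1))) ≤ C0 * (Real.sqrt D + Q * k2) := by gcongr
    have d1 : C0 * (Real.sqrt (En a b (N+1) (z N t) 1) + Real.sqrt (En a b (N+1) (z N t) (1+1))) ≤ C0 * (Q * k2 + k2) := by gcongr
    have q0 : 0 ≤ C0 * (Real.sqrt D + Q * k2) := by positivity
    have q1 : 0 ≤ C0 * (Q * k2 + k2) := by positivity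
    constructor <;> linarith
  set B := 2 * A * k2 + 2 * A * (A * Real.sqrt (b-a)) with hB
  have hB0 : 0 ≤ B := by positivity
  set M := B * 2 + (n2 a b (g1 1) + n2 a b (g2 1)) with hM
  have hM0 : 0 ≤ M := by have := n2_nonneg a b (g1 1); have := n2_nonneg a b (g2 1); positivity
  let P : ℕ → ℝ → ℕ → ℝ → ℝ := fun N t => WP a b (N+1) (z N t)
  let U : ℕ → ℝ → ℕ → ℝ → ℝ := fun N t => WU a b (N+1) (z N t)
  have hPs : ∀ N t, SC (P N t) := fun N t => WP_sc _ _ _ _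
  have hUs : ∀ N t, SC (U N t) := fun N t => WU_sc _ _ _ _
  have hPe : ∀ N t k, PE a b k (P N t) := fun N t k => WP_pe hab _ _ k
  have hUo : ∀ N t k, PO a b k (U N t) := fun N t k => WU_po hab _ _ k
  let q : ℕ → ℝ → ℕ → ℝ := fun N t => cf a b (F1 (P N t) (U N t) 1) (F2 (P N t) (U N t) 1)
  have hres : ∀ N, ∀ t ∈ Icc (-c) c, ∀ x ∈ Icc a b,
      |F1 (P N t) (U N t) 1 x - WP a b (N+1) (q N t) 0 x| ≤ Real.sqrt (2/(b-a)) * Real.sqrt (tl a b (N+1)) * M ∧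
      |F2 (P N t) (U N t) 1 x - WU a b (N+1) (q N t) 0 x| ≤ Real.sqrt (2/(b-a)) * Real.sqrt (tl a b (N+1)) * M := by
    intro N t ht x hx
    have f1 := F1_sc (hPs N t) (hUs N t)
    have f2 := F2_sc (hPs N t) (hUs N t)
    have hp2 : PO a b 1 (fun i => F2 (P N t) (U N t) (i+1)) := (F2_pe (hPe N t 2) (hUo N t 2)).shift
    have := tail hab (f1.shift.wc a b 1) (f2.shift.wc a b 1) hp2 (N+1) (by omega) x hx
    have sP := fun x hx => supg N t ht _ (hHB1 N t) x hx
    have sU := fun x hx => supg N t ht _ (hHB2 N t) x hx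
    have nP : n2 a b (P N t 2) ≤ k2 := ((hHB1 N t).2 2).trans (hs2 N t ht)
    have nU : n2 a b (U N t 2) ≤ k2 := ((hHB2 N t).2 2).trans (hs2 N t ht)
    have l1 := LB2_bd hab (hPs N t) (hUs N t) hA0 (fun x hx => (sP x hx).1) (fun x hx => (sP x hx).2) (fun x hx => (sU x hx).1) (fun x hx => (sU x hx).2) nP nU
    have l2 := LB2_bd hab (hPs N t) (hPs N t) hA0 (fun x hx => (sP x hx).1) (fun x hx => (sP x hx).2) (fun x hx => (sP x hx).1) (fun x hx => (sP x hx).2) nP nP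
    have l3 := LB2_bd hab (hUs N t) (hUs N t) hA0 (fun x hx => (sU x hx).1) (fun x hx => (sU x hx).2) (fun x hx => (sU x hx).1) (fun x hx => (sU x hx).2) nU nU
    have m1 : n2 a b (F1 (P N t) (U N t) 2) ≤ B := by
      unfold F1; rw [n2_cmul, abs_of_pos (by norm_num)]; linarith
    have m2 : n2 a b (F2 (P N t) (U N t) 2) ≤ B := by
      unfold F2
      have := n2_add hab.le ((((hPs N t).mul (hPs N t)).bm 2 a b).cmul (1/4)) ((((hUs N t).mul (hUs N t)).bm 2 a b).cmul (3/4))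
      rw [n2_cmul, n2_cmul, abs_of_pos (by norm_num), abs_of_pos (by norm_num)] at this
      linarith
    have m3 : n2 a b (F1 (P N t) (U N t) (1+1)) + n2 a b (F2 (P N t) (U N t) (1+1)) ≤ M := by
      have := n2_nonneg a b (g1 1); have := n2_nonneg a b (g2 1)
      rw [hM]; simp only [show 1+1 = 2 from rfl]; linarith
    exact ⟨this.1.trans (by gcongr), this.2.trans (by gcongr)⟩
  refine ⟨Real.sqrt K, fun N => Real.sqrt (2/(b-a)) * Real.sqrt (tl a b (N+1)) * M, P, U,
    fun N t x => F1 (P N t) (U N t) 1 x - WP a b (N+1) (q N t) 0 x, fun N t x => F2 (P N t) (U N t) 1 x - WU a b (N+1) (q N t) 0 x, ?_⟩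
  refine ⟨hPs, hUs, hPe, hUo, ?_, ?_, ?_, ?_, fun N t ht x hx => (hres N t ht x hx).1, fun N t ht x hx => (hres N t ht x hx).2,
    fun N t ht => supg N t ht _ (hHB1 N t), fun N t ht => supg N t ht _ (hHB2 N t), ?_, ?_, ?_, ?_, ?_⟩
  · intro N t ht x
    have := HasDerivWithinAt.fun_sum (u := Finset.range (N+1)) (fun n hn => (hz N t ht n (Finset.mem_range.1 hn)).mul_const (e1 a b n 0 x))
    refine HasDerivWithinAt.congr_deriv this ?_
    have e : WP a b (N+1) (q N t) 0 x = ∑ n ∈ Finset.range (N+1), q N t n * e1 a b n 0 x := rfl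
    simp only [neg_mul, Finset.sum_neg_distrib]
    change - (∑ n ∈ Finset.range (N+1), q N t n * e1 a b n 0 x) = _
    rw [← e]; ring
  · intro N t ht x
    have := HasDerivWithinAt.fun_sum (u := Finset.range (N+1)) (fun n hn => (hz N t ht n (Finset.mem_range.1 hn)).mul_const (e2 a b n 0 x))
    refine HasDerivWithinAt.congr_deriv this ?_
    have e : WU a b (N+1) (q N t) 0 x = ∑ n ∈ Finset.range (N+1), q N t n * e2 a b n 0 x := rfl
    simp only [neg_mul, Finset.sum_neg_distrib]
    change - (∑ n ∈ Finset.range (N+1), q N t n * e2 a b n 0 x) = _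
    rw [← e]; ring
  · intro N t
    exact ((F1_sc (hPs N t) (hUs N t)).cont 1).sub ((WP_sc a b (N+1) (q N t)).cont 0)
  · intro N t
    exact ((F2_sc (hPs N t) (hUs N t)).cont 1).sub ((WU_sc a b (N+1) (q N t)).cont 0)
  · intro N t ht; exact ((hHB1 N t).2 r).trans (Real.sqrt_le_sqrt (hEr N t ht))
  · intro N t ht; exact ((hHB2 N t).2 r).trans (Real.sqrt_le_sqrt (hEr N t ht))
  · intro N x hx
    have h3 := (tail hab (w1.le (by omega)) (w2.le (by omega)) (fun i hi => p2 i (by omega)) (N+1) (by omega) x hx).1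
    change |WP a b (N+1) (z N 0) 0 x - g1 0 x| ≤ _
    rw [(WP_congr (hz0 N)).1, abs_sub_comm]
    exact h3.trans (by gcongr; linarith)
  · intro N x hx
    have h3 := (tail hab (w1.le (by omega)) (w2.le (by omega)) (fun i hi => p2 i (by omega)) (N+1) (by omega) x hx).2
    change |WU a b (N+1) (z N 0) 0 x - g2 0 x| ≤ _
    rw [(WP_congr (hz0 N)).2.1, abs_sub_comm]
    exact h3.trans (by gcongr; linarith)
  · have h3 := (tl_tendsto (a := a) (b := b)).comp (tendsto_add_atTop_nat 1)
    have := (((Real.continuous_sqrt.tendsto 0).comp h3).const_mul (Real.sqrt (2/(b-a)))).mul_const M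
    rw [Real.sqrt_zero, mul_zero, zero_mul] at this
    exact this

theorem vand (r : ℕ) : ∃ a : ℕ → ℝ, ∀ j < r, ∑ k ∈ Finset.range r, a k * (-(1/((k:ℝ)+1)))^j = 1 := by
  let v : ℕ → ℝ := fun k => -(1/((k:ℝ)+1))
  refine ⟨fun k => (Lagrange.basis (Finset.range r) v k).eval 1, fun j hj => ?_⟩
  have hinj : Set.InjOn v (Finset.range r) := by
    intro x _ y _ h
    simp only [v, neg_inj, one_div, inv_inj, add_left_inj, Nat.cast_inj] at h
    exact h
  have h := Lagrange.eq_interpolate (f := (Polynomial.X ^ j : Polynomial ℝ)) hinj (by simpa using hj)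
  have h2 := congrArg (Polynomial.eval 1) h
  rw [Lagrange.interpolate_apply, Polynomial.eval_finset_sum] at h2
  simp only [Polynomial.eval_pow, Polynomial.eval_X, one_pow, Polynomial.eval_mul, Polynomial.eval_C] at h2
  refine Eq.trans ?_ h2.symm
  exact Finset.sum_congr rfl fun k _ => mul_comm _ _

theorem Ch.sum {a b : ℝ} {r : ℕ} {ι : Type*} (s : Finset ι) {F : ι → ℕ → ℝ → ℝ} (h : ∀ k ∈ s, Ch a b r (F k)) :
    Ch a b r (fun i x => ∑ k ∈ s, F k i x) :=
  ⟨fun i hi x hx => HasDerivWithinAt.fun_sum fun k hk => (h k hk).1 i hi x hx, continuousOn_finset_sum _ fun k hk => (h k hk).2⟩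

theorem Ch.comp_aff {a b c d : ℝ} {r : ℕ} {F : ℕ → ℝ → ℝ} (h : Ch a b r F) (m e : ℝ) (hm : ∀ x ∈ Icc c d, m * x + e ∈ Icc a b) :
    Ch c d r (fun i x => m^i * F i (m * x + e)) := by
  have haff : ∀ x, HasDerivAt (fun x => m * x + e) m x := fun x => by
    simpa using ((hasDerivAt_id x).const_mul m).add_const e
  refine ⟨fun i hi x hx => ?_, ?_⟩
  · have := ((h.1 i hi (m * x + e) (hm x hx)).comp x (haff x).hasDerivWithinAt hm).const_mul (m^i)
    beta_reduce; rw [pow_succ, mul_assoc, mul_comm m]; exact this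
  · have : Continuous (fun x : ℝ => m * x + e) := by fun_prop
    exact continuousOn_const.mul (h.2.comp this.continuousOn hm)

/-- cutoff chain -/
noncomputable def cut (i : ℕ) (x : ℝ) : ℝ := iteratedDeriv i (fun x => Real.smoothTransition (3 * x + 2)) x

theorem cut_sc : SC cut := by
  intro i x
  have hl : ContDiff ℝ (i+1 : ℕ) (fun x : ℝ => 3 * x + 2) := by fun_prop
  have hc : ContDiff ℝ (i+1 : ℕ) (fun x => Real.smoothTransition (3 * x + 2)) :=
    (Real.smoothTransition.contDiff (n := (i+1 : ℕ))).comp hl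
  have := hc.differentiable_iteratedDeriv i (by exact_mod_cast Nat.lt_succ_self i)
  have h := (this x).hasDerivAt
  unfold cut
  rw [iteratedDeriv_succ]
  exact h

theorem cut_loc {x c : ℝ} (h : (fun x => Real.smoothTransition (3 * x + 2)) =ᶠ[𝓝 x] fun _ => c) (i : ℕ) :
    cut i x = if i = 0 then c else 0 := by
  unfold cut
  rw [h.iteratedDeriv_eq, iteratedDeriv_const]

theorem cut_zero (i : ℕ) : cut i 0 = if i = 0 then 1 else 0 := by
  apply cut_loc
  filter_upwards [Ioi_mem_nhds (show (-1/3:ℝ) < 0 by norm_num)] with x hx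
  exact Real.smoothTransition.one_of_one_le (by have : (-1/3:ℝ) < x := hx; linarith)

theorem cut_neg (i : ℕ) : cut i (-1) = 0 := by
  rw [cut_loc (c := 0)]
  · simp
  · filter_upwards [Iio_mem_nhds (show (-1:ℝ) < -2/3 by norm_num)] with x hx
    exact Real.smoothTransition.zero_of_nonpos (by have : x < (-2/3:ℝ) := hx; linarith)

theorem LB_cut_zero (F : ℕ → ℝ → ℝ) (i : ℕ) : LB cut F i 0 = F i 0 := by
  unfold LB
  rw [Finset.sum_eq_single (0, i)]
  · simp [cut_zero]
  · rintro ⟨a, b⟩ h hne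
    rw [Finset.HasAntidiagonal.mem_antidiagonal] at h
    have : a ≠ 0 := by rintro rfl; apply hne; simp at h; simp [h]
    simp [cut_zero, this]
  · intro h; exact absurd (by simp) h

theorem LB_cut_neg (F : ℕ → ℝ → ℝ) (i : ℕ) : LB cut F i (-1) = 0 := by
  unfold LB
  exact Finset.sum_eq_zero fun p _ => by simp [cut_neg]

theorem n2_LB {a b : ℝ} (hab : a ≤ b) {r : ℕ} {F G : ℕ → ℝ → ℝ} {i : ℕ} (hi : i ≤ r) (hF : Ch a b r F) (hG : Ch a b r G) {c : ℝ}
    (hc : ∀ j ≤ i, ∀ x ∈ Icc a b, |F j x| ≤ c) {K : ℝ} (hK : ∀ j ≤ i, n2 a b (G j) ≤ K) : n2 a b (LB F G i) ≤ 2^i * (c * K) := by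
  have hc0 : 0 ≤ c := (abs_nonneg _).trans (hc 0 (Nat.zero_le _) a ⟨le_rfl, hab⟩)
  have hle : ∀ p ∈ Finset.HasAntidiagonal.antidiagonal i, p.1 ≤ i ∧ p.2 ≤ i := by
    intro p hp; rw [Finset.HasAntidiagonal.mem_antidiagonal] at hp; omega
  have h1 := n2_sum hab (Finset.HasAntidiagonal.antidiagonal i) (f := fun p x => (i.choose p.1 : ℝ) * (F p.1 x * G p.2 x)) (fun p hp =>
    ((hF.bm ((hle p hp).1.trans hi)).mul (hG.bm ((hle p hp).2.trans hi))).cmul _)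
  refine h1.trans ?_
  have h2 : ∀ p ∈ Finset.HasAntidiagonal.antidiagonal i, n2 a b (fun x => (i.choose p.1 : ℝ) * (F p.1 x * G p.2 x)) ≤ (i.choose p.1 : ℝ) * (c * K) := by
    intro p hp
    rw [n2_cmul, abs_of_nonneg (by positivity)]
    gcongr
    refine (n2_mul_sup hab (hF.bm ((hle p hp).1.trans hi)) (hG.bm ((hle p hp).2.trans hi)) (hc _ (hle p hp).1)).trans ?_
    gcongr
    exact hK _ (hle p hp).2
  refine (Finset.sum_le_sum h2).trans ?_
  rw [← Finset.sum_mul]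
  have : ∑ p ∈ Finset.HasAntidiagonal.antidiagonal i, (i.choose p.1 : ℝ) = 2^i := by
    rw [Finset.Nat.sum_antidiagonal_eq_sum_range_succ_mk]
    exact_mod_cast Nat.sum_range_choose i
  rw [this]

/-- left extension -/
theorem extL (r : ℕ) : ∃ C : ℝ, 1 ≤ C ∧ ∀ f : ℕ → ℝ → ℝ, Ch 0 1 r f → ∃ q : ℕ → ℝ → ℝ, Ch (-1) 0 r q ∧ (∀ i < r, q i 0 = f i 0) ∧ (∀ i, q i (-1) = 0) ∧
    ∀ K, ∀ m ≤ r, (∀ j ≤ m, n2 0 1 (f j) ≤ K) → ∀ j ≤ m, n2 (-1) 0 (q j) ≤ C * 2^m * K := by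
  obtain ⟨a, ha⟩ := vand r
  have hcb : ∀ j, ∃ c, ∀ x ∈ Icc (-1:ℝ) 0, |cut j x| ≤ c := fun j => isCompact_Icc.exists_bound_of_continuousOn (cut_sc.cont j).continuousOn
  choose cb hcb using hcb
  have hcb0 : ∀ j, 0 ≤ cb j := fun j => (abs_nonneg _).trans (hcb j 0 (by simp))
  set D := ∑ j ∈ Finset.range (r+1), cb j with hD
  have hD0 : 0 ≤ D := Finset.sum_nonneg fun j _ => hcb0 j
  have hDj : ∀ j ≤ r, cb j ≤ D := fun j hj => Finset.single_le_sum (f := cb) (fun j _ => hcb0 j) (by simp; omega)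
  set S := ∑ k ∈ Finset.range r, |a k| * ((k:ℝ)+1) with hS
  have hS0 : 0 ≤ S := Finset.sum_nonneg fun j _ => by positivity
  refine ⟨1 + D * S, by nlinarith [mul_nonneg hD0 hS0], fun f hf => ?_⟩
  set G : ℕ → ℝ → ℝ := fun i x => ∑ k ∈ Finset.range r, a k * ((-(1/((k:ℝ)+1)))^i * f i (-(1/((k:ℝ)+1)) * x + 0)) with hG
  have hmem : ∀ k : ℕ, ∀ x ∈ Icc (-1:ℝ) 0, -(1/((k:ℝ)+1)) * x + 0 ∈ Icc (0:ℝ) 1 := by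
    intro k x hx
    have h1 : (0:ℝ) < 1/((k:ℝ)+1) := by positivity
    have h2 : 1/((k:ℝ)+1) ≤ 1 := by rw [div_le_one (by positivity)]; linarith [Nat.cast_nonneg (α := ℝ) k]
    constructor <;> nlinarith [hx.1, hx.2]
  have hGk : ∀ k ∈ Finset.range r, Ch (-1) 0 r (fun i x => a k * ((-(1/((k:ℝ)+1)))^i * f i (-(1/((k:ℝ)+1)) * x + 0))) := fun k _ => (hf.comp_aff _ 0 (hmem k)).cmul (a k)
  have hGc : Ch (-1) 0 r G := Ch.sum _ hGk
  refine ⟨LB cut G, (cut_sc.ch _ _ r).mul hGc, ?_, fun i => LB_cut_neg _ _, ?_⟩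
  · intro i hi
    rw [LB_cut_zero]
    simp only [hG, mul_zero, zero_add]
    rw [show ∑ k ∈ Finset.range r, a k * ((-(1/((k:ℝ)+1)))^i * f i 0) = (∑ k ∈ Finset.range r, a k * (-(1/((k:ℝ)+1)))^i) * f i 0 by
      rw [Finset.sum_mul]; exact Finset.sum_congr rfl fun k _ => by ring]
    rw [ha i hi, one_mul]
  · intro K m hm hK j hj
    have hK0 : 0 ≤ K := (n2_nonneg _ _ _).trans (hK 0 (Nat.zero_le _))
    have hGn : ∀ l ≤ j, n2 (-1) 0 (G l) ≤ S * K := by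
      intro l hl
      refine (n2_sum (by norm_num) _ fun k hk => (hGk k hk).bm (by omega)).trans ?_
      rw [hS, Finset.sum_mul]
      apply Finset.sum_le_sum
      intro k _
      rw [n2_cmul, n2_cmul, mul_assoc]
      refine mul_le_mul_of_nonneg_left ?_ (abs_nonneg _)
      set v : ℝ := 1/((k:ℝ)+1) with hv
      have hv0 : 0 < v := by positivity
      have hv1 : v ≤ 1 := by rw [hv, div_le_one (by positivity)]; linarith [Nat.cast_nonneg (α := ℝ) k]
      have h1 : |(-v)^l| ≤ 1 := by
        rw [abs_pow, abs_neg, abs_of_pos hv0]; exact pow_le_one₀ hv0.le hv1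
      have h2 : n2 (-1) 0 (fun x => f l (-v * x + 0)) ≤ ((k:ℝ)+1) * K := by
        unfold n2
        have e : ∫ x in (-1:ℝ)..0, (f l (-v * x + 0))^2 = ((k:ℝ)+1) * ∫ x in (0:ℝ)..v, (f l x)^2 := by
          have := intervalIntegral.integral_comp_mul_left (a := -1) (b := 0) (fun x => (f l x)^2) (c := -v) (by linarith)
          simp only [add_zero]
          rw [this]
          rw [intervalIntegral.integral_symm, smul_eq_mul]
          simp only [mul_zero, mul_neg, mul_one, neg_neg]
          rw [hv, one_div, inv_neg, inv_inv]; ring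
        rw [e]
        have e2 : Real.sqrt (((k:ℝ)+1) * ∫ x in (0:ℝ)..v, (f l x)^2) = Real.sqrt ((k:ℝ)+1) * n2 0 v (f l) := by
          rw [Real.sqrt_mul (by positivity)]; rfl
        rw [e2]
        have h3 : Real.sqrt ((k:ℝ)+1) ≤ (k:ℝ)+1 := by
          rw [Real.sqrt_le_left (by positivity)]; nlinarith [Nat.cast_nonneg (α := ℝ) k]
        have h4 : n2 0 v (f l) ≤ K := (n2_mono_int le_rfl hv0.le hv1 (hf.bm (by omega))).trans (hK l (by omega))
        exact mul_le_mul h3 h4 (n2_nonneg _ _ _) (by positivity)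
      calc _ ≤ 1 * n2 (-1) 0 (fun x => f l (-v * x + 0)) := mul_le_mul_of_nonneg_right h1 (n2_nonneg _ _ _)
        _ ≤ _ := by rw [one_mul]; exact h2
    have := n2_LB (a := -1) (b := 0) (by norm_num) (i := j) (by omega) (cut_sc.ch _ _ r) hGc (c := D) (fun l hl x hx => (hcb l x hx).trans (hDj l (by omega))) hGn
    refine this.trans ?_
    have h5 : (2:ℝ)^j ≤ 2^m := pow_le_pow_right₀ (by norm_num) hj
    have h6 : 0 ≤ D * (S * K) := by positivity
    nlinarith [mul_le_mul_of_nonneg_right h5 h6, pow_pos (show (0:ℝ) < 2 by norm_num) m, mul_nonneg (pow_pos (show (0:ℝ) < 2 by norm_num) m).le hK0]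

theorem BM.union {a b c : ℝ} {f : ℝ → ℝ} (hab : a ≤ b) (hbc : b ≤ c) (h1 : BM a b f) (h2 : BM b c f) : BM a c f := by
  unfold BM at *
  rw [← Ioc_union_Ioc_eq_Ioc hab hbc]
  refine ⟨aestronglyMeasurable_union_iff.2 ⟨h1.1, h2.1⟩, ?_⟩
  have := eLpNorm_exponent_top (f := f) (μ := volume.restrict (Ioc a b ∪ Ioc b c))
  rw [this, eLpNormEssSup]
  have b1 := ae_le_essSup (f := fun x => ‖f x‖ₑ) (μ := volume.restrict (Ioc a b))
  have b2 := ae_le_essSup (f := fun x => ‖f x‖ₑ) (μ := volume.restrict (Ioc b c))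
  have l1 := h1.2; have l2 := h2.2
  rw [eLpNorm_exponent_top, eLpNormEssSup] at l1 l2
  refine lt_of_le_of_lt (essSup_le_of_ae_le (max (essSup (fun x => ‖f x‖ₑ) (volume.restrict (Ioc a b))) (essSup (fun x => ‖f x‖ₑ) (volume.restrict (Ioc b c)))) ?_) (max_lt l1 l2)
  unfold EventuallyLE
  rw [ae_restrict_union_iff]
  exact ⟨b1.mono fun x hx => hx.trans (le_max_left _ _), b2.mono fun x hx => hx.trans (le_max_right _ _)⟩

theorem n2_union {a b c : ℝ} {f : ℝ → ℝ} (hab : a ≤ b) (hbc : b ≤ c) (h1 : BM a b f) (h2 : BM b c f) : n2 a c f ≤ n2 a b f + n2 b c f := by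
  have e : ∫ x in a..c, (f x)^2 = n2 a b f ^2 + n2 b c f ^2 := by
    rw [n2_sq hab, n2_sq hbc, intervalIntegral.integral_add_adjacent_intervals (h1.sq.ii hab) (h2.sq.ii hbc)]
  unfold n2 at e ⊢
  rw [e]
  apply Real.sqrt_le_iff.2
  constructor
  · positivity
  · have := n2_nonneg a b f; have := n2_nonneg b c f
    unfold n2 at *
    nlinarith

theorem Ioc_ae {a b : ℝ} : ∀ᵐ x : ℝ, x ∈ Ioc a b → x < b := by
  have : ∀ᵐ x : ℝ, x ≠ b := by simp [ae_iff]
  filter_upwards [this] with x hx h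
  exact lt_of_le_of_ne h.2 hx

theorem BM.congr_Ioo {a b : ℝ} {f g : ℝ → ℝ} (hf : BM a b f) (h : ∀ x ∈ Ioo a b, f x = g x) : BM a b g := by
  refine MemLp.ae_eq ?_ hf
  rw [EventuallyEq, ae_restrict_iff' measurableSet_Ioc]
  filter_upwards [Ioc_ae (a := a) (b := b)] with x hx hm
  exact h x ⟨hm.1, hx hm⟩

theorem n2_congr_Ioo {a b : ℝ} (hab : a ≤ b) {f g : ℝ → ℝ} (hf : BM a b f) (h : ∀ x ∈ Ioo a b, f x = g x) : n2 a b g ≤ n2 a b f := by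
  refine n2_le_of_ae hab (hf.congr_Ioo h) hf ?_
  filter_upwards [Ioc_ae (a := a) (b := b)] with x hx hm
  rw [h x ⟨hm.1, hx hm⟩]

theorem Ch.hasDerivAt {a b : ℝ} {r : ℕ} {F : ℕ → ℝ → ℝ} (h : Ch a b r F) {i : ℕ} (hi : i < r) {x : ℝ} (hx : x ∈ Ioo a b) : HasDerivAt (F i) (F (i+1) x) x :=
  (h.1 i hi x (Ioo_subset_Icc_self hx)).hasDerivAt (Icc_mem_nhds hx.1 hx.2)

theorem n2_refl {f : ℝ → ℝ} {a b : ℝ} : n2 a b (fun x => f (-1 * x + 1)) = n2 (1-b) (1-a) f := by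
  unfold n2
  have := intervalIntegral.integral_comp_sub_left (fun x => (f x)^2) (1:ℝ) (a := a) (b := b)
  rw [← this]
  congr 1
  apply intervalIntegral.integral_congr
  intro x _
  simp only []
  rw [show -1 * x + 1 = 1 - x by ring]

theorem extW (r : ℕ) (hr : 2 ≤ r) : ∃ C : ℝ, 1 ≤ C ∧ ∀ f : ℕ → ℝ → ℝ, Ch 0 1 r f → ∃ g : ℕ → ℝ → ℝ, WC (-1) 2 r g ∧ (∀ i, ∀ x ∈ Icc (0:ℝ) 1, g i x = f i x) ∧
    (∀ i, g i (-1) = 0 ∧ g i 2 = 0) ∧ ∀ K, (∀ j ≤ 2, n2 0 1 (f j) ≤ K) → ∀ j ≤ 2, n2 (-1) 2 (g j) ≤ C * K := by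
  obtain ⟨C, hC, hext⟩ := extL r
  refine ⟨C * 4 + 1 + C * 4, by linarith, fun f hf => ?_⟩
  obtain ⟨qL, hqL, mL, zL, nL⟩ := hext f hf
  have hf' : Ch 0 1 r (fun i x => (-1)^i * f i (-1 * x + 1)) := hf.comp_aff _ _ (fun x hx => by constructor <;> linarith [hx.1, hx.2])
  obtain ⟨q', hq', mR, zR, nR⟩ := hext _ hf'
  have hqR : Ch 1 2 r (fun i x => (-1)^i * q' i (-1 * x + 1)) := hq'.comp_aff _ _ (fun x hx => by constructor <;> linarith [hx.1, hx.2])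
  set qR : ℕ → ℝ → ℝ := fun i x => (-1)^i * q' i (-1 * x + 1) with hqRd
  have mR' : ∀ i < r, qR i 1 = f i 1 := by
    intro i hi
    have := mR i hi
    simp only [hqRd]
    rw [show (-1 * (1:ℝ) + 1) = 0 by norm_num, this, ← mul_assoc, ← mul_pow]
    norm_num
  set g : ℕ → ℝ → ℝ := fun i x => if x < 0 then qL i x else if x ≤ 1 then f i x else qR i x with hg
  have gf : ∀ i, ∀ x ∈ Icc (0:ℝ) 1, g i x = f i x := fun i x hx => by
    simp only [hg]; rw [if_neg (not_lt.2 hx.1), if_pos hx.2]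
  have gL : ∀ i, ∀ x < (0:ℝ), g i x = qL i x := fun i x hx => by simp only [hg]; rw [if_pos hx]
  have gR : ∀ i, ∀ x > (1:ℝ), g i x = qR i x := fun i x hx => by
    simp only [hg]; rw [if_neg (by linarith), if_neg (by linarith)]
  have gL' : ∀ i < r, ∀ x ≤ (0:ℝ), g i x = qL i x := fun i hi x hx => by
    rcases hx.lt_or_eq with h | h
    · exact gL i x h
    · rw [h, gf i 0 (by simp), mL i hi]
  have gR' : ∀ i < r, ∀ x ≥ (1:ℝ), g i x = qR i x := fun i hi x hx => by
    rcases hx.lt_or_eq with h | h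
    · exact gR i x h
    · rw [← h, gf i 1 (by simp), mR' i hi]
  have b1 : ∀ i ≤ r, BM (-1) 0 (g i) := fun i hi => (hqL.bm hi).congr_Ioo fun x hx => (gL i x hx.2).symm
  have b2 : ∀ i ≤ r, BM 0 1 (g i) := fun i hi => (hf.bm hi).congr_Ioo fun x hx => (gf i x (Ioo_subset_Icc_self hx)).symm
  have b3 : ∀ i ≤ r, BM 1 2 (g i) := fun i hi => (hqR.bm hi).congr_Ioo fun x hx => (gR i x hx.1).symm
  refine ⟨g, ⟨fun i hi => ⟨?_, ?_⟩, fun i hi => ?_⟩, gf, fun i => ⟨?_, ?_⟩, fun K hK j hj => ?_⟩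
  · have c1 : ContinuousOn (g i) (Icc (-1) 0) := (hqL.cont hi.le).congr fun x hx => gL' i hi x hx.2
    have c2 : ContinuousOn (g i) (Icc 0 1) := (hf.cont hi.le).congr fun x hx => gf i x hx
    have c3 : ContinuousOn (g i) (Icc 1 2) := (hqR.cont hi.le).congr fun x hx => gR' i hi x hx.1
    have := (c1.union_of_isClosed c2 isClosed_Icc isClosed_Icc).union_of_isClosed c3 (isClosed_Icc.union isClosed_Icc) isClosed_Icc
    rwa [Icc_union_Icc_eq_Icc (by norm_num) (by norm_num), Icc_union_Icc_eq_Icc (by norm_num) (by norm_num)] at this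
  · rintro x ⟨hx, hne⟩
    simp only [mem_insert_iff, mem_singleton_iff, not_or] at hne
    rcases lt_or_gt_of_ne hne.1 with h0 | h0
    · rw [gL _ x h0]
      refine (hqL.hasDerivAt hi ⟨hx.1, h0⟩).congr_of_eventuallyEq ?_
      filter_upwards [Iio_mem_nhds h0] with y hy using gL i y hy
    · rcases lt_or_gt_of_ne hne.2 with h1 | h1
      · rw [gf _ x ⟨h0.le, h1.le⟩]
        refine (hf.hasDerivAt hi ⟨h0, h1⟩).congr_of_eventuallyEq ?_
        filter_upwards [Ioo_mem_nhds h0 h1] with y hy using gf i y (Ioo_subset_Icc_self hy)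
      · rw [gR _ x h1]
        refine (hqR.hasDerivAt hi ⟨h1, hx.2⟩).congr_of_eventuallyEq ?_
        filter_upwards [Ioi_mem_nhds h1] with y hy using gR i y hy
  · exact ((b1 i hi).union (by norm_num) (by norm_num) (b2 i hi)).union (by norm_num) (by norm_num) (b3 i hi)
  · rw [gL i _ (by norm_num), zL]
  · rw [gR i _ (by norm_num)]
    simp only [hqRd]
    rw [show (-1 * (2:ℝ) + 1) = -1 by norm_num, zR, mul_zero]
  · have hjr : j ≤ r := by omega
    have u1 := n2_union (by norm_num) (by norm_num) (b1 j hjr) (b2 j hjr)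
    have u2 := n2_union (by norm_num) (by norm_num) ((b1 j hjr).union (by norm_num) (by norm_num) (b2 j hjr)) (b3 j hjr)
    have k1 : n2 (-1) 0 (g j) ≤ C * 2^2 * K := (n2_congr_Ioo (by norm_num) (hqL.bm hjr) fun x hx => (gL j x hx.2).symm).trans (nL K 2 hr hK j hj)
    have k2 : n2 0 1 (g j) ≤ K := (n2_congr_Ioo (by norm_num) (hf.bm hjr) fun x hx => (gf j x (Ioo_subset_Icc_self hx)).symm).trans (hK j hj)
    have a1 : ∀ i : ℕ, |((-1:ℝ))^i| = 1 := fun i => by rw [abs_pow, abs_neg, abs_one, one_pow]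
    have k3 : n2 1 2 (g j) ≤ C * 2^2 * K := by
      refine (n2_congr_Ioo (by norm_num) (hqR.bm hjr) fun x hx => (gR j x hx.1).symm).trans ?_
      simp only [hqRd]
      rw [n2_cmul, a1, one_mul, n2_refl]
      rw [show (1-2:ℝ) = -1 by norm_num, show (1-1:ℝ) = 0 by norm_num]
      refine nR K 2 hr (fun l hl => ?_) j hj
      rw [n2_cmul, a1, one_mul, n2_refl]
      simpa using hK l hl
    linarith

theorem F1_one (P U : ℕ → ℝ → ℝ) (x : ℝ) : F1 P U 1 x = 1/2 * (P 0 x * U 1 x + P 1 x * U 0 x) := by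
  unfold F1; rw [LB_one]
theorem F2_one (P U : ℕ → ℝ → ℝ) (x : ℝ) : F2 P U 1 x = 1/2 * (P 0 x * P 1 x) + 3/2 * (U 0 x * U 1 x) := by
  unfold F2; rw [LB_one, LB_one]; ring

theorem abs_mul_le {x y a b : ℝ} (hx : |x| ≤ a) (hy : |y| ≤ b) : |x * y| ≤ a * b := by
  rw [abs_mul]; exact mul_le_mul hx hy (abs_nonneg _) ((abs_nonneg _).trans hx)

theorem abs_add_le' {x y a b : ℝ} (hx : |x| ≤ a) (hy : |y| ≤ b) : |x + y| ≤ a + b := (abs_add_le _ _).trans (add_le_add hx hy)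

theorem GalSol.rho {a b c A K : ℝ} {r : ℕ} {g1 g2 : ℝ → ℝ} {ρ : ℕ → ℝ} {P U : ℕ → ℝ → ℕ → ℝ → ℝ} {R1 R2 : ℕ → ℝ → ℝ → ℝ}
    (gs : GalSol a b c A K r g1 g2 ρ P U R1 R2) (hab : a ≤ b) (N : ℕ) : 0 ≤ ρ N :=
  (abs_nonneg _).trans (gs.iP N a ⟨le_rfl, hab⟩)

theorem end_small {a b c A K : ℝ} {r : ℕ} {g1 g2 : ℝ → ℝ} {ρ : ℕ → ℝ} {P U : ℕ → ℝ → ℕ → ℝ → ℝ} {R1 R2 : ℕ → ℝ → ℝ → ℝ} (hc : 0 < c) (hA : 0 ≤ A) (hab : a ≤ b)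
    (gs : GalSol a b c A K r g1 g2 ρ P U R1 R2) {e : ℝ} (he : e ∈ Icc a b) (h1 : g1 e = 0) (h2 : g2 e = 0) :
    ∃ ε : ℕ → ℝ, Tendsto ε atTop (𝓝 0) ∧ ∀ N, ∀ t ∈ Icc (-c) c, |P N t 0 e| ≤ ε N ∧ |U N t 0 e| ≤ ε N := by
  refine ⟨fun N => Real.sqrt ((2 * ρ N ^2 + 4 * A * ρ N * c) * Real.exp (4 * A * c)), ?_, ?_⟩
  · have h := gs.tρ
    have : Tendsto (fun N => Real.sqrt ((2 * ρ N ^2 + 4 * A * ρ N * c) * Real.exp (4 * A * c))) atTop (𝓝 (Real.sqrt ((2 * 0 ^2 + 4 * A * 0 * c) * Real.exp (4 * A * c)))) := by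
      apply Tendsto.sqrt
      apply Tendsto.mul_const
      exact ((h.pow 2).const_mul 2).add ((h.const_mul (4 * A)).mul_const c)
    simpa using this
  · intro N t ht
    have hρ := gs.rho hab N
    have key : P N t 0 e * P N t 0 e + U N t 0 e * U N t 0 e ≤ (2 * ρ N ^2 + 4 * A * ρ N * c) * Real.exp (4 * A * c) := by
      have h0 : (0:ℝ) ∈ Icc (-c) c := ⟨by linarith, hc.le⟩
      have := gron (c := -c) (d := c) (K := 4 * A) (ε := 4 * A * ρ N) (by positivity) (by positivity)
        (y := fun t => P N t 0 e * P N t 0 e + U N t 0 e * U N t 0 e)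
        (fun s hs => ((gs.dP N s hs e).mul (gs.dP N s hs e)).add ((gs.dU N s hs e).mul (gs.dU N s hs e)))
        (by
          intro s hs
          have bp := gs.bP N s hs e he; have bu := gs.bU N s hs e he
          have r1 := gs.bR1 N s hs e he; have r2 := gs.bR2 N s hs e he
          rw [F1_one, F2_one]
          set p0 := P N s 0 e; set p1 := P N s 1 e; set u0 := U N s 0 e; set u1 := U N s 1 e
          set s1 := R1 N s e; set s2 := R2 N s e
          have q1 : |p0 * u0| * |p1| ≤ |p0 * u0| * A := mul_le_mul_of_nonneg_left bp.2 (abs_nonneg _)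
          have q2 : |p0 * p0| * |u1| ≤ |p0 * p0| * A := mul_le_mul_of_nonneg_left bu.2 (abs_nonneg _)
          have q3 : |u0 * u0| * |u1| ≤ |u0 * u0| * A := mul_le_mul_of_nonneg_left bu.2 (abs_nonneg _)
          have q4 : |p0 * s1| ≤ A * ρ N := abs_mul_le bp.1 r1
          have q5 : |u0 * s2| ≤ A * ρ N := abs_mul_le bu.1 r2
          rw [← abs_mul] at q1 q2 q3
          have q6 : |p0 * u0| ≤ (p0 * p0 + u0 * u0)/2 := by
            rw [abs_le]; constructor <;> nlinarith [sq_nonneg (p0 + u0), sq_nonneg (p0 - u0)]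
          rw [abs_of_nonneg (mul_self_nonneg p0)] at q2
          rw [abs_of_nonneg (mul_self_nonneg u0)] at q3
          have q7 := mul_le_mul_of_nonneg_right q6 hA
          have q8 := mul_nonneg (mul_self_nonneg p0) hA
          rw [abs_le] at q1 q2 q3 q4 q5 ⊢
          constructor <;> linarith [q1.1, q1.2, q2.1, q2.2, q3.1, q3.2, q4.1, q4.2, q5.1, q5.2]) h0 ht
      refine this.trans ?_
      have ht' : |t - 0| ≤ c := by rw [sub_zero]; exact abs_le.2 ht
      have i1 := gs.iP N e he; have i2 := gs.iU N e he
      rw [h1, sub_zero] at i1; rw [h2, sub_zero] at i2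
      have j1 : P N 0 0 e * P N 0 0 e ≤ ρ N * ρ N := (le_abs_self _).trans (abs_mul_le i1 i1)
      have j2 : U N 0 0 e * U N 0 0 e ≤ ρ N * ρ N := (le_abs_self _).trans (abs_mul_le i2 i2)
      apply mul_le_mul _ _ (Real.exp_pos _).le (by positivity)
      · have := mul_le_mul_of_nonneg_left ht' (show 0 ≤ 4 * A * ρ N by positivity)
        linarith
      · apply Real.exp_le_exp.2; gcongr
    constructor
    · apply Real.abs_le_sqrt; nlinarith [mul_self_nonneg (U N t 0 e)]
    · apply Real.abs_le_sqrt; nlinarith [mul_self_nonneg (P N t 0 e)]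

structure Sol (T B : ℝ) (r : ℕ) (p u p1 u1 : ℝ → ℕ → ℝ → ℝ) : Prop where
  chp : ∀ t ∈ Icc 0 T, Ch 0 1 r (p t)
  chu : ∀ t ∈ Icc 0 T, Ch 0 1 r (u t)
  dp : ∀ t ∈ Icc 0 T, ∀ x ∈ Icc (0:ℝ) 1, HasDerivWithinAt (fun t => p t 0 x) (p1 t 0 x) (Icc 0 T) t
  du : ∀ t ∈ Icc 0 T, ∀ x ∈ Icc (0:ℝ) 1, HasDerivWithinAt (fun t => u t 0 x) (u1 t 0 x) (Icc 0 T) t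
  eqp : ∀ t ∈ Icc 0 T, ∀ x ∈ Icc (0:ℝ) 1, p1 t 0 x = -F1 (p t) (u t) 1 x
  equ : ∀ t ∈ Icc 0 T, ∀ x ∈ Icc (0:ℝ) 1, u1 t 0 x = -F2 (p t) (u t) 1 x
  bc : ∀ t ∈ Icc 0 T, u t 0 0 = 0 ∧ u t 0 1 = 0
  bd : ∀ t ∈ Icc 0 T, ∀ x ∈ Icc (0:ℝ) 1, |p t 0 x| ≤ B ∧ |u t 0 x| ≤ B ∧ |p1 t 0 x| ≤ B ∧ |u1 t 0 x| ≤ B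

theorem Sol.le {T B : ℝ} {r s : ℕ} {p u p1 u1 : ℝ → ℕ → ℝ → ℝ} (h : Sol T B r p u p1 u1) (hs : s ≤ r) : Sol T B s p u p1 u1 :=
  ⟨fun t ht => (h.chp t ht).le hs, fun t ht => (h.chu t ht).le hs, h.dp, h.du, h.eqp, h.equ, h.bc, h.bd⟩

set_option maxHeartbeats 2000000 in
theorem relen {α β c A K T B : ℝ} {r : ℕ} {g1 g2 : ℝ → ℝ} {ρ : ℕ → ℝ} {P U : ℕ → ℝ → ℕ → ℝ → ℝ} {R1 R2 : ℕ → ℝ → ℝ → ℝ}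
    {p u p1 u1 : ℝ → ℕ → ℝ → ℝ} (hr : 1 ≤ r) (hc : 0 < c) (hA : 0 ≤ A) (hα : α ≤ 0) (hβ : 1 ≤ β)
    (gs : GalSol α β c A K r g1 g2 ρ P U R1 R2) (sol : Sol T B r p u p1 u1) {a : ℝ} (ha : a ∈ Icc 0 T)
    (hg1 : ∀ x ∈ Icc (0:ℝ) 1, g1 x = p a 0 x) (hg2 : ∀ x ∈ Icc (0:ℝ) 1, g2 x = u a 0 x) {ε : ℕ → ℝ} (hε : Tendsto ε atTop (𝓝 0))
    (hεU : ∀ N, ∀ t ∈ Icc (-c) c, |U N t 0 0| ≤ ε N ∧ |U N t 0 1| ≤ ε N) :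
    ∃ E : ℕ → ℝ, Tendsto E atTop (𝓝 0) ∧ ∀ N, ∀ t ∈ Icc 0 T, |t - a| ≤ c → n2 0 1 (fun x => P N (t-a) 0 x - p t 0 x) ≤ E N ∧ n2 0 1 (fun x => U N (t-a) 0 x - u t 0 x) ≤ E N := by
  have hB : 0 ≤ B := (abs_nonneg _).trans (sol.bd a ha 0 (by simp)).1
  refine ⟨fun N => Real.sqrt ((2 * ρ N ^2 + (4 * ρ N * (A+B) + 4 * (ε N * (A+B)^2)) * c) * Real.exp (2 * A * c)), ?_, ?_⟩
  · have h := gs.tρ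
    have : Tendsto (fun N => Real.sqrt ((2 * ρ N ^2 + (4 * ρ N * (A+B) + 4 * (ε N * (A+B)^2)) * c) * Real.exp (2 * A * c))) atTop
      (𝓝 (Real.sqrt ((2 * 0 ^2 + (4 * 0 * (A+B) + 4 * (0 * (A+B)^2)) * c) * Real.exp (2 * A * c)))) := by
      apply Tendsto.sqrt
      apply Tendsto.mul_const
      exact ((h.pow 2).const_mul 2).add ((((h.const_mul 4).mul_const (A+B)).add ((hε.mul_const _).const_mul 4)).mul_const c)
    simpa using this
  intro N t ht hta
  have hρ := gs.rho (hα.trans (by linarith)) N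
  have hε0 : 0 ≤ ε N := (abs_nonneg _).trans (hεU N 0 ⟨by linarith, hc.le⟩).1
  have sub01 : ∀ x ∈ Icc (0:ℝ) 1, x ∈ Icc α β := fun x hx => ⟨hα.trans hx.1, hx.2.trans hβ⟩
  set l := max 0 (a-c) with hl
  set m := min T (a+c) with hm
  have hI : ∀ s ∈ Icc l m, s ∈ Icc 0 T ∧ s - a ∈ Icc (-c) c := fun s hs => by
    have h1 := le_max_left 0 (a-c); have h2 := le_max_right 0 (a-c)
    have h3 := min_le_left T (a+c); have h4 := min_le_right T (a+c)
    refine ⟨⟨h1.trans hs.1, hs.2.trans h3⟩, ?_, ?_⟩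
    · linarith [hs.1]
    · linarith [hs.2]
  have memI : ∀ s ∈ Icc 0 T, |s - a| ≤ c → s ∈ Icc l m := fun s hs h => by
    rw [abs_le] at h
    exact ⟨max_le hs.1 (by linarith), le_min hs.2 (by linarith)⟩
  have dPt : ∀ s ∈ Icc l m, ∀ x, HasDerivWithinAt (fun t => P N (t-a) 0 x) (-F1 (P N (s-a)) (U N (s-a)) 1 x + R1 N (s-a) x) (Icc l m) s := by
    intro s hs x
    have := (gs.dP N (s-a) (hI s hs).2 x).comp (h := fun t => t - a) s ((hasDerivAt_id s).sub_const a).hasDerivWithinAt (fun y hy => (hI y hy).2)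
    rw [mul_one] at this; exact this
  have dUt : ∀ s ∈ Icc l m, ∀ x, HasDerivWithinAt (fun t => U N (t-a) 0 x) (-F2 (P N (s-a)) (U N (s-a)) 1 x + R2 N (s-a) x) (Icc l m) s := by
    intro s hs x
    have := (gs.dU N (s-a) (hI s hs).2 x).comp (h := fun t => t - a) s ((hasDerivAt_id s).sub_const a).hasDerivWithinAt (fun y hy => (hI y hy).2)
    rw [mul_one] at this; exact this
  have hsubI : Icc l m ⊆ Icc 0 T := fun s hs => (hI s hs).1
  let z1 : ℝ → ℝ → ℝ := fun s x => P N (s-a) 0 x - p s 0 x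
  let z2 : ℝ → ℝ → ℝ := fun s x => U N (s-a) 0 x - u s 0 x
  let f : ℝ → ℝ → ℝ := fun s x => z1 s x * z1 s x + z2 s x * z2 s x
  let d1 : ℝ → ℝ → ℝ := fun s x => (-F1 (P N (s-a)) (U N (s-a)) 1 x + R1 N (s-a) x) - p1 s 0 x
  let d2 : ℝ → ℝ → ℝ := fun s x => (-F2 (P N (s-a)) (U N (s-a)) 1 x + R2 N (s-a) x) - u1 s 0 x
  let f' : ℝ → ℝ → ℝ := fun s x => (d1 s x * z1 s x + z1 s x * d1 s x) + (d2 s x * z2 s x + z2 s x * d2 s x)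
  have hz1 : ∀ s ∈ Icc l m, ∀ x ∈ Icc (0:ℝ) 1, HasDerivWithinAt (fun s => z1 s x) (d1 s x) (Icc l m) s := fun s hs x hx =>
    (dPt s hs x).sub ((sol.dp s (hI s hs).1 x hx).mono hsubI)
  have hz2 : ∀ s ∈ Icc l m, ∀ x ∈ Icc (0:ℝ) 1, HasDerivWithinAt (fun s => z2 s x) (d2 s x) (Icc l m) s := fun s hs x hx =>
    (dUt s hs x).sub ((sol.du s (hI s hs).1 x hx).mono hsubI)
  have hff : ∀ s ∈ Icc l m, ∀ x ∈ Icc (0:ℝ) 1, HasDerivWithinAt (fun s => f s x) (f' s x) (Icc l m) s := fun s hs x hx =>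
    ((hz1 s hs x hx).mul (hz1 s hs x hx)).add ((hz2 s hs x hx).mul (hz2 s hs x hx))
  have cz1 : ∀ s ∈ Icc l m, ContinuousOn (z1 s) (Icc 0 1) := fun s hs =>
    ((gs.scP N _).cont 0).continuousOn.sub ((sol.chp s (hI s hs).1).cont (Nat.zero_le _))
  have cz2 : ∀ s ∈ Icc l m, ContinuousOn (z2 s) (Icc 0 1) := fun s hs =>
    ((gs.scU N _).cont 0).continuousOn.sub ((sol.chu s (hI s hs).1).cont (Nat.zero_le _))
  have cf : ∀ s ∈ Icc l m, ContinuousOn (f s) (Icc 0 1) := fun s hs => ((cz1 s hs).mul (cz1 s hs)).add ((cz2 s hs).mul (cz2 s hs))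
  have bz : ∀ s ∈ Icc l m, ∀ x ∈ Icc (0:ℝ) 1, |z1 s x| ≤ A + B ∧ |z2 s x| ≤ A + B := fun s hs x hx => by
    have h1 := gs.bP N _ (hI s hs).2 x (sub01 x hx); have h2 := gs.bU N _ (hI s hs).2 x (sub01 x hx)
    have h3 := sol.bd s (hI s hs).1 x hx
    exact ⟨(abs_sub _ _).trans (add_le_add h1.1 h3.1), (abs_sub _ _).trans (add_le_add h2.1 h3.2.1)⟩
  have bd' : ∀ s ∈ Icc l m, ∀ x ∈ Icc (0:ℝ) 1, |d1 s x| ≤ (2 * (A * A) + ρ N) + B ∧ |d2 s x| ≤ (2 * (A * A) + ρ N) + B := fun s hs x hx => by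
    have h1 := gs.bP N _ (hI s hs).2 x (sub01 x hx); have h2 := gs.bU N _ (hI s hs).2 x (sub01 x hx)
    have h3 := sol.bd s (hI s hs).1 x hx
    have r1 := gs.bR1 N _ (hI s hs).2 x (sub01 x hx); have r2 := gs.bR2 N _ (hI s hs).2 x (sub01 x hx)
    have m1 := abs_mul_le h1.1 h2.2; have m2 := abs_mul_le h1.2 h2.1; have m3 := abs_mul_le h1.1 h1.2; have m4 := abs_mul_le h2.1 h2.2
    simp only [d1, d2]
    rw [F1_one, F2_one]
    constructor
    · refine (abs_sub _ _).trans (add_le_add (abs_add_le' ?_ r1) h3.2.2.1)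
      rw [abs_le] at m1 m2 ⊢; constructor <;> nlinarith
    · refine (abs_sub _ _).trans (add_le_add (abs_add_le' ?_ r2) h3.2.2.2)
      rw [abs_le] at m3 m4 ⊢; constructor <;> nlinarith
  have hy : ∀ s ∈ Icc l m, HasDerivWithinAt (fun s => ∫ x in (0:ℝ)..1, f s x) (∫ x in (0:ℝ)..1, f' s x) (Icc l m) s := fun s hs =>
    ddint zero_le_one hff cf (B := (((2 * (A * A) + ρ N) + B) * (A+B) + (A+B) * ((2 * (A * A) + ρ N) + B)) + (((2 * (A * A) + ρ N) + B) * (A+B) + (A+B) * ((2 * (A * A) + ρ N) + B)))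
      (fun s hs x hx => abs_add_le' (abs_add_le' (abs_mul_le (bd' s hs x hx).1 (bz s hs x hx).1) (abs_mul_le (bz s hs x hx).1 (bd' s hs x hx).1))
        (abs_add_le' (abs_mul_le (bd' s hs x hx).2 (bz s hs x hx).2) (abs_mul_le (bz s hs x hx).2 (bd' s hs x hx).2))) hs
  have hbound : ∀ s ∈ Icc l m, |∫ x in (0:ℝ)..1, f' s x| ≤ (2 * A) * (∫ x in (0:ℝ)..1, f s x) + (4 * ρ N * (A+B) + 4 * (ε N * (A+B)^2)) := by
    intro s hs
    have hs' := (hI s hs).1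
    let y1 : ℝ → ℝ := fun x => P N (s-a) 1 x - p s 1 x
    let y2 : ℝ → ℝ := fun x => U N (s-a) 1 x - u s 1 x
    let P0 := P N (s-a) 0
    let P1 := P N (s-a) 1
    let U0 := U N (s-a) 0
    let U1 := U N (s-a) 1
    have hP : ∀ x, HasDerivWithinAt P0 (P1 x) (Icc 0 1) x := fun x => (gs.scP N (s-a) 0 x).hasDerivWithinAt
    have hU : ∀ x, HasDerivWithinAt U0 (U1 x) (Icc 0 1) x := fun x => (gs.scU N (s-a) 0 x).hasDerivWithinAt
    have hx1 : ∀ x ∈ Icc (0:ℝ) 1, HasDerivWithinAt (z1 s) (y1 x) (Icc 0 1) x := fun x hx => (hP x).sub ((sol.chp s hs').1 0 hr x hx)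
    have hx2 : ∀ x ∈ Icc (0:ℝ) 1, HasDerivWithinAt (z2 s) (y2 x) (Icc 0 1) x := fun x hx => (hU x).sub ((sol.chu s hs').1 0 hr x hx)
    have cP0 : ContinuousOn P0 (Icc 0 1) := ((gs.scP N _).cont 0).continuousOn
    have cP1 : ContinuousOn P1 (Icc 0 1) := ((gs.scP N _).cont 1).continuousOn
    have cU0 : ContinuousOn U0 (Icc 0 1) := ((gs.scU N _).cont 0).continuousOn
    have cU1 : ContinuousOn U1 (Icc 0 1) := ((gs.scU N _).cont 1).continuousOn
    have cy1 : ContinuousOn y1 (Icc 0 1) := cP1.sub ((sol.chp s hs').cont hr)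
    have cy2 : ContinuousOn y2 (Icc 0 1) := cU1.sub ((sol.chu s hs').cont hr)
    have c1 := cz1 s hs
    have c2 := cz2 s hs
    let Φ : ℝ → ℝ := fun x => -(1/2) * (z1 s x * z1 s x * z2 s x) - 1/2 * (z2 s x * z2 s x * z2 s x) + 1/2 * (P0 x * (z1 s x * z2 s x)) + 1/4 * (U0 x * (z1 s x * z1 s x)) + 3/4 * (U0 x * (z2 s x * z2 s x))
    let Φ' : ℝ → ℝ := fun x => -(1/2) * ((y1 x * z1 s x + z1 s x * y1 x) * z2 s x + z1 s x * z1 s x * y2 x) - 1/2 * ((y2 x * z2 s x + z2 s x * y2 x) * z2 s x + z2 s x * z2 s x * y2 x)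
      + 1/2 * (P1 x * (z1 s x * z2 s x) + P0 x * (y1 x * z2 s x + z1 s x * y2 x)) + 1/4 * (U1 x * (z1 s x * z1 s x) + U0 x * (y1 x * z1 s x + z1 s x * y1 x)) + 3/4 * (U1 x * (z2 s x * z2 s x) + U0 x * (y2 x * z2 s x + z2 s x * y2 x))
    have hΦ : ∀ x ∈ Icc (0:ℝ) 1, HasDerivWithinAt Φ (Φ' x) (Icc 0 1) x := by
      intro x hx
      have a1 := hx1 x hx; have a2 := hx2 x hx; have a3 := hP x; have a4 := hU x
      exact (((((((a1.mul a1).mul a2).const_mul (-(1/2)))).sub (((a2.mul a2).mul a2).const_mul (1/2))).add ((a3.mul (a1.mul a2)).const_mul (1/2))).add ((a4.mul (a1.mul a1)).const_mul (1/4))).add ((a4.mul (a2.mul a2)).const_mul (3/4))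
    have cΦ' : ContinuousOn Φ' (Icc 0 1) := by fun_prop
    have hintg : ∫ x in (0:ℝ)..1, Φ' x = Φ 1 - Φ 0 := ftc zero_le_one hΦ cΦ'
    have hptw : ∀ x ∈ Icc (0:ℝ) 1, f' s x + 2 * Φ' x = - (P1 x * (z1 s x * z2 s x) + 1/2 * (U1 x * (z1 s x * z1 s x)) + 3/2 * (U1 x * (z2 s x * z2 s x))) + 2 * (R1 N (s-a) x * z1 s x + R2 N (s-a) x * z2 s x) := by
      intro x hx
      have e1 := sol.eqp s hs' x hx; have e2 := sol.equ s hs' x hx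
      simp only [f', d1, d2, Φ', z1, z2, y1, y2, P0, P1, U0, U1]
      rw [e1, e2, F1_one, F2_one, F1_one, F2_one]
      ring
    have hpb : ∀ x ∈ Icc (0:ℝ) 1, |f' s x + 2 * Φ' x| ≤ 2 * A * f s x + 4 * ρ N * (A + B) := by
      intro x hx
      rw [hptw x hx]
      have h1 := gs.bP N _ (hI s hs).2 x (sub01 x hx); have h2 := gs.bU N _ (hI s hs).2 x (sub01 x hx)
      have r1 := abs_mul_le (gs.bR1 N _ (hI s hs).2 x (sub01 x hx)) (bz s hs x hx).1; have r2 := abs_mul_le (gs.bR2 N _ (hI s hs).2 x (sub01 x hx)) (bz s hs x hx).2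
      simp only [f]
      have q6 : |z1 s x * z2 s x| ≤ (z1 s x * z1 s x + z2 s x * z2 s x)/2 := by
        rw [abs_le]; constructor <;> nlinarith [sq_nonneg (z1 s x + z2 s x), sq_nonneg (z1 s x - z2 s x)]
      have n1 := abs_mul_le h1.2 q6
      have n2 := abs_mul_le h2.2 (abs_of_nonneg (mul_self_nonneg (z1 s x))).le
      have n3 := abs_mul_le h2.2 (abs_of_nonneg (mul_self_nonneg (z2 s x))).le
      have n4 := mul_nonneg hA (mul_self_nonneg (z1 s x))
      simp only [P1, U1]
      rw [abs_le] at n1 n2 n3 r1 r2 ⊢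
      constructor <;> linarith [n1.1, n1.2, n2.1, n2.2, n3.1, n3.2, r1.1, r1.2, r2.1, r2.2]
    have cs1 : ContinuousOn (f' s) (Icc 0 1) := by
      have := (((((cP1.mul (c1.mul c2)).add ((cU1.mul (c1.mul c1)).const_smul (1/2:ℝ))).add ((cU1.mul (c2.mul c2)).const_smul (3/2:ℝ))).neg).add
        ((((gs.cR1 N (s-a)).continuousOn.mul c1).add ((gs.cR2 N (s-a)).continuousOn.mul c2)).const_smul (2:ℝ))).sub (cΦ'.const_smul (2:ℝ))
      refine this.congr fun x hx => ?_
      have := hptw x hx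
      simp only [smul_eq_mul, Pi.add_apply, Pi.mul_apply, Pi.neg_apply, Pi.sub_apply, Pi.smul_apply]
      linarith
    have i1 := (BM.of_cont cs1).ii zero_le_one
    have i2 := (BM.of_cont cΦ').ii zero_le_one
    have i3 := (BM.of_cont (cf s hs)).ii zero_le_one
    have e1 : ∫ x in (0:ℝ)..1, f' s x = (∫ x in (0:ℝ)..1, (f' s x + 2 * Φ' x)) - 2 * (Φ 1 - Φ 0) := by
      rw [intervalIntegral.integral_add i1 (i2.const_mul 2), intervalIntegral.integral_const_mul, hintg]; ring
    have e2 : |∫ x in (0:ℝ)..1, (f' s x + 2 * Φ' x)| ≤ 2 * A * (∫ x in (0:ℝ)..1, f s x) + 4 * ρ N * (A+B) := by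
      refine (intervalIntegral.abs_integral_le_integral_abs zero_le_one).trans ?_
      have := intervalIntegral.integral_mono_on zero_le_one ((i1.add (i2.const_mul 2)).abs) ((i3.const_mul (2*A)).add (intervalIntegrable_const (c := 4 * ρ N * (A+B)))) hpb
      refine this.trans ?_
      rw [intervalIntegral.integral_add (i3.const_mul (2*A)) (intervalIntegrable_const), intervalIntegral.integral_const_mul]
      simp
    have e3 : ∀ e ∈ Icc (0:ℝ) 1, u s 0 e = 0 → |U N (s-a) 0 e| ≤ ε N → |Φ e| ≤ ε N * (A+B)^2 := by
      intro e he hu0 hUe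
      have h1 := gs.bP N _ (hI s hs).2 e (sub01 e he); have h2 := gs.bU N _ (hI s hs).2 e (sub01 e he)
      have h3 := bz s hs e he
      have : Φ e = U0 e * (-(1/4) * (z1 s e * z1 s e) + 1/4 * (U0 e * U0 e) + 1/2 * (P0 e * z1 s e)) := by
        simp only [Φ]
        have : z2 s e = U0 e := by simp only [z2, U0]; rw [hu0, sub_zero]
        rw [this]; ring
      rw [this]
      apply abs_mul_le hUe
      have q1 := abs_mul_le h3.1 h3.1; have q2 := abs_mul_le h2.1 h2.1; have q3 := abs_mul_le h1.1 h3.1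
      simp only [U0, P0]
      rw [abs_le] at q1 q2 q3 ⊢
      have w1 := mul_nonneg hA hB; have w2 := mul_nonneg hA hA; have w3 := mul_nonneg hB hB
      have w4 : (A+B)^2 = A*A + 2*(A*B) + B*B := by ring
      have w5 : (A+B)*(A+B) = A*A + 2*(A*B) + B*B := by ring
      have w6 : A*(A+B) = A*A + A*B := by ring
      rw [w4]; rw [w5] at q1; rw [w6] at q3
      constructor <;> linarith [q1.1, q1.2, q2.1, q2.2, q3.1, q3.2]
    have e4 := e3 0 (by simp) (sol.bc s hs').1 (hεU N _ (hI s hs).2).1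
    have e5 := e3 1 (by simp) (sol.bc s hs').2 (hεU N _ (hI s hs).2).2
    rw [e1]
    rw [abs_le] at e2 e4 e5 ⊢
    constructor <;> linarith [e2.1, e2.2, e4.1, e4.2, e5.1, e5.2]
  have hta' := memI t ht hta
  have haI := memI a ha (by simp; exact hc.le)
  have key := gron (by positivity) (by positivity) hy hbound haI hta'
  have hya : ∫ x in (0:ℝ)..1, f a x ≤ 2 * ρ N ^2 := by
    have h1 : ∀ x ∈ Icc (0:ℝ) 1, f a x ≤ 2 * ρ N ^2 := by
      intro x hx
      have i1 := gs.iP N x (sub01 x hx); have i2 := gs.iU N x (sub01 x hx)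
      rw [hg1 x hx] at i1; rw [hg2 x hx] at i2
      simp only [f, z1, z2, sub_self]
      have := (le_abs_self _).trans (abs_mul_le i1 i1); have := (le_abs_self _).trans (abs_mul_le i2 i2)
      linarith
    have := intervalIntegral.integral_mono_on zero_le_one ((BM.of_cont (cf a haI)).ii zero_le_one) (intervalIntegrable_const (c := 2 * ρ N ^2)) h1
    simpa using this
  have hy0 : ∫ x in (0:ℝ)..1, f t x ≤ (2 * ρ N ^2 + (4 * ρ N * (A+B) + 4 * (ε N * (A+B)^2)) * c) * Real.exp (2 * A * c) := by
    refine key.trans ?_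
    have hq : 0 ≤ 4 * ρ N * (A+B) + 4 * (ε N * (A+B)^2) := by positivity
    apply mul_le_mul _ _ (Real.exp_pos _).le (by positivity)
    · have := mul_le_mul_of_nonneg_left hta hq
      linarith
    · apply Real.exp_le_exp.2; gcongr
  have j1 := ((BM.of_cont (cz1 t hta')).sq).ii zero_le_one
  have j2 := ((BM.of_cont (cz2 t hta')).sq).ii zero_le_one
  have esum : ∫ x in (0:ℝ)..1, f t x = (∫ x in (0:ℝ)..1, (z1 t x)^2) + ∫ x in (0:ℝ)..1, (z2 t x)^2 := by
    rw [← intervalIntegral.integral_add j1 j2]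
    congr 1; ext x; simp only [f]; ring
  have k1 : 0 ≤ ∫ x in (0:ℝ)..1, (z1 t x)^2 := intervalIntegral.integral_nonneg zero_le_one fun x _ => sq_nonneg _
  have k2 : 0 ≤ ∫ x in (0:ℝ)..1, (z2 t x)^2 := intervalIntegral.integral_nonneg zero_le_one fun x _ => sq_nonneg _
  constructor
  · apply Real.sqrt_le_sqrt; simp only [z1] at *; linarith
  · apply Real.sqrt_le_sqrt; simp only [z2] at *; linarith

def ND (r : ℕ) (p u : ℕ → ℝ → ℝ) (e : ℝ) : Prop := (∀ j < r, Odd j → p j e = 0) ∧ (∀ j < r, Even j → u j e = 0)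

def Adm (r : ℕ) (p u : ℕ → ℝ → ℝ) : Prop := (p 0 0 = 0 ∨ ND r p u 0) ∧ (p 0 1 = 0 ∨ ND r p u 1)

theorem WC.mono {a b c d : ℝ} {r : ℕ} {F : ℕ → ℝ → ℝ} (h : WC a b r F) (h1 : a ≤ c) (h2 : d ≤ b) : WC c d r F :=
  ⟨fun i hi => ⟨(h.1 i hi).1.mono (Icc_subset_Icc h1 h2), fun x hx => (h.1 i hi).2 x ⟨Ioo_subset_Ioo h1 h2 hx.1, hx.2⟩⟩, fun i hi => (h.2 i hi).mono h1 h2⟩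

theorem zero_of_lim {f : ℕ → ℝ} {y : ℝ} {ε : ℕ → ℝ} (hε : Tendsto ε atTop (𝓝 0)) (hf : ∀ N, |f N| ≤ ε N)
    (h : ∀ δ > 0, ∀ᶠ N in atTop, |f N - y| < δ) : y = 0 := by
  by_contra hne
  have hy : 0 < |y| / 2 := by positivity
  obtain ⟨N, h1, h2⟩ := ((h _ hy).and (hε.eventually (gt_mem_nhds hy))).exists
  have h3 := hf N
  have h4 : |y| ≤ |f N| + |f N - y| := by
    have := abs_sub (f N) (f N - y)
    rwa [sub_sub_cancel] at this
  linarith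

theorem local_aux {α β : ℝ} (hα : α = -1 ∨ α = 0) (hβ : β = 2 ∨ β = 1) (r : ℕ) (hr : 2 ≤ r) (K : ℝ) : ∃ c > 0, ∀ (T B : ℝ) (p u p1 u1 : ℝ → ℕ → ℝ → ℝ),
    Sol T B r p u p1 u1 → ∀ a ∈ Icc 0 T, ((α = -1 ∧ p a 0 0 = 0) ∨ (α = 0 ∧ ND r (p a) (u a) 0)) → ((β = 2 ∧ p a 0 1 = 0) ∨ (β = 1 ∧ ND r (p a) (u a) 1)) →
    (∀ j ≤ 2, n2 0 1 (p a j) ≤ K ∧ n2 0 1 (u a j) ≤ K) →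
    ∃ K', ∀ t ∈ Icc 0 T, |t - a| ≤ c → Adm r (p t) (u t) ∧ n2 0 1 (p t r) ≤ K' ∧ n2 0 1 (u t r) ≤ K' := by
  obtain ⟨C, hC, hext⟩ := extW r hr
  have ha0 : α ≤ 0 ∧ -1 ≤ α := by rcases hα with h | h <;> rw [h] <;> norm_num
  have hb0 : 1 ≤ β ∧ β ≤ 2 := by rcases hβ with h | h <;> rw [h] <;> norm_num
  have hab : α < β := by linarith [ha0.1, hb0.1]
  obtain ⟨c, A, hc, hA, hgal⟩ := gal hab (C * K)
  refine ⟨c, hc, fun T B p u p1 u1 sol a ha hL hR hK => ?_⟩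
  obtain ⟨gp, wp, gpe, gpz, gpn⟩ := hext (p a) (sol.chp a ha)
  obtain ⟨gu, wu, gue, guz, gun⟩ := hext (u a) (sol.chu a ha)
  have h01 : (0:ℝ) ∈ Icc (0:ℝ) 1 := by simp
  have h11 : (1:ℝ) ∈ Icc (0:ℝ) 1 := by simp
  have hPE : PE α β r gp := by
    intro i hi ho
    constructor
    · rcases hL with ⟨h, _⟩ | ⟨h, h'⟩
      · rw [h]; exact (gpz i).1
      · rw [h, gpe i 0 h01]; exact h'.1 i hi ho
    · rcases hR with ⟨h, _⟩ | ⟨h, h'⟩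
      · rw [h]; exact (gpz i).2
      · rw [h, gpe i 1 h11]; exact h'.1 i hi ho
  have hPO : PO α β r gu := by
    intro i hi ho
    constructor
    · rcases hL with ⟨h, _⟩ | ⟨h, h'⟩
      · rw [h]; exact (guz i).1
      · rw [h, gue i 0 h01]; exact h'.2 i hi ho
    · rcases hR with ⟨h, _⟩ | ⟨h, h'⟩
      · rw [h]; exact (guz i).2
      · rw [h, gue i 1 h11]; exact h'.2 i hi ho
  obtain ⟨K', ρ, P, U, R1, R2, gs⟩ := hgal r hr gp gu (wp.mono ha0.2 hb0.2) (wu.mono ha0.2 hb0.2) hPE hPO (fun s hs =>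
    ⟨(n2_mono_int ha0.2 hab.le hb0.2 (wp.2 s (by omega))).trans (gpn K (fun j hj => (hK j hj).1) s hs),
     (n2_mono_int ha0.2 hab.le hb0.2 (wu.2 s (by omega))).trans (gun K (fun j hj => (hK j hj).2) s hs)⟩)
  have small : ∀ e ∈ Icc (0:ℝ) 1, u a 0 e = 0 → (p a 0 e = 0 ∨ (e = α ∨ e = β)) → ∃ ε : ℕ → ℝ, Tendsto ε atTop (𝓝 0) ∧ ∀ N, ∀ t ∈ Icc (-c) c, |U N t 0 e| ≤ ε N ∧ (p a 0 e = 0 → |P N t 0 e| ≤ ε N) := by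
    intro e he hu0 h
    by_cases hp0 : p a 0 e = 0
    · obtain ⟨ε, h1, h2⟩ := end_small hc hA hab.le gs (e := e) ⟨ha0.1.trans he.1, he.2.trans hb0.1⟩ (by rw [gpe 0 e he, hp0]) (by rw [gue 0 e he, hu0])
      exact ⟨ε, h1, fun N t ht => ⟨(h2 N t ht).2, fun _ => (h2 N t ht).1⟩⟩
    · refine ⟨fun _ => 0, tendsto_const_nhds, fun N t ht => ⟨?_, fun h => absurd h hp0⟩⟩
      have hpo := gs.po N t 1 0 (by norm_num) (by norm_num)
      rcases h with h | h | h
      · exact absurd h hp0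
      · rw [h, hpo.1]; simp
      · rw [h, hpo.2]; simp
  obtain ⟨ε0, t0, s0⟩ := small 0 h01 (sol.bc a ha).1 (by rcases hL with h | h; exact Or.inl h.2; exact Or.inr (Or.inl h.1.symm))
  obtain ⟨ε1, t1, s1⟩ := small 1 h11 (sol.bc a ha).2 (by rcases hR with h | h; exact Or.inl h.2; exact Or.inr (Or.inr h.1.symm))
  obtain ⟨E, hE, hEn⟩ := relen (by omega) hc hA ha0.1 hb0.1 gs sol ha (gpe 0) (gue 0) (ε := fun N => |ε0 N| + |ε1 N|)
    (by simpa using t0.abs.add t1.abs)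
    (fun N t ht => ⟨((s0 N t ht).1.trans (le_abs_self _)).trans (by linarith [abs_nonneg (ε1 N)]), ((s1 N t ht).1.trans (le_abs_self _)).trans (by linarith [abs_nonneg (ε0 N)])⟩)
  refine ⟨K', fun t ht hta => ?_⟩
  have hta' : t - a ∈ Icc (-c) c := abs_le.1 hta
  have tp : Tendsto (fun N => n2 0 1 (fun x => P N (t-a) 0 x - p t 0 x)) atTop (𝓝 0) :=
    squeeze_zero (fun N => n2_nonneg _ _ _) (fun N => (hEn N t ht hta).1) hE
  have tu : Tendsto (fun N => n2 0 1 (fun x => U N (t-a) 0 x - u t 0 x)) atTop (𝓝 0) :=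
    squeeze_zero (fun N => n2_nonneg _ _ _) (fun N => (hEn N t ht hta).2) hE
  have chP : ∀ N, Ch 0 1 r (P N (t-a)) := fun N => (gs.scP N _).ch 0 1 r
  have chU : ∀ N, Ch 0 1 r (U N (t-a)) := fun N => (gs.scU N _).ch 0 1 r
  have kP : ∀ᶠ N in atTop, n2 0 1 (P N (t-a) r) ≤ K' := Eventually.of_forall fun N =>
    (n2_mono_int ha0.1 zero_le_one hb0.1 ((gs.scP N _).bm r α β)).trans (gs.kP N _ hta')
  have kU : ∀ᶠ N in atTop, n2 0 1 (U N (t-a) r) ≤ K' := Eventually.of_forall fun N =>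
    (n2_mono_int ha0.1 zero_le_one hb0.1 ((gs.scU N _).bm r α β)).trans (gs.kU N _ hta')
  have cP : ∀ j < r, ∀ e ∈ Icc (0:ℝ) 1, ∀ δ > 0, ∀ᶠ N in atTop, |P N (t-a) j e - p t j e| < δ := fun j hj e he δ hδ =>
    (conv_sup zero_lt_one chP (sol.chp t ht) tp kP hj hδ).mono fun N h => h e he
  have cU : ∀ j < r, ∀ e ∈ Icc (0:ℝ) 1, ∀ δ > 0, ∀ᶠ N in atTop, |U N (t-a) j e - u t j e| < δ := fun j hj e he δ hδ =>
    (conv_sup zero_lt_one chU (sol.chu t ht) tu kU hj hδ).mono fun N h => h e he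
  have nd : ∀ e ∈ Icc (0:ℝ) 1, (e = α ∨ e = β) → ND r (p t) (u t) e := by
    intro e he h
    constructor
    · intro j hj ho
      refine zero_of_lim (f := fun N => P N (t-a) j e) (ε := fun _ => 0) tendsto_const_nhds (fun N => ?_) (cP j hj e he)
      have := gs.pe N (t-a) r j hj ho
      rcases h with h | h <;> rw [h]
      · rw [this.1]; simp
      · rw [this.2]; simp
    · intro j hj ho
      refine zero_of_lim (f := fun N => U N (t-a) j e) (ε := fun _ => 0) tendsto_const_nhds (fun N => ?_) (cU j hj e he)
      have := gs.po N (t-a) r j hj ho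
      rcases h with h | h <;> rw [h]
      · rw [this.1]; simp
      · rw [this.2]; simp
  refine ⟨⟨?_, ?_⟩, lsc (by omega) chP (sol.chp t ht) tp kP, lsc (by omega) chU (sol.chu t ht) tu kU⟩
  · rcases hL with h | h
    · left
      exact zero_of_lim t0 (fun N => (s0 N _ hta').2 h.2) (cP 0 (by omega) 0 h01)
    · right; exact nd 0 h01 (Or.inl h.1.symm)
  · rcases hR with h | h
    · left
      exact zero_of_lim t1 (fun N => (s1 N _ hta').2 h.2) (cP 0 (by omega) 1 h11)
    · right; exact nd 1 h11 (Or.inr h.1.symm)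

theorem local_thm (r : ℕ) (hr : 2 ≤ r) (K : ℝ) : ∃ c > 0, ∀ (T B : ℝ) (p u p1 u1 : ℝ → ℕ → ℝ → ℝ),
    Sol T B r p u p1 u1 → ∀ a ∈ Icc 0 T, Adm r (p a) (u a) →
    (∀ j ≤ 2, n2 0 1 (p a j) ≤ K ∧ n2 0 1 (u a j) ≤ K) →
    ∃ K', ∀ t ∈ Icc 0 T, |t - a| ≤ c → Adm r (p t) (u t) ∧ n2 0 1 (p t r) ≤ K' ∧ n2 0 1 (u t r) ≤ K' := by
  obtain ⟨c1, h1, H1⟩ := local_aux (α := -1) (β := 2) (Or.inl rfl) (Or.inl rfl) r hr K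
  obtain ⟨c2, h2, H2⟩ := local_aux (α := -1) (β := 1) (Or.inl rfl) (Or.inr rfl) r hr K
  obtain ⟨c3, h3, H3⟩ := local_aux (α := 0) (β := 2) (Or.inr rfl) (Or.inl rfl) r hr K
  obtain ⟨c4, h4, H4⟩ := local_aux (α := 0) (β := 1) (Or.inr rfl) (Or.inr rfl) r hr K
  refine ⟨min (min c1 c2) (min c3 c4), by simp [h1, h2, h3, h4], fun T B p u p1 u1 sol a ha hadm hK => ?_⟩
  have g : ∀ c, min (min c1 c2) (min c3 c4) ≤ c → (∃ K', ∀ t ∈ Icc 0 T, |t - a| ≤ c → Adm r (p t) (u t) ∧ n2 0 1 (p t r) ≤ K' ∧ n2 0 1 (u t r) ≤ K') →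
      ∃ K', ∀ t ∈ Icc 0 T, |t - a| ≤ min (min c1 c2) (min c3 c4) → Adm r (p t) (u t) ∧ n2 0 1 (p t r) ≤ K' ∧ n2 0 1 (u t r) ≤ K' :=
    fun c hc ⟨K', h⟩ => ⟨K', fun t ht hta => h t ht (hta.trans hc)⟩
  rcases hadm.1 with hL | hL <;> rcases hadm.2 with hR | hR
  · exact g c1 (by simp) (H1 T B p u p1 u1 sol a ha (Or.inl ⟨rfl, hL⟩) (Or.inl ⟨rfl, hR⟩) hK)
  · exact g c2 (by simp) (H2 T B p u p1 u1 sol a ha (Or.inl ⟨rfl, hL⟩) (Or.inr ⟨rfl, hR⟩) hK)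
  · exact g c3 (by simp) (H3 T B p u p1 u1 sol a ha (Or.inr ⟨rfl, hL⟩) (Or.inl ⟨rfl, hR⟩) hK)
  · exact g c4 (by simp) (H4 T B p u p1 u1 sol a ha (Or.inr ⟨rfl, hL⟩) (Or.inr ⟨rfl, hR⟩) hK)

theorem Ch.uniq {a b : ℝ} (hab : a < b) {r : ℕ} {F G : ℕ → ℝ → ℝ} (hF : Ch a b r F) (hG : Ch a b r G)
    (h : ∀ x ∈ Icc a b, F 0 x = G 0 x) : ∀ j ≤ r, ∀ x ∈ Icc a b, F j x = G j x := by
  intro j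
  induction j with
  | zero => intro _; exact h
  | succ j ih =>
    intro hj x hx
    have h1 := hF.1 j (by omega) x hx
    have h2 := (hG.1 j (by omega) x hx).congr (fun y hy => ih (by omega) y hy) (ih (by omega) x hx)
    exact (uniqueDiffOn_Icc hab x hx).eq_deriv _ h1 h2

theorem loc_bdd {T : ℝ} {f : ℝ → ℝ} (h : ∀ a ∈ Icc 0 T, ∃ c > 0, ∃ K, ∀ t ∈ Icc 0 T, |t - a| ≤ c → f t ≤ K) :
    ∃ K, ∀ t ∈ Icc 0 T, f t ≤ K := by
  refine isCompact_Icc.induction_on (p := fun s => ∃ K, ∀ t ∈ s, f t ≤ K) ⟨0, by simp⟩ ?_ ?_ ?_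
  · rintro s t hst ⟨K, hK⟩
    exact ⟨K, fun x hx => hK x (hst hx)⟩
  · rintro s t ⟨K, hK⟩ ⟨K', hK'⟩
    exact ⟨max K K', fun x hx => hx.elim (fun h => (hK x h).trans (le_max_left _ _)) (fun h => (hK' x h).trans (le_max_right _ _))⟩
  · intro a ha
    obtain ⟨c, hc, K, hK⟩ := h a ha
    refine ⟨Icc 0 T ∩ Metric.closedBall a c, inter_mem_nhdsWithin _ (Metric.closedBall_mem_nhds a hc), K, fun t ht => hK t ht.1 ?_⟩
    simpa [Real.dist_eq] using ht.2

theorem n2_lip {B : ℝ} {q : ℝ → ℕ → ℝ → ℝ} {S : Set ℝ} (hc : ∀ t ∈ S, ContinuousOn (q t 0) (Icc 0 1))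
    (hl : ∀ t ∈ S, ∀ s ∈ S, ∀ x ∈ Icc (0:ℝ) 1, |q t 0 x - q s 0 x| ≤ B * |t - s|) {t s : ℝ} (ht : t ∈ S) (hs : s ∈ S) :
    n2 0 1 (fun x => q t 0 x - q s 0 x) ≤ B * |t - s| := by
  have := n2_le_sup zero_le_one ((BM.of_cont (hc t ht)).sub (BM.of_cont (hc s hs))) (hl t ht s hs)
  simpa using this

theorem n2_lip_tend {B : ℝ} {q : ℝ → ℕ → ℝ → ℝ} {S : Set ℝ} (hc : ∀ t ∈ S, ContinuousOn (q t 0) (Icc 0 1))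
    (hl : ∀ t ∈ S, ∀ s ∈ S, ∀ x ∈ Icc (0:ℝ) 1, |q t 0 x - q s 0 x| ≤ B * |t - s|) {ι : Type*} {L : Filter ι} {τ : ι → ℝ}
    (hτ : ∀ k, τ k ∈ S) {t : ℝ} (ht : t ∈ S) (h : Tendsto τ L (𝓝 t)) :
    Tendsto (fun k => n2 0 1 (fun x => q (τ k) 0 x - q t 0 x)) L (𝓝 0) := by
  refine squeeze_zero (fun k => n2_nonneg _ _ _) (fun k => n2_lip hc hl (hτ k) ht) ?_
  have h1 : Tendsto (fun k => τ k - t) L (𝓝 0) := by simpa using h.sub_const t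
  simpa using h1.abs.const_mul B

theorem closed_n2 {B T K : ℝ} {r : ℕ} (hr : 1 ≤ r) {q : ℝ → ℕ → ℝ → ℝ} (hc : ∀ t ∈ Icc 0 T, Ch 0 1 r (q t))
    (hl : ∀ t ∈ Icc 0 T, ∀ s ∈ Icc 0 T, ∀ x ∈ Icc (0:ℝ) 1, |q t 0 x - q s 0 x| ≤ B * |t - s|) :
    IsClosed {t : Icc 0 T | n2 0 1 (q t r) ≤ K} := by
  apply IsSeqClosed.isClosed
  intro τ t hτ hlim
  refine lsc (L := atTop) hr (f := fun k => q (τ k)) (F := q t) (fun k => hc _ (τ k).2) (hc _ t.2) ?_ (Eventually.of_forall hτ)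
  exact n2_lip_tend (fun t ht => (hc t ht).cont (by omega)) hl (fun k => (τ k).2) t.2 ((continuous_subtype_val.tendsto t).comp hlim)

theorem commut {c d B K : ℝ} (hcd : c < d) {r : ℕ} {q q1 : ℝ → ℕ → ℝ → ℝ} (hq : ∀ t ∈ Icc c d, Ch 0 1 r (q t))
    (hq1 : ∀ t ∈ Icc c d, Ch 0 1 r (q1 t))
    (hd : ∀ t ∈ Icc c d, ∀ x ∈ Icc (0:ℝ) 1, HasDerivWithinAt (fun t => q t 0 x) (q1 t 0 x) (Icc c d) t)
    (hb : ∀ t ∈ Icc c d, ∀ x ∈ Icc (0:ℝ) 1, |q1 t 0 x| ≤ B)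
    (hl : ∀ t ∈ Icc c d, ∀ s ∈ Icc c d, ∀ x ∈ Icc (0:ℝ) 1, |q1 t 0 x - q1 s 0 x| ≤ B * |t - s|)
    (hK : ∀ t ∈ Icc c d, n2 0 1 (q1 t r) ≤ K) :
    ∀ j < r, ∀ t ∈ Icc c d, ∀ x ∈ Icc (0:ℝ) 1, HasDerivWithinAt (fun t => q t j x) (q1 t j x) (Icc c d) t := by
  obtain ⟨C, hC, hsob⟩ := sob r
  have hcont : ∀ j < r, ∀ x ∈ Icc (0:ℝ) 1, ContinuousOn (fun t => q1 t j x) (Icc c d) := by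
    intro j hj x hx
    rw [continuousOn_iff_continuous_restrict, continuous_iff_continuousAt]
    intro t
    rw [ContinuousAt, Metric.tendsto_nhds]
    intro ε hε
    have h1 := conv_sup (L := 𝓝 t) zero_lt_one (f := fun k : Icc c d => q1 k) (F := q1 t) (fun k => hq1 _ k.2) (hq1 _ t.2)
      (n2_lip_tend (fun t ht => (hq1 t ht).cont (by omega)) hl (fun k => k.2) t.2 (continuous_subtype_val.tendsto t))
      (Eventually.of_forall fun k => hK k k.2) hj hε
    filter_upwards [h1] with k hk
    rw [Real.dist_eq]
    exact hk x hx
  have hbd : ∀ j < r, ∀ t ∈ Icc c d, ∀ x ∈ Icc (0:ℝ) 1, |q1 t j x| ≤ C * (B + K) := by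
    intro j hj t ht x hx
    refine (hsob _ (hq1 t ht) j hj x hx).trans ?_
    have := n2_le_sup zero_le_one ((hq1 t ht).bm (by omega : 0 ≤ r)) (hb t ht)
    have h2 := hK t ht
    simp at this
    gcongr
  have main : ∀ j < r, ∀ t ∈ Icc c d, ∀ x ∈ Icc (0:ℝ) 1, q t j x - q c j x = ∫ s in c..t, q1 s j x := by
    intro j
    induction j with
    | zero =>
      intro hj t ht x hx
      have hs : Icc c t ⊆ Icc c d := Icc_subset_Icc le_rfl ht.2
      rw [ftc ht.1 (f := fun s => q s 0 x) (fun s hs' => (hd s (hs hs') x hx).mono hs) ((hcont 0 hj x hx).mono hs)]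
    | succ j ih =>
      intro hj t ht x hx
      have hs : Icc c t ⊆ Icc c d := Icc_subset_Icc le_rfl ht.2
      have h1 := ((hq t ht).1 j (by omega) x hx).sub ((hq c ⟨le_rfl, hcd.le⟩).1 j (by omega) x hx)
      have h2 := ddint (c := 0) (d := 1) (B := C * (B + K)) ht.1 (f := fun y s => q1 s j y) (f' := fun y s => q1 s (j+1) y)
        (fun y hy s hs' => (hq1 s (hs hs')).1 j (by omega) y hy)
        (fun y hy => (hcont j (by omega) y hy).mono hs)
        (fun y hy s hs' => hbd (j+1) hj s (hs hs') y hy) hx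
      have h3 := h2.congr (f₁ := fun y => q t j y - q c j y) (fun y hy => ih (by omega) t ht y hy) (ih (by omega) t ht x hx)
      exact (uniqueDiffOn_Icc zero_lt_one x hx).eq_deriv _ h1 h3
  intro j hj t ht x hx
  have h1 : HasDerivWithinAt (fun t => q c j x + ∫ s in c..t, q1 s j x) (q1 t j x) (Icc c d) t := by
    refine HasDerivWithinAt.const_add _ ?_
    haveI : Fact (t ∈ Icc c d) := ⟨ht⟩
    refine intervalIntegral.integral_hasDerivWithinAt_right ?_ ?_ (hcont j hj x hx t ht)
    · exact (((hcont j hj x hx).mono (Icc_subset_Icc le_rfl ht.2)).mono (by rw [uIcc_of_le ht.1])).intervalIntegrable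
    · exact (hcont j hj x hx).stronglyMeasurableAtFilter_nhdsWithin measurableSet_Icc t
  refine h1.congr (fun s hs => ?_) ?_
  · linarith [main j hj s hs x hx]
  · linarith [main j hj t ht x hx]

theorem F2_odd {p u : ℕ → ℝ → ℝ} {e : ℝ} {s : ℕ} (hs : Odd s) (hp : ∀ j < s, Odd j → p j e = 0) (hu : ∀ j < s, Even j → u j e = 0) :
    F2 p u s e = 1/2 * (p 0 e * p s e) := by
  have hs0 : s ≠ 0 := by rintro rfl; simp at hs
  have h1 : LB u u s e = 0 := by
    unfold LB
    apply Finset.sum_eq_zero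
    rintro ⟨i, j⟩ hij
    have hij' : i + j = s := Finset.HasAntidiagonal.mem_antidiagonal.1 hij
    rcases Nat.even_or_odd i with hi | hi
    · rw [hu i (by rcases Nat.lt_or_ge i s with h | h; exact h; exfalso; have : i = s := by omega
                   rw [this] at hi; exact (Nat.not_even_iff_odd.2 hs) hi) hi]; simp
    · have hj : Even j := by
        rcases Nat.even_or_odd j with hj | hj
        · exact hj
        · exfalso; rw [← hij'] at hs; exact (Nat.not_even_iff_odd.2 hs) (hi.add_odd hj)
      rw [hu j (by have := hi.pos; omega) hj]; simp
  have h2 : LB p p s e = 2 * (p 0 e * p s e) := by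
    unfold LB
    rw [Finset.sum_eq_add_of_mem (0, s) (s, 0) (by simp) (by simp) (by simp; omega)]
    · simp; ring
    · rintro ⟨i, j⟩ hij hne
      have hij' : i + j = s := Finset.HasAntidiagonal.mem_antidiagonal.1 hij
      have hi0 : i ≠ 0 := by rintro rfl; apply hne.1; simp at hij' ⊢; exact hij'
      have hj0 : j ≠ 0 := by rintro rfl; apply hne.2; simp at hij' ⊢; exact hij'
      rcases Nat.even_or_odd i with hi | hi
      · have hj : Odd j := by
          rcases Nat.even_or_odd j with hj | hj
          · exfalso; rw [← hij'] at hs; exact (Nat.not_even_iff_odd.2 hs) (hi.add hj)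
          · exact hj
        simp only; rw [hp j (by omega) hj]; simp
      · simp only; rw [hp i (by omega) hi]; simp
  unfold F2
  rw [h1, h2]; ring

theorem F1_even {p u : ℕ → ℝ → ℝ} {e : ℝ} {s : ℕ} (hs : Even s) (hp : ∀ j < s, Odd j → p j e = 0) (hu : ∀ j < s, Even j → u j e = 0) :
    F1 p u s e = 1/2 * (p 0 e * u s e) := by
  have h2 : LB p u s e = p 0 e * u s e := by
    unfold LB
    rw [Finset.sum_eq_single_of_mem (0, s) (by simp)]
    · simp
    · rintro ⟨i, j⟩ hij hne
      have hij' : i + j = s := Finset.HasAntidiagonal.mem_antidiagonal.1 hij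
      have hi0 : i ≠ 0 := by rintro rfl; apply hne; simp at hij' ⊢; exact hij'
      rcases Nat.even_or_odd i with hi | hi
      · have hj : Even j := by
          rcases Nat.even_or_odd j with hj | hj
          · exact hj
          · exfalso; rw [← hij'] at hs; exact (Nat.not_even_iff_odd.2 (hi.add_odd hj)) hs
        simp only; rw [hu j (by omega) hj]; simp
      · have : i ≠ s := by rintro rfl; exact (Nat.not_even_iff_odd.2 hi) hs
        simp only; rw [hp i (by omega) hi]; simp
  unfold F1
  rw [h2]

structure Sol2 (T B : ℝ) (r : ℕ) (p u p1 u1 : ℝ → ℕ → ℝ → ℝ) : Prop extends Sol T B r p u p1 u1 where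
  chp1 : ∀ t ∈ Icc 0 T, Ch 0 1 r (p1 t)
  chu1 : ∀ t ∈ Icc 0 T, Ch 0 1 r (u1 t)
  lp1 : ∀ t ∈ Icc 0 T, ∀ s ∈ Icc 0 T, ∀ x ∈ Icc (0:ℝ) 1, |p1 t 0 x - p1 s 0 x| ≤ B * |t - s|
  lu1 : ∀ t ∈ Icc 0 T, ∀ s ∈ Icc 0 T, ∀ x ∈ Icc (0:ℝ) 1, |u1 t 0 x - u1 s 0 x| ≤ B * |t - s|

theorem lip_of_deriv {T B : ℝ} {f f' : ℝ → ℝ} (hd : ∀ t ∈ Icc 0 T, HasDerivWithinAt f (f' t) (Icc 0 T) t) (hb : ∀ t ∈ Icc 0 T, |f' t| ≤ B)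
    {t s : ℝ} (ht : t ∈ Icc 0 T) (hs : s ∈ Icc 0 T) : |f t - f s| ≤ B * |t - s| := by
  have := (convex_Icc 0 T).norm_image_sub_le_of_norm_hasDerivWithin_le hd (fun t ht => by simpa using hb t ht) hs ht
  simpa using this

section SolSec
variable {T B : ℝ} {r : ℕ} {p u p1 u1 : ℝ → ℕ → ℝ → ℝ}

theorem Sol.lp (s : Sol T B r p u p1 u1) : ∀ t ∈ Icc 0 T, ∀ s ∈ Icc 0 T, ∀ x ∈ Icc (0:ℝ) 1, |p t 0 x - p s 0 x| ≤ B * |t - s| :=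
  fun t ht t' ht' x hx => lip_of_deriv (f := fun t => p t 0 x) (fun t ht => s.dp t ht x hx) (fun t ht => (s.bd t ht x hx).2.2.1) ht ht'

theorem Sol.lu (s : Sol T B r p u p1 u1) : ∀ t ∈ Icc 0 T, ∀ s ∈ Icc 0 T, ∀ x ∈ Icc (0:ℝ) 1, |u t 0 x - u s 0 x| ≤ B * |t - s| :=
  fun t ht t' ht' x hx => lip_of_deriv (f := fun t => u t 0 x) (fun t ht => s.du t ht x hx) (fun t ht => (s.bd t ht x hx).2.2.2) ht ht'

theorem F1_ch {p u : ℕ → ℝ → ℝ} {r : ℕ} (hp : Ch 0 1 r p) (hu : Ch 0 1 r u) : Ch 0 1 r (F1 p u) := (hp.mul hu).cmul (1/2)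
theorem F2_ch {p u : ℕ → ℝ → ℝ} {r : ℕ} (hp : Ch 0 1 r p) (hu : Ch 0 1 r u) : Ch 0 1 r (F2 p u) := ((hp.mul hp).cmul (1/4)).add ((hu.mul hu).cmul (3/4))

theorem Ch.shift1 {F : ℕ → ℝ → ℝ} {a b : ℝ} {r : ℕ} (h : Ch a b r F) (hr : 1 ≤ r) : Ch a b (r-1) (fun j => F (j+1)) :=
  ⟨fun i hi x hx => h.1 (i+1) (by omega) x hx, by have := h.2; show ContinuousOn (F (r - 1 + 1)) _; rwa [show r - 1 + 1 = r by omega]⟩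

theorem Sol2.p1eq (s : Sol2 T B r p u p1 u1) (hr : 1 ≤ r) {t : ℝ} (ht : t ∈ Icc 0 T) : ∀ j < r, ∀ x ∈ Icc (0:ℝ) 1, p1 t j x = -F1 (p t) (u t) (j+1) x := by
  intro j hj x hx
  have := Ch.uniq zero_lt_one ((s.chp1 t ht).le (by omega : r - 1 ≤ r)) (((F1_ch (s.chp t ht) (s.chu t ht)).shift1 hr).cmul (-1))
    (fun x hx => by rw [s.eqp t ht x hx]; ring) j (by omega) x hx
  rw [this]; ring

theorem Sol2.u1eq (s : Sol2 T B r p u p1 u1) (hr : 1 ≤ r) {t : ℝ} (ht : t ∈ Icc 0 T) : ∀ j < r, ∀ x ∈ Icc (0:ℝ) 1, u1 t j x = -F2 (p t) (u t) (j+1) x := by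
  intro j hj x hx
  have := Ch.uniq zero_lt_one ((s.chu1 t ht).le (by omega : r - 1 ≤ r)) (((F2_ch (s.chp t ht) (s.chu t ht)).shift1 hr).cmul (-1))
    (fun x hx => by rw [s.equ t ht x hx]; ring) j (by omega) x hx
  rw [this]; ring

theorem zero_deriv {c d : ℝ} (hcd : c < d) {f : ℝ → ℝ} {y t : ℝ} (h : HasDerivWithinAt f y (Icc c d) t) (ht : t ∈ Icc c d) (hz : ∀ s ∈ Icc c d, f s = 0) : y = 0 :=
  (uniqueDiffOn_Icc hcd t ht).eq_deriv _ h ((hasDerivWithinAt_const t (Icc c d) (0:ℝ)).congr hz (hz t ht))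

theorem nd_interval (s : Sol2 T B r p u p1 u1) (hr : 1 ≤ r) {c d K : ℝ} (hcd : c < d) (hsub : Icc c d ⊆ Icc 0 T)
    (hK : ∀ t ∈ Icc c d, n2 0 1 (p1 t r) ≤ K ∧ n2 0 1 (u1 t r) ≤ K) {e : ℝ} (he : e ∈ Icc (0:ℝ) 1) (hbc : ∀ t ∈ Icc 0 T, u t 0 e = 0)
    (hne : ∀ t ∈ Icc c d, p t 0 e ≠ 0) : ∀ t ∈ Icc c d, ND r (p t) (u t) e := by
  have cp := commut hcd (q := p) (q1 := p1) (fun t ht => s.chp t (hsub ht)) (fun t ht => s.chp1 t (hsub ht)) (fun t ht x hx => (s.dp t (hsub ht) x hx).mono hsub)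
    (fun t ht x hx => (s.bd t (hsub ht) x hx).2.2.1) (fun t ht s' hs' => s.lp1 t (hsub ht) s' (hsub hs')) (fun t ht => (hK t ht).1)
  have cu := commut hcd (q := u) (q1 := u1) (fun t ht => s.chu t (hsub ht)) (fun t ht => s.chu1 t (hsub ht)) (fun t ht x hx => (s.du t (hsub ht) x hx).mono hsub)
    (fun t ht x hx => (s.bd t (hsub ht) x hx).2.2.2) (fun t ht s' hs' => s.lu1 t (hsub ht) s' (hsub hs')) (fun t ht => (hK t ht).2)
  have main : ∀ j < r, ∀ t ∈ Icc c d, (Odd j → p t j e = 0) ∧ (Even j → u t j e = 0) := by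
    intro j
    induction j using Nat.strong_induction_on with
    | _ j ih =>
      intro hj t ht
      have hp : ∀ i < j, Odd i → p t i e = 0 := fun i hi => (ih i hi (by omega) t ht).1
      have hu : ∀ i < j, Even i → u t i e = 0 := fun i hi => (ih i hi (by omega) t ht).2
      constructor
      · intro ho
        obtain ⟨m, rfl⟩ : ∃ m, j = m + 1 := ⟨j - 1, by have := ho.pos; omega⟩
        have hm : Even m := by rcases Nat.even_or_odd m with h | h; exact h; exact absurd (h.add_one) (Nat.not_even_iff_odd.2 ho)
        have h1 := zero_deriv hcd (cu m (by omega) t ht e he) ht (fun s hs => (ih m (by omega) (by omega) s hs).2 hm)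
        rw [s.u1eq hr (hsub ht) m (by omega) e he, F2_odd ho hp hu] at h1
        have := hne t ht
        have h2 : p t 0 e * p t (m+1) e = 0 := by linarith
        exact (mul_eq_zero.1 h2).resolve_left this
      · intro hev
        rcases Nat.eq_zero_or_pos j with h0 | h0
        · rw [h0]; exact hbc t (hsub ht)
        obtain ⟨m, rfl⟩ : ∃ m, j = m + 1 := ⟨j - 1, by omega⟩
        have hm : Odd m := by rcases Nat.even_or_odd m with h | h; exact absurd hev (Nat.not_even_iff_odd.2 h.add_one); exact h
        have h1 := zero_deriv hcd (cp m (by omega) t ht e he) ht (fun s hs => (ih m (by omega) (by omega) s hs).1 hm)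
        rw [s.p1eq hr (hsub ht) m (by omega) e he, F1_even hev hp hu] at h1
        have := hne t ht
        have h2 : p t 0 e * u t (m+1) e = 0 := by linarith
        exact (mul_eq_zero.1 h2).resolve_left this
  exact fun t ht => ⟨fun j hj => (main j hj t ht).1, fun j hj => (main j hj t ht).2⟩

theorem sub_int {T t δ : ℝ} (hT : 0 < T) (ht : t ∈ Icc 0 T) (hδ : 0 < δ) : ∃ c d, c < d ∧ t ∈ Icc c d ∧ Icc c d ⊆ Icc 0 T ∧ ∀ s ∈ Icc c d, |s - t| < δ := by
  refine ⟨max 0 (t - δ/2), min T (t + δ/2), ?_, ⟨?_, ?_⟩, Icc_subset_Icc (le_max_left _ _) (min_le_left _ _), fun s hs => ?_⟩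
  · rw [max_lt_iff, lt_min_iff, lt_min_iff]
    exact ⟨⟨hT, by linarith [ht.1]⟩, by linarith [ht.2], by linarith⟩
  · exact max_le ht.1 (by linarith)
  · exact le_min ht.2 (by linarith)
  · have h1 := (le_max_right 0 (t - δ/2)).trans hs.1
    have h2 := hs.2.trans (min_le_right _ _)
    rw [abs_lt]; constructor <;> linarith

theorem nd_local (s : Sol2 T B r p u p1 u1) (hT : 0 < T) (hr : 1 ≤ r) {t δ K : ℝ} (ht : t ∈ Icc 0 T) (hδ : 0 < δ)
    (hK : ∀ s ∈ Icc 0 T, |s - t| < δ → n2 0 1 (p1 s r) ≤ K ∧ n2 0 1 (u1 s r) ≤ K) {e : ℝ} (he : e ∈ Icc (0:ℝ) 1) (hbc : ∀ t ∈ Icc 0 T, u t 0 e = 0)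
    : p t 0 e = 0 ∨ ND r (p t) (u t) e := by
  by_cases h0 : p t 0 e = 0
  · exact Or.inl h0
  right
  have hc : ContinuousWithinAt (fun s => p s 0 e) (Icc 0 T) t := (s.dp t ht e he).continuousWithinAt
  have hc2 := hc.eventually_ne h0
  obtain ⟨δ', hδ', h'⟩ := Metric.mem_nhdsWithin_iff.1 hc2
  obtain ⟨c, d, hcd, htc, hsub, hs⟩ := sub_int hT ht (lt_min hδ hδ')
  refine nd_interval s hr hcd hsub (fun s' hs' => hK s' (hsub hs') ((hs s' hs').trans_le (min_le_left _ _))) he hbc (fun s' hs' => ?_) t htc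
  exact h' ⟨by simpa [Real.dist_eq] using (hs s' hs').trans_le (min_le_right _ _), hsub hs'⟩

theorem adm_dense (s : Sol2 T B r p u p1 u1) (hT : 0 < T) (hr : 1 ≤ r) {a c : ℝ} (ha : a ∈ Icc 0 T) (hc : 0 < c) :
    ∃ t ∈ Icc 0 T, |t - a| < c ∧ Adm r (p t) (u t) := by
  haveI : Nonempty (Icc 0 T) := ⟨⟨a, ha⟩⟩
  have hd := dense_iUnion_interior_of_closed (X := Icc 0 T) (f := fun n : ℕ => {t : Icc 0 T | n2 0 1 (p1 t r) ≤ n} ∩ {t : Icc 0 T | n2 0 1 (u1 t r) ≤ n})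
    (fun n => (closed_n2 hr s.chp1 s.lp1).inter (closed_n2 hr s.chu1 s.lu1)) (by
      ext t
      simp only [mem_iUnion, mem_univ, iff_true, mem_inter_iff, mem_setOf_eq]
      obtain ⟨n, hn⟩ := exists_nat_ge (max (n2 0 1 (p1 t r)) (n2 0 1 (u1 t r)))
      exact ⟨n, (le_max_left _ _).trans hn, (le_max_right _ _).trans hn⟩)
  obtain ⟨t, htU, hta⟩ := hd.exists_dist_lt ⟨a, ha⟩ hc
  obtain ⟨n, hn⟩ := mem_iUnion.1 htU
  obtain ⟨δ, hδ, hb⟩ := Metric.mem_nhds_iff.1 (mem_interior_iff_mem_nhds.1 hn)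
  have hK : ∀ s ∈ Icc 0 T, |s - t| < δ → n2 0 1 (p1 s r) ≤ n ∧ n2 0 1 (u1 s r) ≤ n := fun s' hs' h => by
    have : (⟨s', hs'⟩ : Icc 0 T) ∈ Metric.ball t δ := by simpa [Subtype.dist_eq, Real.dist_eq] using h
    exact hb this
  refine ⟨t, t.2, ?_, nd_local s hT hr t.2 hδ hK (by simp) (fun t ht => (s.bc t ht).1), nd_local s hT hr t.2 hδ hK (by simp) (fun t ht => (s.bc t ht).2)⟩
  rw [abs_sub_comm]; simpa [Subtype.dist_eq, Real.dist_eq] using hta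

theorem adm_two (s : Sol T B r p u p1 u1) (hT : 0 < T) {t : ℝ} (ht : t ∈ Icc 0 T) : Adm 2 (p t) (u t) := by
  have key : ∀ e ∈ Icc (0:ℝ) 1, (∀ t ∈ Icc 0 T, u t 0 e = 0) → (p t 0 e = 0 ∨ ND 2 (p t) (u t) e) := by
    intro e he hbc
    have h1 := zero_deriv hT (s.du t ht e he) ht hbc
    rw [s.equ t ht e he, F2_one, hbc t ht] at h1
    have h2 : p t 0 e * p t 1 e = 0 := by linarith
    rcases mul_eq_zero.1 h2 with h | h
    · exact Or.inl h
    · right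
      constructor
      · intro j hj ho
        interval_cases j
        · simp at ho
        · exact h
      · intro j hj ho
        interval_cases j
        · exact hbc t ht
        · simp at ho
  exact ⟨key 0 (by simp) fun t ht => (s.bc t ht).1, key 1 (by simp) fun t ht => (s.bc t ht).2⟩

theorem h2_global (s : Sol T B 2 p u p1 u1) (hT : 0 < T) : ∃ K, ∀ t ∈ Icc 0 T, n2 0 1 (p t 2) + n2 0 1 (u t 2) ≤ K := by
  apply loc_bdd
  intro a ha
  obtain ⟨K, hK⟩ : ∃ K, ∀ j ≤ 2, n2 0 1 (p a j) ≤ K ∧ n2 0 1 (u a j) ≤ K := by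
    refine ⟨∑ j ∈ Finset.range 3, (n2 0 1 (p a j) + n2 0 1 (u a j)), fun j hj => ?_⟩
    have := Finset.single_le_sum (f := fun j => n2 0 1 (p a j) + n2 0 1 (u a j)) (fun j _ => add_nonneg (n2_nonneg _ _ _) (n2_nonneg _ _ _)) (Finset.mem_range.2 (by omega : j < 3))
    constructor <;> linarith [n2_nonneg 0 1 (p a j), n2_nonneg 0 1 (u a j)]
  obtain ⟨c, hc, h⟩ := local_thm 2 le_rfl K
  obtain ⟨K', hK'⟩ := h T B p u p1 u1 s a ha (adm_two s hT ha) hK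
  exact ⟨c, hc, K' + K', fun t ht hta => add_le_add (hK' t ht hta).2.1 (hK' t ht hta).2.2⟩

theorem hr_global (hr : 2 ≤ r) (s : Sol2 T B r p u p1 u1) (hT : 0 < T) : ∃ K, ∀ t ∈ Icc 0 T, n2 0 1 (p t r) + n2 0 1 (u t r) ≤ K := by
  have s2 : Sol T B 2 p u p1 u1 := s.toSol.le hr
  obtain ⟨K2, hK2⟩ := h2_global s2 hT
  obtain ⟨C, hC, hsob⟩ := sob 2
  have hB : 0 ≤ B := (abs_nonneg _).trans (s.bd 0 ⟨le_rfl, hT.le⟩ 0 (by simp)).1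
  have hbp : ∀ t ∈ Icc 0 T, n2 0 1 (p t 0) ≤ B := fun t ht => by
    simpa using n2_le_sup zero_le_one ((s2.chp t ht).bm (by omega : 0 ≤ 2)) (fun x hx => (s.bd t ht x hx).1)
  have hbu : ∀ t ∈ Icc 0 T, n2 0 1 (u t 0) ≤ B := fun t ht => by
    simpa using n2_le_sup zero_le_one ((s2.chu t ht).bm (by omega : 0 ≤ 2)) (fun x hx => (s.bd t ht x hx).2.1)
  have hK20 : 0 ≤ K2 := (add_nonneg (n2_nonneg _ _ _) (n2_nonneg _ _ _)).trans (hK2 0 ⟨le_rfl, hT.le⟩)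
  have hall : ∀ t ∈ Icc 0 T, ∀ j ≤ 2, n2 0 1 (p t j) ≤ C * (B + K2) ∧ n2 0 1 (u t j) ≤ C * (B + K2) := by
    intro t ht j hj
    have h1 := hK2 t ht
    have h2 := n2_nonneg 0 1 (p t 2)
    have h3 := n2_nonneg 0 1 (u t 2)
    have h4 : B + K2 ≤ C * (B + K2) := le_mul_of_one_le_left (by linarith) hC
    rcases Nat.lt_or_ge j 2 with hj2 | hj2
    · constructor
      · have := n2_le_sup zero_le_one ((s2.chp t ht).bm hj) (hsob _ (s2.chp t ht) j hj2)
        simp at this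
        refine this.trans ?_
        gcongr
        · exact hbp t ht
        · linarith
      · have := n2_le_sup zero_le_one ((s2.chu t ht).bm hj) (hsob _ (s2.chu t ht) j hj2)
        simp at this
        refine this.trans ?_
        gcongr
        · exact hbu t ht
        · linarith
    · have : j = 2 := by omega
      subst this
      constructor <;> linarith
  obtain ⟨c, hc, h⟩ := local_thm r hr (C * (B + K2))
  apply loc_bdd
  intro a ha
  obtain ⟨t0, ht0, hta, hadm⟩ := adm_dense s hT (by omega) ha (half_pos hc)
  obtain ⟨K', hK'⟩ := h T B p u p1 u1 s.toSol t0 ht0 hadm (hall t0 ht0)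
  refine ⟨c/2, half_pos hc, K' + K', fun t ht h => ?_⟩
  have h5 : |t - t0| ≤ c := by
    have := abs_sub_le t a t0
    rw [abs_sub_comm a t0] at this
    linarith
  exact add_le_add (hK' t ht h5).2.1 (hK' t ht h5).2.2

end SolSec

structure Msh (N : ℕ) (x : ℕ → ℝ) (h : ℝ) : Prop where
  p : IsPartition N x
  m : IsMeshSize N x h

section MshSec
variable {N : ℕ} {x : ℕ → ℝ} {h : ℝ}

theorem Msh.mono (H : Msh N x h) {i j : ℕ} (hij : i ≤ j) (hj : j ≤ N) : x i ≤ x j := by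
  induction j, hij using Nat.le_induction with
  | base => exact le_rfl
  | succ j hij ih => exact (ih (by omega)).trans (H.p.2.2 j (by omega)).le

theorem Msh.mem (H : Msh N x h) {i : ℕ} (hi : i ≤ N) : x i ∈ Icc (0:ℝ) 1 := by
  have h1 := H.mono (Nat.zero_le i) hi
  have h2 := H.mono hi le_rfl
  rw [H.p.1] at h1
  rw [H.p.2.1] at h2
  exact ⟨h1, h2⟩

theorem Msh.lt (H : Msh N x h) {i : ℕ} (hi : i < N) : x i < x (i+1) := H.p.2.2 i hi

theorem Msh.len (H : Msh N x h) {i : ℕ} (hi : i < N) : x (i+1) - x i ≤ h := H.m.1 i hi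

theorem Msh.hpos (H : Msh N x h) : 0 < h := by
  obtain ⟨i, hi, hh⟩ := H.m.2
  rw [← hh]; linarith [H.lt hi]

theorem Msh.hle (H : Msh N x h) : h ≤ 1 := by
  obtain ⟨i, hi, hh⟩ := H.m.2
  rw [← hh]; linarith [(H.mem (by omega : i ≤ N)).1, (H.mem (by omega : i + 1 ≤ N)).2]

theorem Msh.sub (H : Msh N x h) {i : ℕ} (hi : i < N) : Icc (x i) (x (i+1)) ⊆ Icc (0:ℝ) 1 :=
  Icc_subset_Icc (H.mem (by omega)).1 (H.mem (by omega)).2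

theorem Msh.find (H : Msh N x h) {y : ℝ} (hy : y ∈ Icc (0:ℝ) 1) : ∃ j < N, y ∈ Icc (x j) (x (j+1)) := by
  have key : ∀ n ≤ N, y ≤ x n → y = 0 ∨ ∃ j < n, y ∈ Icc (x j) (x (j+1)) := by
    intro n
    induction n with
    | zero => intro _ h; left; rw [H.p.1] at h; exact le_antisymm h hy.1
    | succ n ih =>
      intro hn h
      rcases le_total y (x n) with h' | h'
      · rcases ih (by omega) h' with h0 | ⟨j, hj, hh⟩
        · exact Or.inl h0
        · exact Or.inr ⟨j, by omega, hh⟩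
      · exact Or.inr ⟨n, by omega, h', h⟩
  have hN : 0 < N := by obtain ⟨i, hi, _⟩ := H.m.2; omega
  rcases key N le_rfl (by rw [H.p.2.1]; exact hy.2) with h0 | h'
  · refine ⟨0, hN, ?_⟩
    rw [h0, H.p.1]
    exact ⟨le_rfl, (H.mem (by omega)).1⟩
  · exact h'

def nodes (N : ℕ) (x : ℕ → ℝ) : Set ℝ := x '' (Iic N)

theorem nodes_countable : (nodes N x).Countable := ((Set.to_countable _).image x)

theorem Msh.findo (H : Msh N x h) {y : ℝ} (hy : y ∈ Icc (0:ℝ) 1) (hn : y ∉ nodes N x) : ∃ j < N, y ∈ Ioo (x j) (x (j+1)) := by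
  obtain ⟨j, hj, h1⟩ := H.find hy
  refine ⟨j, hj, lt_of_le_of_ne h1.1 ?_, lt_of_le_of_ne h1.2 ?_⟩
  · intro h; exact hn ⟨j, by simp; omega, h⟩
  · intro h; exact hn ⟨j+1, by simp; omega, h.symm⟩

theorem nodes_ae : ∀ᵐ y : ℝ, y ∉ nodes N x := by
  have := (nodes_countable (N := N) (x := x)).measure_zero volume
  exact (measure_eq_zero_iff_ae_notMem).1 this

theorem Msh.ae (H : Msh N x h) : ∀ᵐ y : ℝ, y ∈ Ioc (0:ℝ) 1 → ∃ j < N, y ∈ Ioo (x j) (x (j+1)) := by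
  filter_upwards [nodes_ae (N := N) (x := x)] with y hy h
  exact H.findo ⟨h.1.le, h.2⟩ hy

theorem Msh.bm (H : Msh N x h) {f : ℝ → ℝ} (hf : ∀ j < N, BM (x j) (x (j+1)) f) : BM 0 1 f := by
  have key : ∀ n ≤ N, BM 0 (x n) f := by
    intro n
    induction n with
    | zero => intro _; rw [H.p.1]; unfold BM; simp
    | succ n ih => intro hn; exact BM.union (H.mem (by omega)).1 (H.lt (by omega)).le (ih (by omega)) (hf n (by omega))
  have := key N le_rfl
  rwa [H.p.2.1] at this

theorem Msh.sumsq (H : Msh N x h) {f : ℝ → ℝ} (hf : BM 0 1 f) : n2 0 1 f ^ 2 = ∑ j ∈ Finset.range N, n2 (x j) (x (j+1)) f ^ 2 := by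
  rw [n2_sq zero_le_one, Finset.sum_congr rfl (fun j hj => n2_sq (H.lt (Finset.mem_range.1 hj)).le f),
    intervalIntegral.sum_integral_adjacent_intervals (f := fun y => f y ^ 2), H.p.1, H.p.2.1]
  intro j hj
  exact ((hf.mono (H.mem (by omega)).1 (H.mem (by omega)).2).sq).ii (H.lt hj).le

theorem Msh.comb (H : Msh N x h) {f g1 g2 : ℝ → ℝ} (hf : BM 0 1 f) (h1 : BM 0 1 g1) (h2 : BM 0 1 g2) {c d : ℝ} (hc : 0 ≤ c) (hd : 0 ≤ d)
    (hl : ∀ j < N, n2 (x j) (x (j+1)) f ≤ c * (n2 (x j) (x (j+1)) g1 + d * n2 (x j) (x (j+1)) g2)) :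
    n2 0 1 f ≤ 2 * c * (n2 0 1 g1 + d * n2 0 1 g2) := by
  have a1 := n2_nonneg 0 1 g1
  have a2 := n2_nonneg 0 1 g2
  refine abs_le_of_sq_le_sq' ?_ (by positivity) |>.2
  rw [H.sumsq hf]
  have : ∑ j ∈ Finset.range N, n2 (x j) (x (j+1)) f ^ 2 ≤ ∑ j ∈ Finset.range N, (2 * c^2 * n2 (x j) (x (j+1)) g1 ^ 2 + 2 * c^2 * d^2 * n2 (x j) (x (j+1)) g2 ^ 2) := by
    apply Finset.sum_le_sum
    intro j hj
    have b1 := n2_nonneg (x j) (x (j+1)) g1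
    have b2 := n2_nonneg (x j) (x (j+1)) g2
    refine (pow_le_pow_left₀ (n2_nonneg _ _ _) (hl j (Finset.mem_range.1 hj)) 2).trans ?_
    nlinarith [mul_nonneg (sq_nonneg c) (sq_nonneg (n2 (x j) (x (j+1)) g1 - d * n2 (x j) (x (j+1)) g2))]
  refine this.trans ?_
  rw [Finset.sum_add_distrib, ← Finset.mul_sum, ← Finset.mul_sum, ← H.sumsq h1, ← H.sumsq h2]
  have e : (0:ℝ) ≤ c^2 * (n2 0 1 g1 * (d * n2 0 1 g2)) := by positivity
  nlinarith [mul_nonneg (sq_nonneg c) (sq_nonneg (n2 0 1 g1)), mul_nonneg (sq_nonneg c) (sq_nonneg (d * n2 0 1 g2))]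

end MshSec

theorem poly_prim (p : Polynomial ℝ) : ∃ P : Polynomial ℝ, P.natDegree ≤ p.natDegree + 1 ∧ Polynomial.derivative P = p := by
  refine ⟨∑ i ∈ Finset.range (p.natDegree + 1), Polynomial.monomial (i+1) (p.coeff i / (i+1)), ?_, ?_⟩
  · apply Polynomial.natDegree_sum_le_of_forall_le
    intro i hi
    refine (Polynomial.natDegree_monomial_le _).trans ?_
    have := Finset.mem_range.1 hi; omega
  · rw [Polynomial.derivative_sum]
    conv_rhs => rw [Polynomial.as_sum_range p]
    apply Finset.sum_congr rfl
    intro i hi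
    rw [Polynomial.derivative_monomial]
    have : ((i:ℝ)+1) ≠ 0 := by positivity
    simp
    field_simp

/-- piecewise polynomials, maximal smoothness, possibly discontinuous for `r = 1` -/
def V (N r : ℕ) (x : ℕ → ℝ) : Set (ℝ → ℝ) :=
  {φ | (2 ≤ r → ContDiffOn ℝ ((r-2 : ℕ)) φ (Icc (0:ℝ) 1)) ∧
    ∀ j < N, ∃ p : Polynomial ℝ, p.natDegree ≤ r - 1 ∧ ∀ y ∈ Ioo (x j) (x (j+1)), φ y = p.eval y}

section VSec
variable {N r : ℕ} {x : ℕ → ℝ} {h : ℝ}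

theorem V.zero : (fun _ => (0:ℝ)) ∈ V N r x := ⟨fun _ => contDiffOn_const, fun j _ => ⟨0, by simp, by simp⟩⟩

theorem V.const (c : ℝ) : (fun _ => c) ∈ V N r x := ⟨fun _ => contDiffOn_const, fun j _ => ⟨Polynomial.C c, by simp, by simp⟩⟩

theorem V.add {f g : ℝ → ℝ} (hf : f ∈ V N r x) (hg : g ∈ V N r x) : (fun y => f y + g y) ∈ V N r x := by
  refine ⟨fun h => (hf.1 h).add (hg.1 h), fun j hj => ?_⟩
  obtain ⟨p, hp, h1⟩ := hf.2 j hj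
  obtain ⟨q, hq, h2⟩ := hg.2 j hj
  exact ⟨p + q, (Polynomial.natDegree_add_le _ _).trans (max_le hp hq), fun y hy => by beta_reduce; rw [h1 y hy, h2 y hy]; simp⟩

theorem V.cmul (c : ℝ) {f : ℝ → ℝ} (hf : f ∈ V N r x) : (fun y => c * f y) ∈ V N r x := by
  refine ⟨fun h => contDiffOn_const.mul (hf.1 h), fun j hj => ?_⟩
  obtain ⟨p, hp, h1⟩ := hf.2 j hj
  exact ⟨Polynomial.C c * p, (Polynomial.natDegree_C_mul_le _ _).trans hp, fun y hy => by beta_reduce; rw [h1 y hy]; simp⟩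

theorem V.bm (H : Msh N x h) {f : ℝ → ℝ} (hf : f ∈ V N r x) : BM 0 1 f := by
  apply H.bm
  intro j hj
  obtain ⟨p, hp, h1⟩ := hf.2 j hj
  exact (BM.of_cont p.continuous.continuousOn).congr_Ioo (fun y hy => (h1 y hy).symm)

theorem V.prim_deriv (H : Msh N x h) {f : ℝ → ℝ} (hf : f ∈ V N r x) {j : ℕ} (hj : j < N) {y : ℝ} (hy : y ∈ Ioo (x j) (x (j+1))) (c : ℝ) :
    HasDerivAt (fun z => c + ∫ s in (0:ℝ)..z, f s) (f y) y := by
  obtain ⟨p, hp, h1⟩ := hf.2 j hj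
  have hy1 : y ∈ Icc (0:ℝ) 1 := H.sub hj (Ioo_subset_Icc_self hy)
  have hbm := V.bm H hf
  have hne : Ioo (x j) (x (j+1)) ∈ 𝓝 y := Ioo_mem_nhds hy.1 hy.2
  refine HasDerivAt.const_add _ ?_
  refine intervalIntegral.integral_hasDerivAt_right ((hbm.mono le_rfl hy1.2).ii hy1.1) ?_ ?_
  · have hc : ContinuousOn f (Ioo (x j) (x (j+1))) := p.continuous.continuousOn.congr h1
    exact hc.stronglyMeasurableAtFilter isOpen_Ioo y hy
  · exact (p.continuous.continuousAt).congr (Filter.eventually_of_mem hne fun z hz => (h1 z hz).symm)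

theorem prim_cont {f : ℝ → ℝ} (hf : BM 0 1 f) (c : ℝ) : ContinuousOn (fun z => c + ∫ s in (0:ℝ)..z, f s) (Icc (0:ℝ) 1) := by
  refine continuousOn_const.add ?_
  have := intervalIntegral.continuousOn_primitive_interval (f := f) (a := 0) (b := 1) (μ := volume) (by
    have := hf.ii zero_le_one
    rw [intervalIntegrable_iff_integrableOn_Icc_of_le zero_le_one] at this
    rwa [uIcc_of_le zero_le_one])
  rwa [uIcc_of_le zero_le_one] at this

theorem V.prim (H : Msh N x h) (hr : 1 ≤ r) {f : ℝ → ℝ} (hf : f ∈ V N r x) (c : ℝ) : (fun z => c + ∫ s in (0:ℝ)..z, f s) ∈ V N (r+1) x := by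
  have hbm := V.bm H hf
  constructor
  · intro _
    rcases Nat.lt_or_ge r 2 with h2 | h2
    · have : r = 1 := by omega
      subst this
      simpa using prim_cont hbm c
    · have hc := hf.1 h2
      have hd : ∀ y ∈ Icc (0:ℝ) 1, HasDerivWithinAt (fun z => c + ∫ s in (0:ℝ)..z, f s) (f y) (Icc 0 1) y := by
        intro y hy
        refine HasDerivWithinAt.const_add _ ?_
        haveI : Fact (y ∈ Icc (0:ℝ) 1) := ⟨hy⟩
        refine intervalIntegral.integral_hasDerivWithinAt_right ((hbm.mono le_rfl hy.2).ii hy.1) ?_ (hc.continuousOn y hy)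
        exact hc.continuousOn.stronglyMeasurableAtFilter_nhdsWithin measurableSet_Icc y
      have hu := uniqueDiffOn_Icc (zero_lt_one (α := ℝ))
      have he : ((r + 1 - 2 : ℕ) : WithTop ℕ∞) = ((r - 2 : ℕ) : WithTop ℕ∞) + 1 := by
        rw [show r + 1 - 2 = (r - 2) + 1 by omega]; simp
      rw [he, contDiffOn_succ_iff_derivWithin hu]
      refine ⟨fun y hy => (hd y hy).differentiableWithinAt, by simp, hc.congr fun y hy => (hd y hy).derivWithin (hu y hy)⟩
  · intro j hj
    obtain ⟨p, hp, h1⟩ := hf.2 j hj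
    obtain ⟨P, hP, hPd⟩ := poly_prim p
    refine ⟨P + Polynomial.C (c + (∫ s in (0:ℝ)..(x j), f s) - P.eval (x j)), ?_, fun y hy => ?_⟩
    · refine (Polynomial.natDegree_add_le _ _).trans (max_le ?_ (by simp))
      omega
    · have hj0 := H.mem (by omega : j ≤ N)
      have hy1 : y ∈ Icc (0:ℝ) 1 := H.sub hj (Ioo_subset_Icc_self hy)
      have e1 : ∫ s in (0:ℝ)..y, f s = (∫ s in (0:ℝ)..(x j), f s) + ∫ s in (x j)..y, f s :=
        (intervalIntegral.integral_add_adjacent_intervals ((hbm.mono le_rfl hj0.2).ii hj0.1) ((hbm.mono hj0.1 hy1.2).ii hy.1.le)).symm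
      have e2 : ∫ s in (x j)..y, f s = ∫ s in (x j)..y, p.eval s := by
        apply intervalIntegral.integral_congr_ae
        rw [uIoc_of_le hy.1.le]
        exact Eventually.of_forall fun s hs => h1 s ⟨hs.1, hs.2.trans_lt hy.2⟩
      have e3 : ∫ s in (x j)..y, p.eval s = P.eval y - P.eval (x j) := by
        refine ftc hy.1.le (f := fun s => P.eval s) (fun s _ => ?_) p.continuous.continuousOn
        rw [← hPd]; exact (P.hasDerivAt s).hasDerivWithinAt
      beta_reduce; rw [e1, e2, e3]; simp; ring

theorem V.sh (H : Msh N x h) (hr : 2 ≤ r) {k : ℕ} (hk : k ≤ r - 2) {f : ℝ → ℝ} (hf : f ∈ V N r x) : f ∈ Sh N r k x := by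
  refine ⟨(hf.1 hr).of_le (by exact_mod_cast hk), fun j hj => ?_⟩
  obtain ⟨p, hp, h1⟩ := hf.2 j hj
  refine ⟨p, hp, ?_⟩
  have hc : ContinuousOn f (Icc (x j) (x (j+1))) := (hf.1 hr).continuousOn.mono (H.sub hj)
  have hcl : closure (Ioo (x j) (x (j+1))) = Icc (x j) (x (j+1)) := closure_Ioo (H.lt hj).ne
  have : EqOn f (fun y => p.eval y) (Icc (x j) (x (j+1))) := by
    refine EqOn.of_subset_closure (s := Ioo (x j) (x (j+1))) h1 hc p.continuous.continuousOn Ioo_subset_Icc_self hcl.ge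
  exact this

end VSec

/-- approximation property of the spline spaces -/
def Clm (r s : ℕ) : Prop := ∃ C : ℝ, 0 ≤ C ∧ ∀ (N : ℕ) (x : ℕ → ℝ) (h : ℝ), Msh N x h → ∀ F : ℕ → ℝ → ℝ, Ch 0 1 s F → ∀ ε > 0,
  ∃ q ∈ V N r x, n2 0 1 (fun y => F 0 y - q y) ≤ C * h^s * n2 0 1 (F s) + ε ∧ (2 ≤ r → 1 ≤ s → q 0 = F 0 0 ∧ q 1 = F 0 1)

theorem clm_zero (r : ℕ) : Clm r 0 := by
  refine ⟨1, zero_le_one, fun N x h H F hF ε hε => ⟨fun _ => 0, V.zero, ?_, fun _ h => by omega⟩⟩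
  simp; exact hε.le

theorem osc {a b : ℝ} (hab : a < b) {F : ℕ → ℝ → ℝ} (hF : Ch a b 1 F) {y : ℝ} (hy : y ∈ Icc a b) : |F 0 y - F 0 a| ≤ √(b-a) * n2 a b (F 1) := by
  have hb1 := hF.bm (le_refl 1)
  have h1 := ftc hy.1 (f := F 0) (f' := F 1) (fun s hs => (hF.1 0 (by norm_num) s ⟨hs.1, hs.2.trans hy.2⟩).mono (Icc_subset_Icc le_rfl hy.2)) ((hF.cont (le_refl 1)).mono (Icc_subset_Icc le_rfl hy.2))
  rw [← h1]
  have h2 := cs hy.1 (BM.const (a := a) (b := y) 1) (hb1.mono le_rfl hy.2)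
  simp only [one_mul] at h2
  refine h2.trans ?_
  have h3 : n2 a y (fun _ => 1) ≤ √(b-a) := by
    have := n2_le_sup hy.1 (BM.const (a := a) (b := y) 1) (c := 1) (by simp)
    rw [one_mul] at this
    exact this.trans (Real.sqrt_le_sqrt (by linarith [hy.2]))
  exact mul_le_mul h3 (n2_mono_int le_rfl hy.1 hy.2 hb1) (n2_nonneg _ _ _) (Real.sqrt_nonneg _)

theorem clm_one : Clm 1 1 := by
  classical
  refine ⟨2, by norm_num, fun N x h H F hF ε hε => ?_⟩
  let q : ℝ → ℝ := fun y => if hy : ∃ j, j < N ∧ y ∈ Ioo (x j) (x (j+1)) then F 0 (x hy.choose) else 0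
  have hq : ∀ j < N, ∀ y ∈ Ioo (x j) (x (j+1)), q y = F 0 (x j) := by
    intro j hj y hy
    have hex : ∃ j, j < N ∧ y ∈ Ioo (x j) (x (j+1)) := ⟨j, hj, hy⟩
    have h1 := hex.choose_spec
    have : hex.choose = j := by
      rcases lt_trichotomy hex.choose j with h2 | h2 | h2
      · have := H.mono (i := hex.choose + 1) (j := j) (by omega) (by omega)
        linarith [h1.2.2, hy.1]
      · exact h2
      · have := H.mono (i := j + 1) (j := hex.choose) (by omega) (by omega)
        linarith [h1.2.1, hy.2]
    simp only [q, dif_pos hex, this]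
  have hqV : q ∈ V N 1 x := ⟨fun h => by omega, fun j hj => ⟨Polynomial.C (F 0 (x j)), by simp, fun y hy => by rw [hq j hj y hy]; simp⟩⟩
  refine ⟨q, hqV, ?_, fun h => by omega⟩
  have hb := (hF.bm (Nat.zero_le 1)).sub (V.bm H hqV)
  have hb1 := hF.bm (le_refl 1)
  have := H.comb hb hb1 hb1 (c := h) (d := 0) H.hpos.le le_rfl (fun j hj => by
    have hl := H.lt hj
    have hFj := hF.mono (H.mem (by omega : j ≤ N)).1 (H.mem (by omega : j + 1 ≤ N)).2
    have e1 : n2 (x j) (x (j+1)) (fun y => F 0 y - q y) ≤ n2 (x j) (x (j+1)) (fun y => F 0 y - F 0 (x j)) :=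
      n2_congr_Ioo hl.le ((hFj.bm (Nat.zero_le 1)).sub (BM.const _ _ _)) (fun y hy => by rw [hq j hj y hy])
    have e2 := n2_le_sup hl.le ((hFj.bm (Nat.zero_le 1)).sub (BM.const _ _ (F 0 (x j)))) (fun y hy => osc hl hFj hy)
    have e3 : √(x (j+1) - x j) * n2 (x j) (x (j+1)) (F 1) * √(x (j+1) - x j) = (x (j+1) - x j) * n2 (x j) (x (j+1)) (F 1) := by
      rw [mul_right_comm, Real.mul_self_sqrt (by linarith)]
    have e4 := mul_le_mul_of_nonneg_right (H.len hj) (n2_nonneg (x j) (x (j+1)) (F 1))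
    linarith)
  simp only [zero_mul, add_zero] at this
  rw [pow_one]; linarith

theorem int_n2_mean {f : ℝ → ℝ} (hf : BM 0 1 f) : n2 0 1 (fun y => f y - ∫ s in (0:ℝ)..1, f s) ≤ n2 0 1 f := by
  refine abs_le_of_sq_le_sq' ?_ (n2_nonneg _ _ _) |>.2
  rw [n2_sq zero_le_one, n2_sq zero_le_one]
  set m := ∫ s in (0:ℝ)..1, f s with hm
  have : ∫ y in (0:ℝ)..1, (f y - m)^2 = (∫ y in (0:ℝ)..1, (f y)^2) - 2 * m * m + m^2 := by
    have e : ∀ y, (f y - m)^2 = (f y)^2 - 2 * m * f y + m^2 := fun y => by ring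
    simp_rw [e]
    rw [intervalIntegral.integral_add ((hf.sq.ii zero_le_one).sub ((hf.ii zero_le_one).const_mul _)) (by simp), intervalIntegral.integral_sub (hf.sq.ii zero_le_one) ((hf.ii zero_le_one).const_mul _), intervalIntegral.integral_const_mul, ← hm]
    simp
  rw [this]; nlinarith [sq_nonneg m]

/-- near minimizers are near orthogonal -/
theorem near_min {N r : ℕ} {x : ℕ → ℝ} {h : ℝ} (H : Msh N x h) {f : ℝ → ℝ} (hf : BM 0 1 f) {A ε : ℝ} (hε : 0 < ε)
    (hA : ∃ q ∈ V N r x, n2 0 1 (fun y => f y - q y) ≤ A) :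
    ∃ g ∈ V N r x, n2 0 1 (fun y => f y - g y) ≤ A + ε ∧ (∫ y in (0:ℝ)..1, (f y - g y)) = 0 ∧
      ∀ χ ∈ V N r x, |∫ y in (0:ℝ)..1, (f y - g y) * χ y| ≤ ε * n2 0 1 χ := by
  obtain ⟨q, hq, hqA⟩ := hA
  have hA0 : 0 ≤ A := (n2_nonneg _ _ _).trans hqA
  let S : Set ℝ := {d | ∃ g ∈ V N r x, d = n2 0 1 (fun y => f y - g y) ^ 2}
  have hS : BddBelow S := ⟨0, by rintro d ⟨g, _, rfl⟩; positivity⟩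
  have hSn : S.Nonempty := ⟨_, q, hq, rfl⟩
  obtain ⟨d, ⟨g0, hg0, rfl⟩, hd⟩ := exists_lt_of_csInf_lt hSn (lt_add_of_pos_right (sInf S) (by positivity : 0 < ε^2))
  have b0 := hf.sub (V.bm H hg0)
  set m := ∫ s in (0:ℝ)..1, (f s - g0 s) with hm
  have hg : (fun y => g0 y + m) ∈ V N r x := V.add hg0 (V.const m)
  have bg := hf.sub (V.bm H hg)
  have h1 : n2 0 1 (fun y => f y - (g0 y + m)) ≤ n2 0 1 (fun y => f y - g0 y) := by
    have := int_n2_mean b0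
    rw [← hm] at this
    refine (le_of_eq ?_).trans this
    congr 1; funext y; ring
  have h1' : n2 0 1 (fun y => f y - (g0 y + m)) ^ 2 < sInf S + ε^2 := (pow_le_pow_left₀ (n2_nonneg _ _ _) h1 2).trans_lt hd
  refine ⟨_, hg, ?_, ?_, ?_⟩
  · refine abs_le_of_sq_le_sq' ?_ (by positivity) |>.2
    have h2 : sInf S ≤ n2 0 1 (fun y => f y - q y) ^ 2 := csInf_le hS ⟨q, hq, rfl⟩
    have h3 := pow_le_pow_left₀ (n2_nonneg _ _ _) hqA 2
    nlinarith
  · have e : (fun y => f y - (g0 y + m)) = fun y => (f y - g0 y) - m := by funext y; ring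
    rw [e, intervalIntegral.integral_sub (b0.ii zero_le_one) (by simp)]
    simp [hm]
  · intro χ hχ
    have bχ := V.bm H hχ
    set I := ∫ y in (0:ℝ)..1, (f y - (g0 y + m)) * χ y with hI
    have key : ∀ t : ℝ, 2 * t * I ≤ ε^2 + t^2 * n2 0 1 χ ^ 2 := by
      intro t
      have h2 : sInf S ≤ n2 0 1 (fun y => f y - ((g0 y + m) + t * χ y)) ^ 2 := csInf_le hS ⟨_, V.add hg (V.cmul t hχ), rfl⟩
      have h3 : n2 0 1 (fun y => f y - ((g0 y + m) + t * χ y)) ^ 2 = n2 0 1 (fun y => f y - (g0 y + m)) ^ 2 - 2 * t * I + t^2 * n2 0 1 χ ^ 2 := by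
        rw [n2_sq zero_le_one, n2_sq zero_le_one, n2_sq zero_le_one, hI]
        have e : ∀ y, (f y - ((g0 y + m) + t * χ y))^2 = (f y - (g0 y + m))^2 - 2 * t * ((f y - (g0 y + m)) * χ y) + t^2 * (χ y)^2 := fun y => by ring
        simp_rw [e]
        rw [intervalIntegral.integral_add ((bg.sq.ii zero_le_one).sub (((bg.mul bχ).ii zero_le_one).const_mul _)) ((bχ.sq.ii zero_le_one).const_mul _),
          intervalIntegral.integral_sub (bg.sq.ii zero_le_one) (((bg.mul bχ).ii zero_le_one).const_mul _), intervalIntegral.integral_const_mul, intervalIntegral.integral_const_mul]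
      linarith
    have hχ0 := n2_nonneg 0 1 χ
    rcases hχ0.eq_or_lt with h0 | h0
    · rw [← h0] at key ⊢
      by_contra hcon
      push Not at hcon
      have hI0 : I ≠ 0 := by intro h; rw [h] at hcon; simp at hcon
      have := key (ε^2 / I)
      have e : 2 * (ε^2 / I) * I = 2 * ε^2 := by field_simp
      rw [e] at this
      nlinarith [sq_nonneg ε]
    · have a := key (ε / n2 0 1 χ)
      have b := key (-(ε / n2 0 1 χ))
      have e : (ε / n2 0 1 χ)^2 * n2 0 1 χ ^ 2 = ε^2 := by field_simp
      have e2 : (-(ε / n2 0 1 χ))^2 * n2 0 1 χ ^ 2 = ε^2 := by rw [neg_sq]; exact e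
      rw [e] at a
      rw [e2] at b
      have c1 : 2 * (ε / n2 0 1 χ) * I = 2 * ε * (I / n2 0 1 χ) := by field_simp
      have c2 : 2 * -(ε / n2 0 1 χ) * I = -(2 * ε * (I / n2 0 1 χ)) := by field_simp
      rw [c1] at a
      rw [c2] at b
      have d1 : I / n2 0 1 χ ≤ ε := by nlinarith
      have d2 : -ε ≤ I / n2 0 1 χ := by nlinarith
      rw [div_le_iff₀ h0] at d1
      rw [le_div_iff₀ h0] at d2
      rw [abs_le]; constructor <;> linarith

theorem quad_le {X a b c : ℝ} (hc : 0 ≤ c) (h : X^2 ≤ a * X + b) (hb : b ≤ c^2) (ha : 0 ≤ a) : X ≤ a + c := by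
  by_contra hcon
  push Not at hcon
  nlinarith

theorem clm_step {r s : ℕ} (hr : 1 ≤ r) (h1 : Clm r 1) (hs : Clm r s) : Clm (r+1) (s+1) := by
  obtain ⟨C1, hC1, H1⟩ := h1
  obtain ⟨C, hC, Hs⟩ := hs
  refine ⟨C1 * C, by positivity, fun N x h H F hF ε hε => ?_⟩
  have hh := H.hpos
  have hh1 := H.hle
  have hF1 : Ch 0 1 s (fun j => F (j+1)) := hF.shift1 (by omega)
  set ε1 : ℝ := ε / (3 * (1 + 3 * C1)) with hε1
  have hε1p : 0 < ε1 := by positivity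
  have hε1e : ε1 * (1 + 3 * C1) = ε / 3 := by rw [hε1]; field_simp
  obtain ⟨q1, hq1, hq1n, _⟩ := Hs N x h H _ hF1 ε1 hε1p
  simp only [zero_add] at hq1n
  set A := C * h^s * n2 0 1 (F (s+1)) with hA
  have hA0 : 0 ≤ A := by have := n2_nonneg 0 1 (F (s+1)); positivity
  have bF1 : BM 0 1 (F 1) := hF.bm (by omega)
  obtain ⟨g, hg, hgn, hgm, hgo⟩ := near_min H bF1 hε1p ⟨q1, hq1, hq1n⟩
  have bg := V.bm H hg
  have hq := V.prim H hr hg (F 0 0)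
  set q : ℝ → ℝ := fun z => F 0 0 + ∫ s in (0:ℝ)..z, g s with hqdef
  have q0 : q 0 = F 0 0 := by simp [hqdef]
  have q1 : q 1 = F 0 1 := by
    have e1 : ∫ s in (0:ℝ)..1, F 1 s = F 0 1 - F 0 0 := ftc zero_le_one (hF.1 0 (by omega)) (hF.cont (by omega))
    rw [intervalIntegral.integral_sub (bF1.ii zero_le_one) (bg.ii zero_le_one), e1] at hgm
    simp only [hqdef]; linarith
  refine ⟨q, hq, ?_, fun _ _ => ⟨q0, q1⟩⟩
  have cF0 : ContinuousOn (F 0) (Icc 0 1) := hF.cont (by omega)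
  have cq : ContinuousOn q (Icc 0 1) := prim_cont bg (F 0 0)
  set e : ℝ → ℝ := fun y => F 0 y - q y with he
  have ce : ContinuousOn e (Icc 0 1) := cF0.sub cq
  have be : BM 0 1 e := BM.of_cont ce
  set Ψ : ℝ → ℝ := fun z => 0 + ∫ s in (0:ℝ)..z, e s with hΨ
  have cΨ : ContinuousOn Ψ (Icc 0 1) := prim_cont be 0
  have bΨ : BM 0 1 Ψ := BM.of_cont cΨ
  have dΨ : ∀ y ∈ Icc (0:ℝ) 1, HasDerivWithinAt Ψ (e y) (Icc 0 1) y := by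
    intro y hy
    refine HasDerivWithinAt.const_add _ ?_
    haveI : Fact (y ∈ Icc (0:ℝ) 1) := ⟨hy⟩
    exact intervalIntegral.integral_hasDerivWithinAt_right ((be.mono le_rfl hy.2).ii hy.1) (ce.stronglyMeasurableAtFilter_nhdsWithin measurableSet_Icc y) (ce y hy)
  have chΨ : Ch 0 1 1 (fun j => if j = 0 then Ψ else e) := by
    constructor
    · intro i hi y hy
      have : i = 0 := by omega
      subst this
      simpa using dΨ y hy
    · simpa using ce
  set D := A + ε1 + ε1 with hD
  have hD0 : 0 < D := by positivity
  set ε2 : ℝ := (ε/3)^2 / (D + ε1) with hε2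
  have hε2p : 0 < ε2 := by positivity
  have hε2e : (D + ε1) * ε2 = (ε/3)^2 := by rw [hε2]; field_simp
  obtain ⟨χ, hχ, hχn, _⟩ := H1 N x h H _ chΨ ε2 hε2p
  simp only [if_true, one_ne_zero, if_false, pow_one] at hχn
  have bχ := V.bm H hχ
  set X := n2 0 1 e with hX
  have hX0 : 0 ≤ X := n2_nonneg _ _ _
  have nΨ : n2 0 1 Ψ ≤ X := by
    have := n2_le_sup zero_le_one bΨ (c := X) (fun y hy => by
      have h2 := cs hy.1 (BM.const (a := 0) (b := y) 1) (be.mono le_rfl hy.2)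
      simp only [one_mul] at h2
      have h3 : n2 0 y (fun _ => 1) ≤ 1 := by
        have := n2_le_sup hy.1 (BM.const (a := 0) (b := y) 1) (c := 1) (by simp)
        rw [one_mul] at this
        refine this.trans (Real.sqrt_le_one.2 (by linarith [hy.2]))
      have h4 := n2_mono_int le_rfl hy.1 hy.2 be
      have h5 : n2 0 y (fun _ => 1) * n2 0 y e ≤ 1 * X := mul_le_mul h3 h4 (n2_nonneg _ _ _) zero_le_one
      simp only [hΨ, zero_add]; linarith)
    simpa using this
  have nχ : n2 0 1 χ ≤ X + (C1 * h * X + ε2) := by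
    have := n2_sub zero_le_one bΨ (bΨ.sub bχ)
    have e2 : (fun y => Ψ y - (Ψ y - χ y)) = χ := by funext y; ring
    rw [e2] at this
    linarith
  have ibp1 : X^2 = -∫ y in (0:ℝ)..1, (F 1 y - g y) * Ψ y := by
    have h1 := integral_eq_of_hasDerivAt_off_countable_of_le (fun y => e y * Ψ y) (fun y => (F 1 y - g y) * Ψ y + e y * e y) zero_le_one (nodes_countable (N := N) (x := x))
      (ce.mul cΨ) (fun y hy => by
        obtain ⟨j, hj, hyj⟩ := H.findo (Ioo_subset_Icc_self hy.1) hy.2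
        have d1 := (hF.hasDerivAt (by omega : 0 < s + 1) hy.1).sub (V.prim_deriv H hg hj hyj (F 0 0))
        have d2 := (dΨ y (Ioo_subset_Icc_self hy.1)).hasDerivAt (Icc_mem_nhds hy.1.1 hy.1.2)
        exact d1.mul d2)
      ((((bF1.sub bg).mul bΨ).ii zero_le_one).add ((be.mul be).ii zero_le_one))
    rw [intervalIntegral.integral_add (((bF1.sub bg).mul bΨ).ii zero_le_one) ((be.mul be).ii zero_le_one)] at h1
    have e0 : e 0 = 0 := by simp [he, q0]
    have e1 : e 1 = 0 := by simp [he, q1]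
    simp only [e0, e1, zero_mul, sub_zero] at h1
    rw [hX, n2_sq zero_le_one]
    have e3 : ∀ y, e y ^ 2 = e y * e y := fun y => sq _
    simp_rw [e3]
    linarith
  have split : ∫ y in (0:ℝ)..1, (F 1 y - g y) * Ψ y = (∫ y in (0:ℝ)..1, (F 1 y - g y) * (Ψ y - χ y)) + ∫ y in (0:ℝ)..1, (F 1 y - g y) * χ y := by
    rw [← intervalIntegral.integral_add (((bF1.sub bg).mul (bΨ.sub bχ)).ii zero_le_one) (((bF1.sub bg).mul bχ).ii zero_le_one)]
    congr 1; funext y; ring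
  have t1 := cs zero_le_one (bF1.sub bg) (bΨ.sub bχ)
  have t2 := hgo χ hχ
  have t3 : n2 0 1 (fun y => F 1 y - g y) * n2 0 1 (fun y => Ψ y - χ y) ≤ D * (C1 * h * X + ε2) :=
    mul_le_mul hgn hχn (n2_nonneg _ _ _) hD0.le
  have t4 : ε1 * n2 0 1 χ ≤ ε1 * (X + (C1 * h * X + ε2)) := mul_le_mul_of_nonneg_left nχ hε1p.le
  have fin : X^2 ≤ (D * C1 * h + ε1 * (1 + C1 * h)) * X + (D + ε1) * ε2 := by
    rw [ibp1, split]
    have a1 := neg_abs_le (∫ y in (0:ℝ)..1, (F 1 y - g y) * (Ψ y - χ y))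
    have a2 := neg_abs_le (∫ y in (0:ℝ)..1, (F 1 y - g y) * χ y)
    nlinarith
  have := quad_le (c := ε/3) (by positivity) fin hε2e.le (by positivity)
  refine this.trans ?_
  have b1 : D * C1 * h + ε1 * (1 + C1 * h) = C1 * h * A + (ε1 + 3 * (ε1 * C1) * h) := by rw [hD]; ring
  have b2 : 3 * (ε1 * C1) * h ≤ 3 * (ε1 * C1) := mul_le_of_le_one_right (by positivity) hh1
  have b3 : C1 * h * A = C1 * C * h^(s+1) * n2 0 1 (F (s+1)) := by rw [hA]; ring
  rw [b1, b3]
  nlinarith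

theorem clm (r s : ℕ) (hr : 1 ≤ r) (hs : s ≤ r) : Clm r s := by
  induction r, hr using Nat.le_induction generalizing s with
  | base =>
    interval_cases s
    · exact clm_zero 1
    · exact clm_one
  | succ r hr ih =>
    rcases s with _ | s
    · exact clm_zero _
    · exact clm_step hr (ih 1 hr) (ih s (by omega))

section ShSec
variable {N r k : ℕ} {x : ℕ → ℝ} {h : ℝ}

theorem Sh.add {f g : ℝ → ℝ} (hf : f ∈ Sh N r k x) (hg : g ∈ Sh N r k x) : (fun y => f y + g y) ∈ Sh N r k x := by
  refine ⟨hf.1.add hg.1, fun j hj => ?_⟩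
  obtain ⟨p, hp, h1⟩ := hf.2 j hj
  obtain ⟨q, hq, h2⟩ := hg.2 j hj
  exact ⟨p + q, (Polynomial.natDegree_add_le _ _).trans (max_le hp hq), fun y hy => by beta_reduce; rw [h1 y hy, h2 y hy]; simp⟩

theorem Sh.cmul (c : ℝ) {f : ℝ → ℝ} (hf : f ∈ Sh N r k x) : (fun y => c * f y) ∈ Sh N r k x := by
  refine ⟨contDiffOn_const.mul hf.1, fun j hj => ?_⟩
  obtain ⟨p, hp, h1⟩ := hf.2 j hj
  exact ⟨Polynomial.C c * p, (Polynomial.natDegree_C_mul_le _ _).trans hp, fun y hy => by beta_reduce; rw [h1 y hy]; simp⟩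

theorem Sh.cont {f : ℝ → ℝ} (hf : f ∈ Sh N r k x) : ContinuousOn f (Icc 0 1) := hf.1.continuousOn

theorem Sh.bm {f : ℝ → ℝ} (hf : f ∈ Sh N r k x) : BM 0 1 f := BM.of_cont (Sh.cont hf)

theorem Sh.hda {f : ℝ → ℝ} (hf : f ∈ Sh N r k x) {j : ℕ} (hj : j < N) {p : Polynomial ℝ} (hp : ∀ y ∈ Icc (x j) (x (j+1)), f y = p.eval y)
    {y : ℝ} (hy : y ∈ Ioo (x j) (x (j+1))) : HasDerivAt f (p.derivative.eval y) y := by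
  refine (p.hasDerivAt y).congr_of_eventuallyEq ?_
  filter_upwards [Ioo_mem_nhds hy.1 hy.2] with z hz
  exact hp z (Ioo_subset_Icc_self hz)

theorem Sh.hd {f : ℝ → ℝ} (hf : f ∈ Sh N r k x) {j : ℕ} (hj : j < N) {y : ℝ} (hy : y ∈ Ioo (x j) (x (j+1))) : HasDerivAt f (deriv f y) y := by
  obtain ⟨p, _, hp⟩ := hf.2 j hj
  exact (Sh.hda hf hj hp hy).differentiableAt.hasDerivAt

theorem Sh.bmd (H : Msh N x h) {f : ℝ → ℝ} (hf : f ∈ Sh N r k x) : BM 0 1 (deriv f) := by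
  apply H.bm
  intro j hj
  obtain ⟨p, _, hp⟩ := hf.2 j hj
  exact (BM.of_cont (Polynomial.continuous (Polynomial.derivative p)).continuousOn).congr_Ioo (fun y hy => (Sh.hda hf hj hp hy).deriv.symm)

/-- pointwise a.e. congruence of `n2` through open mesh cells -/
theorem Msh.n2le (H : Msh N x h) {f g : ℝ → ℝ} (hf : BM 0 1 f) (hfg : ∀ j < N, ∀ y ∈ Ioo (x j) (x (j+1)), f y = g y) : BM 0 1 g ∧ n2 0 1 g = n2 0 1 f := by
  have hae : ∀ᵐ y : ℝ, y ∈ Ioc (0:ℝ) 1 → f y = g y := by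
    filter_upwards [H.ae] with y hy hm
    obtain ⟨j, hj, hyj⟩ := hy hm
    exact hfg j hj y hyj
  have hg : BM 0 1 g := by
    refine MemLp.ae_eq ?_ hf
    rw [EventuallyEq, ae_restrict_iff' measurableSet_Ioc]
    exact hae
  refine ⟨hg, le_antisymm (n2_le_of_ae zero_le_one hg hf ?_) (n2_le_of_ae zero_le_one hf hg ?_)⟩
  · filter_upwards [hae] with y hy hm; rw [hy hm]
  · filter_upwards [hae] with y hy hm; rw [hy hm]

end ShSec

theorem inv_est (r s : ℕ) (hs : 2 ≤ s) (γ : ℝ) (hγ : 1 ≤ γ) : ∃ C : ℝ, 0 ≤ C ∧ ∀ (N k : ℕ) (x : ℕ → ℝ) (h : ℝ), Msh N x h → QuasiUniform N x h γ →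
    ∀ φ ∈ Sh N r k x, ∀ F : ℕ → ℝ → ℝ, Ch 0 1 s F →
    h * n2 0 1 (fun y => F 1 y - deriv φ y) ≤ C * (n2 0 1 (fun y => F 0 y - φ y) + h^s * n2 0 1 (F s)) ∧
    ∀ y ∈ Icc (0:ℝ) 1, √h * |F 0 y - φ y| ≤ C * (n2 0 1 (fun y => F 0 y - φ y) + h^s * n2 0 1 (F s)) := by
  obtain ⟨C0, hC0, H0⟩ := ehr s (r-1)
  refine ⟨2 * γ * C0, by positivity, fun N k x h H hq φ hφ F hF => ?_⟩
  have hh := H.hpos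
  have bφ := (Sh.bm hφ)
  have bd := (Sh.bmd H hφ)
  have bF0 : BM 0 1 (F 0) := hF.bm (by omega)
  have bF1 : BM 0 1 (F 1) := hF.bm (by omega)
  have bFs : BM 0 1 (F s) := hF.bm (by omega)
  have loc : ∀ j < N, ∀ i < s, ∀ p : Polynomial ℝ, p.natDegree ≤ r - 1 → (∀ y ∈ Icc (x j) (x (j+1)), φ y = p.eval y) → ∀ y ∈ Icc (x j) (x (j+1)),
      √(x (j+1) - x j) * (x (j+1) - x j)^i * |F i y - (Polynomial.derivative^[i] p).eval y| ≤ C0 * (n2 (x j) (x (j+1)) (fun y => F 0 y - φ y) + h^s * n2 (x j) (x (j+1)) (F s)) := by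
    intro j hj i hi p hp hpe y hy
    have hl := H.lt hj
    have hFj := hF.mono (H.mem (by omega : j ≤ N)).1 (H.mem (by omega : j + 1 ≤ N)).2
    refine (H0 (a := x j) (b := x (j+1)) hl F p hFj hp i hi y hy).trans ?_
    have e1 : n2 (x j) (x (j+1)) (fun y => F 0 y - p.eval y) = n2 (x j) (x (j+1)) (fun y => F 0 y - φ y) :=
      n2_congr hl.le (fun y hy => by rw [hpe y hy])
    rw [e1]
    have e2 : (x (j+1) - x j)^s ≤ h^s := pow_le_pow_left₀ (by linarith) (H.len hj) s
    have e3 := n2_nonneg (x j) (x (j+1)) (F s)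
    gcongr
  constructor
  · have := H.comb (c := γ * C0 / h) (d := h^s) (bF1.sub bd) (bF0.sub bφ) bFs (by positivity) (by positivity) (fun j hj => by
      obtain ⟨p, hp, hpe⟩ := hφ.2 j hj
      have hl := H.lt hj
      have hjm := H.mem (by omega : j ≤ N)
      have hjm' := H.mem (by omega : j + 1 ≤ N)
      set l := x (j+1) - x j with hldef
      have hlp : 0 < l := by linarith
      set E := n2 (x j) (x (j+1)) (fun y => F 0 y - φ y) + h^s * n2 (x j) (x (j+1)) (F s) with hE
      have hE0 : 0 ≤ E := add_nonneg (n2_nonneg _ _ _) (mul_nonneg (by positivity) (n2_nonneg _ _ _))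
      have bp : BM (x j) (x (j+1)) (fun y => F 1 y - p.derivative.eval y) := (bF1.mono hjm.1 hjm'.2).sub (BM.of_cont (Polynomial.continuous (Polynomial.derivative p)).continuousOn)
      have e1 : n2 (x j) (x (j+1)) (fun y => F 1 y - deriv φ y) ≤ n2 (x j) (x (j+1)) (fun y => F 1 y - p.derivative.eval y) :=
        n2_congr_Ioo hl.le bp (fun y hy => by rw [(Sh.hda hφ hj hpe hy).deriv])
      have e2 := n2_le_sup hl.le bp (c := C0 * E / (√l * l)) (fun y hy => by
        rw [le_div_iff₀ (by positivity)]
        have := loc j hj 1 (by omega) p hp hpe y hy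
        simp only [pow_one, Function.iterate_one] at this
        linarith)
      have e3 : C0 * E / (√l * l) * √l = C0 * E / l := by
        have : √l ≠ 0 := by positivity
        field_simp
      rw [← hldef, e3] at e2
      refine (e1.trans e2).trans ?_
      have h4 : h ≤ γ * l := hq j hj
      rw [div_le_iff₀ hlp]
      have e5 : γ * C0 / h * E * l = C0 * E * (γ * l / h) := by field_simp
      rw [e5]
      refine le_mul_of_one_le_right (by positivity) ?_
      rw [le_div_iff₀ hh]; linarith)
    have e : h * (2 * (γ * C0 / h) * (n2 0 1 (fun y => F 0 y - φ y) + h^s * n2 0 1 (F s))) = 2 * γ * C0 * (n2 0 1 (fun y => F 0 y - φ y) + h^s * n2 0 1 (F s)) := by field_simp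
    rw [← e]
    exact mul_le_mul_of_nonneg_left this hh.le
  · intro y hy
    obtain ⟨j, hj, hyj⟩ := H.find hy
    obtain ⟨p, hp, hpe⟩ := hφ.2 j hj
    have hl := H.lt hj
    have hjm := H.mem (by omega : j ≤ N)
    have hjm' := H.mem (by omega : j + 1 ≤ N)
    have e1 := loc j hj 0 (by omega) p hp hpe y hyj
    simp only [pow_zero, mul_one, Function.iterate_zero, id] at e1
    rw [← hpe y hyj] at e1
    have e2 : √h ≤ γ * √(x (j+1) - x j) := by
      refine (Real.sqrt_le_sqrt (hq j hj)).trans ?_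
      rw [Real.sqrt_mul (by linarith)]
      gcongr
      rw [Real.sqrt_le_left (by linarith)]; nlinarith
    have e3 := n2_mono_int hjm.1 hl.le hjm'.2 (bF0.sub bφ)
    have e4 := n2_mono_int hjm.1 hl.le hjm'.2 bFs
    have e5 : h^s * n2 (x j) (x (j+1)) (F s) ≤ h^s * n2 0 1 (F s) := mul_le_mul_of_nonneg_left e4 (by positivity)
    have e6 : 0 ≤ n2 0 1 (fun y => F 0 y - φ y) + h^s * n2 0 1 (F s) := add_nonneg (n2_nonneg _ _ _) (mul_nonneg (by positivity) (n2_nonneg _ _ _))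
    calc √h * |F 0 y - φ y| ≤ γ * √(x (j+1) - x j) * |F 0 y - φ y| := by gcongr
      _ = γ * (√(x (j+1) - x j) * |F 0 y - φ y|) := by ring
      _ ≤ γ * (C0 * (n2 0 1 (fun y => F 0 y - φ y) + h^s * n2 0 1 (F s))) := by
        refine mul_le_mul_of_nonneg_left (e1.trans ?_) (by linarith)
        exact mul_le_mul_of_nonneg_left (by linarith) (by linarith)
      _ ≤ 2 * γ * C0 * (n2 0 1 (fun y => F 0 y - φ y) + h^s * n2 0 1 (F s)) := by
        have : 0 ≤ γ * (C0 * (n2 0 1 (fun y => F 0 y - φ y) + h^s * n2 0 1 (F s))) := by positivity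
        linarith

/-- finite element subspaces -/
structure Spc (S : Set (ℝ → ℝ)) (N r k : ℕ) (x : ℕ → ℝ) : Prop where
  sub : S ⊆ Sh N r k x
  add : ∀ f ∈ S, ∀ g ∈ S, (fun y => f y + g y) ∈ S
  cmul : ∀ c : ℝ, ∀ f ∈ S, (fun y => c * f y) ∈ S

theorem spc_sh (N r k : ℕ) (x : ℕ → ℝ) : Spc (Sh N r k x) N r k x := ⟨subset_rfl, fun f hf g hg => Sh.add hf hg, fun c f hf => Sh.cmul c hf⟩
theorem spc_sh0 (N r k : ℕ) (x : ℕ → ℝ) : Spc (Sh0 N r k x) N r k x :=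
  ⟨fun f hf => hf.1, fun f hf g hg => ⟨Sh.add hf.1 hg.1, by simp [hf.2.1, hg.2.1], by simp [hf.2.2, hg.2.2]⟩,
    fun c f hf => ⟨Sh.cmul c hf.1, by simp [hf.2.1], by simp [hf.2.2]⟩⟩

def AP (S : Set (ℝ → ℝ)) (h : ℝ) (f f' : ℝ → ℝ) (ε : ℝ) : Prop :=
  ∃ q ∈ S, n2 0 1 (fun y => f y - q y) ≤ ε * h ∧ n2 0 1 (fun y => f' y - deriv q y) ≤ ε ∧ ∀ y ∈ Icc (0:ℝ) 1, |f y - q y| ≤ ε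

theorem AP.mono {S : Set (ℝ → ℝ)} {h : ℝ} (hh : 0 ≤ h) {f f' : ℝ → ℝ} {ε ε' : ℝ} (H : AP S h f f' ε) (he : ε ≤ ε') : AP S h f f' ε' := by
  obtain ⟨q, h1, h2, h3, h4⟩ := H
  exact ⟨q, h1, h2.trans (mul_le_mul_of_nonneg_right he hh), h3.trans he, fun y hy => (h4 y hy).trans he⟩

theorem AP.comb {N r k : ℕ} {x : ℕ → ℝ} {h : ℝ} (M : Msh N x h) {S : Set (ℝ → ℝ)} (hS : Spc S N r k x) {f f' g g' : ℝ → ℝ} {ε1 ε2 c : ℝ} (hc : 0 ≤ c)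
    (bf : BM 0 1 f) (bf' : BM 0 1 f') (bg : BM 0 1 g) (bg' : BM 0 1 g')
    (H1 : AP S h f f' ε1) (H2 : AP S h g g' ε2) : AP S h (fun y => f y + c * g y) (fun y => f' y + c * g' y) (ε1 + c * ε2) := by
  obtain ⟨q1, a1, a2, a3, a4⟩ := H1
  obtain ⟨q2, b1, b2, b3, b4⟩ := H2
  have h1 := hS.sub a1
  have h2 := hS.sub b1
  refine ⟨fun y => q1 y + c * q2 y, hS.add _ a1 _ (hS.cmul c _ b1), ?_, ?_, ?_⟩
  · have := n2_add zero_le_one (bf.sub (Sh.bm h1)) ((bg.sub (Sh.bm h2)).cmul c)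
    have e : (fun y => f y + c * g y - (q1 y + c * q2 y)) = fun y => (f y - q1 y) + c * (g y - q2 y) := by funext y; ring
    rw [n2_cmul, abs_of_nonneg hc] at this
    rw [e]
    refine this.trans ?_
    have := mul_le_mul_of_nonneg_left b2 hc
    linarith
  · have := n2_add zero_le_one (bf'.sub ((Sh.bmd M h1))) ((bg'.sub ((Sh.bmd M h2))).cmul c)
    rw [n2_cmul, abs_of_nonneg hc] at this
    have e := M.n2le (g := fun y => f' y + c * g' y - deriv (fun y => q1 y + c * q2 y) y) ((bf'.sub ((Sh.bmd M h1))).add ((bg'.sub ((Sh.bmd M h2))).cmul c)) (fun j hj y hy => by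
      beta_reduce
      have e := ((Sh.hd h1 hj hy).fun_add ((Sh.hd h2 hj hy).const_mul c)).deriv
      rw [e]; ring)
    rw [e.2]
    refine this.trans ?_
    have := mul_le_mul_of_nonneg_left b3 hc
    linarith
  · intro y hy
    have e : f y + c * g y - (q1 y + c * q2 y) = (f y - q1 y) + c * (g y - q2 y) := by ring
    rw [e]
    refine (abs_add_le _ _).trans ?_
    rw [abs_mul, abs_of_nonneg hc]
    have := mul_le_mul_of_nonneg_left (b4 y hy) hc
    linarith [a4 y hy]

theorem sup_aux {h a C : ℝ} (hh : 0 < h) (hh1 : h ≤ 1) (hC : 0 ≤ C) (H : √h * a ≤ C * h) : a ≤ C := by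
  have h1 : √h * √h = h := Real.mul_self_sqrt hh.le
  have h2 : 0 < √h := Real.sqrt_pos.2 hh
  have h3 : a ≤ C * √h := by
    by_contra hc
    push Not at hc
    nlinarith
  refine h3.trans (mul_le_of_le_one_right hC (Real.sqrt_le_one.2 hh1))

theorem ap_exists (r s : ℕ) (hs : 2 ≤ s) (hsr : s ≤ r) (γ : ℝ) (hγ : 1 ≤ γ) : ∃ C : ℝ, 0 ≤ C ∧ ∀ (N k : ℕ) (x : ℕ → ℝ) (h : ℝ), k ≤ r - 2 → Msh N x h → QuasiUniform N x h γ →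
    ∀ F : ℕ → ℝ → ℝ, Ch 0 1 s F → ∀ K : ℝ, n2 0 1 (F s) ≤ K →
      AP (Sh N r k x) h (F 0) (F 1) (C * (K+1) * h^(s-1)) ∧ (F 0 0 = 0 → F 0 1 = 0 → AP (Sh0 N r k x) h (F 0) (F 1) (C * (K+1) * h^(s-1))) := by
  obtain ⟨C1, hC1, H1⟩ := inv_est r s hs γ hγ
  obtain ⟨C2, hC2, H2⟩ := clm r s (by omega) hsr
  refine ⟨(C1 + 1) * (C2 + 2), by positivity, fun N k x h hk H hq F hF K hK => ?_⟩
  have hh := H.hpos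
  have hh1 := H.hle
  have hK0 : 0 ≤ K := (n2_nonneg _ _ _).trans hK
  obtain ⟨q, hqV, hqn, hqb⟩ := H2 N x h H F hF (h^s) (by positivity)
  have hqS : q ∈ Sh N r k x := V.sh H (by omega) hk hqV
  obtain ⟨i1, i2⟩ := H1 N k x h H hq q hqS F hF
  have hp : h^s = h^(s-1) * h := by rw [← pow_succ]; congr 1; omega
  have e1 : n2 0 1 (fun y => F 0 y - q y) ≤ (C2 + 1) * (K + 1) * h^s := by
    refine hqn.trans ?_
    have : C2 * h^s * n2 0 1 (F s) ≤ C2 * h^s * K := mul_le_mul_of_nonneg_left hK (by positivity)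
    have h0 : 0 ≤ h^s := by positivity
    have h2 : (C2 + 1) * (K + 1) * h^s = C2 * h^s * K + C2 * h^s + K * h^s + h^s := by ring
    have : 0 ≤ C2 * h^s := by positivity
    have : 0 ≤ K * h^s := by positivity
    linarith
  have e2 : h^s * n2 0 1 (F s) ≤ (K+1) * h^s := by
    have : h^s * n2 0 1 (F s) ≤ h^s * (K+1) := mul_le_mul_of_nonneg_left (by linarith) (by positivity)
    linarith
  have e3 : n2 0 1 (fun y => F 0 y - q y) + h^s * n2 0 1 (F s) ≤ (C2 + 2) * (K+1) * h^s := by linarith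
  have e4 : C1 * (n2 0 1 (fun y => F 0 y - q y) + h^s * n2 0 1 (F s)) ≤ ((C1 + 1) * (C2 + 2) * (K+1) * h^(s-1)) * h := by
    have : ((C1 + 1) * (C2 + 2) * (K+1) * h^(s-1)) * h = (C1 + 1) * ((C2 + 2) * (K+1) * h^s) := by rw [hp]; ring
    rw [this]
    refine mul_le_mul (by linarith) e3 (add_nonneg (n2_nonneg _ _ _) (mul_nonneg (by positivity) (n2_nonneg _ _ _))) (by linarith)
  set E := (C1 + 1) * (C2 + 2) * (K+1) * h^(s-1) with hE
  have hE0 : 0 ≤ E := by positivity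
  have key : n2 0 1 (fun y => F 0 y - q y) ≤ E * h ∧ n2 0 1 (fun y => F 1 y - deriv q y) ≤ E ∧ ∀ y ∈ Icc (0:ℝ) 1, |F 0 y - q y| ≤ E := by
    refine ⟨?_, ?_, fun y hy => sup_aux hh hh1 hE0 ((i2 y hy).trans e4)⟩
    · have : E * h = (C1 + 1) * ((C2 + 2) * (K+1) * h^s) := by rw [hp, hE]; ring
      rw [this]
      have h1 : (C2+1) * (K+1) * h^s ≤ (C2+2)*(K+1)*h^s := by gcongr; norm_num
      have h2 : (C2+2)*(K+1)*h^s ≤ (C1+1) * ((C2+2)*(K+1)*h^s) := le_mul_of_one_le_left (by positivity) (by linarith)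
      linarith
    · have := i1.trans e4
      by_contra hc
      push Not at hc
      nlinarith
  refine ⟨⟨q, hqS, key⟩, fun h0 h1 => ⟨q, ⟨hqS, ?_, ?_⟩, key⟩⟩
  · rw [(hqb (by omega) (by omega)).1, h0]
  · rw [(hqb (by omega) (by omega)).2, h1]

/-- projection type estimate -/
theorem test_le {S : Set (ℝ → ℝ)} {N r k : ℕ} {x : ℕ → ℝ} (hS : Spc S N r k x) {g G : ℝ → ℝ} (hg : g ∈ S) (bG : BM 0 1 G)
    (ho : ∀ χ ∈ S, ∫ y in (0:ℝ)..1, g y * χ y = ∫ y in (0:ℝ)..1, G y * χ y) : n2 0 1 g ≤ n2 0 1 G := by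
  have bg := (Sh.bm (hS.sub hg))
  have h1 := ho g hg
  have h2 := cs zero_le_one bG bg
  have h3 : n2 0 1 g ^ 2 = ∫ y in (0:ℝ)..1, g y * g y := by rw [n2_sq zero_le_one]; simp_rw [sq]
  have h4 := le_abs_self (∫ y in (0:ℝ)..1, G y * g y)
  have h5 := n2_nonneg 0 1 g
  by_contra hc
  push Not at hc
  have h6 := n2_nonneg 0 1 G
  nlinarith

theorem proj_est (r : ℕ) (γ : ℝ) (hγ : 1 ≤ γ) : ∃ C : ℝ, 1 ≤ C ∧ ∀ (N k : ℕ) (x : ℕ → ℝ) (h : ℝ), Msh N x h → QuasiUniform N x h γ →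
    ∀ S, Spc S N r k x → ∀ f f' g G : ℝ → ℝ, ∀ A ε : ℝ, BM 0 1 f → BM 0 1 f' → BM 0 1 G → g ∈ S → AP S h f f' ε →
    (∀ χ ∈ S, ∫ y in (0:ℝ)..1, g y * χ y = ∫ y in (0:ℝ)..1, G y * χ y) → n2 0 1 (fun y => G y - f y) ≤ A * h →
    n2 0 1 (fun y => f y - g y) ≤ C * (A + ε) * h ∧ n2 0 1 (fun y => f' y - deriv g y) ≤ C * (A + ε) ∧ ∀ y ∈ Icc (0:ℝ) 1, |f y - g y| ≤ C * (A + ε) := by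
  obtain ⟨C1, hC1, H1⟩ := inv_est r 2 le_rfl γ hγ
  refine ⟨C1 + 2, by linarith, fun N k x h H hq S hS f f' g G A ε bf bf' bG hg hap ho hA => ?_⟩
  have hh := H.hpos
  have hh1 := H.hle
  obtain ⟨q, hqS, q1, q2, q3⟩ := hap
  have hA0 : 0 ≤ A := by
    have := (n2_nonneg _ _ _).trans hA
    by_contra hc; push Not at hc; nlinarith
  have hε0 : 0 ≤ ε := (n2_nonneg _ _ _).trans q2
  have hgS := hS.sub hg
  have hqS' := hS.sub hqS
  have hd : (fun y => g y + (-1) * q y) ∈ S := hS.add _ hg _ (hS.cmul (-1) _ hqS)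
  have hdS := hS.sub hd
  have n1 : n2 0 1 (fun y => g y + (-1) * q y) ≤ (A + ε) * h := by
    refine (test_le hS hd (bG.sub (Sh.bm hqS')) (fun χ hχ => ?_)).trans ?_
    · have bχ := (Sh.bm (hS.sub hχ))
      have e1 : (fun y => (g y + (-1) * q y) * χ y) = fun y => g y * χ y - q y * χ y := by funext y; ring
      have e2 : (fun y => (G y - q y) * χ y) = fun y => G y * χ y - q y * χ y := by funext y; ring
      rw [e1, e2, intervalIntegral.integral_sub (((Sh.bm hgS).mul bχ).ii zero_le_one) (((Sh.bm hqS').mul bχ).ii zero_le_one), ho χ hχ,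
        intervalIntegral.integral_sub ((bG.mul bχ).ii zero_le_one) (((Sh.bm hqS').mul bχ).ii zero_le_one)]
    · have := n2_add zero_le_one (bG.sub bf) (bf.sub (Sh.bm hqS'))
      have e : (fun y => G y - q y) = fun y => (G y - f y) + (f y - q y) := by funext y; ring
      rw [e]; linarith
  have ch0 : Ch 0 1 2 (fun _ _ => (0:ℝ)) := ⟨fun i _ y _ => hasDerivWithinAt_const _ _ _, continuousOn_const⟩
  obtain ⟨i1, i2⟩ := H1 N k x h H hq _ hdS _ ch0
  have z : n2 0 1 (fun _ => (0:ℝ)) = 0 := by simp [n2]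
  simp only [zero_sub, z, mul_zero, add_zero] at i1 i2
  rw [n2_neg] at i1
  have e0 : n2 0 1 (fun y => -(g y + (-1) * q y)) = n2 0 1 (fun y => g y + (-1) * q y) := n2_neg _
  simp only [e0] at i1 i2
  have e4 : C1 * n2 0 1 (fun y => g y + (-1) * q y) ≤ (C1 * (A + ε)) * h := by
    have := mul_le_mul_of_nonneg_left n1 hC1; linarith
  refine ⟨?_, ?_, fun y hy => ?_⟩
  · have := n2_sub zero_le_one (bf.sub (Sh.bm hqS')) (Sh.bm hdS)
    have e : (fun y => f y - q y - (g y + (-1) * q y)) = fun y => f y - g y := by funext y; ring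
    rw [e] at this
    have h1 : 0 ≤ C1 * (A + ε) * h := by positivity
    have h2 : 0 ≤ A * h := by positivity
    nlinarith
  · have n3 : n2 0 1 (deriv (fun y => g y + (-1) * q y)) ≤ C1 * (A + ε) := by
      by_contra hc
      push Not at hc
      have := i1.trans e4
      nlinarith
    have e := H.n2le (g := fun y => f' y - deriv g y) ((bf'.sub ((Sh.bmd H hqS'))).sub ((Sh.bmd H hdS))) (fun j hj y hy => by
      beta_reduce
      have e := ((Sh.hd hgS hj hy).fun_add ((Sh.hd hqS' hj hy).const_mul (-1))).deriv
      rw [e]; ring)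
    rw [e.2]
    have := n2_sub zero_le_one (bf'.sub ((Sh.bmd H hqS'))) ((Sh.bmd H hdS))
    linarith
  · have := i2 y hy
    have h1 := sup_aux hh hh1 (by positivity) (this.trans e4)
    have e : f y - g y = (f y - q y) + -(g y + (-1) * q y) := by ring
    rw [e]
    refine (abs_add_le _ _).trans ?_
    linarith [q3 y hy]

theorem n2_LB_top {r : ℕ} (hr : 1 ≤ r) {F G : ℕ → ℝ → ℝ} (hF : Ch 0 1 r F) (hG : Ch 0 1 r G) {c : ℝ}
    (hcF : ∀ j < r, ∀ x ∈ Icc (0:ℝ) 1, |F j x| ≤ c) (hcG : ∀ j < r, ∀ x ∈ Icc (0:ℝ) 1, |G j x| ≤ c)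
    (hKF : n2 0 1 (F r) ≤ c) (hKG : n2 0 1 (G r) ≤ c) : n2 0 1 (LB F G r) ≤ 2^r * (c * c) := by
  have hc0 : 0 ≤ c := (n2_nonneg _ _ _).trans hKF
  have hle : ∀ p ∈ Finset.HasAntidiagonal.antidiagonal r, p.1 + p.2 = r := by
    intro p hp; rwa [Finset.HasAntidiagonal.mem_antidiagonal] at hp
  have nF : ∀ j ≤ r, n2 0 1 (F j) ≤ c := by
    intro j hj
    rcases hj.eq_or_lt with rfl | hj'
    · exact hKF
    · simpa using n2_le_sup zero_le_one (hF.bm hj) (hcF j hj')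
  have nG : ∀ j ≤ r, n2 0 1 (G j) ≤ c := by
    intro j hj
    rcases hj.eq_or_lt with rfl | hj'
    · exact hKG
    · simpa using n2_le_sup zero_le_one (hG.bm hj) (hcG j hj')
  have h1 := n2_sum zero_le_one (Finset.HasAntidiagonal.antidiagonal r) (f := fun p x => (r.choose p.1 : ℝ) * (F p.1 x * G p.2 x)) (fun p hp =>
    ((hF.bm (by have := hle p hp; omega)).mul (hG.bm (by have := hle p hp; omega))).cmul _)
  refine h1.trans ?_
  have h2 : ∀ p ∈ Finset.HasAntidiagonal.antidiagonal r, n2 0 1 (fun x => (r.choose p.1 : ℝ) * (F p.1 x * G p.2 x)) ≤ (r.choose p.1 : ℝ) * (c * c) := by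
    intro p hp
    have hp' := hle p hp
    rw [n2_cmul, abs_of_nonneg (by positivity)]
    refine mul_le_mul_of_nonneg_left ?_ (by positivity)
    by_cases h : p.1 < r
    · refine (n2_mul_sup zero_le_one (hF.bm (by omega)) (hG.bm (by omega)) (hcF p.1 h)).trans ?_
      exact mul_le_mul_of_nonneg_left (nG _ (by omega)) hc0
    · have e : (fun x => F p.1 x * G p.2 x) = fun x => G p.2 x * F p.1 x := by funext x; ring
      rw [e]
      refine (n2_mul_sup zero_le_one (hG.bm (by omega)) (hF.bm (by omega)) (hcG p.2 (by omega))).trans ?_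
      exact mul_le_mul_of_nonneg_left (nF _ (by omega)) hc0
  refine (Finset.sum_le_sum h2).trans ?_
  rw [← Finset.sum_mul]
  have h3 : ∑ p ∈ Finset.HasAntidiagonal.antidiagonal r, (r.choose p.1 : ℝ) = 2^r := by
    rw [Finset.Nat.sum_antidiagonal_eq_sum_range_succ_mk]
    exact_mod_cast Nat.sum_range_choose r
  rw [h3]

noncomputable def idw (f : ℝ → ℝ) : ℕ → ℝ → ℝ := fun j => iteratedDerivWithin j f (Icc 0 1)

theorem idw_ch {f : ℝ → ℝ} {r : ℕ} (hf : ContDiffOn ℝ r f (Icc 0 1)) : Ch 0 1 r (idw f) := by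
  have hu := uniqueDiffOn_Icc (zero_lt_one' ℝ)
  refine ⟨fun i hi x hx => ?_, hf.continuousOn_iteratedDerivWithin le_rfl hu⟩
  have := (hf.differentiableOn_iteratedDerivWithin (by exact_mod_cast hi) hu x hx).hasDerivWithinAt
  unfold idw
  rw [iteratedDerivWithin_succ]; exact this

theorem idw_zero (f : ℝ → ℝ) : idw f 0 = f := iteratedDerivWithin_zero

theorem Ch.dw {r : ℕ} {F : ℕ → ℝ → ℝ} (h : Ch 0 1 r F) (hr : 1 ≤ r) {x : ℝ} (hx : x ∈ Icc (0:ℝ) 1) : derivWithin (F 0) (Icc 0 1) x = F 1 x :=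
  (h.1 0 (by omega) x hx).derivWithin (uniqueDiffOn_Icc (zero_lt_one' ℝ) x hx)

theorem taylor3 {T B : ℝ} {f f1 f2 : ℝ → ℝ} (h0 : ∀ t ∈ Icc 0 T, HasDerivWithinAt f (f1 t) (Icc 0 T) t)
    (h1 : ∀ t ∈ Icc 0 T, HasDerivWithinAt f1 (f2 t) (Icc 0 T) t) (hl : ∀ t ∈ Icc 0 T, ∀ s ∈ Icc 0 T, |f2 t - f2 s| ≤ B * |t - s|) (hB : 0 ≤ B)
    {t τ : ℝ} (hτ : 0 ≤ τ) (ht : t ∈ Icc 0 T) (htt : t + τ ∈ Icc 0 T) : |f (t+τ) - f t - τ * f1 t - τ^2/2 * f2 t| ≤ B * τ^3 := by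
  have hsub : Icc t (t+τ) ⊆ Icc 0 T := Icc_subset_Icc ht.1 htt.2
  have a1 : ∀ s ∈ Icc t (t+τ), |f1 s - f1 t - (s - t) * f2 t| ≤ B * τ^2 := by
    intro s hs
    have hd : ∀ y ∈ Icc t (t+τ), HasDerivWithinAt (fun y => f1 y - (y - t) * f2 t) (f2 y - f2 t) (Icc t (t+τ)) y := fun y hy => by
      have := ((h1 y (hsub hy)).mono hsub).sub (((hasDerivWithinAt_id y (Icc t (t+τ))).sub_const t).mul_const (f2 t))
      refine this.congr_deriv ?_
      simp
    have := (convex_Icc t (t+τ)).norm_image_sub_le_of_norm_hasDerivWithin_le hd (C := B * τ) (fun y hy => by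
      rw [Real.norm_eq_abs]
      refine (hl y (hsub hy) t ht).trans (mul_le_mul_of_nonneg_left ?_ hB)
      rw [abs_of_nonneg (by linarith [hy.1])]; linarith [hy.2]) (left_mem_Icc.2 (by linarith)) hs
    simp only [Real.norm_eq_abs, sub_self, zero_mul, sub_zero] at this
    have e : f1 s - f1 t - (s-t) * f2 t = f1 s - (s - t) * f2 t - f1 t := by ring
    rw [e]
    refine this.trans ?_
    rw [abs_of_nonneg (by linarith [hs.1]), sq, ← mul_assoc]
    exact mul_le_mul_of_nonneg_left (by linarith [hs.2]) (by positivity)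
  have hd : ∀ y ∈ Icc t (t+τ), HasDerivWithinAt (fun y => f y - (y - t) * f1 t - (y-t)^2/2 * f2 t) (f1 y - f1 t - (y - t) * f2 t) (Icc t (t+τ)) y := fun y hy => by
    have h2 := ((hasDerivWithinAt_id y (Icc t (t+τ))).sub_const t)
    have := (((h0 y (hsub hy)).mono hsub).sub (h2.mul_const (f1 t))).sub (((h2.pow 2).div_const 2).mul_const (f2 t))
    refine this.congr_deriv ?_
    simp
  have := (convex_Icc t (t+τ)).norm_image_sub_le_of_norm_hasDerivWithin_le hd (C := B * τ^2) (fun y hy => by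
      rw [Real.norm_eq_abs]; exact a1 y hy) (left_mem_Icc.2 (by linarith)) (right_mem_Icc.2 (by linarith))
  simp only [Real.norm_eq_abs, sub_self, zero_mul, sub_zero, add_sub_cancel_left] at this
  have e : f (t+τ) - f t - τ * f1 t - τ^2/2 * f2 t = f (t + τ) - τ * f1 t - τ ^ 2 / 2 * f2 t - f t := by ring
  rw [e]
  simp only [ne_eq, OfNat.ofNat_ne_zero, not_false_eq_true, zero_pow, zero_div, zero_mul, sub_zero] at this
  refine this.trans (le_of_eq ?_)
  rw [abs_of_nonneg hτ]; ring

/-- regularity package used by the finite element analysis -/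
structure Reg (T K : ℝ) (r : ℕ) (p u p1 u1 : ℝ → ℕ → ℝ → ℝ) : Prop where
  chp : ∀ t ∈ Icc 0 T, Ch 0 1 r (p t)
  chu : ∀ t ∈ Icc 0 T, Ch 0 1 r (u t)
  chp1 : ∀ t ∈ Icc 0 T, Ch 0 1 (r-1) (p1 t)
  chu1 : ∀ t ∈ Icc 0 T, Ch 0 1 (r-1) (u1 t)
  nn : ∀ t ∈ Icc 0 T, n2 0 1 (p t r) ≤ K ∧ n2 0 1 (u t r) ≤ K ∧ n2 0 1 (p1 t (r-1)) ≤ K ∧ n2 0 1 (u1 t (r-1)) ≤ K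
  ss : ∀ t ∈ Icc 0 T, ∀ j < 2, ∀ x ∈ Icc (0:ℝ) 1, |p t j x| ≤ K ∧ |u t j x| ≤ K ∧ |p1 t j x| ≤ K ∧ |u1 t j x| ≤ K
  eqp : ∀ t ∈ Icc 0 T, ∀ x ∈ Icc (0:ℝ) 1, p1 t 0 x = -(1/2 * (p t 0 x * u t 1 x + p t 1 x * u t 0 x))
  equ : ∀ t ∈ Icc 0 T, ∀ x ∈ Icc (0:ℝ) 1, u1 t 0 x = -(1/2 * (p t 0 x * p t 1 x) + 3/2 * (u t 0 x * u t 1 x))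
  bc : ∀ t ∈ Icc 0 T, u t 0 0 = 0 ∧ u t 0 1 = 0 ∧ u1 t 0 0 = 0 ∧ u1 t 0 1 = 0
  c1 : ∀ t ∈ Icc 0 T, ∀ τ : ℝ, 0 ≤ τ → t + τ ∈ Icc 0 T → ∀ x ∈ Icc (0:ℝ) 1,
    |p (t+τ) 0 x - p t 0 x + τ/2 * ((p t 0 x + τ/2 * p1 t 0 x) * (u t 1 x + τ/2 * u1 t 1 x) + (p t 1 x + τ/2 * p1 t 1 x) * (u t 0 x + τ/2 * u1 t 0 x))| ≤ K * τ^3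
  c2 : ∀ t ∈ Icc 0 T, ∀ τ : ℝ, 0 ≤ τ → t + τ ∈ Icc 0 T → ∀ x ∈ Icc (0:ℝ) 1,
    |u (t+τ) 0 x - u t 0 x + τ/2 * ((p t 0 x + τ/2 * p1 t 0 x) * (p t 1 x + τ/2 * p1 t 1 x) + 3 * ((u t 0 x + τ/2 * u1 t 0 x) * (u t 1 x + τ/2 * u1 t 1 x)))| ≤ K * τ^3

set_option maxHeartbeats 2000000 in
theorem reg_of_sol {T B : ℝ} {r : ℕ} (hr : 3 ≤ r) (hT : 0 < T) {p u p1 u1 : ℝ → ℕ → ℝ → ℝ} (s : Sol2 T B r p u p1 u1) {p2 u2 : ℝ → ℝ → ℝ}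
    (hp2 : ∀ x ∈ Icc (0:ℝ) 1, ∀ t ∈ Icc 0 T, HasDerivWithinAt (fun t => p1 t 0 x) (p2 t x) (Icc 0 T) t)
    (hu2 : ∀ x ∈ Icc (0:ℝ) 1, ∀ t ∈ Icc 0 T, HasDerivWithinAt (fun t => u1 t 0 x) (u2 t x) (Icc 0 T) t)
    (lp2 : ∀ x ∈ Icc (0:ℝ) 1, ∀ t ∈ Icc 0 T, ∀ s ∈ Icc 0 T, |p2 t x - p2 s x| ≤ B * |t - s|)
    (lu2 : ∀ x ∈ Icc (0:ℝ) 1, ∀ t ∈ Icc 0 T, ∀ s ∈ Icc 0 T, |u2 t x - u2 s x| ≤ B * |t - s|) : ∃ K, 1 ≤ K ∧ Reg T K r p u p1 u1 := by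
  have h0T : (0:ℝ) ∈ Icc 0 T := ⟨le_rfl, hT.le⟩
  have hB : 0 ≤ B := (abs_nonneg _).trans (s.bd 0 h0T 0 (by simp)).1
  obtain ⟨K0, hK0⟩ := hr_global (by omega) s hT
  obtain ⟨C, hC, hsob⟩ := sob r
  obtain ⟨C', hC', hsob'⟩ := sob (r-1)
  have nsup : ∀ {f : ℝ → ℝ}, BM 0 1 f → (∀ x ∈ Icc (0:ℝ) 1, |f x| ≤ B) → n2 0 1 f ≤ B := fun hf h => by simpa using n2_le_sup zero_le_one hf h
  have hKp : ∀ t ∈ Icc 0 T, n2 0 1 (p t r) ≤ K0 := fun t ht => by linarith [hK0 t ht, n2_nonneg 0 1 (u t r)]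
  have hKu : ∀ t ∈ Icc 0 T, n2 0 1 (u t r) ≤ K0 := fun t ht => by linarith [hK0 t ht, n2_nonneg 0 1 (p t r)]
  have hK00 : 0 ≤ K0 := (n2_nonneg _ _ _).trans (hKp 0 h0T)
  set K1 := C * (B + K0) with hK1
  have hK0K1 : K0 ≤ K1 := by nlinarith
  have sp : ∀ t ∈ Icc 0 T, ∀ j < r, ∀ x ∈ Icc (0:ℝ) 1, |p t j x| ≤ K1 := fun t ht j hj x hx =>
    (hsob (p t) (s.chp t ht) j hj x hx).trans (mul_le_mul_of_nonneg_left (add_le_add (nsup ((s.chp t ht).bm (by omega)) (fun x hx => (s.bd t ht x hx).1)) (hKp t ht)) (by linarith))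
  have su : ∀ t ∈ Icc 0 T, ∀ j < r, ∀ x ∈ Icc (0:ℝ) 1, |u t j x| ≤ K1 := fun t ht j hj x hx =>
    (hsob (u t) (s.chu t ht) j hj x hx).trans (mul_le_mul_of_nonneg_left (add_le_add (nsup ((s.chu t ht).bm (by omega)) (fun x hx => (s.bd t ht x hx).2.1)) (hKu t ht)) (by linarith))
  set K2 := 2^r * (K1 * K1) with hK2
  have hK20 : 0 ≤ K2 := by positivity
  have npu : ∀ t ∈ Icc 0 T, n2 0 1 (LB (p t) (u t) r) ≤ K2 := fun t ht => n2_LB_top (by omega) (s.chp t ht) (s.chu t ht) (sp t ht) (su t ht) ((hKp t ht).trans hK0K1) ((hKu t ht).trans hK0K1)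
  have npp : ∀ t ∈ Icc 0 T, n2 0 1 (LB (p t) (p t) r) ≤ K2 := fun t ht => n2_LB_top (by omega) (s.chp t ht) (s.chp t ht) (sp t ht) (sp t ht) ((hKp t ht).trans hK0K1) ((hKp t ht).trans hK0K1)
  have nuu : ∀ t ∈ Icc 0 T, n2 0 1 (LB (u t) (u t) r) ≤ K2 := fun t ht => n2_LB_top (by omega) (s.chu t ht) (s.chu t ht) (su t ht) (su t ht) ((hKu t ht).trans hK0K1) ((hKu t ht).trans hK0K1)
  have er : r - 1 + 1 = r := by omega
  have np1 : ∀ t ∈ Icc 0 T, n2 0 1 (p1 t (r-1)) ≤ K2 := fun t ht => by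
    have e : n2 0 1 (p1 t (r-1)) = n2 0 1 (fun x => (-(1/2)) * LB (p t) (u t) r x) := n2_congr zero_le_one (fun x hx => by
      rw [s.p1eq (by omega) ht (r-1) (by omega) x hx, er]; unfold F1; ring)
    rw [e, n2_cmul]
    have := npu t ht
    have h1 : |(-(1/2):ℝ)| = 1/2 := by norm_num
    rw [h1]; linarith
  have nu1 : ∀ t ∈ Icc 0 T, n2 0 1 (u1 t (r-1)) ≤ K2 := fun t ht => by
    have e : n2 0 1 (u1 t (r-1)) = n2 0 1 (fun x => (-(1/4)) * LB (p t) (p t) r x + (-(3/4)) * LB (u t) (u t) r x) := n2_congr zero_le_one (fun x hx => by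
      rw [s.u1eq (by omega) ht (r-1) (by omega) x hx, er]; unfold F2; ring)
    rw [e]
    refine (n2_add zero_le_one ((((s.chp t ht).mul (s.chp t ht)).bm le_rfl).cmul _) ((((s.chu t ht).mul (s.chu t ht)).bm le_rfl).cmul _)).trans ?_
    rw [n2_cmul, n2_cmul]
    have := npp t ht
    have := nuu t ht
    have h1 : |(-(1/4):ℝ)| = 1/4 := by norm_num
    have h2 : |(-(3/4):ℝ)| = 3/4 := by rw [abs_neg, abs_of_nonneg (by norm_num)]
    rw [h1, h2]; linarith
  have chp1 : ∀ t ∈ Icc 0 T, Ch 0 1 (r-1) (p1 t) := fun t ht => (s.chp1 t ht).le (by omega)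
  have chu1 : ∀ t ∈ Icc 0 T, Ch 0 1 (r-1) (u1 t) := fun t ht => (s.chu1 t ht).le (by omega)
  set K3 := C' * (B + K2) with hK3
  have hK30 : 0 ≤ K3 := by positivity
  have sp1 : ∀ t ∈ Icc 0 T, ∀ j < r - 1, ∀ x ∈ Icc (0:ℝ) 1, |p1 t j x| ≤ K3 := fun t ht j hj x hx =>
    (hsob' (p1 t) (chp1 t ht) j hj x hx).trans (mul_le_mul_of_nonneg_left (add_le_add (nsup ((chp1 t ht).bm (by omega)) (fun x hx => (s.bd t ht x hx).2.2.1)) (np1 t ht)) (by linarith))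
  have su1 : ∀ t ∈ Icc 0 T, ∀ j < r - 1, ∀ x ∈ Icc (0:ℝ) 1, |u1 t j x| ≤ K3 := fun t ht j hj x hx =>
    (hsob' (u1 t) (chu1 t ht) j hj x hx).trans (mul_le_mul_of_nonneg_left (add_le_add (nsup ((chu1 t ht).bm (by omega)) (fun x hx => (s.bd t ht x hx).2.2.2)) (nu1 t ht)) (by linarith))
  have cp := commut hT (q := p) (q1 := p1) (fun t ht => (s.chp t ht).le (by omega : r - 1 ≤ r)) chp1 s.dp (fun t ht x hx => (s.bd t ht x hx).2.2.1) s.lp1 np1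
  have cu := commut hT (q := u) (q1 := u1) (fun t ht => (s.chu t ht).le (by omega : r - 1 ≤ r)) chu1 s.du (fun t ht x hx => (s.bd t ht x hx).2.2.2) s.lu1 nu1
  have eqp : ∀ t ∈ Icc 0 T, ∀ x ∈ Icc (0:ℝ) 1, p1 t 0 x = -(1/2 * (p t 0 x * u t 1 x + p t 1 x * u t 0 x)) := fun t ht x hx => by rw [s.eqp t ht x hx, F1_one]
  have equ : ∀ t ∈ Icc 0 T, ∀ x ∈ Icc (0:ℝ) 1, u1 t 0 x = -(1/2 * (p t 0 x * p t 1 x) + 3/2 * (u t 0 x * u t 1 x)) := fun t ht x hx => by rw [s.equ t ht x hx, F2_one]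
  have ep2 : ∀ x ∈ Icc (0:ℝ) 1, ∀ t ∈ Icc 0 T, p2 t x = -(1/2 * ((p1 t 0 x * u t 1 x + p t 0 x * u1 t 1 x) + (p1 t 1 x * u t 0 x + p t 1 x * u1 t 0 x))) := by
    intro x hx t ht
    refine (uniqueDiffOn_Icc hT t ht).eq_deriv _ (hp2 x hx t ht) ?_
    refine HasDerivWithinAt.congr ?_ (fun t ht => eqp t ht x hx) (eqp t ht x hx)
    exact ((((cp 0 (by omega) t ht x hx).mul (cu 1 (by omega) t ht x hx)).add ((cp 1 (by omega) t ht x hx).mul (cu 0 (by omega) t ht x hx))).const_mul (1/2)).neg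
  have eu2 : ∀ x ∈ Icc (0:ℝ) 1, ∀ t ∈ Icc 0 T, u2 t x = -(1/2 * (p1 t 0 x * p t 1 x + p t 0 x * p1 t 1 x) + 3/2 * (u1 t 0 x * u t 1 x + u t 0 x * u1 t 1 x)) := by
    intro x hx t ht
    refine (uniqueDiffOn_Icc hT t ht).eq_deriv _ (hu2 x hx t ht) ?_
    refine HasDerivWithinAt.congr ?_ (fun t ht => equ t ht x hx) (equ t ht x hx)
    exact ((((cp 0 (by omega) t ht x hx).mul (cp 1 (by omega) t ht x hx)).const_mul (1/2)).add (((cu 0 (by omega) t ht x hx).mul (cu 1 (by omega) t ht x hx)).const_mul (3/2))).neg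
  have hKK : 0 ≤ K3 * K3 := by positivity
  have hK10 : 0 ≤ K1 := by linarith
  refine ⟨1 + B + K1 + K2 + K3 + K3 * K3, by linarith, s.chp, s.chu, chp1, chu1, ?_, ?_, eqp, equ, ?_, ?_, ?_⟩
  · intro t ht
    have := hKp t ht; have := hKu t ht; have := np1 t ht; have := nu1 t ht
    refine ⟨?_, ?_, ?_, ?_⟩ <;> linarith
  · intro t ht j hj x hx
    have := sp t ht j (by omega) x hx; have := su t ht j (by omega) x hx
    have := sp1 t ht j (by omega) x hx; have := su1 t ht j (by omega) x hx
    refine ⟨?_, ?_, ?_, ?_⟩ <;> linarith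
  · intro t ht
    exact ⟨(s.bc t ht).1, (s.bc t ht).2, zero_deriv hT (s.du t ht 0 (by simp)) ht (fun t ht => (s.bc t ht).1), zero_deriv hT (s.du t ht 1 (by simp)) ht (fun t ht => (s.bc t ht).2)⟩
  · intro t ht τ hτ htt x hx
    have ta := taylor3 (f := fun t => p t 0 x) (fun t ht => s.dp t ht x hx) (hp2 x hx) (lp2 x hx) hB hτ ht htt
    beta_reduce at ta
    rw [ep2 x hx t ht] at ta
    have e1 := abs_mul_le (sp1 t ht 0 (by omega) x hx) (su1 t ht 1 (by omega) x hx)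
    have e2 := abs_mul_le (sp1 t ht 1 (by omega) x hx) (su1 t ht 0 (by omega) x hx)
    have e3 := eqp t ht x hx
    set Q := p (t + τ) 0 x - p t 0 x - τ * p1 t 0 x - τ ^ 2 / 2 * -(1 / 2 * (p1 t 0 x * u t 1 x + p t 0 x * u1 t 1 x + (p1 t 1 x * u t 0 x + p t 1 x * u1 t 0 x))) with hQ
    have e4 : p (t+τ) 0 x - p t 0 x + τ/2 * ((p t 0 x + τ/2 * p1 t 0 x) * (u t 1 x + τ/2 * u1 t 1 x) + (p t 1 x + τ/2 * p1 t 1 x) * (u t 0 x + τ/2 * u1 t 0 x))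
      = Q + τ^3 * (1/8 * (p1 t 0 x * u1 t 1 x) + 1/8 * (p1 t 1 x * u1 t 0 x)) := by
      rw [hQ]; linear_combination τ * e3
    rw [e4]
    refine (abs_add_le _ _).trans ?_
    rw [abs_mul, abs_of_nonneg (by positivity : 0 ≤ τ^3)]
    have e5 : |1/8 * (p1 t 0 x * u1 t 1 x) + 1/8 * (p1 t 1 x * u1 t 0 x)| ≤ K3 * K3 := by
      rw [abs_le] at *; constructor <;> linarith
    have e6 : (0:ℝ) ≤ τ^3 := by positivity
    have e7 := mul_le_mul_of_nonneg_left e5 e6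
    have e8 : 0 ≤ (1 + K1 + K2 + K3) * τ^3 := by positivity
    have e9 : (1 + B + K1 + K2 + K3 + K3 * K3) * τ^3 = B * τ^3 + τ^3 * (K3 * K3) + (1 + K1 + K2 + K3) * τ^3 := by ring
    rw [e9]; linarith
  · intro t ht τ hτ htt x hx
    have ta := taylor3 (f := fun t => u t 0 x) (fun t ht => s.du t ht x hx) (hu2 x hx) (lu2 x hx) hB hτ ht htt
    beta_reduce at ta
    rw [eu2 x hx t ht] at ta
    have e1 := abs_mul_le (sp1 t ht 0 (by omega) x hx) (sp1 t ht 1 (by omega) x hx)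
    have e2 := abs_mul_le (su1 t ht 0 (by omega) x hx) (su1 t ht 1 (by omega) x hx)
    have e3 := equ t ht x hx
    set Q := u (t + τ) 0 x - u t 0 x - τ * u1 t 0 x - τ ^ 2 / 2 * -(1 / 2 * (p1 t 0 x * p t 1 x + p t 0 x * p1 t 1 x) + 3 / 2 * (u1 t 0 x * u t 1 x + u t 0 x * u1 t 1 x)) with hQ
    have e4 : u (t+τ) 0 x - u t 0 x + τ/2 * ((p t 0 x + τ/2 * p1 t 0 x) * (p t 1 x + τ/2 * p1 t 1 x) + 3 * ((u t 0 x + τ/2 * u1 t 0 x) * (u t 1 x + τ/2 * u1 t 1 x)))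
      = Q + τ^3 * (1/8 * (p1 t 0 x * p1 t 1 x) + 3/8 * (u1 t 0 x * u1 t 1 x)) := by
      rw [hQ]; linear_combination τ * e3
    rw [e4]
    refine (abs_add_le _ _).trans ?_
    rw [abs_mul, abs_of_nonneg (by positivity : 0 ≤ τ^3)]
    have e5 : |1/8 * (p1 t 0 x * p1 t 1 x) + 3/8 * (u1 t 0 x * u1 t 1 x)| ≤ K3 * K3 := by
      rw [abs_le] at *; constructor <;> linarith
    have e6 : (0:ℝ) ≤ τ^3 := by positivity
    have e7 := mul_le_mul_of_nonneg_left e5 e6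
    have e8 : 0 ≤ (1 + K1 + K2 + K3) * τ^3 := by positivity
    have e9 : (1 + B + K1 + K2 + K3 + K3 * K3) * τ^3 = B * τ^3 + τ^3 * (K3 * K3) + (1 + K1 + K2 + K3) * τ^3 := by ring
    rw [e9]; linarith

theorem bound_joint {T : ℝ} {f : ℝ → ℝ → ℝ} (h : ContinuousOn (fun p : ℝ × ℝ => f p.1 p.2) ((Icc (0:ℝ) 1) ×ˢ (Icc (0:ℝ) T))) :
    ∃ B, ∀ t ∈ Icc 0 T, ∀ x ∈ Icc (0:ℝ) 1, |f x t| ≤ B := by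
  obtain ⟨B, hB⟩ := (isCompact_Icc.prod isCompact_Icc).exists_bound_of_continuousOn h
  exact ⟨B, fun t ht x hx => hB (x, t) ⟨hx, ht⟩⟩

theorem reg_exists {r : ℕ} (hr : 3 ≤ r) {T : ℝ} (hT : 0 < T) {ηs us : ℕ → ℝ → ℝ → ℝ}
    (hη : SmoothChain T r 3 ηs) (hu : SmoothChain T r 3 us) (hsol : SSW T (ηs 0) (us 0) (ηs 1) (us 1)) :
    ∃ K p u p1 u1, 1 ≤ K ∧ Reg T K r p u p1 u1 ∧ (∀ t x, p t 0 x = ηs 0 x t + 2) ∧ (∀ t x, u t 0 x = us 0 x t) := by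
  obtain ⟨B0, hB0⟩ := bound_joint (hη.2.2 0 (by norm_num))
  obtain ⟨B1, hB1⟩ := bound_joint (hη.2.2 1 (by norm_num))
  obtain ⟨B2, hB2⟩ := bound_joint (hη.2.2 2 (by norm_num))
  obtain ⟨B3, hB3⟩ := bound_joint (hη.2.2 3 (by norm_num))
  obtain ⟨D0, hD0⟩ := bound_joint (hu.2.2 0 (by norm_num))
  obtain ⟨D1, hD1⟩ := bound_joint (hu.2.2 1 (by norm_num))
  obtain ⟨D2, hD2⟩ := bound_joint (hu.2.2 2 (by norm_num))
  obtain ⟨D3, hD3⟩ := bound_joint (hu.2.2 3 (by norm_num))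
  have h0T : (0:ℝ) ∈ Icc 0 T := ⟨le_rfl, hT.le⟩
  have h01 : (0:ℝ) ∈ Icc (0:ℝ) 1 := by simp
  have := (abs_nonneg _).trans (hB0 0 h0T 0 h01)
  have := (abs_nonneg _).trans (hB1 0 h0T 0 h01)
  have := (abs_nonneg _).trans (hB2 0 h0T 0 h01)
  have := (abs_nonneg _).trans (hB3 0 h0T 0 h01)
  have := (abs_nonneg _).trans (hD0 0 h0T 0 h01)
  have := (abs_nonneg _).trans (hD1 0 h0T 0 h01)
  have := (abs_nonneg _).trans (hD2 0 h0T 0 h01)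
  have := (abs_nonneg _).trans (hD3 0 h0T 0 h01)
  set B := 2 + B0 + B1 + B2 + B3 + D0 + D1 + D2 + D3 with hB
  let E : ℕ → ℝ → ℕ → ℝ → ℝ := fun i t => idw (fun y => ηs i y t)
  let U : ℕ → ℝ → ℕ → ℝ → ℝ := fun i t => idw (fun y => us i y t)
  have hE0 : ∀ i t x, E i t 0 x = ηs i x t := fun i t x => by simp only [E, idw_zero]
  have hU0 : ∀ i t x, U i t 0 x = us i x t := fun i t x => by simp only [U, idw_zero]
  have chE : ∀ i ≤ 3, ∀ t ∈ Icc 0 T, Ch 0 1 r (E i t) := fun i hi t ht => idw_ch (hη.2.1 i hi t ht)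
  have chU : ∀ i ≤ 3, ∀ t ∈ Icc 0 T, Ch 0 1 r (U i t) := fun i hi t ht => idw_ch (hu.2.1 i hi t ht)
  let two : ℕ → ℝ → ℝ := fun j _ => if j = 0 then 2 else 0
  have ch2 : Ch 0 1 r two := ⟨fun i hi x hx => by simpa [two] using hasDerivWithinAt_const x (Icc (0:ℝ) 1) (if i = 0 then (2:ℝ) else 0), continuousOn_const⟩
  let p : ℝ → ℕ → ℝ → ℝ := fun t j x => E 0 t j x + two j x
  have p0 : ∀ t x, p t 0 x = ηs 0 x t + 2 := fun t x => by simp [p, hE0, two]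
  have pj : ∀ t x, p t 1 x = E 0 t 1 x := fun t x => by simp [p, two]
  have s : Sol2 T B r p (U 0) (E 1) (U 1) := by
    refine ⟨⟨fun t ht => (chE 0 (by norm_num) t ht).add ch2, chU 0 (by norm_num), ?_, ?_, ?_, ?_, ?_, ?_⟩, chE 1 (by norm_num), chU 1 (by norm_num), ?_, ?_⟩
    · intro t ht x hx
      simp only [p0, hE0]
      exact (hη.1 0 (by norm_num) x hx t ht).add_const 2
    · intro t ht x hx
      simp only [hU0]
      exact hu.1 0 (by norm_num) x hx t ht
    · intro t ht x hx
      have h1 := (hsol.1 x hx t ht).1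
      have hEd := (chE 0 (by norm_num) t ht).1 0 (by omega) x hx
      have hUd := (chU 0 (by norm_num) t ht).1 0 (by omega) x hx
      have eE : E 0 t 0 = fun z => ηs 0 z t := by funext z; exact hE0 0 t z
      have eU : U 0 t 0 = fun z => us 0 z t := by funext z; exact hU0 0 t z
      rw [eE] at hEd
      rw [eU] at hUd
      have ud := uniqueDiffOn_Icc (zero_lt_one' ℝ) x hx
      rw [hUd.derivWithin ud, (hEd.fun_mul hUd).derivWithin ud] at h1
      rw [F1_one, p0, pj, hE0, hU0]
      simp only [zero_add] at h1
      linarith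
    · intro t ht x hx
      have h1 := (hsol.1 x hx t ht).2
      have hEd := (chE 0 (by norm_num) t ht).1 0 (by omega) x hx
      have hUd := (chU 0 (by norm_num) t ht).1 0 (by omega) x hx
      have eE : E 0 t 0 = fun z => ηs 0 z t := by funext z; exact hE0 0 t z
      have eU : U 0 t 0 = fun z => us 0 z t := by funext z; exact hU0 0 t z
      rw [eE] at hEd
      rw [eU] at hUd
      have ud := uniqueDiffOn_Icc (zero_lt_one' ℝ) x hx
      rw [hUd.derivWithin ud, hEd.derivWithin ud] at h1
      rw [F2_one, p0, pj, hU0, hU0]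
      simp only [zero_add] at h1
      linarith
    · intro t ht
      rw [hU0, hU0]; exact hsol.2 t ht
    · intro t ht x hx
      rw [p0, hU0, hE0, hU0]
      have := hB0 t ht x hx; have := hB1 t ht x hx; have := hD0 t ht x hx; have := hD1 t ht x hx
      have h2 := abs_add_le (ηs 0 x t) 2
      rw [abs_of_pos (by norm_num : (0:ℝ) < 2)] at h2
      refine ⟨?_, ?_, ?_, ?_⟩ <;> linarith
    · intro t ht t' ht' x hx
      rw [hE0, hE0]
      exact lip_of_deriv (f := fun t => ηs 1 x t) (f' := fun t => ηs 2 x t) (fun t ht => hη.1 1 (by norm_num) x hx t ht) (fun t ht => (hB2 t ht x hx).trans (by linarith)) ht ht'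
    · intro t ht t' ht' x hx
      rw [hU0, hU0]
      exact lip_of_deriv (f := fun t => us 1 x t) (f' := fun t => us 2 x t) (fun t ht => hu.1 1 (by norm_num) x hx t ht) (fun t ht => (hD2 t ht x hx).trans (by linarith)) ht ht'
  obtain ⟨K, hK, hR⟩ := reg_of_sol hr hT s (p2 := fun t x => ηs 2 x t) (u2 := fun t x => us 2 x t)
    (fun x hx t ht => by simp only [hE0]; exact hη.1 1 (by norm_num) x hx t ht)
    (fun x hx t ht => by simp only [hU0]; exact hu.1 1 (by norm_num) x hx t ht)
    (fun x hx t ht t' ht' => lip_of_deriv (f := fun t => ηs 2 x t) (f' := fun t => ηs 3 x t) (fun t ht => hη.1 2 (by norm_num) x hx t ht) (fun t ht => (hB3 t ht x hx).trans (by linarith)) ht ht')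
    (fun x hx t ht t' ht' => lip_of_deriv (f := fun t => us 2 x t) (f' := fun t => us 3 x t) (fun t ht => hu.1 2 (by norm_num) x hx t ht) (fun t ht => (hD3 t ht x hx).trans (by linarith)) ht ht')
  exact ⟨K, p, U 0, E 1, U 1, hK, hR, p0, fun t x => hU0 0 t x⟩

theorem prod_est {K a : ℝ} {f g' F G' : ℝ → ℝ} (bf : BM 0 1 f) (bg : BM 0 1 g') (bF : BM 0 1 F) (bG : BM 0 1 G')
    (hf : ∀ y ∈ Icc (0:ℝ) 1, |f y| ≤ K) (hg : ∀ y ∈ Icc (0:ℝ) 1, |g' y| ≤ K) (h1 : ∀ y ∈ Icc (0:ℝ) 1, |f y - F y| ≤ a)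
    (h2 : n2 0 1 (fun y => g' y - G' y) ≤ a) : n2 0 1 (fun y => f y * g' y - F y * G' y) ≤ a * (2 * K + a) := by
  have ha : 0 ≤ a := (n2_nonneg _ _ _).trans h2
  have hK : 0 ≤ K := (abs_nonneg _).trans (hf 0 (by simp))
  have e : (fun y => f y * g' y - F y * G' y) = fun y => F y * (g' y - G' y) + (f y - F y) * g' y := by funext y; ring
  rw [e]
  refine (n2_add zero_le_one (bF.mul (bg.sub bG)) ((bf.sub bF).mul bg)).trans ?_
  have i1 := n2_mul_sup zero_le_one bF (bg.sub bG) (c := K + a) (fun y hy => by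
    have e : F y = f y - (f y - F y) := by ring
    rw [e]; exact (abs_sub _ _).trans (add_le_add (hf y hy) (h1 y hy)))
  have i2 := n2_mul_sup zero_le_one (bf.sub bF) bg h1
  have i3 : n2 0 1 g' ≤ K := by simpa using n2_le_sup zero_le_one bg hg
  have i4 : (K + a) * n2 0 1 (fun y => g' y - G' y) ≤ (K + a) * a := mul_le_mul_of_nonneg_left h2 (by positivity)
  have i5 : a * n2 0 1 g' ≤ a * K := mul_le_mul_of_nonneg_left i3 ha
  nlinarith

theorem brk_est {K a c : ℝ} (hc : 0 ≤ c) (hc3 : c ≤ 3) {f g' F G' v w' V W' : ℝ → ℝ} (bf : BM 0 1 f) (bg : BM 0 1 g') (bF : BM 0 1 F) (bG : BM 0 1 G')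
    (bv : BM 0 1 v) (bw : BM 0 1 w') (bV : BM 0 1 V) (bW : BM 0 1 W')
    (hf : ∀ y ∈ Icc (0:ℝ) 1, |f y| ≤ K) (hg : ∀ y ∈ Icc (0:ℝ) 1, |g' y| ≤ K) (h1 : ∀ y ∈ Icc (0:ℝ) 1, |f y - F y| ≤ a)
    (h2 : n2 0 1 (fun y => g' y - G' y) ≤ a)
    (hv : ∀ y ∈ Icc (0:ℝ) 1, |v y| ≤ K) (hw : ∀ y ∈ Icc (0:ℝ) 1, |w' y| ≤ K) (h3 : ∀ y ∈ Icc (0:ℝ) 1, |v y - V y| ≤ a)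
    (h4 : n2 0 1 (fun y => w' y - W' y) ≤ a) :
    n2 0 1 (fun y => (f y * g' y + c * (v y * w' y)) - (F y * G' y + c * (V y * W' y))) ≤ 4 * (a * (2 * K + a)) := by
  have e : (fun y => (f y * g' y + c * (v y * w' y)) - (F y * G' y + c * (V y * W' y))) = fun y => (f y * g' y - F y * G' y) + c * (v y * w' y - V y * W' y) := by funext y; ring
  rw [e]
  refine (n2_add zero_le_one ((bf.mul bg).sub (bF.mul bG)) (((bv.mul bw).sub (bV.mul bW)).cmul c)).trans ?_
  rw [n2_cmul, abs_of_nonneg hc]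
  have i1 := prod_est bf bg bF bG hf hg h1 h2
  have i2 := prod_est bv bw bV bW hv hw h3 h4
  have i3 := n2_nonneg 0 1 (fun y => v y * w' y - V y * W' y)
  nlinarith

theorem stage_est {τ a D : ℝ} (hτ : 0 ≤ τ) {f f1 b F Bk : ℝ → ℝ} (bf : BM 0 1 f) (bb : BM 0 1 b) (bF : BM 0 1 F) (bB : BM 0 1 Bk)
    (hf1 : ∀ y ∈ Icc (0:ℝ) 1, f1 y = -(1/2 * b y)) (h1 : n2 0 1 (fun y => f y - F y) ≤ a) (h2 : n2 0 1 (fun y => b y - Bk y) ≤ D) :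
    n2 0 1 (fun y => (F y - τ/4 * Bk y) - (f y + τ/2 * f1 y)) ≤ a + τ/4 * D := by
  have e : n2 0 1 (fun y => (F y - τ/4 * Bk y) - (f y + τ/2 * f1 y)) = n2 0 1 (fun y => (τ/4) * (b y - Bk y) - (f y - F y)) :=
    n2_congr zero_le_one (fun y hy => by beta_reduce; rw [hf1 y hy]; ring)
  rw [e]
  refine (n2_sub zero_le_one ((bb.sub bB).cmul _) (bf.sub bF)).trans ?_
  rw [n2_cmul, abs_of_nonneg (by positivity)]
  have := mul_le_mul_of_nonneg_left h2 (by positivity : 0 ≤ τ/4)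
  linarith

theorem final_est {τ c D : ℝ} (hτ : 0 ≤ τ) {f fn b Bk : ℝ → ℝ} (bf : BM 0 1 f) (bfn : BM 0 1 fn) (bb : BM 0 1 b) (bB : BM 0 1 Bk)
    (h1 : ∀ y ∈ Icc (0:ℝ) 1, |fn y - f y + τ/2 * b y| ≤ c) (h2 : n2 0 1 (fun y => b y - Bk y) ≤ D) :
    n2 0 1 (fun y => fn y - f y + τ/2 * Bk y) ≤ c + τ/2 * D := by
  have e : (fun y => fn y - f y + τ/2 * Bk y) = fun y => (fn y - f y + τ/2 * b y) - τ/2 * (b y - Bk y) := by funext y; ring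
  rw [e]
  have b1 := (bfn.sub bf).add (bb.cmul (τ/2))
  refine (n2_sub zero_le_one b1 ((bb.sub bB).cmul _)).trans ?_
  rw [n2_cmul, abs_of_nonneg (by positivity)]
  have := mul_le_mul_of_nonneg_left h2 (by positivity : 0 ≤ τ/2)
  have i2 : n2 0 1 (fun y => fn y - f y + τ/2 * b y) ≤ c := by simpa using n2_le_sup zero_le_one b1 h1
  linarith

set_option maxHeartbeats 2000000 in
theorem fe_core {r : ℕ} (hr : 3 ≤ r) {γ T K : ℝ} (hγ : 1 ≤ γ) (hT : 0 < T) (hK : 1 ≤ K) {p u p1 u1 : ℝ → ℕ → ℝ → ℝ} (R : Reg T K r p u p1 u1) :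
    ∃ c : ℝ, 0 ≤ c ∧ ∀ (N k : ℕ) (x : ℕ → ℝ) (h : ℝ), k ≤ r - 2 → Msh N x h → QuasiUniform N x h γ →
    ∀ t ∈ Icc 0 T, ∀ τ : ℝ, 0 < τ → t + τ ∈ Icc 0 T → ∀ P U Pn Un P1 U1 d1 d2 : ℝ → ℝ,
    P ∈ Sh N r k x → U ∈ Sh0 N r k x → Pn ∈ Sh N r k x → Un ∈ Sh0 N r k x → P1 ∈ Sh N r k x → U1 ∈ Sh0 N r k x → d1 ∈ Sh N r k x → d2 ∈ Sh0 N r k x →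
    (∀ χ ∈ Sh N r k x, ∫ y in (0:ℝ)..1, P y * χ y = ∫ y in (0:ℝ)..1, p t 0 y * χ y) →
    (∀ χ ∈ Sh0 N r k x, ∫ y in (0:ℝ)..1, U y * χ y = ∫ y in (0:ℝ)..1, u t 0 y * χ y) →
    (∀ χ ∈ Sh N r k x, ∫ y in (0:ℝ)..1, Pn y * χ y = ∫ y in (0:ℝ)..1, p (t+τ) 0 y * χ y) →
    (∀ χ ∈ Sh0 N r k x, ∫ y in (0:ℝ)..1, Un y * χ y = ∫ y in (0:ℝ)..1, u (t+τ) 0 y * χ y) →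
    (∀ χ ∈ Sh N r k x, ∫ y in (0:ℝ)..1, P1 y * χ y = ∫ y in (0:ℝ)..1, (P y - τ/4 * (P y * deriv U y + 1 * (U y * deriv P y))) * χ y) →
    (∀ χ ∈ Sh0 N r k x, ∫ y in (0:ℝ)..1, U1 y * χ y = ∫ y in (0:ℝ)..1, (U y - τ/4 * (P y * deriv P y + 3 * (U y * deriv U y))) * χ y) →
    (∀ χ ∈ Sh N r k x, ∫ y in (0:ℝ)..1, d1 y * χ y = ∫ y in (0:ℝ)..1, (Pn y - P y + τ/2 * (P1 y * deriv U1 y + 1 * (U1 y * deriv P1 y))) * χ y) →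
    (∀ χ ∈ Sh0 N r k x, ∫ y in (0:ℝ)..1, d2 y * χ y = ∫ y in (0:ℝ)..1, (Un y - U y + τ/2 * (P1 y * deriv P1 y + 3 * (U1 y * deriv U1 y))) * χ y) →
    n2 0 1 d1 + n2 0 1 d2 ≤ c * (1 + τ/h)^2 * τ * (τ^2 + h^(r-1)) := by
  obtain ⟨Cp, hCp, HP⟩ := proj_est r γ hγ
  obtain ⟨Ca, hCa, HA⟩ := ap_exists r r (by omega) le_rfl γ hγ
  obtain ⟨Cb, hCb, HB⟩ := ap_exists r (r-1) (by omega) (by omega) γ hγ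
  set A0 := Cp * (Ca * (K+1)) with hA0
  have A0n : 0 ≤ A0 := by positivity
  set E1 := (Ca + Cb) * (K + 1) with hE1
  have E1n : 0 ≤ E1 := by positivity
  set A1 := Cp * (A0 * (1 + 2 * K + A0) + E1) with hA1
  have A1n : 0 ≤ A1 := by positivity
  set K1 := K * (1 + T) with hK1
  have K1n : 0 ≤ K1 := by positivity
  refine ⟨2 * K + 4 * (A1 * (2 * K1 + A1)), by positivity, ?_⟩
  intro N k x h hk M hq t ht τ hτ htt P U Pn Un P1 U1 d1 d2 hP hU hPn hUn hP1 hU1 hd1 hd2 wP wU wPn wUn wP1 wU1 wd1 wd2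
  have hh := M.hpos
  have hh1 := M.hle
  have hτT : τ ≤ T := by linarith [htt.2, ht.1]
  set Hh := h^(r-1) with hHh
  have Hh0 : 0 < Hh := by positivity
  have Hh1 : Hh ≤ 1 := pow_le_one₀ hh.le hh1
  set L := 1 + τ/h with hL
  have hL1 : 1 ≤ L := by rw [hL]; linarith [div_pos hτ hh]
  have hLh : L * h = h + τ := by rw [hL]; field_simp
  have hpw : h^(r-1-1) * h = Hh := by rw [hHh, ← pow_succ]; congr 1; omega
  have hτp : τ * h^(r-1-1) ≤ L * Hh := by
    rw [← hpw, mul_comm _ h, ← mul_assoc, hLh]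
    exact mul_le_mul_of_nonneg_right (by linarith) (by positivity)
  have sS := spc_sh N r k x
  have sS0 := spc_sh0 N r k x
  have chp := R.chp t ht
  have chu := R.chu t ht
  have chp1 := R.chp1 t ht
  have chu1 := R.chu1 t ht
  obtain ⟨np, nu, np1, nu1⟩ := R.nn t ht
  obtain ⟨bc0, bc1, bc2, bc3⟩ := R.bc t ht
  have bp0 : BM 0 1 (p t 0) := chp.bm (by omega)
  have bp1 : BM 0 1 (p t 1) := chp.bm (by omega)
  have bu0 : BM 0 1 (u t 0) := chu.bm (by omega)
  have bu1 : BM 0 1 (u t 1) := chu.bm (by omega)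
  have bq0 : BM 0 1 (p1 t 0) := chp1.bm (by omega)
  have bq1 : BM 0 1 (p1 t 1) := chp1.bm (by omega)
  have bv0 : BM 0 1 (u1 t 0) := chu1.bm (by omega)
  have bv1 : BM 0 1 (u1 t 1) := chu1.bm (by omega)
  have bpn : BM 0 1 (p (t+τ) 0) := (R.chp _ htt).bm (by omega)
  have bun : BM 0 1 (u (t+τ) 0) := (R.chu _ htt).bm (by omega)
  have zz : ∀ f : ℝ → ℝ, n2 0 1 (fun y => f y - f y) ≤ 0 * h := fun f => by simp [n2]
  -- first level
  have apP := (HA N k x h hk M hq (p t) chp K np).1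
  have apU := (HA N k x h hk M hq (u t) chu K nu).2 bc0 bc1
  obtain ⟨P_1, P_2, P_3⟩ := HP N k x h M hq _ sS _ _ P (p t 0) 0 _ bp0 bp1 bp0 hP apP wP (zz _)
  obtain ⟨U_1, U_2, U_3⟩ := HP N k x h M hq _ sS0 _ _ U (u t 0) 0 _ bu0 bu1 bu0 hU apU wU (zz _)
  have eA0 : Cp * (0 + Ca * (K + 1) * h^(r-1)) = A0 * Hh := by rw [hA0]; ring
  rw [eA0] at P_1 P_2 P_3 U_1 U_2 U_3
  have hU' := hU.1
  have hU1' := hU1.1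
  have cP := Sh.bm hP
  have cU := Sh.bm hU'
  have cP' := Sh.bmd M hP
  have cU' := Sh.bmd M hU'
  have cP1 := Sh.bm hP1
  have cU1 := Sh.bm hU1'
  have cP1' := Sh.bmd M hP1
  have cU1' := Sh.bmd M hU1'
  have ss0 := R.ss t ht 0 (by norm_num)
  have ss1 := R.ss t ht 1 (by norm_num)
  have bk1 := brk_est (c := 1) (by norm_num) (by norm_num) bp0 bu1 cP cU' bu0 bp1 cU cP' (fun y hy => (ss0 y hy).1) (fun y hy => (ss1 y hy).2.1) P_3 U_2
    (fun y hy => (ss0 y hy).2.1) (fun y hy => (ss1 y hy).1) U_3 P_2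
  have bk2 := brk_est (c := 3) (by norm_num) (by norm_num) bp0 bp1 cP cP' bu0 bu1 cU cU' (fun y hy => (ss0 y hy).1) (fun y hy => (ss1 y hy).1) P_3 P_2
    (fun y hy => (ss0 y hy).2.1) (fun y hy => (ss1 y hy).2.1) U_3 U_2
  have st1 := stage_est hτ.le (f1 := p1 t 0) bp0 ((bp0.mul bu1).add ((bu0.mul bp1).cmul 1)) cP ((cP.mul cU').add ((cU.mul cP').cmul 1))
    (fun y hy => by rw [R.eqp t ht y hy]; ring) P_1 bk1
  have st2 := stage_est hτ.le (f1 := u1 t 0) bu0 ((bp0.mul bp1).add ((bu0.mul bu1).cmul 3)) cU ((cP.mul cP').add ((cU.mul cU').cmul 3))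
    (fun y hy => by rw [R.equ t ht y hy]; ring) U_1 bk2
  have hA : A0 * Hh * h + τ/4 * (4 * (A0 * Hh * (2 * K + A0 * Hh))) ≤ (A0 * (1 + 2 * K + A0) * L * Hh) * h := by
    have e1 : (A0 * (1 + 2 * K + A0) * L * Hh) * h = A0 * Hh * ((1 + 2 * K + A0) * (h + τ)) := by rw [← hLh]; ring
    have e2 : A0 * Hh * h + τ/4 * (4 * (A0 * Hh * (2 * K + A0 * Hh))) = A0 * Hh * (h + τ * (2 * K + A0 * Hh)) := by ring
    rw [e1, e2]
    refine mul_le_mul_of_nonneg_left ?_ (by positivity)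
    have e3 : A0 * Hh ≤ A0 := mul_le_of_le_one_right A0n Hh1
    have e4 : τ * (2 * K + A0 * Hh) ≤ τ * (2 * K + A0) := mul_le_mul_of_nonneg_left (by linarith) hτ.le
    have e5 : 0 ≤ (2 * K + A0) * h := by positivity
    have e6 : (1 + 2 * K + A0) * (h + τ) = h + τ + (2 * K + A0) * h + τ * (2 * K + A0) := by ring
    rw [e6]; linarith only [e4, e5, hτ]
  -- second level
  have apP1 := (HB N k x h hk M hq (p1 t) chp1 K np1).1
  have apU1 := (HB N k x h hk M hq (u1 t) chu1 K nu1).2 bc2 bc3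
  have hε : Ca * (K+1) * h^(r-1) + τ/2 * (Cb * (K+1) * h^(r-1-1)) ≤ E1 * L * Hh := by
    have e1 : E1 * L * Hh = Ca * (K+1) * (L * Hh) + Cb * (K+1) * (L * Hh) := by rw [hE1]; ring
    have e2 : τ/2 * (Cb * (K+1) * h^(r-1-1)) = Cb * (K+1) * (τ * h^(r-1-1) / 2) := by ring
    rw [e1, e2]
    have e3 : Hh ≤ L * Hh := le_mul_of_one_le_left Hh0.le hL1
    have e4 : 0 ≤ τ * h^(r-1-1) := by positivity
    exact add_le_add (mul_le_mul_of_nonneg_left e3 (by positivity)) (mul_le_mul_of_nonneg_left (by linarith) (by positivity))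
  have apQ := (AP.comb M sS (by positivity : 0 ≤ τ/2) bp0 bp1 bq0 bq1 apP apP1).mono hh.le hε
  have apV := (AP.comb M sS0 (by positivity : 0 ≤ τ/2) bu0 bu1 bv0 bv1 apU apU1).mono hh.le hε
  have BQ0 : BM 0 1 (fun y => p t 0 y + τ/2 * p1 t 0 y) := bp0.add (bq0.cmul _)
  have BQ1 : BM 0 1 (fun y => p t 1 y + τ/2 * p1 t 1 y) := bp1.add (bq1.cmul _)
  have BV0 : BM 0 1 (fun y => u t 0 y + τ/2 * u1 t 0 y) := bu0.add (bv0.cmul _)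
  have BV1 : BM 0 1 (fun y => u t 1 y + τ/2 * u1 t 1 y) := bu1.add (bv1.cmul _)
  obtain ⟨Q_1, Q_2, Q_3⟩ := HP N k x h M hq _ sS _ _ P1 (fun y => P y - τ/4 * (P y * deriv U y + 1 * (U y * deriv P y))) (A0 * (1 + 2 * K + A0) * L * Hh) _ BQ0 BQ1
    (cP.sub (((cP.mul cU').add ((cU.mul cP').cmul 1)).cmul _)) hP1 apQ wP1 (st1.trans hA)
  obtain ⟨V_1, V_2, V_3⟩ := HP N k x h M hq _ sS0 _ _ U1 (fun y => U y - τ/4 * (P y * deriv P y + 3 * (U y * deriv U y))) (A0 * (1 + 2 * K + A0) * L * Hh) _ BV0 BV1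
    (cU.sub (((cP.mul cP').add ((cU.mul cU').cmul 3)).cmul _)) hU1 apV wU1 (st2.trans hA)
  have eA1 : Cp * (A0 * (1 + 2 * K + A0) * L * Hh + E1 * L * Hh) = A1 * L * Hh := by rw [hA1]; ring
  rw [eA1] at Q_2 Q_3 V_2 V_3
  have kb : ∀ a b : ℝ, |a| ≤ K → |b| ≤ K → |a + τ/2 * b| ≤ K1 := by
    intro a b ha hb
    refine (abs_add_le _ _).trans ?_
    rw [abs_mul, abs_of_nonneg (by positivity : 0 ≤ τ/2)]
    have : τ/2 * |b| ≤ T * K := mul_le_mul (by linarith) hb (abs_nonneg _) hT.le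
    have e : K1 = K + T * K := by rw [hK1]; ring
    rw [e]; linarith only [this, ha]
  have q0 : ∀ y ∈ Icc (0:ℝ) 1, |p t 0 y + τ/2 * p1 t 0 y| ≤ K1 := fun y hy => kb _ _ (ss0 y hy).1 (ss0 y hy).2.2.1
  have q1 : ∀ y ∈ Icc (0:ℝ) 1, |p t 1 y + τ/2 * p1 t 1 y| ≤ K1 := fun y hy => kb _ _ (ss1 y hy).1 (ss1 y hy).2.2.1
  have v0 : ∀ y ∈ Icc (0:ℝ) 1, |u t 0 y + τ/2 * u1 t 0 y| ≤ K1 := fun y hy => kb _ _ (ss0 y hy).2.1 (ss0 y hy).2.2.2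
  have v1 : ∀ y ∈ Icc (0:ℝ) 1, |u t 1 y + τ/2 * u1 t 1 y| ≤ K1 := fun y hy => kb _ _ (ss1 y hy).2.1 (ss1 y hy).2.2.2
  have ck1 := brk_est (c := 1) (by norm_num) (by norm_num) BQ0 BV1 cP1 cU1' BV0 BQ1 cU1 cP1' q0 v1 Q_3 V_2 v0 q1 V_3 Q_2
  have ck2 := brk_est (c := 3) (by norm_num) (by norm_num) BQ0 BQ1 cP1 cP1' BV0 BV1 cU1 cU1' q0 q1 Q_3 Q_2 v0 v1 V_3 V_2
  have f1 := final_est hτ.le bp0 bpn ((BQ0.mul BV1).add ((BV0.mul BQ1).cmul 1)) ((cP1.mul cU1').add ((cU1.mul cP1').cmul 1))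
    (fun y hy => by
      have := R.c1 t ht τ hτ.le htt y hy
      refine le_trans (le_of_eq ?_) this
      congr 1; ring) ck1
  have f2 := final_est hτ.le bu0 bun ((BQ0.mul BQ1).add ((BV0.mul BV1).cmul 3)) ((cP1.mul cP1').add ((cU1.mul cU1').cmul 3))
    (fun y hy => R.c2 t ht τ hτ.le htt y hy) ck2
  have bB1 := (cP1.mul cU1').add ((cU1.mul cP1').cmul 1)
  have bB2 := (cP1.mul cP1').add ((cU1.mul cU1').cmul 3)
  have g1 := test_le sS hd1 ((bpn.sub bp0).add (bB1.cmul (τ/2))) (fun χ hχ => by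
    have bχ := Sh.bm hχ
    rw [wd1 χ hχ]
    have e1 : (fun y => (Pn y - P y + τ/2 * (P1 y * deriv U1 y + 1 * (U1 y * deriv P1 y))) * χ y) = fun y => (Pn y * χ y - P y * χ y) + (τ/2 * (P1 y * deriv U1 y + 1 * (U1 y * deriv P1 y))) * χ y := by funext y; ring
    have e2 : (fun y => (p (t+τ) 0 y - p t 0 y + τ/2 * (P1 y * deriv U1 y + 1 * (U1 y * deriv P1 y))) * χ y) = fun y => (p (t+τ) 0 y * χ y - p t 0 y * χ y) + (τ/2 * (P1 y * deriv U1 y + 1 * (U1 y * deriv P1 y))) * χ y := by funext y; ring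
    rw [e1, e2, intervalIntegral.integral_add (((Sh.bm hPn).mul bχ).sub (cP.mul bχ) |>.ii zero_le_one) (((bB1.cmul (τ/2)).mul bχ).ii zero_le_one),
      intervalIntegral.integral_add ((bpn.mul bχ).sub (bp0.mul bχ) |>.ii zero_le_one) (((bB1.cmul (τ/2)).mul bχ).ii zero_le_one),
      intervalIntegral.integral_sub (((Sh.bm hPn).mul bχ).ii zero_le_one) ((cP.mul bχ).ii zero_le_one),
      intervalIntegral.integral_sub ((bpn.mul bχ).ii zero_le_one) ((bp0.mul bχ).ii zero_le_one), wP χ hχ, wPn χ hχ])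
  have g2 := test_le sS0 hd2 ((bun.sub bu0).add (bB2.cmul (τ/2))) (fun χ hχ => by
    have bχ := Sh.bm hχ.1
    rw [wd2 χ hχ]
    have e1 : (fun y => (Un y - U y + τ/2 * (P1 y * deriv P1 y + 3 * (U1 y * deriv U1 y))) * χ y) = fun y => (Un y * χ y - U y * χ y) + (τ/2 * (P1 y * deriv P1 y + 3 * (U1 y * deriv U1 y))) * χ y := by funext y; ring
    have e2 : (fun y => (u (t+τ) 0 y - u t 0 y + τ/2 * (P1 y * deriv P1 y + 3 * (U1 y * deriv U1 y))) * χ y) = fun y => (u (t+τ) 0 y * χ y - u t 0 y * χ y) + (τ/2 * (P1 y * deriv P1 y + 3 * (U1 y * deriv U1 y))) * χ y := by funext y; ring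
    rw [e1, e2, intervalIntegral.integral_add (((Sh.bm hUn.1).mul bχ).sub (cU.mul bχ) |>.ii zero_le_one) (((bB2.cmul (τ/2)).mul bχ).ii zero_le_one),
      intervalIntegral.integral_add ((bun.mul bχ).sub (bu0.mul bχ) |>.ii zero_le_one) (((bB2.cmul (τ/2)).mul bχ).ii zero_le_one),
      intervalIntegral.integral_sub (((Sh.bm hUn.1).mul bχ).ii zero_le_one) ((cU.mul bχ).ii zero_le_one),
      intervalIntegral.integral_sub ((bun.mul bχ).ii zero_le_one) ((bu0.mul bχ).ii zero_le_one), wU χ hχ, wUn χ hχ])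
  have tot : n2 0 1 d1 + n2 0 1 d2 ≤ 2 * (K * τ^3 + τ/2 * (4 * (A1 * L * Hh * (2 * K1 + A1 * L * Hh)))) := by linarith [g1.trans f1, g2.trans f2]
  refine tot.trans ?_
  have hL2 : 1 ≤ L^2 := one_le_pow₀ hL1
  have i1 : A1 * L * Hh ≤ A1 * L := mul_le_of_le_one_right (by positivity) Hh1
  have i2 : 2 * K1 + A1 * L * Hh ≤ (2 * K1 + A1) * L := by
    have j1 : 2 * K1 ≤ 2 * K1 * L := le_mul_of_one_le_right (by positivity) hL1
    have j2 : (2 * K1 + A1) * L = 2 * K1 * L + A1 * L := by ring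
    rw [j2]; exact add_le_add j1 i1
  have i3 : A1 * L * Hh * (2 * K1 + A1 * L * Hh) ≤ A1 * L * Hh * ((2 * K1 + A1) * L) := mul_le_mul_of_nonneg_left i2 (by positivity)
  have i4 : 2 * (K * τ^3) ≤ 2 * K * L^2 * τ * τ^2 := by
    have : 2 * K * L^2 * τ * τ^2 = L^2 * (2 * (K * τ^3)) := by ring
    rw [this]; exact le_mul_of_one_le_left (by positivity) hL2
  have i5 : 4 * τ * (A1 * L * Hh * (2 * K1 + A1 * L * Hh)) ≤ 4 * (A1 * (2 * K1 + A1)) * L^2 * τ * Hh := by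
    have e : 4 * (A1 * (2 * K1 + A1)) * L^2 * τ * Hh = 4 * τ * (A1 * L * Hh * ((2 * K1 + A1) * L)) := by ring
    rw [e]; exact mul_le_mul_of_nonneg_left i3 (by positivity)
  have i6 : 0 ≤ 2 * K * L^2 * τ * Hh := by positivity
  have i7 : 0 ≤ 4 * (A1 * (2 * K1 + A1)) * L^2 * τ * τ^2 := by positivity
  have e : (2 * K + 4 * (A1 * (2 * K1 + A1))) * L^2 * τ * (τ^2 + Hh) = 2 * K * L^2 * τ * τ^2 + 2 * K * L^2 * τ * Hh + 4 * (A1 * (2 * K1 + A1)) * L^2 * τ * τ^2 + 4 * (A1 * (2 * K1 + A1)) * L^2 * τ * Hh := by ring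
  rw [e]; linarith only [i4, i5, i6, i7]

theorem nrm_n2 (f : ℝ → ℝ) : nrm f = n2 0 1 f := rfl

theorem ipc {a b φ : ℝ → ℝ} (ha : BM 0 1 a) (hb : BM 0 1 b) (hφ : BM 0 1 φ) (c : ℝ) : ip a φ + c * ip b φ = ip (fun y => a y + c * b y) φ := by
  unfold ip
  rw [← intervalIntegral.integral_const_mul, ← intervalIntegral.integral_add ((ha.mul hφ).ii zero_le_one) (((hb.mul hφ).cmul c).ii zero_le_one)]
  congr 1; funext y; ring

theorem ip_cell {N : ℕ} {x : ℕ → ℝ} {h : ℝ} (M : Msh N x h) {f g : ℝ → ℝ} (φ : ℝ → ℝ) (hfg : ∀ j < N, ∀ y ∈ Ioo (x j) (x (j+1)), f y = g y) : ip f φ = ip g φ := by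
  unfold ip
  refine intervalIntegral.integral_congr_ae ?_
  filter_upwards [M.ae] with y hy hm
  rw [uIoc_of_le zero_le_one] at hm
  obtain ⟨j, hj, hyj⟩ := hy hm
  rw [hfg j hj y hyj]

theorem Sh.two {N r k : ℕ} {x : ℕ → ℝ} : (fun _ => (2:ℝ)) ∈ Sh N r k x :=
  ⟨contDiffOn_const, fun j hj => ⟨Polynomial.C 2, by simp, fun y hy => by simp⟩⟩

theorem Sh.add2 {N r k : ℕ} {x : ℕ → ℝ} {f : ℝ → ℝ} (hf : f ∈ Sh N r k x) : (fun y => f y + 2) ∈ Sh N r k x := Sh.add hf Sh.two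

theorem Sh.mul_d {N r k : ℕ} {x : ℕ → ℝ} {h : ℝ} (M : Msh N x h) {f g : ℝ → ℝ} (hf : f ∈ Sh N r k x) (hg : g ∈ Sh N r k x) :
    BM 0 1 (deriv (fun y => f y * g y)) ∧ ∀ j < N, ∀ y ∈ Ioo (x j) (x (j+1)), deriv (fun y => f y * g y) y = deriv f y * g y + f y * deriv g y := by
  have e : ∀ j < N, ∀ y ∈ Ioo (x j) (x (j+1)), deriv (fun y => f y * g y) y = deriv f y * g y + f y * deriv g y :=
    fun j hj y hy => ((Sh.hd hf hj hy).fun_mul (Sh.hd hg hj hy)).deriv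
  exact ⟨(M.n2le (((Sh.bmd M hf).mul (Sh.bm hg)).add ((Sh.bm hf).mul (Sh.bmd M hg))) (fun j hj y hy => (e j hj y hy).symm)).1, e⟩

theorem proj_w {S : Set (ℝ → ℝ)} {N r k : ℕ} {x : ℕ → ℝ} (sS : Spc S N r k x) {f g : ℝ → ℝ} (bf : BM 0 1 f) (H : IsL2ProjOn S f g) : ∀ χ ∈ S, ip g χ = ip f χ := by
  intro χ hχ
  have h1 := H.2 χ hχ
  have h2 := ipc bf (Sh.bm (sS.sub H.1)) (Sh.bm (sS.sub hχ)) (-1)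
  have e : (fun y => f y + -1 * g y) = fun y => f y - g y := by funext y; ring
  rw [e, h1] at h2
  linarith

set_option maxHeartbeats 1000000 in
theorem final_thm (r k : ℕ) (hr : 3 ≤ r) (hk : k ≤ r - 2)
    (γ T : ℝ) (hγ : 1 ≤ γ) (hT : 0 < T)
    (ηs us : ℕ → ℝ → ℝ → ℝ)
    (hηsm : SmoothChain T r 3 ηs) (husm : SmoothChain T r 3 us)
    (hsol : SSW T (ηs 0) (us 0) (ηs 1) (us 1)) :
    ∃ C : Polynomial ℝ, ∀ (N : ℕ) (x : ℕ → ℝ) (h : ℝ),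
      IsPartition N x → IsMeshSize N x h → QuasiUniform N x h γ →
      ∀ (M : ℕ) (τ : ℝ), 0 < M → τ = T / M →
      ∀ Hn Un Hn1 Un1 δ1 δ2 : ℕ → ℝ → ℝ,
      (∀ n ≤ M, IsL2ProjOn (Sh N r k x) (fun y => ηs 0 y ((n : ℝ) * τ)) (Hn n) ∧
          IsL2ProjOn (Sh0 N r k x) (fun y => us 0 y ((n : ℝ) * τ)) (Un n)) →
      (∀ n < M, Hn1 n ∈ Sh N r k x ∧ ∀ φ ∈ Sh N r k x,
        ip (Hn1 n) φ = ip (Hn n) φ - (τ/2) * ip (deriv (Un n)) φ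
          - (τ/4) * ip (deriv (fun y => Hn n y * Un n y)) φ) →
      (∀ n < M, Un1 n ∈ Sh0 N r k x ∧ ∀ χ ∈ Sh0 N r k x,
        ip (Un1 n) χ = ip (Un n) χ - (τ/2) * ip (deriv (Hn n)) χ
          - (τ/4) * ip (fun y => Hn n y * deriv (Hn n) y) χ
          - (3*τ/4) * ip (fun y => Un n y * deriv (Un n) y) χ) →
      (∀ n < M, δ1 n ∈ Sh N r k x ∧ ∀ φ ∈ Sh N r k x,
        ip (δ1 n) φ = ip (fun y => Hn (n+1) y - Hn n y) φ + τ * ip (deriv (Un1 n)) φ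
          + (τ/2) * ip (deriv (fun y => Hn1 n y * Un1 n y)) φ) →
      (∀ n < M, δ2 n ∈ Sh0 N r k x ∧ ∀ χ ∈ Sh0 N r k x,
        ip (δ2 n) χ = ip (fun y => Un (n+1) y - Un n y) χ + τ * ip (deriv (Hn1 n)) χ
          + (τ/2) * ip (fun y => Hn1 n y * deriv (Hn1 n) y) χ
          + (3*τ/2) * ip (fun y => Un1 n y * deriv (Un1 n) y) χ) →
      ∀ n < M,
        nrm (δ1 n) + nrm (δ2 n) ≤ C.eval (τ / h) * τ * (τ ^ 2 + h ^ (r - 1)) := by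
  obtain ⟨K, p, u, p1, u1, hK, R, hp0, hu0⟩ := reg_exists hr hT hηsm husm hsol
  obtain ⟨c, hc, H⟩ := fe_core hr hγ hT hK R
  refine ⟨Polynomial.C c * (1 + Polynomial.X)^2, ?_⟩
  intro N x h hp hm hq M τ hM hτ Hn Un Hn1 Un1 δ1 δ2 w0 w1 w2 w3 w4 n hn
  have Ms : Msh N x h := ⟨hp, hm⟩
  have hM' : (0:ℝ) < M := by exact_mod_cast hM
  have hτ0 : 0 < τ := by rw [hτ]; positivity
  have hMτ : (M:ℝ) * τ = T := by rw [hτ]; field_simp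
  have tm : ∀ m ≤ M, (m:ℝ) * τ ∈ Icc 0 T := fun m hm => ⟨by positivity, by rw [← hMτ]; exact mul_le_mul_of_nonneg_right (by exact_mod_cast hm) hτ0.le⟩
  have et : (n:ℝ) * τ + τ = ((n+1:ℕ):ℝ) * τ := by push_cast; ring
  have sS := spc_sh N r k x
  have sS0 := spc_sh0 N r k x
  have hH := fun m hm => (w0 m hm).1.1
  have hU := fun m hm => (w0 m hm).2.1
  have wH : ∀ m ≤ M, ∀ χ ∈ Sh N r k x, ip (fun y => Hn m y + 2) χ = ip (p ((m:ℝ) * τ) 0) χ := by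
    intro m hm χ hχ
    have bη : BM 0 1 (fun y => ηs 0 y ((m:ℝ) * τ)) := BM.of_cont (hηsm.2.1 0 (by norm_num) _ (tm m hm)).continuousOn
    have e1 := proj_w sS bη (w0 m hm).1 χ hχ
    have b2 : BM 0 1 (fun _ => (1:ℝ)) := BM.const 0 1 1
    have e2 := ipc (Sh.bm (hH m hm)) b2 (Sh.bm hχ) 2
    have e3 := ipc bη b2 (Sh.bm hχ) 2
    have e4 : p ((m:ℝ) * τ) 0 = fun y => ηs 0 y ((m:ℝ) * τ) + 2 * 1 := by funext y; rw [hp0]; ring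
    simp only [mul_one] at e2 e3 e4
    rw [e4, ← e3, ← e2, e1]
  have wU : ∀ m ≤ M, ∀ χ ∈ Sh0 N r k x, ip (Un m) χ = ip (u ((m:ℝ) * τ) 0) χ := by
    intro m hm χ hχ
    have bη : BM 0 1 (fun y => us 0 y ((m:ℝ) * τ)) := BM.of_cont (husm.2.1 0 (by norm_num) _ (tm m hm)).continuousOn
    have e4 : u ((m:ℝ) * τ) 0 = fun y => us 0 y ((m:ℝ) * τ) := by funext y; rw [hu0]
    rw [e4]
    exact proj_w sS0 bη (w0 m hm).2 χ hχ
  have hHn := hH n hn.le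
  have hUn := hU n hn.le
  have hHn' := hH (n+1) hn
  have hUn' := hU (n+1) hn
  obtain ⟨hH1, wH1⟩ := w1 n hn
  obtain ⟨hU1, wU1⟩ := w2 n hn
  obtain ⟨hd1, wd1⟩ := w3 n hn
  obtain ⟨hd2, wd2⟩ := w4 n hn
  have dP : ∀ f : ℝ → ℝ, deriv (fun y => f y + 2) = deriv f := fun f => by funext y; exact deriv_add_const 2
  have bH := Sh.bm hHn
  have bU := Sh.bm hUn.1
  have bH' := Sh.bmd Ms hHn
  have bU' := Sh.bmd Ms hUn.1
  have bH1 := Sh.bm hH1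
  have bU1 := Sh.bm hU1.1
  have bH1' := Sh.bmd Ms hH1
  have bU1' := Sh.bmd Ms hU1.1
  have bHn := Sh.bm hHn'
  have bUn := Sh.bm hUn'.1
  obtain ⟨bHU, eHU⟩ := Sh.mul_d Ms hHn hUn.1
  obtain ⟨bHU1, eHU1⟩ := Sh.mul_d Ms hH1 hU1.1
  have b2 : BM 0 1 (fun _ => (1:ℝ)) := BM.const 0 1 1
  have key := H N k x h hk Ms hq ((n:ℝ) * τ) (tm n hn.le) τ hτ0 (by rw [et]; exact tm (n+1) hn)
    (fun y => Hn n y + 2) (Un n) (fun y => Hn (n+1) y + 2) (Un (n+1)) (fun y => Hn1 n y + 2) (Un1 n) (δ1 n) (δ2 n)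
    (Sh.add2 hHn) hUn (Sh.add2 hHn') hUn' (Sh.add2 hH1) hU1 hd1 hd2 (wH n hn.le) (wU n hn.le)
    (fun χ hχ => by rw [et]; exact wH (n+1) hn χ hχ) (fun χ hχ => by rw [et]; exact wU (n+1) hn χ hχ)
    (fun χ hχ => by
      have bχ := Sh.bm hχ
      rw [dP]
      have e0 := ipc bH1 b2 bχ 2
      have e1 := ipc bH bU' bχ (-(τ/2))
      have e2 := ipc (bH.add (bU'.cmul (-(τ/2)))) bHU bχ (-(τ/4))
      have e3 := ipc ((bH.add (bU'.cmul (-(τ/2)))).add (bHU.cmul (-(τ/4)))) b2 bχ 2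
      have e4 := wH1 χ hχ
      have e5 := ip_cell Ms χ (f := fun y => Hn n y + -(τ/2) * deriv (Un n) y + -(τ/4) * deriv (fun y => Hn n y * Un n y) y + 2 * 1)
        (g := fun y => Hn n y + 2 - τ/4 * ((Hn n y + 2) * deriv (Un n) y + 1 * (Un n y * deriv (Hn n) y))) (fun j hj y hy => by
          beta_reduce; rw [eHU j hj y hy]; ring)
      have e6 : ip (fun y => Hn1 n y + 2 * 1) χ = ip (fun y => Hn1 n y + 2) χ := by simp only [mul_one]
      show ip (fun y => Hn1 n y + 2) χ = ip (fun y => Hn n y + 2 - τ/4 * ((Hn n y + 2) * deriv (Un n) y + 1 * (Un n y * deriv (Hn n) y))) χ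
      linarith only [e0, e1, e2, e3, e4, e5, e6])
    (fun χ hχ => by
      have bχ := Sh.bm hχ.1
      rw [dP]
      have e1 := ipc bU bH' bχ (-(τ/2))
      have e2 := ipc (bU.add (bH'.cmul (-(τ/2)))) (bH.mul bH') bχ (-(τ/4))
      have e3 := ipc ((bU.add (bH'.cmul (-(τ/2)))).add ((bH.mul bH').cmul (-(τ/4)))) (bU.mul bU') bχ (-(3*τ/4))
      have e4 := wU1 χ hχ
      have e5 : (fun y => Un n y + -(τ/2) * deriv (Hn n) y + -(τ/4) * (Hn n y * deriv (Hn n) y) + -(3*τ/4) * (Un n y * deriv (Un n) y))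
        = fun y => Un n y - τ/4 * ((Hn n y + 2) * deriv (Hn n) y + 3 * (Un n y * deriv (Un n) y)) := by funext y; ring
      rw [e5] at e3
      show ip (Un1 n) χ = ip (fun y => Un n y - τ/4 * ((Hn n y + 2) * deriv (Hn n) y + 3 * (Un n y * deriv (Un n) y))) χ
      linarith only [e1, e2, e3, e4])
    (fun χ hχ => by
      have bχ := Sh.bm hχ
      rw [dP]
      have e1 := ipc (bHn.sub bH) bU1' bχ τ
      have e2 := ipc ((bHn.sub bH).add (bU1'.cmul τ)) bHU1 bχ (τ/2)
      have e4 := wd1 χ hχ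
      have e5 := ip_cell Ms χ (f := fun y => Hn (n+1) y - Hn n y + τ * deriv (Un1 n) y + (τ/2) * deriv (fun y => Hn1 n y * Un1 n y) y)
        (g := fun y => Hn (n+1) y + 2 - (Hn n y + 2) + τ/2 * ((Hn1 n y + 2) * deriv (Un1 n) y + 1 * (Un1 n y * deriv (Hn1 n) y))) (fun j hj y hy => by
          beta_reduce; rw [eHU1 j hj y hy]; ring)
      show ip (δ1 n) χ = ip (fun y => Hn (n+1) y + 2 - (Hn n y + 2) + τ/2 * ((Hn1 n y + 2) * deriv (Un1 n) y + 1 * (Un1 n y * deriv (Hn1 n) y))) χ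
      linarith only [e1, e2, e4, e5])
    (fun χ hχ => by
      have bχ := Sh.bm hχ.1
      rw [dP]
      have e1 := ipc (bUn.sub bU) bH1' bχ τ
      have e2 := ipc ((bUn.sub bU).add (bH1'.cmul τ)) (bH1.mul bH1') bχ (τ/2)
      have e3 := ipc (((bUn.sub bU).add (bH1'.cmul τ)).add ((bH1.mul bH1').cmul (τ/2))) (bU1.mul bU1') bχ (3*τ/2)
      have e4 := wd2 χ hχ
      have e5 : (fun y => Un (n+1) y - Un n y + τ * deriv (Hn1 n) y + (τ/2) * (Hn1 n y * deriv (Hn1 n) y) + (3*τ/2) * (Un1 n y * deriv (Un1 n) y))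
        = fun y => Un (n+1) y - Un n y + τ/2 * ((Hn1 n y + 2) * deriv (Hn1 n) y + 3 * (Un1 n y * deriv (Un1 n) y)) := by funext y; ring
      rw [e5] at e3
      show ip (δ2 n) χ = ip (fun y => Un (n+1) y - Un n y + τ/2 * ((Hn1 n y + 2) * deriv (Hn1 n) y + 3 * (Un1 n y * deriv (Un1 n) y))) χ
      linarith only [e1, e2, e3, e4])
  rw [nrm_n2, nrm_n2]
  simpa using key

end Helpers

/-- **Consistency estimate for the improved Euler (explicit midpoint) full
discretization of (SSW):** the local truncation errors are `O(k(k² + h^{r-1}))`,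
with a constant depending polynomially on `λ = k/h`. -/
theorem stmt_17 (r k : ℕ) (hr : 3 ≤ r) (hk : k ≤ r - 2)
    (γ T : ℝ) (hγ : 1 ≤ γ) (hT : 0 < T)
    (ηs us : ℕ → ℝ → ℝ → ℝ)
    (hηsm : SmoothChain T r 3 ηs) (husm : SmoothChain T r 3 us)
    (hsol : SSW T (ηs 0) (us 0) (ηs 1) (us 1)) :
    ∃ C : Polynomial ℝ, ∀ (N : ℕ) (x : ℕ → ℝ) (h : ℝ),
      IsPartition N x → IsMeshSize N x h → QuasiUniform N x h γ →
      ∀ (M : ℕ) (τ : ℝ), 0 < M → τ = T / M →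
      ∀ Hn Un Hn1 Un1 δ1 δ2 : ℕ → ℝ → ℝ,
      (∀ n ≤ M, IsL2ProjOn (Sh N r k x) (fun y => ηs 0 y ((n : ℝ) * τ)) (Hn n) ∧
          IsL2ProjOn (Sh0 N r k x) (fun y => us 0 y ((n : ℝ) * τ)) (Un n)) →
      (∀ n < M, Hn1 n ∈ Sh N r k x ∧ ∀ φ ∈ Sh N r k x,
        ip (Hn1 n) φ = ip (Hn n) φ - (τ/2) * ip (deriv (Un n)) φ
          - (τ/4) * ip (deriv (fun y => Hn n y * Un n y)) φ) →
      (∀ n < M, Un1 n ∈ Sh0 N r k x ∧ ∀ χ ∈ Sh0 N r k x,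
        ip (Un1 n) χ = ip (Un n) χ - (τ/2) * ip (deriv (Hn n)) χ
          - (τ/4) * ip (fun y => Hn n y * deriv (Hn n) y) χ
          - (3*τ/4) * ip (fun y => Un n y * deriv (Un n) y) χ) →
      (∀ n < M, δ1 n ∈ Sh N r k x ∧ ∀ φ ∈ Sh N r k x,
        ip (δ1 n) φ = ip (fun y => Hn (n+1) y - Hn n y) φ + τ * ip (deriv (Un1 n)) φ
          + (τ/2) * ip (deriv (fun y => Hn1 n y * Un1 n y)) φ) →
      (∀ n < M, δ2 n ∈ Sh0 N r k x ∧ ∀ χ ∈ Sh0 N r k x,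
        ip (δ2 n) χ = ip (fun y => Un (n+1) y - Un n y) χ + τ * ip (deriv (Hn1 n)) χ
          + (τ/2) * ip (fun y => Hn1 n y * deriv (Hn1 n) y) χ
          + (3*τ/2) * ip (fun y => Un1 n y * deriv (Un1 n) y) χ) →
      ∀ n < M,
        nrm (δ1 n) + nrm (δ2 n) ≤ C.eval (τ / h) * τ * (τ ^ 2 + h ^ (r - 1)) := by
  exact final_thm r k hr hk γ T hγ hT ηs us hηsm husm hsol
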